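/- Let 𝔸 and 𝔹 be generalized algebraic theories. Given context morphisms f = (f₁,…,f_M) : X → A in 𝔸 and g = (g₁,…,g_N) : Y → B in 𝔹, the tuple f⊗g is a context morphism X⊗Y → A⊗B in 𝔸⊗𝔹, and the morphism equalities f⊗g ≡ (A⊗g) ∘ (f⊗Y) and f⊗g ≡ (f⊗B) ∘ (X⊗g) : X⊗Y → A⊗B are derivable, where f⊗Y : X⊗Y → A⊗Y, A⊗g : A⊗Y → A⊗B, X⊗g : X⊗Y → X⊗B and f⊗B : X⊗B → A⊗B are context morphisms. -/

import Mathlib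

set_option linter.unusedVariables false

/-! # Syntax of generalized algebraic theories (following Cartmell / the paper's appendix) -/

namespace GATPaper

/-- A sort-and-term alphabet: a countably infinite set of variables, a set of sort
symbols and a set of term symbols. -/
structure Alphabet : Type 1 where
  Var : Type
  SortSym : Type
  TermSym : Type
  var_infinite : Infinite Var
  var_countable : Countable Var

attribute [instance] Alphabet.var_infinite Alphabet.var_countable

variable {A B : Alphabet}

/-- Term expressions over an alphabet. -/
inductive Expr (A : Alphabet) : Type where
  | var : A.Var → Expr A
  | app : A.TermSym → List (Expr A) → Expr A

/-- Sort expressions: a sort symbol applied to a list of term expressions. -/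
structure SortE (A : Alphabet) : Type where
  head : A.SortSym
  args : List (Expr A)

/-- Occurrence of a variable in a term expression. -/
inductive Occurs (x : A.Var) : Expr A → Prop where
  | var : Occurs x (Expr.var x)
  | app {t : A.TermSym} {es : List (Expr A)} {e : Expr A} :
      e ∈ es → Occurs x e → Occurs x (Expr.app t es)

/-- Occurrence of a variable in a sort expression. -/
def SOccurs (x : A.Var) (U : SortE A) : Prop := ∃ e ∈ U.args, Occurs x e

/-- Simultaneous substitution along a function on variables. -/
def Expr.subst (σ : A.Var → Expr A) : Expr A → Expr A
  | .var x => σ x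
  | .app t es => .app t (es.attach.map fun e => Expr.subst σ e.1)
termination_by e => sizeOf e
decreasing_by
  have := List.sizeOf_lt_of_mem e.2
  simp only [Expr.app.sizeOf_spec]
  omega

def SortE.subst (σ : A.Var → Expr A) (U : SortE A) : SortE A :=
  ⟨U.head, U.args.map (Expr.subst σ)⟩

open Classical in
/-- The function on variables determined by a finite list of substitution pairs
`(zᵢ, uᵢ)` (substituting `uᵢ` for `zᵢ`, first matching pair winning, all other
variables unchanged). -/
noncomputable def lookupV : List (A.Var × Expr A) → A.Var → Expr A
  | [], x => .var x
  | p :: ps, x => if p.1 = x then p.2 else lookupV ps x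

/-- The simultaneous substitution `e[u₁ | z₁, …, u_k | z_k]` where
`ps = [(z₁,u₁),…,(z_k,u_k)]`. -/
noncomputable def Expr.substL (e : Expr A) (ps : List (A.Var × Expr A)) : Expr A :=
  e.subst (lookupV ps)

noncomputable def SortE.substL (U : SortE A) (ps : List (A.Var × Expr A)) : SortE A :=
  U.subst (lookupV ps)

/-- A (pre)context is a finite list of (variable, sort expression) pairs. -/
abbrev PreCtx (A : Alphabet) := List (A.Var × SortE A)

/-- The list of variables of a precontext, as term expressions. -/
def ctxVars (X : PreCtx A) : List (Expr A) := X.map fun p => Expr.var p.1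

/-- The scoping condition of a precontext: the `i`-th sort expression only contains
variables among the first `i` variables. -/
def IsPreCtx (X : PreCtx A) : Prop :=
  ∀ i (hi : i < X.length) (v : A.Var),
    SOccurs v (X[i]'hi).2 → v ∈ (X.take i).map Prod.fst

/-- Substitution pairs sending the variables of `X` to the entries of `f`. -/
def mkSub (X : PreCtx A) (f : List (Expr A)) : List (A.Var × Expr A) :=
  (X.map Prod.fst).zip f

/-- `Xᵢ[f₁ | x₁, …, f_{i-1} | x_{i-1}]` (0-based: the `i`-th sort of `X`
substituted along the first `i` entries of `f`). -/
noncomputable def subPre (X : PreCtx A) (f : List (Expr A)) (i : ℕ) (hi : i < X.length) :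
    SortE A :=
  ((X[i]'hi).2).substL (mkSub (X.take i) (f.take i))

/-- Judgments: context judgments and the four kinds of standard judgments. -/
inductive Judg (A : Alphabet) : Type where
  | ctx (X : PreCtx A)
  | sort (X : PreCtx A) (U : SortE A)
  | term (X : PreCtx A) (u : Expr A) (U : SortE A)
  | sortEq (X : PreCtx A) (U V : SortE A)
  | termEq (X : PreCtx A) (u v : Expr A) (U : SortE A)

/-- The context of a judgment. -/
def Judg.ctxOf : Judg A → PreCtx A
  | .ctx X => X
  | .sort X _ => X
  | .term X _ _ => X
  | .sortEq X _ _ => X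
  | .termEq X _ _ _ => X

/-- The judgment introducing a sort symbol over the context `X`. -/
def introSort (X : PreCtx A) (S : A.SortSym) : Judg A := .sort X ⟨S, ctxVars X⟩

/-- The judgment introducing a term symbol over the context `X`, with sort `U`. -/
def introTerm (X : PreCtx A) (t : A.TermSym) (U : SortE A) : Judg A :=
  .term X (.app t (ctxVars X)) U

/-- A set of axioms is a pretheory if: no axiom is a context judgment, every
axiom's context is a precontext, every sort symbol has a unique introducing sort
axiom and there are no other sort axioms, and likewise for term symbols. -/
structure IsPretheory (Ax : Set (Judg A)) : Prop where
  no_ctx : ∀ X : PreCtx A, Judg.ctx X ∉ Ax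
  wf_ctx : ∀ J ∈ Ax, IsPreCtx J.ctxOf
  sort_intro : ∀ S : A.SortSym, ∃! X : PreCtx A, introSort X S ∈ Ax
  sort_shape : ∀ (X : PreCtx A) (U : SortE A), Judg.sort X U ∈ Ax → U.args = ctxVars X
  term_intro : ∀ t : A.TermSym, ∃! p : PreCtx A × SortE A, introTerm p.1 t p.2 ∈ Ax
  term_shape : ∀ (X : PreCtx A) (u : Expr A) (U : SortE A), Judg.term X u U ∈ Ax →
      ∃ t : A.TermSym, u = Expr.app t (ctxVars X)

/-- One inference step of the paper's system: `Step Ax D J` holds when `J` is the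
conclusion of an instance of one of the sixteen rules all of whose premises
satisfy `D`. -/
inductive Step (Ax : Set (Judg A)) (D : Judg A → Prop) : Judg A → Prop where
  | ctx_nil : Step Ax D (.ctx [])
  | ctx_cons {X : PreCtx A} {U : SortE A} {x : A.Var}
      (hs : D (.sort X U)) (hfresh : ∀ p ∈ X, p.1 ≠ x)
      (hpre : IsPreCtx (X ++ [(x, U)])) :
      Step Ax D (.ctx (X ++ [(x, U)]))
  | s1 {X : PreCtx A} {U : SortE A} (h : D (.sort X U)) : Step Ax D (.sortEq X U U)
  | s2 {X : PreCtx A} {U V : SortE A} (h : D (.sortEq X U V)) : Step Ax D (.sortEq X V U)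
  | s3 {X : PreCtx A} {U V W : SortE A}
      (h1 : D (.sortEq X U V)) (h2 : D (.sortEq X V W)) : Step Ax D (.sortEq X U W)
  | t1 {X : PreCtx A} {u : Expr A} {U : SortE A}
      (h : D (.term X u U)) : Step Ax D (.termEq X u u U)
  | t2 {X : PreCtx A} {u v : Expr A} {U : SortE A}
      (h : D (.termEq X u v U)) : Step Ax D (.termEq X v u U)
  | t3 {X : PreCtx A} {u v w : Expr A} {U : SortE A}
      (h1 : D (.termEq X u v U)) (h2 : D (.termEq X v w U)) : Step Ax D (.termEq X u w U)
  | seqt {X : PreCtx A} {U U' : SortE A} {u : Expr A}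
      (h1 : D (.sortEq X U U')) (h2 : D (.term X u U)) : Step Ax D (.term X u U')
  | seqteq {X : PreCtx A} {U U' : SortE A} {u u' : Expr A}
      (h1 : D (.sortEq X U U')) (h2 : D (.termEq X u u' U))
      (h3 : D (.term X u U')) (h4 : D (.term X u' U')) : Step Ax D (.termEq X u u' U')
  | var {X : PreCtx A} {i : ℕ} (hi : i < X.length)
      (h : D (.sort X (X[i]'hi).2)) :
      Step Ax D (.term X (.var (X[i]'hi).1) (X[i]'hi).2)
  | sA {X : PreCtx A} {U : SortE A} (hax : Judg.sort X U ∈ Ax) (h : D (.ctx X))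
      (hv : ∀ i (hi : i < X.length), D (.term X (.var (X[i]'hi).1) (X[i]'hi).2)) :
      Step Ax D (.sort X U)
  | tA {X : PreCtx A} {u : Expr A} {U : SortE A} (hax : Judg.term X u U ∈ Ax)
      (h : D (.sort X U))
      (hv : ∀ i (hi : i < X.length), D (.term X (.var (X[i]'hi).1) (X[i]'hi).2)) :
      Step Ax D (.term X u U)
  | seqA {X : PreCtx A} {U U' : SortE A} (hax : Judg.sortEq X U U' ∈ Ax)
      (h1 : D (.sort X U)) (h2 : D (.sort X U')) : Step Ax D (.sortEq X U U')
  | teqA {X : PreCtx A} {u u' : Expr A} {U : SortE A} (hax : Judg.termEq X u u' U ∈ Ax)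
      (h1 : D (.term X u U)) (h2 : D (.term X u' U)) : Step Ax D (.termEq X u u' U)
  | sSub {X : PreCtx A} {S : A.SortSym} (hax : introSort X S ∈ Ax)
      {Y : PreCtx A} (hY : IsPreCtx Y) {f : List (Expr A)} (hlen : f.length = X.length)
      (hJ : D (introSort X S)) (hYc : D (.ctx Y))
      (hargs : ∀ i (hi : i < X.length) (hif : i < f.length),
        D (.term Y (f[i]'hif) (subPre X f i hi))) :
      Step Ax D (.sort Y ⟨S, f⟩)
  | tSub {X : PreCtx A} {t : A.TermSym} {U : SortE A} (hax : introTerm X t U ∈ Ax)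
      {Y : PreCtx A} (hY : IsPreCtx Y) {f : List (Expr A)} (hlen : f.length = X.length)
      (hJ : D (introTerm X t U))
      (hU : D (.sort Y (U.substL (mkSub X f))))
      (hargs : ∀ i (hi : i < X.length) (hif : i < f.length),
        D (.term Y (f[i]'hif) (subPre X f i hi))) :
      Step Ax D (.term Y (.app t f) (U.substL (mkSub X f)))
  | seqSub1 {X : PreCtx A} {U U' : SortE A} (hax : Judg.sortEq X U U' ∈ Ax)
      {Y : PreCtx A} (hY : IsPreCtx Y) {f : List (Expr A)} (hlen : f.length = X.length)
      (hJ : D (.sortEq X U U'))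
      (h1 : D (.sort Y (U.substL (mkSub X f)))) (h2 : D (.sort Y (U'.substL (mkSub X f))))
      (hargs : ∀ i (hi : i < X.length) (hif : i < f.length),
        D (.term Y (f[i]'hif) (subPre X f i hi))) :
      Step Ax D (.sortEq Y (U.substL (mkSub X f)) (U'.substL (mkSub X f)))
  | seqSub2 {X : PreCtx A} {S : A.SortSym} (hax : introSort X S ∈ Ax)
      {Y : PreCtx A} (hY : IsPreCtx Y) {f g : List (Expr A)}
      (hlf : f.length = X.length) (hlg : g.length = X.length)
      (hJ : D (introSort X S))
      (h1 : D (.sort Y ⟨S, f⟩)) (h2 : D (.sort Y ⟨S, g⟩))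
      (hargs : ∀ i (hi : i < X.length) (hif : i < f.length) (hig : i < g.length),
        D (.termEq Y (f[i]'hif) (g[i]'hig) (subPre X f i hi))) :
      Step Ax D (.sortEq Y ⟨S, f⟩ ⟨S, g⟩)
  | teqSub1 {X : PreCtx A} {u u' : Expr A} {U : SortE A}
      (hax : Judg.termEq X u u' U ∈ Ax)
      {Y : PreCtx A} (hY : IsPreCtx Y) {f : List (Expr A)} (hlen : f.length = X.length)
      (hJ : D (.termEq X u u' U))
      (h1 : D (.term Y (u.substL (mkSub X f)) (U.substL (mkSub X f))))
      (h2 : D (.term Y (u'.substL (mkSub X f)) (U.substL (mkSub X f))))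
      (hargs : ∀ i (hi : i < X.length) (hif : i < f.length),
        D (.term Y (f[i]'hif) (subPre X f i hi))) :
      Step Ax D (.termEq Y (u.substL (mkSub X f)) (u'.substL (mkSub X f))
        (U.substL (mkSub X f)))
  | teqSub2 {X : PreCtx A} {t : A.TermSym} {U : SortE A} (hax : introTerm X t U ∈ Ax)
      {Y : PreCtx A} (hY : IsPreCtx Y) {f g : List (Expr A)}
      (hlf : f.length = X.length) (hlg : g.length = X.length)
      (hJ : D (introTerm X t U))
      (h1 : D (.term Y (.app t f) (U.substL (mkSub X f))))
      (h2 : D (.term Y (.app t g) (U.substL (mkSub X f))))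
      (hargs : ∀ i (hi : i < X.length) (hif : i < f.length) (hig : i < g.length),
        D (.termEq Y (f[i]'hif) (g[i]'hig) (subPre X f i hi))) :
      Step Ax D (.termEq Y (.app t f) (.app t g) (U.substL (mkSub X f)))

/-- `DerAt Ax n J`: `J` is the conclusion of an inference step in the `n`-th stage
`𝒟ₙ` of the recursive construction of the derivable judgments. -/
def DerAt (Ax : Set (Judg A)) : ℕ → Judg A → Prop
  | 0, _ => False
  | n + 1, J => DerAt Ax n J ∨ Step Ax (DerAt Ax n) J

/-- A judgment is derivable if it is the conclusion of a step of some stage. -/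
def Derivable (Ax : Set (Judg A)) (J : Judg A) : Prop := ∃ n, DerAt Ax n J

/-- The height of a (derivable) judgment: the least stage at which it appears. -/
noncomputable def ht (Ax : Set (Judg A)) (J : Judg A) : ℕ := sInf {n | DerAt Ax n J}

/-- The height of a context: `0` for the empty context, and the height of
`∂X ⊢ Xₙ sort` otherwise. -/
noncomputable def htCtx (Ax : Set (Judg A)) (X : PreCtx A) : ℕ :=
  match X with
  | [] => 0
  | p :: X' =>
      ht Ax (.sort ((p :: X').dropLast) (((p :: X').getLast (List.cons_ne_nil p X')).2))

/-- A generalized algebraic theory: a pretheory all of whose axioms are derivable. -/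
def IsGAT (Ax : Set (Judg A)) : Prop := IsPretheory Ax ∧ ∀ J ∈ Ax, Derivable Ax J

/-- The partial term judgment `X ⊢ u term` is derivable. -/
def DerTerm (Ax : Set (Judg A)) (X : PreCtx A) (u : Expr A) : Prop :=
  ∃ U, Derivable Ax (.term X u U)

/-- The partial term equality judgment `X ⊢ u ≡ v term` is derivable. -/
def DerTermEq (Ax : Set (Judg A)) (X : PreCtx A) (u v : Expr A) : Prop :=
  ∃ U, Derivable Ax (.termEq X u v U)

/-- Height of a derivable partial term judgment: the minimum of the heights of
`X ⊢ u : U` over all `U`. -/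
noncomputable def htTerm (Ax : Set (Judg A)) (X : PreCtx A) (u : Expr A) : ℕ :=
  sInf {n | ∃ U, DerAt Ax n (.term X u U)}

/-- `f` is a context morphism from `X` to `Y`. -/
def IsMor (Ax : Set (Judg A)) (X Y : PreCtx A) (f : List (Expr A)) : Prop :=
  Derivable Ax (.ctx X) ∧ Derivable Ax (.ctx Y) ∧ f.length = Y.length ∧
  ∀ i (hi : i < Y.length) (hif : i < f.length),
    Derivable Ax (.term X (f[i]'hif) (subPre Y f i hi))

/-- The morphism equality `f ≡ g : X → Y` is derivable. -/
def MorEq (Ax : Set (Judg A)) (X Y : PreCtx A) (f g : List (Expr A)) : Prop :=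
  IsMor Ax X Y f ∧ IsMor Ax X Y g ∧
  ∀ i (hi : i < Y.length) (hif : i < f.length) (hig : i < g.length),
    Derivable Ax (.termEq X (f[i]'hif) (g[i]'hig) (subPre Y f i hi))

/-- The context equality `X ≡ Y ctx` is derivable. -/
def CtxEq (Ax : Set (Judg A)) (X Y : PreCtx A) : Prop :=
  X.length = Y.length ∧ Derivable Ax (.ctx X) ∧ Derivable Ax (.ctx Y) ∧
  ∀ i (hX : i < X.length) (hY : i < Y.length),
    Derivable Ax (.sortEq (X.take i) (X[i]'hX).2
      (((Y[i]'hY).2).substL (mkSub (Y.take i) (ctxVars (X.take i)))))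

/-- Height of a context morphism. -/
noncomputable def htMor (Ax : Set (Judg A)) (X Y : PreCtx A) (f : List (Expr A)) : ℕ :=
  max (htCtx Ax X) (max (htCtx Ax Y)
    ((Finset.range Y.length).sup fun i =>
      if h : i < Y.length ∧ i < f.length then
        ht Ax (.term X (f[i]'h.2) (subPre Y f i h.1))
      else 0))

/-- Height of a morphism equality. -/
noncomputable def htMorEq (Ax : Set (Judg A)) (X Y : PreCtx A) (f g : List (Expr A)) : ℕ :=
  max (htMor Ax X Y f) (max (htMor Ax X Y g)
    ((Finset.range Y.length).sup fun i =>
      if h : i < Y.length ∧ i < f.length ∧ i < g.length then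
        ht Ax (.termEq X (f[i]'h.2.1) (g[i]'h.2.2) (subPre Y f i h.1))
      else 0))

/-- The composite `g ∘ f` of tuples of term expressions, where `f : X → Y` and
`g : Y → Z`: the `i`-th entry is `gᵢ[f]`. -/
noncomputable def compMor (Y : PreCtx A) (f g : List (Expr A)) : List (Expr A) :=
  g.map fun e => e.substL (mkSub Y f)

/-- The canonical sort `𝒮(u)` of a term in a context (as a relation). -/
inductive CanonSort (Ax : Set (Judg A)) (X : PreCtx A) : Expr A → SortE A → Prop where
  | var {i : ℕ} (hi : i < X.length) : CanonSort Ax X (.var (X[i]'hi).1) (X[i]'hi).2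
  | app {t : A.TermSym} {f : List (Expr A)} {Xa : PreCtx A} {V : SortE A}
      (hax : introTerm Xa t V ∈ Ax) :
      CanonSort Ax X (.app t f) (V.substL (mkSub Xa f))


/-! ## The tensor product of generalized algebraic theories (§2 of the paper) -/

/-- The tensor product of two sort-and-term alphabets. -/
abbrev Alphabet.tensor (A B : Alphabet) : Alphabet :=
  { Var := A.Var × B.Var
    SortSym := A.SortSym × B.SortSym
    TermSym := (A.SortSym × B.TermSym) ⊕ (A.TermSym × B.SortSym)
    var_infinite := inferInstance
    var_countable := inferInstance }

/-- An input for the tensor term operations `⊗_t`, `●_t`: a derivable term judgment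
`X ⊢ u : U` (notation `u^U`), or an augmented derivable sort judgment
`(X ⊢ U sort, x)` (notation `x^U`), represented with `tm = var x`. -/
structure TArg (A : Alphabet) : Type where
  ctx : PreCtx A
  tm : Expr A
  srt : SortE A

/-- `L` is the lexicographically ordered `m × n` grid whose `(i,j)` entry is `M i j`. -/
def IsGrid {γ : Type} (m n : ℕ) (M : ℕ → ℕ → γ) (L : List γ) : Prop :=
  L.length = m * n ∧
  ∀ i j (hi : i < m) (hj : j < n) (h : i * n + j < L.length), L[i * n + j]'h = M i j

/-- Substitution pairs `[g 1 | x y₁, …, g n | x yₙ]` where the `yⱼ` are the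
variables of `Y`. -/
def pairsR (x : A.Var) (Y : PreCtx B) (g : ℕ → Expr (A.tensor B)) :
    List ((A.tensor B).Var × Expr (A.tensor B)) :=
  (List.finRange Y.length).map fun j => ((x, (Y.get j).1), g j.1)

/-- Substitution pairs `[g 1 | x₁ y, …, g m | x_m y]` where the `xᵢ` are the
variables of `X`. -/
def pairsL (X : PreCtx A) (y : B.Var) (g : ℕ → Expr (A.tensor B)) :
    List ((A.tensor B).Var × Expr (A.tensor B)) :=
  (List.finRange X.length).map fun i => (((X.get i).1, y), g i.1)

variable {A B : Alphabet}

/-- The graph of the tensor term operation on pairs of (augmented sort / term)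
judgments: `TTg TA TB false a b e` means `e = a ⊗_t b` and
`TTg TA TB true a b e` means `e = a ⊗*_t b` (the variant of §8 in which the two
defining substitution formulas for non-variable terms are interchanged). -/
inductive TTg (TA : Set (Judg A)) (TB : Set (Judg B)) :
    Bool → TArg A → TArg B → Expr (A.tensor B) → Prop where
  | varvar {b : Bool} {X : PreCtx A} {U : SortE A} {x : A.Var}
      {Y : PreCtx B} {V : SortE B} {y : B.Var} :
      TTg TA TB b ⟨X, .var x, U⟩ ⟨Y, .var y, V⟩ (.var (x, y))
  | varapp {b : Bool} {X : PreCtx A} {x : A.Var} {S : A.SortSym} {ss : List (Expr A)}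
      {Y : PreCtx B} {t : B.TermSym} {ts : List (Expr B)} {V : SortE B}
      (SS : ℕ → SortE A) (TSf : ℕ → SortE B)
      (hSS : ∀ i (hi : i < ss.length), CanonSort TA X (ss[i]'hi) (SS i))
      (hTS : ∀ j (hj : j < ts.length), CanonSort TB Y (ts[j]'hj) (TSf j))
      (M : ℕ → ℕ → Expr (A.tensor B)) (out : List (Expr (A.tensor B)))
      (hM : ∀ i (hi : i < ss.length), ∀ j (hj : j < ts.length),
          TTg TA TB b ⟨X, ss[i]'hi, SS i⟩ ⟨Y, ts[j]'hj, TSf j⟩ (M i j))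
      (hMx : ∀ j (hj : j < ts.length),
          TTg TA TB b ⟨X, .var x, ⟨S, ss⟩⟩ ⟨Y, ts[j]'hj, TSf j⟩ (M ss.length j))
      (hout : IsGrid (ss.length + 1) ts.length M out) :
      TTg TA TB b ⟨X, .var x, ⟨S, ss⟩⟩ ⟨Y, .app t ts, V⟩ (.app (Sum.inl (S, t)) out)
  | appvar {b : Bool} {X : PreCtx A} {s : A.TermSym} {ss : List (Expr A)} {U : SortE A}
      {Y : PreCtx B} {y : B.Var} {T : B.SortSym} {ts : List (Expr B)}
      (SS : ℕ → SortE A) (TSf : ℕ → SortE B)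
      (hSS : ∀ i (hi : i < ss.length), CanonSort TA X (ss[i]'hi) (SS i))
      (hTS : ∀ j (hj : j < ts.length), CanonSort TB Y (ts[j]'hj) (TSf j))
      (M : ℕ → ℕ → Expr (A.tensor B)) (out : List (Expr (A.tensor B)))
      (hM : ∀ i (hi : i < ss.length), ∀ j (hj : j < ts.length),
          TTg TA TB b ⟨X, ss[i]'hi, SS i⟩ ⟨Y, ts[j]'hj, TSf j⟩ (M i j))
      (hMy : ∀ i (hi : i < ss.length),
          TTg TA TB b ⟨X, ss[i]'hi, SS i⟩ ⟨Y, .var y, ⟨T, ts⟩⟩ (M i ts.length))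
      (hout : IsGrid ss.length (ts.length + 1) M out) :
      TTg TA TB b ⟨X, .app s ss, U⟩ ⟨Y, .var y, ⟨T, ts⟩⟩ (.app (Sum.inr (s, T)) out)
  | appapp_base {X : PreCtx A} {s : A.TermSym} {ss : List (Expr A)} {U : SortE A}
      {Y : PreCtx B} {t : B.TermSym} {ts : List (Expr B)} {V : SortE B} {x : A.Var}
      (hx : ∀ p ∈ X, p.1 ≠ x)
      (e0 : Expr (A.tensor B))
      (h0 : TTg TA TB false ⟨X, .var x, U⟩ ⟨Y, .app t ts, V⟩ e0)
      (g : ℕ → Expr (A.tensor B))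
      (hg : ∀ j (hj : j < Y.length),
          TTg TA TB false ⟨X, .app s ss, U⟩
            ⟨Y.take j, .var (Y[j]'hj).1, (Y[j]'hj).2⟩ (g j)) :
      TTg TA TB false ⟨X, .app s ss, U⟩ ⟨Y, .app t ts, V⟩ (e0.substL (pairsR x Y g))
  | appapp_star {X : PreCtx A} {s : A.TermSym} {ss : List (Expr A)} {U : SortE A}
      {Y : PreCtx B} {t : B.TermSym} {ts : List (Expr B)} {V : SortE B} {y : B.Var}
      (hy : ∀ p ∈ Y, p.1 ≠ y)
      (e0 : Expr (A.tensor B))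
      (h0 : TTg TA TB true ⟨X, .app s ss, U⟩ ⟨Y, .var y, V⟩ e0)
      (g : ℕ → Expr (A.tensor B))
      (hg : ∀ i (hi : i < X.length),
          TTg TA TB true ⟨X.take i, .var (X[i]'hi).1, (X[i]'hi).2⟩
            ⟨Y, .app t ts, V⟩ (g i)) :
      TTg TA TB true ⟨X, .app s ss, U⟩ ⟨Y, .app t ts, V⟩ (e0.substL (pairsL X y g))

/-- The graph of the operation `●_t` (flag `false`), resp. of `●*_t` (flag `true`). -/
inductive TTd (TA : Set (Judg A)) (TB : Set (Judg B)) :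
    Bool → TArg A → TArg B → Expr (A.tensor B) → Prop where
  | varL {b : Bool} {X : PreCtx A} {x : A.Var} {U : SortE A} {bArg : TArg B}
      {e : Expr (A.tensor B)}
      (h : TTg TA TB b ⟨X, .var x, U⟩ bArg e) : TTd TA TB b ⟨X, .var x, U⟩ bArg e
  | varR {b : Bool} {aArg : TArg A} {Y : PreCtx B} {y : B.Var} {V : SortE B}
      {e : Expr (A.tensor B)}
      (h : TTg TA TB b aArg ⟨Y, .var y, V⟩ e) : TTd TA TB b aArg ⟨Y, .var y, V⟩ e
  | appapp_base {X : PreCtx A} {s : A.TermSym} {ss : List (Expr A)} {U : SortE A}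
      {Y : PreCtx B} {t : B.TermSym} {ts : List (Expr B)} {V : SortE B} {y : B.Var}
      (hy : ∀ p ∈ Y, p.1 ≠ y)
      (e0 : Expr (A.tensor B))
      (h0 : TTg TA TB false ⟨X, .app s ss, U⟩ ⟨Y, .var y, V⟩ e0)
      (g : ℕ → Expr (A.tensor B))
      (hg : ∀ i (hi : i < X.length),
          TTg TA TB false ⟨X.take i, .var (X[i]'hi).1, (X[i]'hi).2⟩
            ⟨Y, .app t ts, V⟩ (g i)) :
      TTd TA TB false ⟨X, .app s ss, U⟩ ⟨Y, .app t ts, V⟩ (e0.substL (pairsL X y g))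
  | appapp_star {X : PreCtx A} {s : A.TermSym} {ss : List (Expr A)} {U : SortE A}
      {Y : PreCtx B} {t : B.TermSym} {ts : List (Expr B)} {V : SortE B} {x : A.Var}
      (hx : ∀ p ∈ X, p.1 ≠ x)
      (e0 : Expr (A.tensor B))
      (h0 : TTg TA TB true ⟨X, .var x, U⟩ ⟨Y, .app t ts, V⟩ e0)
      (g : ℕ → Expr (A.tensor B))
      (hg : ∀ j (hj : j < Y.length),
          TTg TA TB true ⟨X, .app s ss, U⟩
            ⟨Y.take j, .var (Y[j]'hj).1, (Y[j]'hj).2⟩ (g j)) :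
      TTd TA TB true ⟨X, .app s ss, U⟩ ⟨Y, .app t ts, V⟩ (e0.substL (pairsR x Y g))

/-- The graph of the tensor sort operation `⊗_s` (resp. `⊗*_s` for flag `true`):
`TSo TA TB b X x U Y y V W` means `W = U^x ⊗ V^y`. -/
inductive TSo (TA : Set (Judg A)) (TB : Set (Judg B)) :
    Bool → PreCtx A → A.Var → SortE A → PreCtx B → B.Var → SortE B →
    SortE (A.tensor B) → Prop where
  | mk {b : Bool} {X : PreCtx A} {x : A.Var} {S : A.SortSym} {ss : List (Expr A)}
      {Y : PreCtx B} {y : B.Var} {T : B.SortSym} {ts : List (Expr B)}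
      (hx : ∀ p ∈ X, p.1 ≠ x) (hy : ∀ p ∈ Y, p.1 ≠ y)
      (SS : ℕ → SortE A) (TSf : ℕ → SortE B)
      (hSS : ∀ i (hi : i < ss.length), CanonSort TA X (ss[i]'hi) (SS i))
      (hTS : ∀ j (hj : j < ts.length), CanonSort TB Y (ts[j]'hj) (TSf j))
      (M : ℕ → ℕ → Expr (A.tensor B)) (out : List (Expr (A.tensor B)))
      (hM : ∀ i (hi : i < ss.length), ∀ j (hj : j < ts.length),
          TTg TA TB b ⟨X, ss[i]'hi, SS i⟩ ⟨Y, ts[j]'hj, TSf j⟩ (M i j))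
      (hMx : ∀ j (hj : j < ts.length),
          TTg TA TB b ⟨X, .var x, ⟨S, ss⟩⟩ ⟨Y, ts[j]'hj, TSf j⟩ (M ss.length j))
      (hMy : ∀ i (hi : i < ss.length),
          TTg TA TB b ⟨X, ss[i]'hi, SS i⟩ ⟨Y, .var y, ⟨T, ts⟩⟩ (M i ts.length))
      (hout : IsGrid (ss.length + 1) (ts.length + 1) M out) :
      TSo TA TB b X x ⟨S, ss⟩ Y y ⟨T, ts⟩ ⟨(S, T), out.dropLast⟩

/-- The tensor precontext `Z = X ⊗ Y`, with entries `xᵢyⱼ : Xᵢ ⊗ Yⱼ` ordered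
lexicographically. -/
def TCtx (TA : Set (Judg A)) (TB : Set (Judg B)) (b : Bool)
    (X : PreCtx A) (Y : PreCtx B) (Z : PreCtx (A.tensor B)) : Prop :=
  Z.length = X.length * Y.length ∧
  ∀ i j (hi : i < X.length) (hj : j < Y.length) (h : i * Y.length + j < Z.length),
    (Z[i * Y.length + j]'h).1 = ((X[i]'hi).1, (Y[j]'hj).1) ∧
    TSo TA TB b (X.take i) (X[i]'hi).1 (X[i]'hi).2
      (Y.take j) (Y[j]'hj).1 (Y[j]'hj).2 (Z[i * Y.length + j]'h).2

/-- The graph of the tensor operation `⊙` on pairs of judgments of the admissible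
kinds of Table 1 (flag `false`), resp. of the interchanged operation `⊙*` of §8
(flag `true`).  `chA` and `chB` are the functions choosing, for each context, a
variable not occurring in it. -/
inductive TJudg (TA : Set (Judg A)) (TB : Set (Judg B))
    (chA : PreCtx A → A.Var) (chB : PreCtx B → B.Var) :
    Bool → Judg A → Judg B → Judg (A.tensor B) → Prop where
  /- sort ⊙ sort -/
  | ss {b : Bool} {X : PreCtx A} {U : SortE A} {Y : PreCtx B} {V : SortE B}
      {Z : PreCtx (A.tensor B)} {W : SortE (A.tensor B)}
      (hZ : TCtx TA TB b (X ++ [(chA X, U)]) (Y ++ [(chB Y, V)]) Z)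
      (hW : TSo TA TB b X (chA X) U Y (chB Y) V W) :
      TJudg TA TB chA chB b (.sort X U) (.sort Y V) (.sort Z.dropLast W)
  /- sort ⊙ term -/
  | st {b : Bool} {X : PreCtx A} {U : SortE A} {Y : PreCtx B} {v : Expr B} {V : SortE B}
      {Z : PreCtx (A.tensor B)} {e : Expr (A.tensor B)} {W : SortE (A.tensor B)}
      {g : ℕ → Expr (A.tensor B)}
      (hZ : TCtx TA TB b (X ++ [(chA X, U)]) Y Z)
      (he : TTg TA TB b ⟨X, .var (chA X), U⟩ ⟨Y, v, V⟩ e)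
      (hW : TSo TA TB b X (chA X) U Y (chB Y) V W)
      (hg : ∀ i (hi : i < X.length),
          TTg TA TB b ⟨X.take i, .var (X[i]'hi).1, (X[i]'hi).2⟩ ⟨Y, v, V⟩ (g i)) :
      TJudg TA TB chA chB b (.sort X U) (.term Y v V)
        (.term Z e (W.substL (pairsL X (chB Y) g)))
  /- term ⊙ sort -/
  | ts {b : Bool} {X : PreCtx A} {u : Expr A} {U : SortE A} {Y : PreCtx B} {V : SortE B}
      {Z : PreCtx (A.tensor B)} {e : Expr (A.tensor B)} {W : SortE (A.tensor B)}
      {g : ℕ → Expr (A.tensor B)}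
      (hZ : TCtx TA TB b X (Y ++ [(chB Y, V)]) Z)
      (he : TTg TA TB b ⟨X, u, U⟩ ⟨Y, .var (chB Y), V⟩ e)
      (hW : TSo TA TB b X (chA X) U Y (chB Y) V W)
      (hg : ∀ j (hj : j < Y.length),
          TTg TA TB b ⟨X, u, U⟩ ⟨Y.take j, .var (Y[j]'hj).1, (Y[j]'hj).2⟩ (g j)) :
      TJudg TA TB chA chB b (.term X u U) (.sort Y V)
        (.term Z e (W.substL (pairsR (chA X) Y g)))
  /- term ⊙ term -/
  | tt {b : Bool} {X : PreCtx A} {u : Expr A} {U : SortE A}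
      {Y : PreCtx B} {v : Expr B} {V : SortE B}
      {Z : PreCtx (A.tensor B)} {e1 e2 : Expr (A.tensor B)} {W : SortE (A.tensor B)}
      {gx gy : ℕ → Expr (A.tensor B)}
      (hZ : TCtx TA TB b X Y Z)
      (he1 : TTg TA TB b ⟨X, u, U⟩ ⟨Y, v, V⟩ e1)
      (he2 : TTd TA TB b ⟨X, u, U⟩ ⟨Y, v, V⟩ e2)
      (hW : TSo TA TB b X (chA X) U Y (chB Y) V W)
      (hgx : ∀ i (hi : i < X.length),
          TTg TA TB b ⟨X.take i, .var (X[i]'hi).1, (X[i]'hi).2⟩ ⟨Y, v, V⟩ (gx i))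
      (hgy : ∀ j (hj : j < Y.length),
          TTg TA TB b ⟨X, u, U⟩ ⟨Y.take j, .var (Y[j]'hj).1, (Y[j]'hj).2⟩ (gy j)) :
      TJudg TA TB chA chB b (.term X u U) (.term Y v V)
        (.termEq Z e1 e2 (W.substL (pairsL X (chB Y) gx ++ pairsR (chA X) Y gy)))
  /- sort ⊙ sort equality -/
  | sseq {b : Bool} {X : PreCtx A} {U : SortE A} {Y : PreCtx B} {V V' : SortE B}
      {Z : PreCtx (A.tensor B)} {W W' : SortE (A.tensor B)}
      (hZ : TCtx TA TB b (X ++ [(chA X, U)]) (Y ++ [(chB Y, V)]) Z)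
      (hW : TSo TA TB b X (chA X) U Y (chB Y) V W)
      (hW' : TSo TA TB b X (chA X) U Y (chB Y) V' W') :
      TJudg TA TB chA chB b (.sort X U) (.sortEq Y V V') (.sortEq Z.dropLast W W')
  /- sort equality ⊙ sort -/
  | seqs {b : Bool} {X : PreCtx A} {U U' : SortE A} {Y : PreCtx B} {V : SortE B}
      {Z : PreCtx (A.tensor B)} {W W' : SortE (A.tensor B)}
      (hZ : TCtx TA TB b (X ++ [(chA X, U)]) (Y ++ [(chB Y, V)]) Z)
      (hW : TSo TA TB b X (chA X) U Y (chB Y) V W)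
      (hW' : TSo TA TB b X (chA X) U' Y (chB Y) V W') :
      TJudg TA TB chA chB b (.sortEq X U U') (.sort Y V) (.sortEq Z.dropLast W W')
  /- sort ⊙ term equality -/
  | steq {b : Bool} {X : PreCtx A} {U : SortE A} {Y : PreCtx B} {v v' : Expr B}
      {V : SortE B} {Z : PreCtx (A.tensor B)} {e e' : Expr (A.tensor B)}
      {W : SortE (A.tensor B)} {g : ℕ → Expr (A.tensor B)}
      (hZ : TCtx TA TB b (X ++ [(chA X, U)]) Y Z)
      (he : TTg TA TB b ⟨X, .var (chA X), U⟩ ⟨Y, v, V⟩ e)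
      (he' : TTg TA TB b ⟨X, .var (chA X), U⟩ ⟨Y, v', V⟩ e')
      (hW : TSo TA TB b X (chA X) U Y (chB Y) V W)
      (hg : ∀ i (hi : i < X.length),
          TTg TA TB b ⟨X.take i, .var (X[i]'hi).1, (X[i]'hi).2⟩ ⟨Y, v, V⟩ (g i)) :
      TJudg TA TB chA chB b (.sort X U) (.termEq Y v v' V)
        (.termEq Z e e' (W.substL (pairsL X (chB Y) g)))
  /- term equality ⊙ sort -/
  | teqs {b : Bool} {X : PreCtx A} {u u' : Expr A} {U : SortE A} {Y : PreCtx B}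
      {V : SortE B} {Z : PreCtx (A.tensor B)} {e e' : Expr (A.tensor B)}
      {W : SortE (A.tensor B)} {g : ℕ → Expr (A.tensor B)}
      (hZ : TCtx TA TB b X (Y ++ [(chB Y, V)]) Z)
      (he : TTg TA TB b ⟨X, u, U⟩ ⟨Y, .var (chB Y), V⟩ e)
      (he' : TTg TA TB b ⟨X, u', U⟩ ⟨Y, .var (chB Y), V⟩ e')
      (hW : TSo TA TB b X (chA X) U Y (chB Y) V W)
      (hg : ∀ j (hj : j < Y.length),
          TTg TA TB b ⟨X, u, U⟩ ⟨Y.take j, .var (Y[j]'hj).1, (Y[j]'hj).2⟩ (g j)) :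
      TJudg TA TB chA chB b (.termEq X u u' U) (.sort Y V)
        (.termEq Z e e' (W.substL (pairsR (chA X) Y g)))
  /- sort equality ⊙ term -/
  | seqt {b : Bool} {X : PreCtx A} {U U' : SortE A} {Y : PreCtx B} {v : Expr B}
      {V : SortE B} {Z : PreCtx (A.tensor B)} {e e' : Expr (A.tensor B)}
      {W : SortE (A.tensor B)} {g : ℕ → Expr (A.tensor B)}
      (hZ : TCtx TA TB b (X ++ [(chA X, U)]) Y Z)
      (he : TTg TA TB b ⟨X, .var (chA X), U⟩ ⟨Y, v, V⟩ e)
      (he' : TTg TA TB b ⟨X, .var (chA X), U'⟩ ⟨Y, v, V⟩ e')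
      (hW : TSo TA TB b X (chA X) U Y (chB Y) V W)
      (hg : ∀ i (hi : i < X.length),
          TTg TA TB b ⟨X.take i, .var (X[i]'hi).1, (X[i]'hi).2⟩ ⟨Y, v, V⟩ (g i)) :
      TJudg TA TB chA chB b (.sortEq X U U') (.term Y v V)
        (.termEq Z e e' (W.substL (pairsL X (chB Y) g)))
  /- term ⊙ sort equality -/
  | tseq {b : Bool} {X : PreCtx A} {u : Expr A} {U : SortE A} {Y : PreCtx B}
      {V V' : SortE B} {Z : PreCtx (A.tensor B)} {e e' : Expr (A.tensor B)}
      {W : SortE (A.tensor B)} {g : ℕ → Expr (A.tensor B)}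
      (hZ : TCtx TA TB b X (Y ++ [(chB Y, V)]) Z)
      (he : TTg TA TB b ⟨X, u, U⟩ ⟨Y, .var (chB Y), V⟩ e)
      (he' : TTg TA TB b ⟨X, u, U⟩ ⟨Y, .var (chB Y), V'⟩ e')
      (hW : TSo TA TB b X (chA X) U Y (chB Y) V W)
      (hg : ∀ j (hj : j < Y.length),
          TTg TA TB b ⟨X, u, U⟩ ⟨Y.take j, .var (Y[j]'hj).1, (Y[j]'hj).2⟩ (g j)) :
      TJudg TA TB chA chB b (.term X u U) (.sortEq Y V V')
        (.termEq Z e e' (W.substL (pairsR (chA X) Y g)))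

/-- A choice, for every precontext, of a variable not contained in it. -/
def FreshCh {A : Alphabet} (ch : PreCtx A → A.Var) : Prop :=
  ∀ X : PreCtx A, ∀ p ∈ X, p.1 ≠ ch X

/-- The set of axioms of the pretheory `𝔸 ⊗ 𝔹`: the judgments `J ⊙ J'` for `J` an
axiom of `𝔸` and `J'` an axiom of `𝔹`. -/
def tensorAx (TA : Set (Judg A)) (TB : Set (Judg B))
    (chA : PreCtx A → A.Var) (chB : PreCtx B → B.Var) : Set (Judg (A.tensor B)) :=
  {K | ∃ J J', J ∈ TA ∧ J' ∈ TB ∧ TJudg TA TB chA chB false J J' K}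

/-- The pair `(𝔸, 𝔹)` is `h`-derivable: `J ⊙ J'` is derivable in the pretheory
`𝔸 ⊗ 𝔹` whenever `J`, `J'` are derivable judgments of `𝔸`, `𝔹` (of admissible
kinds) with `ht J * ht J' ≤ h`. -/
def hDerivable (TA : Set (Judg A)) (TB : Set (Judg B))
    (chA : PreCtx A → A.Var) (chB : PreCtx B → B.Var) (h : ℕ) : Prop :=
  ∀ (J : Judg A) (J' : Judg B) (K : Judg (A.tensor B)),
    Derivable TA J → Derivable TB J' → ht TA J * ht TB J' ≤ h →
    TJudg TA TB chA chB false J J' K → Derivable (tensorAx TA TB chA chB) K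

/-- The tensor `out = f ⊗ g` of two tuples of derivable terms, each entry being
the tensor of terms taken at their canonical sorts, ordered lexicographically. -/
def TMor (TA : Set (Judg A)) (TB : Set (Judg B)) (b : Bool)
    (X : PreCtx A) (f : List (Expr A)) (Y : PreCtx B) (g : List (Expr B))
    (out : List (Expr (A.tensor B))) : Prop :=
  out.length = f.length * g.length ∧
  ∀ i j (hi : i < f.length) (hj : j < g.length) (h : i * g.length + j < out.length),
    ∃ U V, CanonSort TA X (f[i]'hi) U ∧ CanonSort TB Y (g[j]'hj) V ∧
      TTg TA TB b ⟨X, f[i]'hi, U⟩ ⟨Y, g[j]'hj, V⟩ (out[i * g.length + j]'h)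

/-- The tensor `out = f ⊗ Y` of a tuple of derivable terms of `𝔸` with a context
of `𝔹`: entries `fᵢ^{𝒮(fᵢ)} ⊗ yⱼ^{Yⱼ}`. -/
def TMorCtx (TA : Set (Judg A)) (TB : Set (Judg B)) (b : Bool)
    (X : PreCtx A) (f : List (Expr A)) (Y : PreCtx B)
    (out : List (Expr (A.tensor B))) : Prop :=
  out.length = f.length * Y.length ∧
  ∀ i j (hi : i < f.length) (hj : j < Y.length) (h : i * Y.length + j < out.length),
    ∃ U, CanonSort TA X (f[i]'hi) U ∧
      TTg TA TB b ⟨X, f[i]'hi, U⟩ ⟨Y.take j, .var (Y[j]'hj).1, (Y[j]'hj).2⟩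
        (out[i * Y.length + j]'h)

/-- The tensor `out = X ⊗ g` of a context of `𝔸` with a tuple of derivable terms
of `𝔹`: entries `xᵢ^{Xᵢ} ⊗ gⱼ^{𝒮(gⱼ)}`. -/
def TCtxMor (TA : Set (Judg A)) (TB : Set (Judg B)) (b : Bool)
    (X : PreCtx A) (Y : PreCtx B) (g : List (Expr B))
    (out : List (Expr (A.tensor B))) : Prop :=
  out.length = X.length * g.length ∧
  ∀ i j (hi : i < X.length) (hj : j < g.length) (h : i * g.length + j < out.length),
    ∃ V, CanonSort TB Y (g[j]'hj) V ∧
      TTg TA TB b ⟨X.take i, .var (X[i]'hi).1, (X[i]'hi).2⟩ ⟨Y, g[j]'hj, V⟩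
        (out[i * g.length + j]'h)

/-- The tensor `out = (x₁,…,x_m,u^U) ⊗ Y` of the section determined by a term
`X ⊢ u : U` with a context of `𝔹`. -/
def TSecL (TA : Set (Judg A)) (TB : Set (Judg B)) (b : Bool)
    (X : PreCtx A) (u : Expr A) (U : SortE A) (Y : PreCtx B)
    (out : List (Expr (A.tensor B))) : Prop :=
  out.length = (X.length + 1) * Y.length ∧
  (∀ i j (hi : i < X.length) (hj : j < Y.length) (h : i * Y.length + j < out.length),
      TTg TA TB b ⟨X.take i, .var (X[i]'hi).1, (X[i]'hi).2⟩
        ⟨Y.take j, .var (Y[j]'hj).1, (Y[j]'hj).2⟩ (out[i * Y.length + j]'h)) ∧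
  (∀ j (hj : j < Y.length) (h : X.length * Y.length + j < out.length),
      TTg TA TB b ⟨X, u, U⟩ ⟨Y.take j, .var (Y[j]'hj).1, (Y[j]'hj).2⟩
        (out[X.length * Y.length + j]'h))

/-- The tensor `out = X ⊗ (y₁,…,yₙ,v^V)` of a context of `𝔸` with the section
determined by a term `Y ⊢ v : V` of `𝔹`. -/
def TSecR (TA : Set (Judg A)) (TB : Set (Judg B)) (b : Bool)
    (X : PreCtx A) (Y : PreCtx B) (v : Expr B) (V : SortE B)
    (out : List (Expr (A.tensor B))) : Prop :=
  out.length = X.length * (Y.length + 1) ∧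
  (∀ i j (hi : i < X.length) (hj : j < Y.length)
      (h : i * (Y.length + 1) + j < out.length),
      TTg TA TB b ⟨X.take i, .var (X[i]'hi).1, (X[i]'hi).2⟩
        ⟨Y.take j, .var (Y[j]'hj).1, (Y[j]'hj).2⟩ (out[i * (Y.length + 1) + j]'h)) ∧
  (∀ i (hi : i < X.length) (h : i * (Y.length + 1) + Y.length < out.length),
      TTg TA TB b ⟨X.take i, .var (X[i]'hi).1, (X[i]'hi).2⟩ ⟨Y, v, V⟩
        (out[i * (Y.length + 1) + Y.length]'h))

/-! ### Substitution -/

@[elab_as_elim]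
theorem Expr.ind {P : Expr A → Prop} (hv : ∀ x, P (.var x))
    (ha : ∀ t es, (∀ e ∈ es, P e) → P (.app t es)) : ∀ e, P e
  | .var x => hv x
  | .app t es => ha t es fun e he => Expr.ind hv ha e
termination_by e => sizeOf e
decreasing_by
  have := List.sizeOf_lt_of_mem he
  simp only [Expr.app.sizeOf_spec]
  omega

@[simp] theorem subst_var (σ : A.Var → Expr A) (x : A.Var) : (Expr.var x).subst σ = σ x := by
  rw [Expr.subst]

@[simp] theorem subst_app (σ : A.Var → Expr A) (t : A.TermSym) (es : List (Expr A)) :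
    (Expr.app t es).subst σ = .app t (es.map (Expr.subst σ)) := by
  rw [Expr.subst, List.attach_map_val (l := es) (f := Expr.subst σ)]

theorem subst_congr {σ τ : A.Var → Expr A} {e : Expr A} (h : ∀ x, Occurs x e → σ x = τ x) :
    e.subst σ = e.subst τ := by
  induction e using Expr.ind with
  | hv x => simpa using h x .var
  | ha t es ih =>
    simp only [subst_app, Expr.app.injEq, true_and]
    exact List.map_congr_left fun e he => ih e he fun x hx => h x (.app he hx)

theorem subst_id (e : Expr A) : e.subst Expr.var = e := by
  induction e using Expr.ind with
  | hv x => simp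
  | ha t es ih =>
    simp only [subst_app, Expr.app.injEq, true_and]
    conv_rhs => rw [← List.map_id es]
    exact List.map_congr_left fun e he => ih e he

theorem subst_eq_self {σ : A.Var → Expr A} {e : Expr A} (h : ∀ x, Occurs x e → σ x = .var x) :
    e.subst σ = e := (subst_congr h).trans (subst_id e)

theorem subst_subst (σ τ : A.Var → Expr A) (e : Expr A) :
    (e.subst σ).subst τ = e.subst fun x => (σ x).subst τ := by
  induction e using Expr.ind with
  | hv x => simp
  | ha t es ih =>
    simp only [subst_app, Expr.app.injEq, true_and, List.map_map]
    exact List.map_congr_left fun e he => ih e he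

theorem occurs_app {x : A.Var} {t : A.TermSym} {es : List (Expr A)} :
    Occurs x (.app t es) ↔ ∃ e ∈ es, Occurs x e :=
  ⟨fun h => by cases h with | app h1 h2 => exact ⟨_, h1, h2⟩, fun ⟨e, h1, h2⟩ => .app h1 h2⟩

theorem occurs_var {x y : A.Var} : Occurs x (.var y) ↔ x = y :=
  ⟨fun h => by cases h; rfl, fun h => h ▸ .var⟩

theorem ssubst_congr {σ τ : A.Var → Expr A} {U : SortE A} (h : ∀ x, SOccurs x U → σ x = τ x) :
    U.subst σ = U.subst τ := by
  simp only [SortE.subst, SortE.mk.injEq, true_and]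
  exact List.map_congr_left fun e he => subst_congr fun x hx => h x ⟨e, he, hx⟩

theorem ssubst_eq_self {σ : A.Var → Expr A} {U : SortE A}
    (h : ∀ x, SOccurs x U → σ x = .var x) : U.subst σ = U := by
  obtain ⟨S, l⟩ := U
  simp only [SortE.subst, SortE.mk.injEq, true_and]
  conv_rhs => rw [← List.map_id l]
  exact List.map_congr_left fun e he => subst_eq_self fun x hx => h x ⟨e, he, hx⟩

@[simp] theorem ssubst_id (U : SortE A) : U.subst Expr.var = U := ssubst_eq_self fun _ _ => rfl

theorem ssubst_subst (σ τ : A.Var → Expr A) (U : SortE A) :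
    (U.subst σ).subst τ = U.subst fun x => (σ x).subst τ := by
  simp only [SortE.subst, SortE.mk.injEq, true_and, List.map_map]
  exact List.map_congr_left fun e _ => subst_subst σ τ e

/-! ### Lookup of substitution pairs -/

theorem lookupV_of_mem {ps : List (A.Var × Expr A)} (nd : (ps.map Prod.fst).Nodup)
    {x : A.Var} {e : Expr A} (h : (x, e) ∈ ps) : lookupV ps x = e := by
  induction ps with
  | nil => simp at h
  | cons p ps ih =>
    simp only [List.map_cons, List.nodup_cons] at nd
    rcases List.mem_cons.1 h with rfl | h
    · simp [lookupV]
    · have : p.1 ≠ x := fun hp => nd.1 (hp ▸ List.mem_map_of_mem (f := Prod.fst) h)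
      simp [lookupV, this, ih nd.2 h]

theorem lookupV_of_forall {ps : List (A.Var × Expr A)} {x : A.Var} {e : Expr A}
    (h : ∀ p ∈ ps, p.1 = x → p.2 = e) (hx : x ∈ ps.map Prod.fst) : lookupV ps x = e := by
  induction ps with
  | nil => simp at hx
  | cons p ps ih =>
    by_cases hp : p.1 = x
    · simp [lookupV, hp, h p (by simp) hp]
    · simp only [lookupV, hp, if_false]
      refine ih (fun q hq => h q (by simp [hq])) ?_
      rcases List.mem_cons.1 hx with h | h
      · exact absurd h.symm hp
      · exact h

theorem lookupV_of_notMem {ps : List (A.Var × Expr A)} {x : A.Var}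
    (h : x ∉ ps.map Prod.fst) : lookupV ps x = .var x := by
  induction ps with
  | nil => rfl
  | cons p ps ih =>
    simp only [List.map_cons, List.mem_cons, not_or] at h
    simp [lookupV, Ne.symm h.1, ih h.2]

theorem mkSub_map (X : PreCtx A) (φ : A.Var → Expr A) :
    mkSub X (X.map fun p => φ p.1) = X.map fun p => (p.1, φ p.1) := by
  induction X with
  | nil => rfl
  | cons p X ih => simpa [mkSub] using ih

theorem lookupV_mkSub_map (X : PreCtx A) (φ : A.Var → Expr A) {x : A.Var}
    (hx : x ∈ X.map Prod.fst) : lookupV (mkSub X (X.map fun p => φ p.1)) x = φ x := by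
  rw [mkSub_map]
  apply lookupV_of_forall
  · simp only [List.mem_map]
    rintro _ ⟨q, _, rfl⟩ rfl
    rfl
  · simpa using hx

/-- Every tuple indexed by a list of distinct variables is given by a function. -/
theorem exists_fun_of_nodup {X : PreCtx A} {f : List (Expr A)} (nd : (X.map Prod.fst).Nodup)
    (hl : f.length = X.length) : ∃ φ : A.Var → Expr A, f = X.map fun p => φ p.1 := by
  refine ⟨lookupV (mkSub X f), ?_⟩
  apply List.ext_getElem (by simp [hl])
  intro i h1 h2
  rw [List.getElem_map]
  symm
  apply lookupV_of_mem
  · rw [show (mkSub X f).map Prod.fst = X.map Prod.fst from List.map_fst_zip (by simp [hl])]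
    exact nd
  · change _ ∈ (X.map Prod.fst).zip f
    rw [List.mem_iff_getElem]
    exact ⟨i, by simp [hl] at h1 ⊢; omega, by simp⟩

theorem subPre_map {X : PreCtx A} (hX : IsPreCtx X) (φ : A.Var → Expr A) (i : ℕ)
    (hi : i < X.length) : subPre X (X.map fun p => φ p.1) i hi = (X[i]'hi).2.subst φ := by
  rw [subPre, SortE.substL, ← List.map_take]
  exact ssubst_congr fun x hx => lookupV_mkSub_map _ _ (hX i hi x hx)

/-! ### A ranked presentation of the derivable judgments -/

/-- The standard judgments without their contexts. -/
inductive Jd (A : Alphabet) : Type where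
  | so (U : SortE A)
  | tm (u : Expr A) (U : SortE A)
  | seq (U V : SortE A)
  | teq (u v : Expr A) (U : SortE A)

def Jd.subst (φ : A.Var → Expr A) : Jd A → Jd A
  | .so U => .so (U.subst φ)
  | .tm u U => .tm (u.subst φ) (U.subst φ)
  | .seq U V => .seq (U.subst φ) (V.subst φ)
  | .teq u v U => .teq (u.subst φ) (v.subst φ) (U.subst φ)

/-- The standard judgment over a given context. -/
def Jd.over (X : PreCtx A) : Jd A → Judg A
  | .so U => .sort X U
  | .tm u U => .term X u U
  | .seq U V => .sortEq X U V
  | .teq u v U => .termEq X u v U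

/-- A presentation of derivability in which tuples are given by functions on variables and
derivations carry a rank, which drops strictly in the premises of all rules but `var`. -/
inductive W (Ax : Set (Judg A)) : ℕ → PreCtx A → Jd A → Prop
  | var {n : ℕ} {X₀ X₁ : PreCtx A} {x : A.Var} {U : SortE A} (h : W Ax n X₀ (.so U)) :
      W Ax n (X₀ ++ (x, U) :: X₁) (.tm (.var x) U)
  | so {n k : ℕ} {X C : PreCtx A} {S : A.SortSym} {φ : A.Var → Expr A} (hk : k < n)
      (ax : introSort C S ∈ Ax) (nd : (C.map Prod.fst).Nodup)
      (hC : ∀ C₀ p C₁, C = C₀ ++ p :: C₁ → W Ax k C₀ (.so p.2))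
      (ha : ∀ p ∈ C, W Ax k X (.tm (φ p.1) (p.2.subst φ))) :
      W Ax n X (.so ⟨S, C.map fun p => φ p.1⟩)
  | tm {n k : ℕ} {X C : PreCtx A} {t : A.TermSym} {U : SortE A} {φ : A.Var → Expr A} (hk : k < n)
      (ax : introTerm C t U ∈ Ax) (nd : (C.map Prod.fst).Nodup)
      (hC : ∀ C₀ p C₁, C = C₀ ++ p :: C₁ → W Ax k C₀ (.so p.2))
      (hU : W Ax k C (.so U))
      (ha : ∀ p ∈ C, W Ax k X (.tm (φ p.1) (p.2.subst φ)))
      (hUφ : W Ax k X (.so (U.subst φ))) :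
      W Ax n X (.tm (.app t (C.map fun p => φ p.1)) (U.subst φ))
  | conv {n k : ℕ} {X : PreCtx A} {u : Expr A} {U U' : SortE A} (hk : k < n)
      (he : W Ax k X (.seq U U')) (hu : W Ax k X (.tm u U)) (hU : W Ax k X (.so U))
      (hU' : W Ax k X (.so U')) : W Ax n X (.tm u U')
  | srefl {n k : ℕ} {X : PreCtx A} {U : SortE A} (hk : k < n) (h : W Ax k X (.so U)) :
      W Ax n X (.seq U U)
  | ssym {n k : ℕ} {X : PreCtx A} {U V : SortE A} (hk : k < n) (h : W Ax k X (.seq U V)) :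
      W Ax n X (.seq V U)
  | strans {n k : ℕ} {X : PreCtx A} {U V V' : SortE A} (hk : k < n)
      (h1 : W Ax k X (.seq U V)) (h2 : W Ax k X (.seq V V')) : W Ax n X (.seq U V')
  | sax {n k : ℕ} {X C : PreCtx A} {U U' : SortE A} {φ : A.Var → Expr A} (hk : k < n)
      (ax : Judg.sortEq C U U' ∈ Ax) (nd : (C.map Prod.fst).Nodup)
      (hC : ∀ C₀ p C₁, C = C₀ ++ p :: C₁ → W Ax k C₀ (.so p.2))
      (hU : W Ax k C (.so U)) (hU' : W Ax k C (.so U'))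
      (ha : ∀ p ∈ C, W Ax k X (.tm (φ p.1) (p.2.subst φ)))
      (hUφ : W Ax k X (.so (U.subst φ))) (hUφ' : W Ax k X (.so (U'.subst φ))) :
      W Ax n X (.seq (U.subst φ) (U'.subst φ))
  | scong {n k : ℕ} {X C : PreCtx A} {S : A.SortSym} {φ φ' : A.Var → Expr A} (hk : k < n)
      (ax : introSort C S ∈ Ax) (nd : (C.map Prod.fst).Nodup)
      (hC : ∀ C₀ p C₁, C = C₀ ++ p :: C₁ → W Ax k C₀ (.so p.2))
      (ha : ∀ p ∈ C, W Ax k X (.tm (φ p.1) (p.2.subst φ)))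
      (ha' : ∀ p ∈ C, W Ax k X (.tm (φ' p.1) (p.2.subst φ')))
      (he : ∀ p ∈ C, W Ax k X (.teq (φ p.1) (φ' p.1) (p.2.subst φ))) :
      W Ax n X (.seq ⟨S, C.map fun p => φ p.1⟩ ⟨S, C.map fun p => φ' p.1⟩)
  | trefl {n k : ℕ} {X : PreCtx A} {u : Expr A} {U : SortE A} (hk : k < n)
      (h : W Ax k X (.tm u U)) : W Ax n X (.teq u u U)
  | tsym {n k : ℕ} {X : PreCtx A} {u v : Expr A} {U : SortE A} (hk : k < n)
      (h : W Ax k X (.teq u v U)) : W Ax n X (.teq v u U)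
  | ttrans {n k : ℕ} {X : PreCtx A} {u v w : Expr A} {U : SortE A} (hk : k < n)
      (h1 : W Ax k X (.teq u v U)) (h2 : W Ax k X (.teq v w U)) : W Ax n X (.teq u w U)
  | tconv {n k : ℕ} {X : PreCtx A} {u v : Expr A} {U U' : SortE A} (hk : k < n)
      (he : W Ax k X (.seq U U')) (hu : W Ax k X (.teq u v U)) (hU : W Ax k X (.so U))
      (hU' : W Ax k X (.so U')) : W Ax n X (.teq u v U')
  | tax {n k : ℕ} {X C : PreCtx A} {u u' : Expr A} {U : SortE A} {φ : A.Var → Expr A} (hk : k < n)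
      (ax : Judg.termEq C u u' U ∈ Ax) (nd : (C.map Prod.fst).Nodup)
      (hC : ∀ C₀ p C₁, C = C₀ ++ p :: C₁ → W Ax k C₀ (.so p.2))
      (hu : W Ax k C (.tm u U)) (hu' : W Ax k C (.tm u' U))
      (ha : ∀ p ∈ C, W Ax k X (.tm (φ p.1) (p.2.subst φ)))
      (huφ : W Ax k X (.tm (u.subst φ) (U.subst φ)))
      (huφ' : W Ax k X (.tm (u'.subst φ) (U.subst φ))) :
      W Ax n X (.teq (u.subst φ) (u'.subst φ) (U.subst φ))
  | tcong {n k : ℕ} {X C : PreCtx A} {t : A.TermSym} {U : SortE A} {φ φ' : A.Var → Expr A}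
      (hk : k < n) (ax : introTerm C t U ∈ Ax) (nd : (C.map Prod.fst).Nodup)
      (hC : ∀ C₀ p C₁, C = C₀ ++ p :: C₁ → W Ax k C₀ (.so p.2))
      (hU : W Ax k C (.so U))
      (ha : ∀ p ∈ C, W Ax k X (.tm (φ p.1) (p.2.subst φ)))
      (ha' : ∀ p ∈ C, W Ax k X (.tm (φ' p.1) (p.2.subst φ')))
      (he : ∀ p ∈ C, W Ax k X (.teq (φ p.1) (φ' p.1) (p.2.subst φ)))
      (hUφ : W Ax k X (.so (U.subst φ)))
      (ht : W Ax k X (.tm (.app t (C.map fun p => φ p.1)) (U.subst φ)))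
      (ht' : W Ax k X (.tm (.app t (C.map fun p => φ' p.1)) (U.subst φ))) :
      W Ax n X (.teq (.app t (C.map fun p => φ p.1)) (.app t (C.map fun p => φ' p.1)) (U.subst φ))

variable {Ax : Set (Judg A)}

theorem W.mono {n : ℕ} {X : PreCtx A} {j : Jd A} (h : W Ax n X j) :
    ∀ {n' : ℕ}, n ≤ n' → W Ax n' X j := by
  induction h with
  | var h ih => intro n' hn; exact .var (ih hn)
  | so hk ax nd hC ha => intro n' hn; exact .so (hk.trans_le hn) ax nd hC ha
  | tm hk ax nd hC hU ha hUφ => intro n' hn; exact .tm (hk.trans_le hn) ax nd hC hU ha hUφ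
  | conv hk a b c d => intro n' hn; exact .conv (hk.trans_le hn) a b c d
  | srefl hk h => intro n' hn; exact .srefl (hk.trans_le hn) h
  | ssym hk h => intro n' hn; exact .ssym (hk.trans_le hn) h
  | strans hk h h' => intro n' hn; exact .strans (hk.trans_le hn) h h'
  | sax hk ax nd hC hU hU' ha h1 h2 =>
    intro n' hn; exact .sax (hk.trans_le hn) ax nd hC hU hU' ha h1 h2
  | scong hk ax nd hC ha ha' he => intro n' hn; exact .scong (hk.trans_le hn) ax nd hC ha ha' he
  | trefl hk h => intro n' hn; exact .trefl (hk.trans_le hn) h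
  | tsym hk h => intro n' hn; exact .tsym (hk.trans_le hn) h
  | ttrans hk h h' => intro n' hn; exact .ttrans (hk.trans_le hn) h h'
  | tconv hk a b c d => intro n' hn; exact .tconv (hk.trans_le hn) a b c d
  | tax hk ax nd hC hU hU' ha h1 h2 =>
    intro n' hn; exact .tax (hk.trans_le hn) ax nd hC hU hU' ha h1 h2
  | tcong hk ax nd hC hU ha ha' he hUφ h1 h2 =>
    intro n' hn; exact .tcong (hk.trans_le hn) ax nd hC hU ha ha' he hUφ h1 h2

theorem W.weaken {n : ℕ} {X : PreCtx A} {j : Jd A} (h : W Ax n X j) (X' : PreCtx A) :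
    W Ax n (X ++ X') j := by
  induction h with
  | var h ih => rw [List.append_assoc, List.cons_append]; exact .var h
  | so hk ax nd hC ha _ iha => exact .so hk ax nd hC iha
  | tm hk ax nd hC hU ha hUφ _ _ iha ihU => exact .tm hk ax nd hC hU iha ihU
  | conv hk _ _ _ _ a b c d => exact .conv hk a b c d
  | srefl hk _ h => exact .srefl hk h
  | ssym hk _ h => exact .ssym hk h
  | strans hk _ _ h h' => exact .strans hk h h'
  | sax hk ax nd hC hU hU' _ _ _ _ _ _ ha h1 h2 => exact .sax hk ax nd hC hU hU' ha h1 h2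
  | scong hk ax nd hC _ _ _ _ ha ha' he => exact .scong hk ax nd hC ha ha' he
  | trefl hk _ h => exact .trefl hk h
  | tsym hk _ h => exact .tsym hk h
  | ttrans hk _ _ h h' => exact .ttrans hk h h'
  | tconv hk _ _ _ _ a b c d => exact .tconv hk a b c d
  | tax hk ax nd hC hU hU' _ _ _ _ _ _ ha h1 h2 => exact .tax hk ax nd hC hU hU' ha h1 h2
  | tcong hk ax nd hC hU _ _ _ _ _ _ _ _ ha ha' he hUφ h1 h2 =>
    exact .tcong hk ax nd hC hU ha ha' he hUφ h1 h2

/-- The sorts and terms which a judgment presupposes. -/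
def Presup (Ax : Set (Judg A)) (n : ℕ) (X : PreCtx A) : Jd A → Prop
  | .so _ => True
  | .tm _ U => W Ax n X (.so U)
  | .seq U V => W Ax n X (.so U) ∧ W Ax n X (.so V)
  | .teq u v U => W Ax n X (.tm u U) ∧ W Ax n X (.tm v U) ∧ W Ax n X (.so U)

theorem W.presup {n : ℕ} {X : PreCtx A} {j : Jd A} (h : W Ax n X j) : Presup Ax n X j := by
  induction h with
  | var h ih => exact h.weaken _
  | so hk ax nd hC ha => trivial
  | tm hk ax nd hC hU ha hUφ => exact hUφ.mono hk.le
  | conv hk a b c d => exact d.mono hk.le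
  | srefl hk h => exact ⟨h.mono hk.le, h.mono hk.le⟩
  | ssym hk h ih => exact ⟨ih.2.mono hk.le, ih.1.mono hk.le⟩
  | strans hk h h' ih ih' => exact ⟨ih.1.mono hk.le, ih'.2.mono hk.le⟩
  | sax hk ax nd hC hU hU' ha h1 h2 => exact ⟨h1.mono hk.le, h2.mono hk.le⟩
  | scong hk ax nd hC ha ha' he => exact ⟨.so hk ax nd hC ha, .so hk ax nd hC ha'⟩
  | trefl hk h ih => exact ⟨h.mono hk.le, h.mono hk.le, W.mono ih hk.le⟩
  | tsym hk h ih => exact ⟨ih.2.1.mono hk.le, ih.1.mono hk.le, ih.2.2.mono hk.le⟩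
  | ttrans hk h h' ih ih' => exact ⟨ih.1.mono hk.le, ih'.2.1.mono hk.le, ih.2.2.mono hk.le⟩
  | tconv hk a b c d _ ih => exact ⟨.conv hk a ih.1 c d, .conv hk a ih.2.1 c d, d.mono hk.le⟩
  | tax hk ax nd hC hU hU' ha h1 h2 _ _ _ _ ih =>
    exact ⟨h1.mono hk.le, h2.mono hk.le, W.mono ih hk.le⟩
  | tcong hk ax nd hC hU ha ha' he hUφ h1 h2 => exact ⟨h1.mono hk.le, h2.mono hk.le, hUφ.mono hk.le⟩

/-- All variables of a judgment lie in the given set. -/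
def Jd.Scoped (P : A.Var → Prop) : Jd A → Prop
  | .so U => ∀ x, SOccurs x U → P x
  | .tm u U => (∀ x, Occurs x u → P x) ∧ ∀ x, SOccurs x U → P x
  | .seq U V => (∀ x, SOccurs x U → P x) ∧ ∀ x, SOccurs x V → P x
  | .teq u v U => (∀ x, Occurs x u → P x) ∧ (∀ x, Occurs x v → P x) ∧ ∀ x, SOccurs x U → P x

theorem occurs_map {C : PreCtx A} {φ : A.Var → Expr A} {P : A.Var → Prop}
    (h : ∀ p ∈ C, ∀ x, Occurs x (φ p.1) → P x) {x : A.Var} :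
    (∃ e ∈ C.map (fun p => φ p.1), Occurs x e) → P x := by
  rintro ⟨e, he, hx⟩
  obtain ⟨p, hp, rfl⟩ := List.mem_map.1 he
  exact h p hp x hx

theorem W.scoped {n : ℕ} {X : PreCtx A} {j : Jd A} (h : W Ax n X j) :
    j.Scoped (· ∈ X.map Prod.fst) := by
  induction h with
  | var h ih =>
    refine ⟨fun x hx => ?_, fun x hx => ?_⟩
    · rw [occurs_var] at hx; subst hx; simp
    · have := ih x hx
      exact (List.map_append ▸ List.mem_append.2 (.inl this) : x ∈ List.map Prod.fst (_ ++ _))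
  | so hk ax nd hC ha ihC iha => exact fun x hx => occurs_map (fun p hp => (iha p hp).1) hx
  | tm hk ax nd hC hU ha hUφ ihC ihU iha ih =>
    exact ⟨fun x hx => occurs_map (fun p hp => (iha p hp).1) (occurs_app.1 hx), ih⟩
  | conv hk a b c d iha ihb ihc ihd => exact ⟨ihb.1, ihd⟩
  | srefl hk h ih => exact ⟨ih, ih⟩
  | ssym hk h ih => exact ⟨ih.2, ih.1⟩
  | strans hk h h' ih ih' => exact ⟨ih.1, ih'.2⟩
  | sax hk ax nd hC hU hU' ha h1 h2 _ _ _ _ ih ih' => exact ⟨ih, ih'⟩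
  | scong hk ax nd hC ha ha' he ihC iha iha' ihe =>
    exact ⟨fun x hx => occurs_map (fun p hp => (iha p hp).1) hx,
      fun x hx => occurs_map (fun p hp => (iha' p hp).1) hx⟩
  | trefl hk h ih => exact ⟨ih.1, ih.1, ih.2⟩
  | tsym hk h ih => exact ⟨ih.2.1, ih.1, ih.2.2⟩
  | ttrans hk h h' ih ih' => exact ⟨ih.1, ih'.2.1, ih.2.2⟩
  | tconv hk a b c d iha ihb ihc ihd => exact ⟨ihb.1, ihb.2.1, ihd⟩
  | tax hk ax nd hC hU hU' ha h1 h2 _ _ _ _ ih ih' => exact ⟨ih.1, ih'.1, ih.2⟩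
  | tcong hk ax nd hC hU ha ha' he hUφ h1 h2 _ _ _ _ _ _ ih ih' => exact ⟨ih.1, ih'.1, ih.2⟩

section
variable {Ax : Set (Judg A)}

/-! ### Unranked derivability -/

def Dv (Ax : Set (Judg A)) (X : PreCtx A) (j : Jd A) : Prop := ∃ n, W Ax n X j

/-- The context `C` has distinct variables and derivable sorts. -/
def DCtx (Ax : Set (Judg A)) (C : PreCtx A) : Prop :=
  (C.map Prod.fst).Nodup ∧ ∀ C₀ p C₁, C = C₀ ++ p :: C₁ → Dv Ax C₀ (.so p.2)

theorem exists_bound {ι : Type*} {P : ℕ → ι → Prop} (hm : ∀ n m i, n ≤ m → P n i → P m i)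
    {l : List ι} (h : ∀ i ∈ l, ∃ n, P n i) : ∃ n, ∀ i ∈ l, P n i := by
  induction l with
  | nil => exact ⟨0, by simp⟩
  | cons a l ih =>
    obtain ⟨n, hn⟩ := ih fun i hi => h i (by simp [hi])
    obtain ⟨m, hm'⟩ := h a (by simp)
    refine ⟨max n m, fun i hi => ?_⟩
    rcases List.mem_cons.1 hi with rfl | hi
    · exact hm _ _ _ (le_max_right _ _) hm'
    · exact hm _ _ _ (le_max_left _ _) (hn i hi)

theorem exists_bound_tm {X C : PreCtx A} {φ : A.Var → Expr A}
    (ha : ∀ p ∈ C, Dv Ax X (.tm (φ p.1) (p.2.subst φ))) :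
    ∃ n, ∀ p ∈ C, W Ax n X (.tm (φ p.1) (p.2.subst φ)) :=
  exists_bound (fun _ _ _ h w => w.mono h) ha

theorem concat_eq_append_cons {α : Type*} {C C₀ C₁ : List α} {p q : α}
    (h : C ++ [p] = C₀ ++ q :: C₁) :
    (C₀ = C ∧ q = p ∧ C₁ = []) ∨ ∃ C₂, C₁ = C₂ ++ [p] ∧ C = C₀ ++ q :: C₂ := by
  rcases List.eq_nil_or_concat C₁ with rfl | ⟨C₂, r, rfl⟩
  · left
    obtain ⟨h1, h2⟩ := List.append_inj' h rfl
    simp at h2; exact ⟨h1.symm, h2.symm, rfl⟩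
  · right
    have h' : C ++ [p] = (C₀ ++ q :: C₂) ++ [r] := by simpa using h
    obtain ⟨h1, h2⟩ := List.append_inj' h' rfl
    simp at h2; subst h2
    exact ⟨C₂, by simp, h1⟩

theorem exists_bound_ctx {C : PreCtx A} (h : ∀ C₀ p C₁, C = C₀ ++ p :: C₁ → Dv Ax C₀ (.so p.2)) :
    ∃ n, ∀ C₀ p C₁, C = C₀ ++ p :: C₁ → W Ax n C₀ (.so p.2) := by
  induction C using List.reverseRecOn with
  | nil => exact ⟨0, fun C₀ p C₁ h => by simp at h⟩
  | append_singleton C q ih =>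
    obtain ⟨n, hn⟩ := ih fun C₀ p C₁ hC => h C₀ p (C₁ ++ [q]) (by simp [hC])
    obtain ⟨m, hm⟩ := h C q [] rfl
    refine ⟨max n m, fun C₀ p C₁ hC => ?_⟩
    rcases concat_eq_append_cons hC with ⟨rfl, rfl, rfl⟩ | ⟨C₂, rfl, h2⟩
    · exact hm.mono (le_max_right _ _)
    · exact (hn _ _ _ h2).mono (le_max_left _ _)

theorem DCtx.nil : DCtx Ax [] := ⟨by simp, fun C₀ p C₁ h => by simp at h⟩

theorem DCtx.concat {C : PreCtx A} (h : DCtx Ax C) {x : A.Var} {U : SortE A}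
    (hx : ∀ p ∈ C, p.1 ≠ x) (hU : Dv Ax C (.so U)) : DCtx Ax (C ++ [(x, U)]) := by
  refine ⟨?_, fun C₀ p C₁ hC => ?_⟩
  · rw [List.map_append, List.nodup_append]
    refine ⟨h.1, by simp, ?_⟩
    intro a ha b hb
    simp at hb; subst hb
    obtain ⟨p, hp, rfl⟩ := List.mem_map.1 ha
    exact hx p hp
  · rcases concat_eq_append_cons hC with ⟨rfl, rfl, rfl⟩ | ⟨C₂, rfl, h2⟩
    · exact hU
    · exact h.2 _ _ _ h2

theorem DCtx.left {C C' : PreCtx A} (h : DCtx Ax (C ++ C')) : DCtx Ax C := by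
  refine ⟨?_, fun C₀ p C₁ hC => h.2 C₀ p (C₁ ++ C') (by simp [hC])⟩
  have := h.1
  rw [List.map_append, List.nodup_append] at this
  exact this.1

theorem DCtx.mem {C : PreCtx A} (h : DCtx Ax C) {p : A.Var × SortE A} (hp : p ∈ C) :
    ∃ C₀ C₁, C = C₀ ++ p :: C₁ ∧ Dv Ax C₀ (.so p.2) := by
  obtain ⟨C₀, C₁, hC⟩ := List.append_of_mem hp
  exact ⟨C₀, C₁, hC, h.2 _ _ _ hC⟩

theorem Dv.weaken {X : PreCtx A} {j : Jd A} (h : Dv Ax X j) (X' : PreCtx A) :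
    Dv Ax (X ++ X') j := h.imp fun _ h => h.weaken X'

theorem Dv.var {X₀ X₁ : PreCtx A} {x : A.Var} {U : SortE A} (h : Dv Ax X₀ (.so U)) :
    Dv Ax (X₀ ++ (x, U) :: X₁) (.tm (.var x) U) := h.imp fun _ h => .var h

theorem DCtx.var {C : PreCtx A} (h : DCtx Ax C) {p : A.Var × SortE A} (hp : p ∈ C) :
    Dv Ax C (.tm (.var p.1) p.2) := by
  obtain ⟨C₀, C₁, rfl, h1⟩ := h.mem hp
  exact .var h1

theorem DCtx.so {C : PreCtx A} (h : DCtx Ax C) {p : A.Var × SortE A} (hp : p ∈ C) :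
    Dv Ax C (.so p.2) := by
  obtain ⟨C₀, C₁, rfl, h1⟩ := h.mem hp
  exact h1.weaken _

theorem Dv.tm_so {X : PreCtx A} {u : Expr A} {U : SortE A} (h : Dv Ax X (.tm u U)) :
    Dv Ax X (.so U) := h.imp fun _ h => h.presup

theorem Dv.seq_left {X : PreCtx A} {U V : SortE A} (h : Dv Ax X (.seq U V)) :
    Dv Ax X (.so U) := h.imp fun _ h => h.presup.1

theorem Dv.seq_right {X : PreCtx A} {U V : SortE A} (h : Dv Ax X (.seq U V)) :
    Dv Ax X (.so V) := h.imp fun _ h => h.presup.2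

theorem Dv.teq_left {X : PreCtx A} {u v : Expr A} {U : SortE A} (h : Dv Ax X (.teq u v U)) :
    Dv Ax X (.tm u U) := h.imp fun _ h => h.presup.1

theorem Dv.teq_right {X : PreCtx A} {u v : Expr A} {U : SortE A} (h : Dv Ax X (.teq u v U)) :
    Dv Ax X (.tm v U) := h.imp fun _ h => h.presup.2.1

theorem Dv.so {X C : PreCtx A} {S : A.SortSym} {φ : A.Var → Expr A}
    (ax : introSort C S ∈ Ax) (hC : DCtx Ax C)
    (ha : ∀ p ∈ C, Dv Ax X (.tm (φ p.1) (p.2.subst φ))) :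
    Dv Ax X (.so ⟨S, C.map fun p => φ p.1⟩) := by
  obtain ⟨n, hn⟩ := exists_bound_ctx hC.2
  obtain ⟨m, hm⟩ := exists_bound_tm ha
  exact ⟨max n m + 1, .so (Nat.lt_succ_self _) ax hC.1
    (fun _ _ _ h => (hn _ _ _ h).mono (le_max_left _ _))
    fun p hp => (hm p hp).mono (le_max_right _ _)⟩

theorem Dv.conv {X : PreCtx A} {u : Expr A} {U U' : SortE A}
    (hu : Dv Ax X (.tm u U)) (he : Dv Ax X (.seq U U')) : Dv Ax X (.tm u U') := by
  obtain ⟨n, hn⟩ := he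
  obtain ⟨m, hm⟩ := hu
  have h1 := hn.presup
  exact ⟨max n m + 1, .conv (Nat.lt_succ_self _) (hn.mono (le_max_left _ _))
    (hm.mono (le_max_right _ _)) (h1.1.mono (le_max_left _ _)) (h1.2.mono (le_max_left _ _))⟩

theorem Dv.srefl {X : PreCtx A} {U : SortE A} (h : Dv Ax X (.so U)) : Dv Ax X (.seq U U) :=
  let ⟨n, hn⟩ := h; ⟨n + 1, .srefl (Nat.lt_succ_self _) hn⟩

theorem Dv.ssym {X : PreCtx A} {U V : SortE A} (h : Dv Ax X (.seq U V)) : Dv Ax X (.seq V U) :=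
  let ⟨n, hn⟩ := h; ⟨n + 1, .ssym (Nat.lt_succ_self _) hn⟩

theorem Dv.strans {X : PreCtx A} {U V V' : SortE A} (h : Dv Ax X (.seq U V))
    (h' : Dv Ax X (.seq V V')) : Dv Ax X (.seq U V') :=
  let ⟨n, hn⟩ := h; let ⟨m, hm⟩ := h'
  ⟨max n m + 1, .strans (Nat.lt_succ_self _) (hn.mono (le_max_left _ _))
    (hm.mono (le_max_right _ _))⟩

theorem Dv.trefl {X : PreCtx A} {u : Expr A} {U : SortE A} (h : Dv Ax X (.tm u U)) :
    Dv Ax X (.teq u u U) :=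
  let ⟨n, hn⟩ := h; ⟨n + 1, .trefl (Nat.lt_succ_self _) hn⟩

theorem Dv.tsym {X : PreCtx A} {u v : Expr A} {U : SortE A} (h : Dv Ax X (.teq u v U)) :
    Dv Ax X (.teq v u U) :=
  let ⟨n, hn⟩ := h; ⟨n + 1, .tsym (Nat.lt_succ_self _) hn⟩

theorem Dv.ttrans {X : PreCtx A} {u v w : Expr A} {U : SortE A} (h : Dv Ax X (.teq u v U))
    (h' : Dv Ax X (.teq v w U)) : Dv Ax X (.teq u w U) :=
  let ⟨n, hn⟩ := h; let ⟨m, hm⟩ := h'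
  ⟨max n m + 1, .ttrans (Nat.lt_succ_self _) (hn.mono (le_max_left _ _))
    (hm.mono (le_max_right _ _))⟩

theorem Dv.tconv {X : PreCtx A} {u v : Expr A} {U U' : SortE A}
    (hu : Dv Ax X (.teq u v U)) (he : Dv Ax X (.seq U U')) : Dv Ax X (.teq u v U') := by
  obtain ⟨n, hn⟩ := he
  obtain ⟨m, hm⟩ := hu
  have h1 := hn.presup
  exact ⟨max n m + 1, .tconv (Nat.lt_succ_self _) (hn.mono (le_max_left _ _))
    (hm.mono (le_max_right _ _)) (h1.1.mono (le_max_left _ _)) (h1.2.mono (le_max_left _ _))⟩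

theorem Dv.scong {X C : PreCtx A} {S : A.SortSym} {φ φ' : A.Var → Expr A}
    (ax : introSort C S ∈ Ax) (hC : DCtx Ax C)
    (ha' : ∀ p ∈ C, Dv Ax X (.tm (φ' p.1) (p.2.subst φ')))
    (he : ∀ p ∈ C, Dv Ax X (.teq (φ p.1) (φ' p.1) (p.2.subst φ))) :
    Dv Ax X (.seq ⟨S, C.map fun p => φ p.1⟩ ⟨S, C.map fun p => φ' p.1⟩) := by
  obtain ⟨n, hn⟩ := exists_bound_ctx hC.2
  obtain ⟨m, hm⟩ := exists_bound_tm ha'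
  obtain ⟨l, hl⟩ := exists_bound
    (P := fun n (p : A.Var × SortE A) => W Ax n X (.teq (φ p.1) (φ' p.1) (p.2.subst φ)))
    (fun _ _ _ h w => w.mono h) he
  exact ⟨max n (max m l) + 1, .scong (Nat.lt_succ_self _) ax hC.1
    (fun _ _ _ h => (hn _ _ _ h).mono (by omega))
    (fun p hp => (hl p hp).presup.1.mono (by omega))
    (fun p hp => (hm p hp).mono (by omega)) (fun p hp => (hl p hp).mono (by omega))⟩

theorem W.subst {n : ℕ} {C : PreCtx A} {j : Jd A} (h : W Ax n C j) {Z : PreCtx A}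
    {φ : A.Var → Expr A} (hφ : ∀ p ∈ C, Dv Ax Z (.tm (φ p.1) (p.2.subst φ))) :
    Dv Ax Z (j.subst φ) := by
  induction h with
  | var h ih => simpa [Jd.subst] using hφ (_, _) (by simp)
  | @so n k X C S ψ hk ax nd hC ha ihC iha =>
    have := Dv.so (X := Z) (φ := fun x => (ψ x).subst φ) ax
      ⟨nd, fun _ _ _ h => ⟨_, hC _ _ _ h⟩⟩ fun p hp => by
        simpa [Jd.subst, ssubst_subst] using iha p hp hφ
    simpa [Jd.subst, SortE.subst, Function.comp_def] using this
  | @tm n k X C t U ψ hk ax nd hC hU ha hUφ ihC ihU iha ihUφ =>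
    have h1 : ∀ p ∈ C, Dv Ax Z (.tm ((ψ p.1).subst φ) (p.2.subst fun x => (ψ x).subst φ)) :=
      fun p hp => by simpa [Jd.subst, ssubst_subst] using iha p hp hφ
    obtain ⟨m, hm⟩ := exists_bound_tm (φ := fun x => (ψ x).subst φ) h1
    obtain ⟨l, hl⟩ := ihUφ hφ
    have := W.tm (n := max k (max m l) + 1) (k := max k (max m l)) (X := Z) (Nat.lt_succ_self _)
      ax nd (fun _ _ _ h => (hC _ _ _ h).mono (by omega)) (hU.mono (by omega))
      (φ := fun x => (ψ x).subst φ) (fun p hp => (hm p hp).mono (by omega))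
      (by rw [← ssubst_subst]; exact hl.mono (by omega))
    rw [← ssubst_subst] at this
    exact ⟨_, by simpa [Jd.subst, Function.comp_def] using this⟩
  | conv hk a b c d iha ihb ihc ihd => exact (ihb hφ).conv (iha hφ)
  | srefl hk h ih => exact (ih hφ).srefl
  | ssym hk h ih => exact (ih hφ).ssym
  | strans hk h h' ih ih' => exact (ih hφ).strans (ih' hφ)
  | @sax n k X C U U' ψ hk ax nd hC hU hU' ha h1 h2 ihC _ _ iha ih1 ih2 =>
    have h1 : ∀ p ∈ C, Dv Ax Z (.tm ((ψ p.1).subst φ) (p.2.subst fun x => (ψ x).subst φ)) :=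
      fun p hp => by simpa [Jd.subst, ssubst_subst] using iha p hp hφ
    obtain ⟨m, hm⟩ := exists_bound_tm (φ := fun x => (ψ x).subst φ) h1
    obtain ⟨l, hl⟩ := ih1 hφ
    obtain ⟨l', hl'⟩ := ih2 hφ
    have := W.sax (n := max k (max m (max l l')) + 1) (k := max k (max m (max l l'))) (X := Z)
      (Nat.lt_succ_self _)
      ax nd (fun _ _ _ h => (hC _ _ _ h).mono (by omega)) (hU.mono (by omega))
      (hU'.mono (by omega)) (φ := fun x => (ψ x).subst φ) (fun p hp => (hm p hp).mono (by omega))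
      (by rw [← ssubst_subst]; exact hl.mono (by omega))
      (by rw [← ssubst_subst]; exact hl'.mono (by omega))
    exact ⟨_, by simpa [Jd.subst, ← ssubst_subst] using this⟩
  | @scong n k X C S ψ ψ' hk ax nd hC ha ha' he ihC iha iha' ihe =>
    have := Dv.scong (X := Z) (φ := fun x => (ψ x).subst φ) (φ' := fun x => (ψ' x).subst φ) ax
      ⟨nd, fun _ _ _ h => ⟨_, hC _ _ _ h⟩⟩
      (fun p hp => by simpa [Jd.subst, ssubst_subst] using iha' p hp hφ)
      (fun p hp => by simpa [Jd.subst, ssubst_subst] using ihe p hp hφ)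
    simpa [Jd.subst, SortE.subst, Function.comp_def] using this
  | trefl hk h ih => exact (ih hφ).trefl
  | tsym hk h ih => exact (ih hφ).tsym
  | ttrans hk h h' ih ih' => exact (ih hφ).ttrans (ih' hφ)
  | tconv hk a b c d iha ihb ihc ihd => exact (ihb hφ).tconv (iha hφ)
  | @tax n k X C u u' U ψ hk ax nd hC hU hU' ha h1 h2 ihC _ _ iha ih1 ih2 =>
    have h1 : ∀ p ∈ C, Dv Ax Z (.tm ((ψ p.1).subst φ) (p.2.subst fun x => (ψ x).subst φ)) :=
      fun p hp => by simpa [Jd.subst, ssubst_subst] using iha p hp hφ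
    obtain ⟨m, hm⟩ := exists_bound_tm (φ := fun x => (ψ x).subst φ) h1
    obtain ⟨l, hl⟩ := ih1 hφ
    obtain ⟨l', hl'⟩ := ih2 hφ
    have := W.tax (n := max k (max m (max l l')) + 1) (k := max k (max m (max l l'))) (X := Z)
      (Nat.lt_succ_self _)
      ax nd (fun _ _ _ h => (hC _ _ _ h).mono (by omega)) (hU.mono (by omega))
      (hU'.mono (by omega)) (φ := fun x => (ψ x).subst φ) (fun p hp => (hm p hp).mono (by omega))
      (by rw [← ssubst_subst, ← subst_subst]; exact hl.mono (by omega))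
      (by rw [← ssubst_subst, ← subst_subst]; exact hl'.mono (by omega))
    exact ⟨_, by simpa [Jd.subst, ← ssubst_subst, ← subst_subst] using this⟩
  | @tcong n k X C t U ψ ψ' hk ax nd hC hU ha ha' he hUφ h1 h2 ihC _ iha iha' ihe ihU ih1 ih2 =>
    have e1 : ∀ p ∈ C, Dv Ax Z (.tm ((ψ p.1).subst φ) (p.2.subst fun x => (ψ x).subst φ)) :=
      fun p hp => by simpa [Jd.subst, ssubst_subst] using iha p hp hφ
    have e2 : ∀ p ∈ C, Dv Ax Z (.tm ((ψ' p.1).subst φ) (p.2.subst fun x => (ψ' x).subst φ)) :=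
      fun p hp => by simpa [Jd.subst, ssubst_subst] using iha' p hp hφ
    have e3 : ∀ p ∈ C, Dv Ax Z (.teq ((ψ p.1).subst φ) ((ψ' p.1).subst φ)
        (p.2.subst fun x => (ψ x).subst φ)) :=
      fun p hp => by simpa [Jd.subst, ssubst_subst] using ihe p hp hφ
    obtain ⟨m1, hm1⟩ := exists_bound_tm (φ := fun x => (ψ x).subst φ) e1
    obtain ⟨m2, hm2⟩ := exists_bound_tm (φ := fun x => (ψ' x).subst φ) e2
    obtain ⟨m3, hm3⟩ := exists_bound
      (P := fun n (p : A.Var × SortE A) => W Ax n Z (.teq ((ψ p.1).subst φ) ((ψ' p.1).subst φ)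
        (p.2.subst fun x => (ψ x).subst φ))) (fun _ _ _ h w => w.mono h) e3
    obtain ⟨l, hl⟩ := ihU hφ
    obtain ⟨l1, hl1⟩ := ih1 hφ
    obtain ⟨l2, hl2⟩ := ih2 hφ
    obtain ⟨N, h1, h2, h3, h4, h5, h6, h7⟩ : ∃ N, k ≤ N ∧ m1 ≤ N ∧ m2 ≤ N ∧ m3 ≤ N ∧ l ≤ N ∧
      l1 ≤ N ∧ l2 ≤ N := ⟨k + m1 + m2 + m3 + l + l1 + l2, by omega⟩
    simp only [Jd.subst, subst_app, List.map_map] at hl1 hl2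
    have := W.tcong (X := Z) (Nat.lt_succ_self N)
      ax nd (fun _ _ _ h => (hC _ _ _ h).mono h1) (hU.mono h1)
      (φ := fun x => (ψ x).subst φ) (φ' := fun x => (ψ' x).subst φ)
      (fun p hp => (hm1 p hp).mono h2) (fun p hp => (hm2 p hp).mono h3)
      (fun p hp => (hm3 p hp).mono h4)
      (by rw [← ssubst_subst]; exact hl.mono h5)
      (by rw [← ssubst_subst]; exact hl1.mono h6)
      (by rw [← ssubst_subst]; exact hl2.mono h7)
    exact ⟨_, by simpa [Jd.subst, ← ssubst_subst, Function.comp_def] using this⟩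

theorem Dv.subst {C : PreCtx A} {j : Jd A} (h : Dv Ax C j) {Z : PreCtx A}
    {φ : A.Var → Expr A} (hφ : ∀ p ∈ C, Dv Ax Z (.tm (φ p.1) (p.2.subst φ))) :
    Dv Ax Z (j.subst φ) := let ⟨_, h⟩ := h; h.subst hφ

end

section
variable {Ax : Set (Judg A)}

/-! ### Congruence of substitution -/

theorem Dv.tcong {X C : PreCtx A} {t : A.TermSym} {U : SortE A} {φ φ' : A.Var → Expr A}
    (ax : introTerm C t U ∈ Ax) (hC : DCtx Ax C) (hU : Dv Ax C (.so U))
    (ha' : ∀ p ∈ C, Dv Ax X (.tm (φ' p.1) (p.2.subst φ')))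
    (he : ∀ p ∈ C, Dv Ax X (.teq (φ p.1) (φ' p.1) (p.2.subst φ)))
    (hs : Dv Ax X (.seq (U.subst φ') (U.subst φ))) :
    Dv Ax X (.teq (.app t (C.map fun p => φ p.1)) (.app t (C.map fun p => φ' p.1))
      (U.subst φ)) := by
  obtain ⟨n, hn⟩ := exists_bound_ctx hC.2
  obtain ⟨m, hm⟩ := exists_bound_tm ha'
  obtain ⟨l, hl⟩ := exists_bound
    (P := fun n (p : A.Var × SortE A) => W Ax n X (.teq (φ p.1) (φ' p.1) (p.2.subst φ)))
    (fun _ _ _ h w => w.mono h) he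
  obtain ⟨a, hU⟩ := hU
  obtain ⟨b, hs⟩ := hs
  obtain ⟨N, h1, h2, h3, h4, h5⟩ : ∃ N, n ≤ N ∧ m ≤ N ∧ l ≤ N ∧ a ≤ N ∧ b ≤ N :=
    ⟨n + m + l + a + b, by omega⟩
  have t1 : W Ax (N + 1) X (.tm (.app t (C.map fun p => φ p.1)) (U.subst φ)) :=
    .tm (Nat.lt_succ_self N) ax hC.1 (fun _ _ _ h => (hn _ _ _ h).mono h1) (hU.mono h4)
      (fun p hp => (hl p hp).presup.1.mono h3) (hs.presup.2.mono h5)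
  have t2 : W Ax (N + 1) X (.tm (.app t (C.map fun p => φ' p.1)) (U.subst φ')) :=
    .tm (Nat.lt_succ_self N) ax hC.1 (fun _ _ _ h => (hn _ _ _ h).mono h1) (hU.mono h4)
      (fun p hp => (hm p hp).mono h2) (hs.presup.1.mono h5)
  have t3 := W.conv (Nat.lt_succ_self (N + 1)) (hs.mono (by omega)) t2
    (hs.presup.1.mono (by omega)) (hs.presup.2.mono (by omega))
  exact ⟨_, .tcong (Nat.lt_succ_self (N + 2)) ax hC.1
    (fun _ _ _ h => (hn _ _ _ h).mono (by omega)) (hU.mono (by omega))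
    (fun p hp => (hl p hp).presup.1.mono (by omega))
    (fun p hp => (hm p hp).mono (by omega)) (fun p hp => (hl p hp).mono (by omega))
    (hs.presup.2.mono (by omega)) (t1.mono (by omega)) t3⟩

/-- The congruence statement for a judgment. -/
def Cong (Ax : Set (Judg A)) (Z : PreCtx A) (φ φ' : A.Var → Expr A) : Jd A → Prop
  | .so U => Dv Ax Z (.seq (U.subst φ) (U.subst φ'))
  | .tm u U => Dv Ax Z (.teq (u.subst φ) (u.subst φ') (U.subst φ))
  | _ => True

theorem W.cong {n : ℕ} {C : PreCtx A} {j : Jd A} (h : W Ax n C j) {Z : PreCtx A}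
    {φ φ' : A.Var → Expr A} (hφ' : ∀ p ∈ C, Dv Ax Z (.tm (φ' p.1) (p.2.subst φ')))
    (he : ∀ p ∈ C, Dv Ax Z (.teq (φ p.1) (φ' p.1) (p.2.subst φ))) : Cong Ax Z φ φ' j := by
  induction h with
  | var h ih => simpa [Cong] using he (_, _) (by simp)
  | @so n k X C S ψ hk ax nd hC ha ihC iha =>
    have := Dv.scong (X := Z) (φ := fun x => (ψ x).subst φ) (φ' := fun x => (ψ x).subst φ') ax
      ⟨nd, fun _ _ _ h => ⟨_, hC _ _ _ h⟩⟩
      (fun p hp => by simpa [Jd.subst, ssubst_subst] using (ha p hp).subst hφ')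
      (fun p hp => by simpa [Cong, ssubst_subst] using iha p hp hφ' he)
    simpa [Cong, SortE.subst, Function.comp_def] using this
  | @tm n k X C t U ψ hk ax nd hC hU ha hUφ ihC ihU iha ihUφ =>
    have := Dv.tcong (X := Z) (φ := fun x => (ψ x).subst φ) (φ' := fun x => (ψ x).subst φ') ax
      ⟨nd, fun _ _ _ h => ⟨_, hC _ _ _ h⟩⟩ ⟨_, hU⟩
      (fun p hp => by simpa [Jd.subst, ssubst_subst] using (ha p hp).subst hφ')
      (fun p hp => by simpa [Cong, ssubst_subst] using iha p hp hφ' he)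
      (by
        have := ihUφ hφ' he
        simp only [Cong, ssubst_subst] at this
        exact this.ssym)
    rw [← ssubst_subst] at this
    simpa [Cong, Function.comp_def] using this
  | conv hk a b c d iha ihb ihc ihd =>
    exact (ihb hφ' he).tconv (a.subst fun p hp => (he p hp).teq_left)
  | _ => trivial

theorem Dv.cong_so {C : PreCtx A} {U : SortE A} (h : Dv Ax C (.so U)) {Z : PreCtx A}
    {φ φ' : A.Var → Expr A} (hφ' : ∀ p ∈ C, Dv Ax Z (.tm (φ' p.1) (p.2.subst φ')))
    (he : ∀ p ∈ C, Dv Ax Z (.teq (φ p.1) (φ' p.1) (p.2.subst φ))) :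
    Dv Ax Z (.seq (U.subst φ) (U.subst φ')) := let ⟨_, h⟩ := h; h.cong hφ' he

theorem Dv.scoped {X : PreCtx A} {j : Jd A} (h : Dv Ax X j) :
    j.Scoped (· ∈ X.map Prod.fst) := let ⟨_, h⟩ := h; h.scoped

/-! ### Inversion -/

theorem W.so_inv {n : ℕ} {X : PreCtx A} {U : SortE A} (h : W Ax n X (.so U)) :
    ∃ k C φ, k < n ∧ introSort C U.head ∈ Ax ∧ (C.map Prod.fst).Nodup ∧
      (∀ C₀ p C₁, C = C₀ ++ p :: C₁ → W Ax k C₀ (.so p.2)) ∧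
      (∀ p ∈ C, W Ax k X (.tm (φ p.1) (p.2.subst φ))) ∧ U.args = C.map fun p => φ p.1 := by
  cases h with
  | so hk ax nd hC ha => exact ⟨_, _, _, hk, ax, nd, hC, ha, rfl⟩

theorem W.var_inv {n : ℕ} {X : PreCtx A} {x : A.Var} {U : SortE A}
    (h : W Ax n X (.tm (.var x) U)) :
    ∃ X₀ U₀ X₁, X = X₀ ++ (x, U₀) :: X₁ ∧ W Ax n X₀ (.so U₀) ∧ Dv Ax X (.seq U₀ U) := by
  generalize hj : Jd.tm (.var x) U = j at h
  induction h generalizing U with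
  | var h ih => cases hj; exact ⟨_, _, _, rfl, h, .srefl ⟨_, h.weaken _⟩⟩
  | conv hk a b c d iha ihb ihc ihd =>
    cases hj
    obtain ⟨X₀, U₀, X₁, h1, h2, h3⟩ := ihb rfl
    exact ⟨X₀, U₀, X₁, h1, h2.mono hk.le, h3.strans ⟨_, a⟩⟩
  | _ => cases hj

theorem W.app_inv {n : ℕ} {X : PreCtx A} {t : A.TermSym} {es : List (Expr A)} {U : SortE A}
    (h : W Ax n X (.tm (.app t es) U)) :
    ∃ k C U₀ φ, k < n ∧ introTerm C t U₀ ∈ Ax ∧ (C.map Prod.fst).Nodup ∧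
      (∀ C₀ p C₁, C = C₀ ++ p :: C₁ → W Ax k C₀ (.so p.2)) ∧ W Ax k C (.so U₀) ∧
      (∀ p ∈ C, W Ax k X (.tm (φ p.1) (p.2.subst φ))) ∧ W Ax k X (.so (U₀.subst φ)) ∧
      (es = C.map fun p => φ p.1) ∧ Dv Ax X (.seq (U₀.subst φ) U) := by
  generalize hj : Jd.tm (.app t es) U = j at h
  induction h generalizing U with
  | tm hk ax nd hC hU ha hUφ =>
    cases hj
    exact ⟨_, _, _, _, hk, ax, nd, hC, hU, ha, hUφ, rfl, .srefl ⟨_, hUφ⟩⟩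
  | conv hk a b c d iha ihb ihc ihd =>
    cases hj
    obtain ⟨k, C, U₀, φ, h1, h2, h3, h4, h5, h6, h7, h8, h9⟩ := ihb rfl
    exact ⟨k, C, U₀, φ, h1.trans hk, h2, h3, h4, h5, h6, h7, h8, h9.strans ⟨_, a⟩⟩
  | _ => cases hj

/-- Every symbol is introduced by at most one axiom. -/
structure UniqueIntro (Ax : Set (Judg A)) : Prop where
  sort : ∀ {S C C'}, introSort C S ∈ Ax → introSort C' S ∈ Ax → C = C'
  term : ∀ {t C C' U U'}, introTerm C t U ∈ Ax → introTerm C' t U' ∈ Ax → C = C' ∧ U = U'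

theorem map_fun_inj {C : PreCtx A} {φ φ' : A.Var → Expr A}
    (h : (C.map fun p => φ p.1) = C.map fun p => φ' p.1) : ∀ x ∈ C.map Prod.fst, φ x = φ' x := by
  intro x hx
  obtain ⟨p, hp, rfl⟩ := List.mem_map.1 hx
  exact List.map_inj_left.1 h p hp

theorem args_transfer {k : ℕ} {C X : PreCtx A} {φ φ' : A.Var → Expr A}
    (hC : ∀ C₀ p C₁, C = C₀ ++ p :: C₁ → W Ax k C₀ (.so p.2))
    (h : ∀ x ∈ C.map Prod.fst, φ x = φ' x)
    (ha : ∀ p ∈ C, W Ax k X (.tm (φ p.1) (p.2.subst φ))) :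
    ∀ p ∈ C, W Ax k X (.tm (φ' p.1) (p.2.subst φ')) := by
  intro p hp
  obtain ⟨C₀, C₁, rfl⟩ := List.append_of_mem hp
  have h1 := (hC _ _ _ rfl).scoped
  have := ha p hp
  rwa [h p.1 (List.mem_map_of_mem hp), ssubst_congr (τ := φ')] at this
  intro x hx
  exact h x (by simpa using .inl (by simpa using h1 x hx))

theorem W.app_inv' (hu : UniqueIntro Ax) {n : ℕ} {X C : PreCtx A} {t : A.TermSym}
    {φ : A.Var → Expr A} {U₀ U : SortE A} (ax : introTerm C t U₀ ∈ Ax)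
    (h : W Ax n X (.tm (.app t (C.map fun p => φ p.1)) U)) :
    ∃ k, k < n ∧ (C.map Prod.fst).Nodup ∧
      (∀ C₀ p C₁, C = C₀ ++ p :: C₁ → W Ax k C₀ (.so p.2)) ∧ W Ax k C (.so U₀) ∧
      (∀ p ∈ C, W Ax k X (.tm (φ p.1) (p.2.subst φ))) ∧ W Ax k X (.so (U₀.subst φ)) ∧
      Dv Ax X (.seq (U₀.subst φ) U) := by
  obtain ⟨k, C', U₀', φ', hk, ax', nd, hC, hU, ha, hUφ, he, hs⟩ := h.app_inv
  obtain ⟨rfl, rfl⟩ := hu.term ax ax'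
  have h1 := map_fun_inj he.symm
  have h2 : U₀.subst φ' = U₀.subst φ := ssubst_congr fun x hx => h1 x (hU.scoped x hx)
  exact ⟨k, hk, nd, hC, hU, args_transfer hC h1 ha, h2 ▸ hUφ, h2 ▸ hs⟩

theorem nodup_split_unique {X₀ X₁ X₀' X₁' : PreCtx A} {x : A.Var} {U U' : SortE A}
    (nd : ((X₀ ++ (x, U) :: X₁).map Prod.fst).Nodup)
    (h : X₀ ++ (x, U) :: X₁ = X₀' ++ (x, U') :: X₁') : U = U' := by
  have key : ∀ {l : PreCtx A}, (l.map Prod.fst).Nodup → (x, U) ∈ l → (x, U') ∈ l → U = U' := by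
    intro l nd h1 h2
    have := List.inj_on_of_nodup_map nd h1 h2 rfl
    exact (Prod.mk.inj this).2
  exact key nd (by simp) (h ▸ by simp)

theorem Dv.unique (hu : UniqueIntro Ax) {X : PreCtx A} (nd : (X.map Prod.fst).Nodup)
    {u : Expr A} {U U' : SortE A} (h : Dv Ax X (.tm u U)) (h' : Dv Ax X (.tm u U')) :
    Dv Ax X (.seq U U') := by
  obtain ⟨n, h⟩ := h
  obtain ⟨n', h'⟩ := h'
  cases u with
  | var x =>
    obtain ⟨X₀, U₀, X₁, rfl, -, h1⟩ := h.var_inv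
    obtain ⟨X₀', U₀', X₁', e, -, h2⟩ := h'.var_inv
    obtain rfl := nodup_split_unique nd e
    exact h1.ssym.strans h2
  | app t es =>
    obtain ⟨k, C, U₀, φ, -, ax, -, -, -, -, -, rfl, h1⟩ := h.app_inv
    obtain ⟨k, -, -, -, -, -, -, h2⟩ := h'.app_inv' hu ax
    exact h1.ssym.strans h2

/-! ### Untyped equality -/

/-- Equality of terms at an unspecified sort. -/
def Te (Ax : Set (Judg A)) (X : PreCtx A) (u v : Expr A) : Prop := ∃ U, Dv Ax X (.teq u v U)

theorem Te.symm {X : PreCtx A} {u v : Expr A} (h : Te Ax X u v) : Te Ax X v u :=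
  h.imp fun _ h => h.tsym

theorem Dv.te {X : PreCtx A} {u : Expr A} {U : SortE A} (h : Dv Ax X (.tm u U)) :
    Te Ax X u u := ⟨U, h.trefl⟩

theorem Te.typed (hu : UniqueIntro Ax) {X : PreCtx A} (nd : (X.map Prod.fst).Nodup)
    {u v : Expr A} {U : SortE A} (h : Te Ax X u v) (hU : Dv Ax X (.tm u U)) :
    Dv Ax X (.teq u v U) := by
  obtain ⟨V, h⟩ := h
  exact h.tconv (h.teq_left.unique hu nd hU)

theorem Te.trans (hu : UniqueIntro Ax) {X : PreCtx A} (nd : (X.map Prod.fst).Nodup)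
    {u v w : Expr A} (h : Te Ax X u v) (h' : Te Ax X v w) : Te Ax X u w := by
  obtain ⟨U, h⟩ := h
  exact ⟨U, h.ttrans (h'.typed hu nd h.teq_right)⟩

theorem tele (hu : UniqueIntro Ax) {Z C : PreCtx A} (nd : (Z.map Prod.fst).Nodup)
    {φ φ' : A.Var → Expr A} (hC : DCtx Ax C)
    (hφ : ∀ p ∈ C, Dv Ax Z (.tm (φ p.1) (p.2.subst φ)))
    (he : ∀ p ∈ C, Te Ax Z (φ p.1) (φ' p.1)) :
    (∀ p ∈ C, Dv Ax Z (.tm (φ' p.1) (p.2.subst φ'))) ∧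
      ∀ p ∈ C, Dv Ax Z (.teq (φ p.1) (φ' p.1) (p.2.subst φ)) := by
  have h2 : ∀ p ∈ C, Dv Ax Z (.teq (φ p.1) (φ' p.1) (p.2.subst φ)) :=
    fun p hp => (he p hp).typed hu nd (hφ p hp)
  refine ⟨?_, h2⟩
  clear he
  induction C using List.reverseRecOn with
  | nil => simp
  | append_singleton C q ih =>
    have ih := ih hC.left (fun p hp => hφ p (by simp [hp])) (fun p hp => h2 p (by simp [hp]))
    intro p hp
    rcases List.mem_append.1 hp with hp | hp
    · exact ih p hp
    · obtain rfl := List.mem_singleton.1 hp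
      exact (h2 p (by simp)).teq_right.conv
        ((hC.2 C p [] rfl).cong_so ih fun p hp => h2 p (by simp [hp]))

theorem Te.app (hu : UniqueIntro Ax) {Z : PreCtx A} (nd : (Z.map Prod.fst).Nodup)
    {t : A.TermSym} {es es' : List (Expr A)} {U : SortE A} (h : Dv Ax Z (.tm (.app t es) U))
    (he : List.Forall₂ (Te Ax Z) es es') : Dv Ax Z (.teq (.app t es) (.app t es') U) := by
  obtain ⟨n, h⟩ := h
  obtain ⟨k, C, U₀, φ, -, ax, ndC, hC, hU, ha, hUφ, rfl, hs⟩ := h.app_inv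
  obtain ⟨φ', rfl⟩ := exists_fun_of_nodup ndC (he.length_eq.symm.trans (by simp))
  rw [List.forall₂_map_left_iff, List.forall₂_map_right_iff, List.forall₂_same] at he
  have hC' : DCtx Ax C := ⟨ndC, fun _ _ _ h => ⟨_, hC _ _ _ h⟩⟩
  obtain ⟨h1, h2⟩ := tele hu nd hC' (fun p hp => ⟨_, ha p hp⟩) he
  exact (Dv.tcong ax hC' ⟨_, hU⟩ h1 h2 (Dv.cong_so ⟨_, hU⟩ h1 h2).ssym).tconv hs

theorem Te.sort (hu : UniqueIntro Ax) {Z : PreCtx A} (nd : (Z.map Prod.fst).Nodup)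
    {S : A.SortSym} {es es' : List (Expr A)} (h : Dv Ax Z (.so ⟨S, es⟩))
    (he : List.Forall₂ (Te Ax Z) es es') : Dv Ax Z (.seq ⟨S, es⟩ ⟨S, es'⟩) := by
  obtain ⟨n, h⟩ := h
  obtain ⟨k, C, φ, -, ax, ndC, hC, ha, hes⟩ := h.so_inv
  simp only at hes ax; subst hes
  obtain ⟨φ', rfl⟩ := exists_fun_of_nodup ndC (he.length_eq.symm.trans (by simp))
  rw [List.forall₂_map_left_iff, List.forall₂_map_right_iff, List.forall₂_same] at he
  have hC' : DCtx Ax C := ⟨ndC, fun _ _ _ h => ⟨_, hC _ _ _ h⟩⟩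
  obtain ⟨h1, h2⟩ := tele hu nd hC' (fun p hp => ⟨_, ha p hp⟩) he
  exact Dv.scong ax hC' h1 h2

end

section
variable {Ax : Set (Judg A)}

/-! ### Comparison with the original rules -/

theorem DerAt.mono {n m : ℕ} (h : n ≤ m) {J : Judg A} (hJ : DerAt Ax n J) : DerAt Ax m J := by
  induction h with
  | refl => exact hJ
  | step _ ih => exact .inl ih

theorem exists_bound_lt {P : ℕ → ℕ → Prop} (hm : ∀ n m i, n ≤ m → P n i → P m i) (N : ℕ)
    (h : ∀ i < N, ∃ n, P n i) : ∃ n, ∀ i < N, P n i := by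
  obtain ⟨n, hn⟩ := exists_bound (l := List.range N) hm (by simpa using h)
  exact ⟨n, by simpa using hn⟩

theorem derivable_of_step {J : Judg A} (h : Step Ax (Derivable Ax) J) : Derivable Ax J := by
  suffices ∃ n, Step Ax (DerAt Ax n) J by
    obtain ⟨n, hn⟩ := this; exact ⟨n + 1, .inr hn⟩
  cases h with
  | ctx_nil => exact ⟨0, .ctx_nil⟩
  | ctx_cons hs hf hp => exact hs.imp fun n hs => .ctx_cons hs hf hp
  | s1 h => exact h.imp fun n hs => .s1 hs
  | s2 h => exact h.imp fun n hs => .s2 hs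
  | s3 h h' =>
    obtain ⟨n, h⟩ := h; obtain ⟨m, h'⟩ := h'
    exact ⟨max n m, .s3 (h.mono (by omega)) (h'.mono (by omega))⟩
  | t1 h => exact h.imp fun n hs => .t1 hs
  | t2 h => exact h.imp fun n hs => .t2 hs
  | t3 h h' =>
    obtain ⟨n, h⟩ := h; obtain ⟨m, h'⟩ := h'
    exact ⟨max n m, .t3 (h.mono (by omega)) (h'.mono (by omega))⟩
  | seqt h h' =>
    obtain ⟨n, h⟩ := h; obtain ⟨m, h'⟩ := h'
    exact ⟨max n m, .seqt (h.mono (by omega)) (h'.mono (by omega))⟩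
  | seqteq h1 h2 h3 h4 =>
    obtain ⟨a, h1⟩ := h1; obtain ⟨b, h2⟩ := h2; obtain ⟨c, h3⟩ := h3; obtain ⟨d, h4⟩ := h4
    exact ⟨a + b + c + d, .seqteq (h1.mono (by omega)) (h2.mono (by omega)) (h3.mono (by omega))
      (h4.mono (by omega))⟩
  | var hi h => exact h.imp fun n hs => .var hi hs
  | @sA X U hax h hv =>
    obtain ⟨a, h⟩ := h
    obtain ⟨b, hv⟩ := exists_bound_lt (N := X.length)
      (P := fun n i => ∀ hi : i < X.length, DerAt Ax n (.term X (.var (X[i]'hi).1) (X[i]'hi).2))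
      (fun n m i h w hp => (w hp).mono h)
      fun i hi => let ⟨n, hn⟩ := hv i hi; ⟨n, fun _ => hn⟩
    exact ⟨a + b, .sA hax (h.mono (by omega)) fun i hi => (hv i hi hi).mono (by omega)⟩
  | @tA X u U hax h hv =>
    obtain ⟨a, h⟩ := h
    obtain ⟨b, hv⟩ := exists_bound_lt (N := X.length)
      (P := fun n i => ∀ hi : i < X.length, DerAt Ax n (.term X (.var (X[i]'hi).1) (X[i]'hi).2))
      (fun n m i h w hp => (w hp).mono h)
      fun i hi => let ⟨n, hn⟩ := hv i hi; ⟨n, fun _ => hn⟩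
    exact ⟨a + b, .tA hax (h.mono (by omega)) fun i hi => (hv i hi hi).mono (by omega)⟩
  | seqA hax h h' =>
    obtain ⟨n, h⟩ := h; obtain ⟨m, h'⟩ := h'
    exact ⟨max n m, .seqA hax (h.mono (by omega)) (h'.mono (by omega))⟩
  | teqA hax h h' =>
    obtain ⟨n, h⟩ := h; obtain ⟨m, h'⟩ := h'
    exact ⟨max n m, .teqA hax (h.mono (by omega)) (h'.mono (by omega))⟩
  | @sSub X S hax Y hY f hlen hJ hYc hargs =>
    obtain ⟨a, hJ⟩ := hJ; obtain ⟨b, hYc⟩ := hYc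
    obtain ⟨c, hargs⟩ := exists_bound_lt (N := X.length)
      (P := fun n i => ∀ (hi : i < X.length) (hif : i < f.length),
        DerAt Ax n (.term Y (f[i]'hif) (subPre X f i hi)))
      (fun n m i h w hp hp' => (w hp hp').mono h)
      fun i hi => let ⟨n, hn⟩ := hargs i hi (hlen ▸ hi); ⟨n, fun _ _ => hn⟩
    exact ⟨a + b + c, .sSub hax hY hlen (hJ.mono (by omega)) (hYc.mono (by omega))
      fun i hi hif => (hargs i hi hi hif).mono (by omega)⟩
  | @tSub X t U hax Y hY f hlen hJ hU hargs =>
    obtain ⟨a, hJ⟩ := hJ; obtain ⟨b, hU⟩ := hU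
    obtain ⟨c, hargs⟩ := exists_bound_lt (N := X.length)
      (P := fun n i => ∀ (hi : i < X.length) (hif : i < f.length),
        DerAt Ax n (.term Y (f[i]'hif) (subPre X f i hi)))
      (fun n m i h w hp hp' => (w hp hp').mono h)
      fun i hi => let ⟨n, hn⟩ := hargs i hi (hlen ▸ hi); ⟨n, fun _ _ => hn⟩
    exact ⟨a + b + c, .tSub hax hY hlen (hJ.mono (by omega)) (hU.mono (by omega))
      fun i hi hif => (hargs i hi hi hif).mono (by omega)⟩
  | @seqSub1 X U U' hax Y hY f hlen hJ h1 h2 hargs =>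
    obtain ⟨a, hJ⟩ := hJ; obtain ⟨b, h1⟩ := h1; obtain ⟨d, h2⟩ := h2
    obtain ⟨c, hargs⟩ := exists_bound_lt (N := X.length)
      (P := fun n i => ∀ (hi : i < X.length) (hif : i < f.length),
        DerAt Ax n (.term Y (f[i]'hif) (subPre X f i hi)))
      (fun n m i h w hp hp' => (w hp hp').mono h)
      fun i hi => let ⟨n, hn⟩ := hargs i hi (hlen ▸ hi); ⟨n, fun _ _ => hn⟩
    exact ⟨a + b + c + d, .seqSub1 hax hY hlen (hJ.mono (by omega)) (h1.mono (by omega))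
      (h2.mono (by omega)) fun i hi hif => (hargs i hi hi hif).mono (by omega)⟩
  | @seqSub2 X S hax Y hY f g hlf hlg hJ h1 h2 hargs =>
    obtain ⟨a, hJ⟩ := hJ; obtain ⟨b, h1⟩ := h1; obtain ⟨d, h2⟩ := h2
    obtain ⟨c, hargs⟩ := exists_bound_lt (N := X.length)
      (P := fun n i => ∀ (hi : i < X.length) (hif : i < f.length) (hig : i < g.length),
        DerAt Ax n (.termEq Y (f[i]'hif) (g[i]'hig) (subPre X f i hi)))
      (fun n m i h w hp hp' hp'' => (w hp hp' hp'').mono h)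
      fun i hi => let ⟨n, hn⟩ := hargs i hi (hlf ▸ hi) (hlg ▸ hi); ⟨n, fun _ _ _ => hn⟩
    exact ⟨a + b + c + d, .seqSub2 hax hY hlf hlg (hJ.mono (by omega)) (h1.mono (by omega))
      (h2.mono (by omega)) fun i hi hif hig => (hargs i hi hi hif hig).mono (by omega)⟩
  | @teqSub1 X u u' U hax Y hY f hlen hJ h1 h2 hargs =>
    obtain ⟨a, hJ⟩ := hJ; obtain ⟨b, h1⟩ := h1; obtain ⟨d, h2⟩ := h2
    obtain ⟨c, hargs⟩ := exists_bound_lt (N := X.length)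
      (P := fun n i => ∀ (hi : i < X.length) (hif : i < f.length),
        DerAt Ax n (.term Y (f[i]'hif) (subPre X f i hi)))
      (fun n m i h w hp hp' => (w hp hp').mono h)
      fun i hi => let ⟨n, hn⟩ := hargs i hi (hlen ▸ hi); ⟨n, fun _ _ => hn⟩
    exact ⟨a + b + c + d, .teqSub1 hax hY hlen (hJ.mono (by omega)) (h1.mono (by omega))
      (h2.mono (by omega)) fun i hi hif => (hargs i hi hi hif).mono (by omega)⟩
  | @teqSub2 X t U hax Y hY f g hlf hlg hJ h1 h2 hargs =>
    obtain ⟨a, hJ⟩ := hJ; obtain ⟨b, h1⟩ := h1; obtain ⟨d, h2⟩ := h2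
    obtain ⟨c, hargs⟩ := exists_bound_lt (N := X.length)
      (P := fun n i => ∀ (hi : i < X.length) (hif : i < f.length) (hig : i < g.length),
        DerAt Ax n (.termEq Y (f[i]'hif) (g[i]'hig) (subPre X f i hi)))
      (fun n m i h w hp hp' hp'' => (w hp hp' hp'').mono h)
      fun i hi => let ⟨n, hn⟩ := hargs i hi (hlf ▸ hi) (hlg ▸ hi); ⟨n, fun _ _ _ => hn⟩
    exact ⟨a + b + c + d, .teqSub2 hax hY hlf hlg (hJ.mono (by omega)) (h1.mono (by omega))
      (h2.mono (by omega)) fun i hi hif hig => (hargs i hi hi hif hig).mono (by omega)⟩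

theorem isPreCtx_of_dctx {C : PreCtx A}
    (hC : ∀ C₀ p C₁, C = C₀ ++ p :: C₁ → Dv Ax C₀ (.so p.2)) : IsPreCtx C := by
  intro i hi v hv
  have := (hC (C.take i) C[i] (C.drop (i + 1)) (by simp)).scoped
  exact this v hv

theorem isPreCtx_of_derivable {C : PreCtx A} (h : Derivable Ax (.ctx C)) : IsPreCtx C := by
  obtain ⟨n, h⟩ := h
  induction n with
  | zero => cases h
  | succ n ih =>
    rcases h with h | h
    · exact ih h
    · cases h with
      | ctx_nil => intro i hi; simp at hi
      | ctx_cons hs hf hp => exact hp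

theorem DCtx.derivable_aux {C : PreCtx A} (hC : DCtx Ax C)
    (h : ∀ C₀ p C₁, C = C₀ ++ p :: C₁ → Derivable Ax (.ctx C₀) → Derivable Ax (.sort C₀ p.2)) :
    Derivable Ax (.ctx C) := by
  induction C using List.reverseRecOn with
  | nil => exact derivable_of_step .ctx_nil
  | append_singleton C p ih =>
    have h1 := ih hC.left fun C₀ q C₁ e => h C₀ q (C₁ ++ [p]) (by simp [e])
    refine derivable_of_step (.ctx_cons (h C p [] rfl h1) ?_ (isPreCtx_of_dctx hC.2))
    have := hC.1
    rw [List.map_append, List.nodup_append] at this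
    exact fun q hq => this.2.2 q.1 (List.mem_map_of_mem hq) p.1 (by simp)

theorem derivable_sub_args {C X' : PreCtx A} (hC : IsPreCtx C) {φ : A.Var → Expr A}
    (h : ∀ p ∈ C, Derivable Ax (.term X' (φ p.1) (p.2.subst φ))) :
    ∀ i (hi : i < C.length) (hif : i < (C.map fun p => φ p.1).length),
      Derivable Ax (.term X' ((C.map fun p => φ p.1)[i]'hif)
        (subPre C (C.map fun p => φ p.1) i hi)) := by
  intro i hi hif
  rw [subPre_map hC, List.getElem_map]
  exact h _ (List.getElem_mem hi)

theorem substL_map {C : PreCtx A} {φ : A.Var → Expr A} {U : SortE A}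
    (h : ∀ x, SOccurs x U → x ∈ C.map Prod.fst) :
    U.substL (mkSub C (C.map fun p => φ p.1)) = U.subst φ :=
  ssubst_congr fun x hx => lookupV_mkSub_map C φ (h x hx)

theorem substL_map_tm {C : PreCtx A} {φ : A.Var → Expr A} {u : Expr A}
    (h : ∀ x, Occurs x u → x ∈ C.map Prod.fst) :
    u.substL (mkSub C (C.map fun p => φ p.1)) = u.subst φ :=
  subst_congr fun x hx => lookupV_mkSub_map C φ (h x hx)

theorem derivable_vars {C : PreCtx A} (hC : ∀ p ∈ C, Derivable Ax (.sort C p.2)) :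
    ∀ i (hi : i < C.length), Derivable Ax (.term C (.var (C[i]'hi).1) (C[i]'hi).2) :=
  fun i hi => derivable_of_step (.var hi (hC _ (List.getElem_mem hi)))

/-- Derivability of the two sides of a term equality. -/
def Jd.Sides (Ax : Set (Judg A)) (X : PreCtx A) : Jd A → Prop
  | .teq u v U => Derivable Ax (.term X u U) ∧ Derivable Ax (.term X v U)
  | _ => True

theorem W.derivable_sides {n : ℕ} {X : PreCtx A} {j : Jd A} (h : W Ax n X j) :
    ∀ X₁, Derivable Ax (.ctx (X ++ X₁)) →
      Derivable Ax (j.over (X ++ X₁)) ∧ j.Sides Ax (X ++ X₁) := by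
  have hctx : ∀ {k : ℕ} {C : PreCtx A}, (C.map Prod.fst).Nodup →
      (∀ C₀ p C₁, C = C₀ ++ p :: C₁ → W Ax k C₀ (.so p.2)) →
      (∀ C₀ p C₁, C = C₀ ++ p :: C₁ →
        ∀ X₁, Derivable Ax (.ctx (C₀ ++ X₁)) →
          Derivable Ax (Jd.over (C₀ ++ X₁) (.so p.2)) ∧ Jd.Sides Ax (C₀ ++ X₁) (.so p.2)) →
      IsPreCtx C ∧ Derivable Ax (.ctx C) ∧ ∀ p ∈ C, Derivable Ax (.sort C p.2) := by
    intro k C nd hC ih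
    have h1 : DCtx Ax C := ⟨nd, fun _ _ _ h => ⟨_, hC _ _ _ h⟩⟩
    have h2 := h1.derivable_aux fun C₀ p C₁ e h => by
      simpa [Jd.over] using (ih C₀ p C₁ e [] (by simpa using h)).1
    refine ⟨isPreCtx_of_dctx h1.2, h2, fun p hp => ?_⟩
    obtain ⟨C₀, C₁, rfl⟩ := List.append_of_mem hp
    exact (ih C₀ p C₁ rfl _ h2).1
  induction h with
  | @var n X₀ X₁ x U h ih =>
    intro X' hX
    rw [List.append_assoc, List.cons_append] at hX ⊢
    have := (ih _ hX).1
    have h2 := derivable_of_step (Ax := Ax)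
      (.var (X := X₀ ++ (x, U) :: (X₁ ++ X')) (i := X₀.length) (by simp)
        (by simpa [Jd.over] using this))
    exact ⟨by simpa [Jd.over] using h2, trivial⟩
  | so hk ax nd hC ha ihC iha =>
    intro X' hX
    obtain ⟨h1, h2, h3⟩ := hctx nd hC ihC
    exact ⟨derivable_of_step (.sSub ax (isPreCtx_of_derivable hX) (by simp)
      (derivable_of_step (.sA ax h2 (derivable_vars h3))) hX
      (derivable_sub_args h1 fun p hp => (iha p hp X' hX).1)), trivial⟩
  | @tm n k X C t U φ hk ax nd hC hU ha hUφ ihC ihU iha ihUφ =>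
    intro X' hX
    obtain ⟨h1, h2, h3⟩ := hctx nd hC ihC
    have hU' : Derivable Ax (.sort C U) := by
      simpa [Jd.over] using (ihU [] (by simpa using h2)).1
    have := derivable_of_step (.tSub ax (isPreCtx_of_derivable hX)
      (f := C.map fun p => φ p.1) (by simp)
      (derivable_of_step (.tA ax hU' (derivable_vars h3)))
      (by rw [substL_map hU.scoped]; exact (ihUφ X' hX).1)
      (derivable_sub_args h1 fun p hp => (iha p hp X' hX).1))
    rw [substL_map hU.scoped] at this
    exact ⟨this, trivial⟩
  | conv hk a b c d iha ihb ihc ihd =>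
    exact fun X' hX => ⟨derivable_of_step (.seqt (iha X' hX).1 (ihb X' hX).1), trivial⟩
  | srefl hk h ih => exact fun X' hX => ⟨derivable_of_step (.s1 (ih X' hX).1), trivial⟩
  | ssym hk h ih => exact fun X' hX => ⟨derivable_of_step (.s2 (ih X' hX).1), trivial⟩
  | strans hk h h' ih ih' =>
    exact fun X' hX => ⟨derivable_of_step (.s3 (ih X' hX).1 (ih' X' hX).1), trivial⟩
  | trefl hk h ih =>
    exact fun X' hX => ⟨derivable_of_step (.t1 (ih X' hX).1), (ih X' hX).1, (ih X' hX).1⟩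
  | tsym hk h ih =>
    exact fun X' hX => ⟨derivable_of_step (.t2 (ih X' hX).1), (ih X' hX).2.symm⟩
  | ttrans hk h h' ih ih' =>
    exact fun X' hX => ⟨derivable_of_step (.t3 (ih X' hX).1 (ih' X' hX).1),
      (ih X' hX).2.1, (ih' X' hX).2.2⟩
  | @sax n k X C U U' φ hk ax nd hC hU hU' ha h1 h2 ihC ihU ihU' iha ih1 ih2 =>
    intro X' hX
    obtain ⟨e1, e2, e3⟩ := hctx nd hC ihC
    have hd : Derivable Ax (.sort C U) := by
      simpa [Jd.over] using (ihU [] (by simpa using e2)).1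
    have hd' : Derivable Ax (.sort C U') := by
      simpa [Jd.over] using (ihU' [] (by simpa using e2)).1
    have := derivable_of_step (.seqSub1 ax (isPreCtx_of_derivable hX)
      (f := C.map fun p => φ p.1) (by simp)
      (derivable_of_step (.seqA ax hd hd'))
      (by rw [substL_map hU.scoped]; exact (ih1 X' hX).1)
      (by rw [substL_map hU'.scoped]; exact (ih2 X' hX).1)
      (derivable_sub_args e1 fun p hp => (iha p hp X' hX).1))
    rw [substL_map hU.scoped, substL_map hU'.scoped] at this
    exact ⟨this, trivial⟩
  | scong hk ax nd hC ha ha' he ihC iha iha' ihe =>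
    intro X' hX
    obtain ⟨h1, h2, h3⟩ := hctx nd hC ihC
    have h4 := derivable_of_step (.sA ax h2 (derivable_vars h3))
    refine ⟨derivable_of_step (.seqSub2 ax (isPreCtx_of_derivable hX) (by simp) (by simp) h4
      (derivable_of_step (.sSub ax (isPreCtx_of_derivable hX) (by simp) h4 hX
      (derivable_sub_args h1 fun p hp => (iha p hp X' hX).1)))
      (derivable_of_step (.sSub ax (isPreCtx_of_derivable hX) (by simp) h4 hX
      (derivable_sub_args h1 fun p hp => (iha' p hp X' hX).1))) ?_), trivial⟩
    intro i hi hif hig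
    rw [subPre_map h1, List.getElem_map, List.getElem_map]
    exact (ihe _ (List.getElem_mem hi) X' hX).1
  | @tconv n k X u v U U' hk he hu hU hU' ihe ihu ihU ihU' =>
    intro X' hX
    have h1 := derivable_of_step (.seqt (ihe X' hX).1 (ihu X' hX).2.1)
    have h2 := derivable_of_step (.seqt (ihe X' hX).1 (ihu X' hX).2.2)
    exact ⟨derivable_of_step (.seqteq (ihe X' hX).1 (ihu X' hX).1 h1 h2), h1, h2⟩
  | @tax n k X C u u' U φ hk ax nd hC hu hu' ha h1 h2 ihC ihu ihu' iha ih1 ih2 =>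
    intro X' hX
    obtain ⟨e1, e2, e3⟩ := hctx nd hC ihC
    have hd : Derivable Ax (.term C u U) := by
      simpa [Jd.over] using (ihu [] (by simpa using e2)).1
    have hd' : Derivable Ax (.term C u' U) := by
      simpa [Jd.over] using (ihu' [] (by simpa using e2)).1
    have := derivable_of_step (.teqSub1 ax (isPreCtx_of_derivable hX)
      (f := C.map fun p => φ p.1) (by simp)
      (derivable_of_step (.teqA ax hd hd'))
      (by rw [substL_map hu.scoped.2, substL_map_tm hu.scoped.1]; exact (ih1 X' hX).1)
      (by rw [substL_map hu.scoped.2, substL_map_tm hu'.scoped.1]; exact (ih2 X' hX).1)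
      (derivable_sub_args e1 fun p hp => (iha p hp X' hX).1))
    rw [substL_map hu.scoped.2, substL_map_tm hu.scoped.1, substL_map_tm hu'.scoped.1] at this
    exact ⟨this, (ih1 X' hX).1, (ih2 X' hX).1⟩
  | @tcong n k X C t U φ φ' hk ax nd hC hU ha ha' he hUφ ht ht' ihC ihU iha iha' ihe ihUφ iht
      iht' =>
    intro X' hX
    obtain ⟨h1, h2, h3⟩ := hctx nd hC ihC
    have hU' : Derivable Ax (.sort C U) := by
      simpa [Jd.over] using (ihU [] (by simpa using h2)).1
    have := derivable_of_step (.teqSub2 ax (isPreCtx_of_derivable hX)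
      (f := C.map fun p => φ p.1) (g := C.map fun p => φ' p.1) (by simp) (by simp)
      (derivable_of_step (.tA ax hU' (derivable_vars h3)))
      (by rw [substL_map hU.scoped]; exact (iht X' hX).1)
      (by rw [substL_map hU.scoped]; exact (iht' X' hX).1)
      (by
        intro i hi hif hig
        rw [subPre_map h1, List.getElem_map, List.getElem_map]
        exact (ihe _ (List.getElem_mem hi) X' hX).1))
    rw [substL_map hU.scoped] at this
    exact ⟨this, (iht X' hX).1, (iht' X' hX).1⟩

theorem DCtx.derivable {X : PreCtx A} (h : DCtx Ax X) : Derivable Ax (.ctx X) :=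
  h.derivable_aux fun C₀ p C₁ e h' => by
    obtain ⟨n, hn⟩ := h.2 C₀ p C₁ e
    simpa [Jd.over] using (hn.derivable_sides [] (by simpa using h')).1

theorem Dv.derivable {X : PreCtx A} {j : Jd A} (hX : DCtx Ax X) (h : Dv Ax X j) :
    Derivable Ax (j.over X) := by
  obtain ⟨n, hn⟩ := h
  simpa using (hn.derivable_sides [] (by simpa using hX.derivable)).1

end

section
variable {Ax : Set (Judg A)}

theorem Dv.tm {X C : PreCtx A} {t : A.TermSym} {U : SortE A} {φ : A.Var → Expr A}
    (ax : introTerm C t U ∈ Ax) (hC : DCtx Ax C) (hU : Dv Ax C (.so U))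
    (ha : ∀ p ∈ C, Dv Ax X (.tm (φ p.1) (p.2.subst φ))) :
    Dv Ax X (.tm (.app t (C.map fun p => φ p.1)) (U.subst φ)) :=
  (Dv.tcong ax hC hU ha (fun p hp => (ha p hp).trefl) (.srefl (hU.subst ha))).teq_left

theorem Dv.sax {X C : PreCtx A} {U U' : SortE A} {φ : A.Var → Expr A}
    (ax : Judg.sortEq C U U' ∈ Ax) (hC : DCtx Ax C) (hU : Dv Ax C (.so U))
    (hU' : Dv Ax C (.so U'))
    (ha : ∀ p ∈ C, Dv Ax X (.tm (φ p.1) (p.2.subst φ))) :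
    Dv Ax X (.seq (U.subst φ) (U'.subst φ)) := by
  obtain ⟨a, h1⟩ := exists_bound_ctx hC.2
  obtain ⟨b, h2⟩ := exists_bound_tm ha
  obtain ⟨c, h3⟩ := hU
  obtain ⟨d, h4⟩ := hU'
  obtain ⟨e, h5⟩ := h3.subst ha
  obtain ⟨f, h6⟩ := h4.subst ha
  exact ⟨a + b + c + d + e + f + 1, .sax (Nat.lt_succ_self _) ax hC.1
    (fun _ _ _ h => (h1 _ _ _ h).mono (by omega)) (h3.mono (by omega)) (h4.mono (by omega))
    (fun p hp => (h2 p hp).mono (by omega)) (h5.mono (by omega)) (h6.mono (by omega))⟩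

theorem Dv.tax {X C : PreCtx A} {u u' : Expr A} {U : SortE A} {φ : A.Var → Expr A}
    (ax : Judg.termEq C u u' U ∈ Ax) (hC : DCtx Ax C) (hu : Dv Ax C (.tm u U))
    (hu' : Dv Ax C (.tm u' U))
    (ha : ∀ p ∈ C, Dv Ax X (.tm (φ p.1) (p.2.subst φ))) :
    Dv Ax X (.teq (u.subst φ) (u'.subst φ) (U.subst φ)) := by
  obtain ⟨a, h1⟩ := exists_bound_ctx hC.2
  obtain ⟨b, h2⟩ := exists_bound_tm ha
  obtain ⟨c, h3⟩ := hu
  obtain ⟨d, h4⟩ := hu'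
  obtain ⟨e, h5⟩ := h3.subst ha
  obtain ⟨f, h6⟩ := h4.subst ha
  exact ⟨a + b + c + d + e + f + 1, .tax (Nat.lt_succ_self _) ax hC.1
    (fun _ _ _ h => (h1 _ _ _ h).mono (by omega)) (h3.mono (by omega)) (h4.mono (by omega))
    (fun p hp => (h2 p hp).mono (by omega)) (h5.mono (by omega)) (h6.mono (by omega))⟩

theorem IsPretheory.uniqueIntro (h : IsPretheory Ax) : UniqueIntro Ax where
  sort h1 h2 := (h.sort_intro _).unique h1 h2
  term := by
    intro t C C' U U' h1 h2
    have := (h.term_intro t).unique (y₁ := (C, U)) (y₂ := (C', U')) h1 h2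
    simpa using this

/-- The reformulated content of a judgment. -/
def Judg.Good (Ax : Set (Judg A)) : Judg A → Prop
  | .ctx X => DCtx Ax X
  | .sort X U => DCtx Ax X ∧ Dv Ax X (.so U)
  | .term X u U => DCtx Ax X ∧ Dv Ax X (.tm u U)
  | .sortEq X U V => DCtx Ax X ∧ Dv Ax X (.seq U V)
  | .termEq X u v U => DCtx Ax X ∧ Dv Ax X (.teq u v U)

theorem good_args {X Y : PreCtx A} {f : List (Expr A)} (hX : DCtx Ax X)
    (hlen : f.length = X.length)
    (hargs : ∀ i (hi : i < X.length) (hif : i < f.length),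
      Judg.Good Ax (.term Y (f[i]'hif) (subPre X f i hi))) :
    ∃ φ : A.Var → Expr A, f = (X.map fun p => φ p.1) ∧
      ∀ p ∈ X, Dv Ax Y (.tm (φ p.1) (p.2.subst φ)) := by
  obtain ⟨φ, rfl⟩ := exists_fun_of_nodup hX.1 hlen
  refine ⟨φ, rfl, fun p hp => ?_⟩
  obtain ⟨i, hi, rfl⟩ := List.getElem_of_mem hp
  have := (hargs i hi (by simpa using hi)).2
  rwa [subPre_map (isPreCtx_of_dctx hX.2), List.getElem_map] at this

theorem forall₂_te {X Y : PreCtx A} {f g : List (Expr A)}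
    (hf : f.length = X.length) (hg : g.length = X.length)
    (h : ∀ i (hi : i < X.length) (hif : i < f.length) (hig : i < g.length),
      Judg.Good Ax (.termEq Y (f[i]'hif) (g[i]'hig) (subPre X f i hi))) :
    List.Forall₂ (Te Ax Y) f g := by
  rw [List.forall₂_iff_get]
  exact ⟨hf.trans hg.symm, fun i hi hi' => ⟨_, (h i (hf ▸ hi) hi hi').2⟩⟩

theorem IsPretheory.good_of_step (hT : IsPretheory Ax) {J : Judg A}
    (h : Step Ax (Judg.Good Ax) J) : J.Good Ax := by
  have hu := hT.uniqueIntro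
  cases h with
  | ctx_nil => exact .nil
  | ctx_cons hs hf hp => exact hs.1.concat hf hs.2
  | s1 h => exact ⟨h.1, h.2.srefl⟩
  | s2 h => exact ⟨h.1, h.2.ssym⟩
  | s3 h h' => exact ⟨h.1, h.2.strans h'.2⟩
  | t1 h => exact ⟨h.1, h.2.trefl⟩
  | t2 h => exact ⟨h.1, h.2.tsym⟩
  | t3 h h' => exact ⟨h.1, h.2.ttrans h'.2⟩
  | seqt h h' => exact ⟨h.1, h'.2.conv h.2⟩
  | seqteq h h' _ _ => exact ⟨h.1, h'.2.tconv h.2⟩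
  | var hi h => exact ⟨h.1, h.1.var (List.getElem_mem hi)⟩
  | @sA X U hax h hv =>
    refine ⟨h, ?_⟩
    obtain ⟨S, es⟩ := U
    obtain rfl : es = ctxVars X := hT.sort_shape _ _ hax
    exact Dv.so (φ := Expr.var) hax h fun p hp => by simpa using DCtx.var h hp
  | @tA X u U hax h hv =>
    refine ⟨h.1, ?_⟩
    obtain ⟨t, rfl⟩ := hT.term_shape _ _ _ hax
    have := Dv.tm (φ := Expr.var) hax h.1 h.2 fun p hp => by simpa using DCtx.var h.1 hp
    simpa [ctxVars] using this
  | @seqA X U U' hax h h' =>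
    refine ⟨h.1, ?_⟩
    simpa using Dv.sax (φ := Expr.var) hax h.1 h.2 h'.2 fun p hp => by
      simpa using DCtx.var h.1 hp
  | @teqA X u u' U hax h h' =>
    refine ⟨h.1, ?_⟩
    simpa [subst_id] using Dv.tax (φ := Expr.var) hax h.1 h.2 h'.2 fun p hp => by
      simpa using DCtx.var h.1 hp
  | @sSub X S hax Y hY f hlen hJ hYc hargs =>
    obtain ⟨φ, rfl, ha⟩ := good_args hJ.1 hlen hargs
    exact ⟨hYc, Dv.so hax hJ.1 ha⟩
  | @tSub X t U hax Y hY f hlen hJ hU hargs =>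
    obtain ⟨φ, rfl, ha⟩ := good_args hJ.1 hlen hargs
    refine ⟨hU.1, ?_⟩
    rw [substL_map hJ.2.tm_so.scoped]
    exact Dv.tm hax hJ.1 hJ.2.tm_so ha
  | @seqSub1 X U U' hax Y hY f hlen hJ h1 h2 hargs =>
    obtain ⟨φ, rfl, ha⟩ := good_args hJ.1 hlen hargs
    refine ⟨h1.1, ?_⟩
    rw [substL_map hJ.2.seq_left.scoped, substL_map hJ.2.seq_right.scoped]
    exact hJ.2.subst ha
  | @seqSub2 X S hax Y hY f g hlf hlg hJ h1 h2 hargs =>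
    exact ⟨h1.1, Te.sort hu h1.1.1 h1.2 (forall₂_te hlf hlg hargs)⟩
  | @teqSub1 X u u' U hax Y hY f hlen hJ h1 h2 hargs =>
    obtain ⟨φ, rfl, ha⟩ := good_args hJ.1 hlen hargs
    refine ⟨h1.1, ?_⟩
    rw [substL_map hJ.2.teq_left.scoped.2, substL_map_tm hJ.2.teq_left.scoped.1,
      substL_map_tm hJ.2.teq_right.scoped.1]
    exact hJ.2.subst ha
  | @teqSub2 X t U hax Y hY f g hlf hlg hJ h1 h2 hargs =>
    exact ⟨h1.1, Te.app hu h1.1.1 h1.2 (forall₂_te hlf hlg hargs)⟩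

theorem Step.mono {D D' : Judg A → Prop} (hD : ∀ J, D J → D' J) {J : Judg A}
    (h : Step Ax D J) : Step Ax D' J := by
  cases h with
  | ctx_nil => exact .ctx_nil
  | ctx_cons hs hf hp => exact .ctx_cons (hD _ hs) hf hp
  | s1 h => exact .s1 (hD _ h)
  | s2 h => exact .s2 (hD _ h)
  | s3 h h' => exact .s3 (hD _ h) (hD _ h')
  | t1 h => exact .t1 (hD _ h)
  | t2 h => exact .t2 (hD _ h)
  | t3 h h' => exact .t3 (hD _ h) (hD _ h')
  | seqt h h' => exact .seqt (hD _ h) (hD _ h')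
  | seqteq h1 h2 h3 h4 => exact .seqteq (hD _ h1) (hD _ h2) (hD _ h3) (hD _ h4)
  | var hi h => exact .var hi (hD _ h)
  | sA hax h hv => exact .sA hax (hD _ h) fun i hi => hD _ (hv i hi)
  | tA hax h hv => exact .tA hax (hD _ h) fun i hi => hD _ (hv i hi)
  | seqA hax h h' => exact .seqA hax (hD _ h) (hD _ h')
  | teqA hax h h' => exact .teqA hax (hD _ h) (hD _ h')
  | sSub hax hY hl hJ h ha =>
    exact .sSub hax hY hl (hD _ hJ) (hD _ h) fun i hi hi' => hD _ (ha i hi hi')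
  | tSub hax hY hl hJ h ha =>
    exact .tSub hax hY hl (hD _ hJ) (hD _ h) fun i hi hi' => hD _ (ha i hi hi')
  | seqSub1 hax hY hl hJ h h' ha =>
    exact .seqSub1 hax hY hl (hD _ hJ) (hD _ h) (hD _ h') fun i hi hi' => hD _ (ha i hi hi')
  | seqSub2 hax hY hl hl' hJ h h' ha =>
    exact .seqSub2 hax hY hl hl' (hD _ hJ) (hD _ h) (hD _ h')
      fun i hi hi' hi'' => hD _ (ha i hi hi' hi'')
  | teqSub1 hax hY hl hJ h h' ha =>
    exact .teqSub1 hax hY hl (hD _ hJ) (hD _ h) (hD _ h') fun i hi hi' => hD _ (ha i hi hi')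
  | teqSub2 hax hY hl hl' hJ h h' ha =>
    exact .teqSub2 hax hY hl hl' (hD _ hJ) (hD _ h) (hD _ h')
      fun i hi hi' hi'' => hD _ (ha i hi hi' hi'')

theorem IsPretheory.good (hT : IsPretheory Ax) {J : Judg A} (h : Derivable Ax J) :
    J.Good Ax := by
  obtain ⟨n, h⟩ := h
  induction n generalizing J with
  | zero => cases h
  | succ n ih =>
    rcases h with h | h
    · exact ih h
    · exact hT.good_of_step (h.mono fun _ => ih)

end

/-! ### Canonical sorts -/

/-- A generalized algebraic theory over a given alphabet. -/
structure Thy (A : Alphabet) where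
  ax : Set (Judg A)
  gat : IsGAT ax

variable {𝔸 : Thy A} {𝔹 : Thy B}

theorem Thy.unique (𝔸 : Thy A) : UniqueIntro 𝔸.ax := 𝔸.gat.1.uniqueIntro

/-- A function assigning a sort to every variable. -/
def Env (𝔸 : Thy A) : Type := A.Var → SortE A

/-- The context and the sort with which a term symbol is introduced. -/
noncomputable def Thy.intro (𝔸 : Thy A) (t : A.TermSym) : PreCtx A × SortE A :=
  (𝔸.gat.1.term_intro t).choose

theorem Thy.intro_mem (𝔸 : Thy A) (t : A.TermSym) :
    introTerm (𝔸.intro t).1 t (𝔸.intro t).2 ∈ 𝔸.ax :=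
  (𝔸.gat.1.term_intro t).choose_spec.1

theorem Thy.intro_eq {t : A.TermSym} {C : PreCtx A} {U : SortE A}
    (h : introTerm C t U ∈ 𝔸.ax) : 𝔸.intro t = (C, U) := by
  have := 𝔸.unique.term (𝔸.intro_mem t) h
  exact Prod.ext this.1 this.2

/-- The canonical sort of a term. -/
noncomputable def cs (σ : Env 𝔸) : Expr A → SortE A
  | .var x => σ x
  | .app t es => (𝔸.intro t).2.substL (mkSub (𝔸.intro t).1 es)

@[simp] theorem cs_var (σ : Env 𝔸) (x : A.Var) : cs σ (.var x) = σ x := rfl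

theorem cs_app (σ : Env 𝔸) {t : A.TermSym} {C : PreCtx A} {U : SortE A}
    (h : introTerm C t U ∈ 𝔸.ax) {φ : A.Var → Expr A} (hU : Dv 𝔸.ax C (.so U)) :
    cs σ (.app t (C.map fun p => φ p.1)) = U.subst φ := by
  rw [cs, Thy.intro_eq h]
  exact substL_map hU.scoped

/-- The sorts of the variables of a context are those given by `σ`. -/
def Agree (σ : Env 𝔸) (X : PreCtx A) : Prop := ∀ p ∈ X, σ p.1 = p.2

theorem Agree.left {σ : Env 𝔸} {X X' : PreCtx A} (h : Agree σ (X ++ X')) : Agree σ X :=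
  fun p hp => h p (List.mem_append_left _ hp)

theorem W.cs {σ : Env 𝔸} {X : PreCtx A} (hσ : Agree σ X) {n : ℕ} {u : Expr A} {U : SortE A}
    (h : W 𝔸.ax n X (.tm u U)) : W 𝔸.ax n X (.tm u (cs σ u)) := by
  generalize hj : Jd.tm u U = j at h
  induction h generalizing u U with
  | @var n X₀ X₁ x U' h ih =>
    cases hj
    rw [cs_var, hσ (x, U') (by simp)]
    exact .var h
  | @tm n k X C t U' φ hk ax nd hC hU ha hUφ =>
    cases hj
    rw [cs_app _ ax ⟨_, hU⟩]
    exact .tm hk ax nd hC hU ha hUφ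
  | conv hk he hu hU hU' _ ihu =>
    cases hj
    exact (ihu hσ rfl).mono hk.le
  | _ => cases hj

/-- The sort of a canonically typed term. -/
theorem W.tm_cases {σ : Env 𝔸} {X : PreCtx A} (hσ : Agree σ X) {n : ℕ} {u : Expr A} {U : SortE A}
    (h : W 𝔸.ax n X (.tm u U)) : U = GATPaper.cs σ u ∨
      ∃ k U', k < n ∧ W 𝔸.ax k X (.seq U' U) ∧ W 𝔸.ax k X (.tm u U') ∧ W 𝔸.ax k X (.so U) := by
  cases h with
  | @var n X₀ X₁ x U' h =>
    rw [cs_var, hσ (x, U) (by simp)]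
    exact .inl rfl
  | @tm n k X C t U' φ hk ax nd hC hU ha hUφ =>
    rw [cs_app _ ax ⟨_, hU⟩]
    exact .inl rfl
  | conv hk he hu hU hU' => exact .inr ⟨_, _, hk, he, hu, hU'⟩

theorem W.var_mem {Ax : Set (Judg A)} {X : PreCtx A} {n : ℕ} {x : A.Var} {U : SortE A}
    (h : W Ax n X (.tm (.var x) U)) : ∃ U₀, (x, U₀) ∈ X := by
  obtain ⟨X₀, U₀, X₁, rfl, _⟩ := h.var_inv
  exact ⟨U₀, by simp⟩

theorem W.args_so {X : PreCtx A} {n : ℕ} {U : SortE A} (h : W 𝔸.ax n X (.so U))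
    {a : Expr A} (ha : a ∈ U.args) : ∃ k U', k < n ∧ W 𝔸.ax k X (.tm a U') := by
  obtain ⟨k, C, φ, hk, ax, nd, hC, h, e⟩ := h.so_inv
  rw [e] at ha
  obtain ⟨p, hp, rfl⟩ := List.mem_map.1 ha
  exact ⟨k, _, hk, h p hp⟩

theorem W.args_app {X : PreCtx A} {n : ℕ} {t : A.TermSym} {es : List (Expr A)} {U : SortE A}
    (h : W 𝔸.ax n X (.tm (.app t es) U))
    {a : Expr A} (ha : a ∈ es) : ∃ k U', k < n ∧ W 𝔸.ax k X (.tm a U') := by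
  obtain ⟨k, C, U₀, φ, hk, ax, nd, hC, hU, h, h', e, _⟩ := h.app_inv
  rw [e] at ha
  obtain ⟨p, hp, rfl⟩ := List.mem_map.1 ha
  exact ⟨k, _, hk, h p hp⟩

/-- Terms over `X`, or variables whose sort is a sort over `X`. -/
inductive Arg (σ : Env 𝔸) (X : PreCtx A) (n : ℕ) : Expr A → Prop where
  | var {x : A.Var} (h : W 𝔸.ax n X (.so (σ x))) : Arg σ X n (.var x)
  | app {t : A.TermSym} {es : List (Expr A)} {U : SortE A}
      (h : W 𝔸.ax n X (.tm (.app t es) U)) : Arg σ X n (.app t es)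

theorem W.arg {σ : Env 𝔸} {X : PreCtx A} (hσ : Agree σ X) {n : ℕ} {u : Expr A} {U : SortE A}
    (h : W 𝔸.ax n X (.tm u U)) : Arg σ X n u := by
  cases u with
  | var x => exact .var (h.cs hσ).presup
  | app t es => exact .app h

theorem Arg.cs_so {σ : Env 𝔸} {X : PreCtx A} (hσ : Agree σ X) {n : ℕ} {u : Expr A}
    (h : Arg σ X n u) : W 𝔸.ax n X (.so (cs σ u)) := by
  cases h with
  | var h => exact h
  | app h => exact (h.cs hσ).presup

theorem Arg.cs_args {σ : Env 𝔸} {X : PreCtx A} (hσ : Agree σ X) {n : ℕ} {u : Expr A}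
    (h : Arg σ X n u) {a : Expr A} (ha : a ∈ (cs σ u).args) :
    ∃ k U, k < n ∧ W 𝔸.ax k X (.tm a U) :=
  (h.cs_so hσ).args_so ha

theorem Arg.cs_args' {σ : Env 𝔸} {X : PreCtx A} (hσ : Agree σ X) {n : ℕ} {u : Expr A}
    (h : Arg σ X n u) {a : Expr A} (ha : a ∈ (cs σ u).args) : ∃ k, k < n ∧ Arg σ X k a := by
  obtain ⟨k, U, hk, h⟩ := h.cs_args hσ ha
  exact ⟨k, hk, h.arg hσ⟩

theorem Arg.args {σ : Env 𝔸} {X : PreCtx A} (hσ : Agree σ X) {n : ℕ} {t : A.TermSym}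
    {es : List (Expr A)} (h : Arg σ X n (.app t es)) {a : Expr A} (ha : a ∈ es) :
    ∃ k, k < n ∧ Arg σ X k a := by
  cases h with
  | app h =>
    obtain ⟨k, U, hk, h⟩ := h.args_app ha
    exact ⟨k, hk, h.arg hσ⟩

theorem canonSort_iff {σ : Env 𝔸} {X : PreCtx A} (hσ : Agree σ X) {n : ℕ} {u : Expr A}
    {U V : SortE A} (h : W 𝔸.ax n X (.tm u U)) : CanonSort 𝔸.ax X u V ↔ V = cs σ u := by
  constructor
  · intro h'
    cases h' with
    | var hi => exact (hσ _ (List.getElem_mem hi)).symm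
    | app hax => rw [cs, Thy.intro_eq hax]
  · rintro rfl
    cases u with
    | var x =>
      obtain ⟨U₀, hU⟩ := h.var_mem
      obtain ⟨i, hi, e⟩ := List.getElem_of_mem hU
      have h1 := hσ _ hU
      have := CanonSort.var (Ax := 𝔸.ax) hi
      rw [e] at this
      simpa [h1] using this
    | app t es => exact .app (𝔸.intro_mem t)

theorem cs_subst {σ₀ σ : Env 𝔸} {C : PreCtx A} {n : ℕ} {t : A.TermSym} {es : List (Expr A)}
    {U : SortE A} (h : W 𝔸.ax n C (.tm (.app t es) U)) (φ : A.Var → Expr A) :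
    cs σ ((Expr.app t es).subst φ) = (cs σ₀ (.app t es)).subst φ := by
  obtain ⟨k, D, U₀, ψ, hk, ax, nd, hC, hU, h, h', rfl, _⟩ := h.app_inv
  have := cs_app σ ax ⟨_, hU⟩ (φ := fun x => (ψ x).subst φ)
  rw [cs_app _ ax ⟨_, hU⟩, ssubst_subst, ← this]
  simp [Function.comp_def]

section
variable {𝔸 : Thy A} {𝔹 : Thy B}

/-! ### Lexicographically ordered grids -/

section Grid
variable {α β γ δ : Type}

/-- The values of a binary function on two lists, in lexicographic order. -/
def grid (F : α → β → γ) (L : List α) (L' : List β) : List γ :=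
  L.flatMap fun a => L'.map (F a)

theorem grid_nil (F : α → β → γ) (L' : List β) : grid F [] L' = [] := rfl

theorem grid_cons (F : α → β → γ) (a : α) (L : List α) (L' : List β) :
    grid F (a :: L) L' = L'.map (F a) ++ grid F L L' := by simp [grid]

theorem grid_append (F : α → β → γ) (L₁ L₂ : List α) (L' : List β) :
    grid F (L₁ ++ L₂) L' = grid F L₁ L' ++ grid F L₂ L' := by simp [grid]

theorem grid_singleton (F : α → β → γ) (a : α) (L' : List β) :
    grid F [a] L' = L'.map (F a) := by simp [grid]

theorem grid_empty (F : α → β → γ) (L : List α) : grid F L [] = [] := by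
  induction L with
  | nil => rfl
  | cons a L ih => simp [grid_cons, ih]

theorem mem_grid {F : α → β → γ} {L : List α} {L' : List β} {c : γ} :
    c ∈ grid F L L' ↔ ∃ a ∈ L, ∃ b ∈ L', F a b = c := by simp [grid]

theorem map_grid (g : γ → δ) (F : α → β → γ) (L : List α) (L' : List β) :
    (grid F L L').map g = grid (fun a b => g (F a b)) L L' := by
  simp [grid, List.map_flatMap, Function.comp_def]

theorem grid_map {α' β' : Type} (F : α → β → γ) (f : α' → α) (g : β' → β) (L : List α')
    (L' : List β') : grid F (L.map f) (L'.map g) = grid (fun a b => F (f a) (g b)) L L' := by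
  simp [grid, List.flatMap_map, Function.comp_def]

theorem grid_congr {F G : α → β → γ} {L : List α} {L' : List β}
    (h : ∀ a ∈ L, ∀ b ∈ L', F a b = G a b) : grid F L L' = grid G L L' := by
  induction L with
  | nil => rfl
  | cons a L ih =>
    rw [grid_cons, grid_cons, ih fun a ha => h a (List.mem_cons_of_mem _ ha),
      List.map_congr_left (h a List.mem_cons_self)]

theorem length_grid (F : α → β → γ) (L : List α) (L' : List β) :
    (grid F L L').length = L.length * L'.length := by
  induction L with
  | nil => simp [grid_nil]
  | cons a L ih => simp [grid_cons, ih, Nat.add_mul, Nat.add_comm]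

theorem getElem_grid (F : α → β → γ) (L : List α) (L' : List β) {i j : ℕ} (hi : i < L.length)
    (hj : j < L'.length) (h : i * L'.length + j < (grid F L L').length) :
    (grid F L L')[i * L'.length + j] = F L[i] L'[j] := by
  induction L generalizing i with
  | nil => simp at hi
  | cons a L ih =>
    cases i with
    | zero =>
      simp only [grid_cons]
      rw [List.getElem_append_left (by simpa using hj)]
      simp
    | succ i =>
      simp only [grid_cons]
      rw [List.getElem_append_right (by simp [Nat.add_mul]; omega)]
      simp only [List.length_map, List.getElem_cons_succ]
      have e : (i + 1) * L'.length + j - L'.length = i * L'.length + j := by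
        rw [Nat.add_mul]; omega
      simp only [e]
      exact ih (by simpa using hi) _

theorem lex_index {m n k : ℕ} (h : k < m * n) : k / n < m ∧ k % n < n ∧ k / n * n + k % n = k := by
  have hn : 0 < n := Nat.pos_of_ne_zero fun e => by simp [e] at h
  exact ⟨Nat.div_lt_of_lt_mul (by rwa [Nat.mul_comm]), Nat.mod_lt _ hn, Nat.div_add_mod' k n⟩

theorem grid_ext {F : α → β → γ} {L : List α} {L' : List β} {out : List γ}
    (hl : out.length = L.length * L'.length)
    (h : ∀ i j (hi : i < L.length) (hj : j < L'.length) (h : i * L'.length + j < out.length),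
      out[i * L'.length + j] = F L[i] L'[j]) : out = grid F L L' := by
  apply List.ext_getElem
  · rw [hl, length_grid]
  · intro k hk hk'
    obtain ⟨hi, hj, e⟩ := lex_index (hl ▸ hk)
    have h1 := h _ _ hi hj (by omega)
    have h2 := getElem_grid F L L' hi hj (by omega)
    simp only [e] at h1 h2
    rw [h1, h2]

theorem isGrid_iff {F : α → β → γ} {L : List α} {L' : List β} {M : ℕ → ℕ → γ} {m n : ℕ}
    (hm : L.length = m) (hn : L'.length = n)
    (hM : ∀ i j (hi : i < L.length) (hj : j < L'.length), M i j = F L[i] L'[j]) {out : List γ} :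
    IsGrid m n M out ↔ out = grid F L L' := by
  subst hm hn
  constructor
  · rintro ⟨hl, h⟩
    exact grid_ext hl fun i j hi hj h' => (h i j hi hj h').trans (hM i j hi hj)
  · rintro rfl
    exact ⟨length_grid _ _ _, fun i j hi hj h => by rw [getElem_grid F L L' hi hj h, hM i j hi hj]⟩

theorem forall₂_grid {F G : α → β → γ} {R : γ → γ → Prop} {L : List α} {L' : List β}
    (h : ∀ a ∈ L, ∀ b ∈ L', R (F a b) (G a b)) : List.Forall₂ R (grid F L L') (grid G L L') := by
  induction L with
  | nil => exact .nil
  | cons a L ih =>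
    rw [grid_cons, grid_cons]
    apply List.rel_append
    · rw [List.forall₂_map_left_iff, List.forall₂_map_right_iff, List.forall₂_same]
      exact h a List.mem_cons_self
    · exact ih fun a ha => h a (List.mem_cons_of_mem _ ha)

end Grid

/-! ### The tensor product of terms as a function -/

section Tens
variable (σ : Env 𝔸) (τ : Env 𝔹)

/-- The two lists of terms whose tensor products are the arguments of a tensor product. -/
noncomputable def argsOf : Expr A → Expr B → List (Expr A) × List (Expr B)
  | u, .app _ p => ((cs σ u).args ++ [u], p)
  | .app _ h, .var y => (h, (τ y).args ++ [.var y])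
  | .var _, .var _ => ([], [])

/-- The expression over the tensor alphabet in terms of the products of the arguments. -/
noncomputable def tensStep (G : Expr A → Expr B → Expr (A.tensor B)) (u : Expr A) (v : Expr B) :
    Expr (A.tensor B) :=
  match u, v with
  | .var x, .var y => .var (x, y)
  | u, .app t p => .app (.inl ((cs σ u).head, t)) (grid G ((cs σ u).args ++ [u]) p)
  | .app s h, .var y => .app (.inr (s, (τ y).head)) (grid G h ((τ y).args ++ [.var y]))

/-- The relation along which the tensor product is defined. -/
def ArgRel (q p : Expr A × Expr B) : Prop :=
  q.1 ∈ (argsOf σ τ p.1 p.2).1 ∧ q.2 ∈ (argsOf σ τ p.1 p.2).2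

theorem tensStep_congr {G G' : Expr A → Expr B → Expr (A.tensor B)} {u : Expr A} {v : Expr B}
    (h : ∀ a b, ArgRel σ τ (a, b) (u, v) → G a b = G' a b) :
    tensStep σ τ G u v = tensStep σ τ G' u v := by
  cases v with
  | app t p =>
    simp only [tensStep]
    rw [grid_congr fun a ha b hb => h a b ⟨by simpa [argsOf] using ha, by simpa [argsOf] using hb⟩]
  | var y =>
    cases u with
    | var x => rfl
    | app s l =>
      simp only [tensStep]
      rw [grid_congr fun a ha b hb =>
        h a b ⟨by simpa [argsOf] using ha, by simpa [argsOf] using hb⟩]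

open Classical in
/-- The tensor product of two terms. -/
noncomputable def tens (u : Expr A) (v : Expr B) : Expr (A.tensor B) :=
  if h : Acc (ArgRel σ τ) (u, v) then
    WellFounded.fixF (C := fun _ => Expr (A.tensor B)) (fun p ih =>
      tensStep σ τ (fun a b => if h : ArgRel σ τ (a, b) p then ih (a, b) h
        else .var (Classical.arbitrary A.Var, Classical.arbitrary B.Var)) p.1 p.2) (u, v) h
  else .var (Classical.arbitrary A.Var, Classical.arbitrary B.Var)

theorem tens_eq {u : Expr A} {v : Expr B} (h : Acc (ArgRel σ τ) (u, v)) :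
    tens σ τ u v = tensStep σ τ (tens σ τ) u v := by
  rw [tens, dif_pos h, WellFounded.fixF_eq]
  apply tensStep_congr
  intro a b hab
  rw [dif_pos hab, tens, dif_pos (h.inv hab)]

/-- The tensor product of two sorts, taken at two terms of these sorts. -/
noncomputable def Ty (U : SortE A) (V : SortE B) (u : Expr A) (v : Expr B) : SortE (A.tensor B) :=
  ⟨(U.head, V.head), grid (tens σ τ) U.args (V.args ++ [v]) ++ V.args.map (tens σ τ u)⟩

/-- The tensor product of two precontexts. -/
noncomputable def tctx (X : PreCtx A) (Y : PreCtx B) : PreCtx (A.tensor B) :=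
  grid (fun p q => ((p.1, q.1), Ty σ τ p.2 q.2 (.var p.1) (.var q.1))) X Y

variable {σ τ} {X : PreCtx A} {Y : PreCtx B} {k l : ℕ}

theorem Arg.acc (hσ : Agree σ X) (hτ : Agree τ Y) {u : Expr A} {v : Expr B}
    (hu : Arg σ X k u) (hv : Arg τ Y l v) : Acc (ArgRel σ τ) (u, v) := by
  induction hs : k + l using Nat.strong_induction_on generalizing k l u v with
  | _ s ih =>
    subst hs
    constructor
    rintro ⟨a, b⟩ ⟨ha, hb⟩
    cases v with
    | app t p =>
      simp only [argsOf, List.mem_append, List.mem_singleton] at ha hb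
      obtain ⟨l', hl, hb⟩ := hv.args hτ hb
      rcases ha with ha | rfl
      · obtain ⟨k', hk, ha⟩ := hu.cs_args' hσ ha
        exact ih _ (by omega) ha hb rfl
      · exact ih _ (by omega) hu hb rfl
    | var y =>
      cases u with
      | var x => simp [argsOf] at ha
      | app s h =>
        simp only [argsOf, List.mem_append, List.mem_singleton] at ha hb
        obtain ⟨k', hk, ha⟩ := hu.args hσ ha
        rcases hb with hb | rfl
        · obtain ⟨l', hl, hb⟩ := hv.cs_args' hτ hb
          exact ih _ (by omega) ha hb rfl
        · exact ih _ (by omega) ha hv rfl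

theorem tens_var (σ : Env 𝔸) (τ : Env 𝔹) (x : A.Var) (y : B.Var) :
    tens σ τ (.var x) (.var y) = .var (x, y) := by
  apply tens_eq σ τ
  constructor
  rintro ⟨a, b⟩ ⟨ha, hb⟩
  simp [argsOf] at ha

theorem tens_app (hσ : Agree σ X) (hτ : Agree τ Y) {u : Expr A} {t : B.TermSym}
    {p : List (Expr B)} (hu : Arg σ X k u) (hv : Arg τ Y l (.app t p)) :
    tens σ τ u (.app t p) =
      .app (.inl ((cs σ u).head, t)) (grid (tens σ τ) ((cs σ u).args ++ [u]) p) := by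
  rw [tens_eq σ τ (hu.acc hσ hτ hv)]
  cases u <;> rfl

theorem tens_app_var (hσ : Agree σ X) (hτ : Agree τ Y) {s : A.TermSym} {h : List (Expr A)}
    {y : B.Var} (hu : Arg σ X k (.app s h)) (hv : Arg τ Y l (.var y)) :
    tens σ τ (.app s h) (.var y) =
      .app (.inr (s, (τ y).head)) (grid (tens σ τ) h ((τ y).args ++ [.var y])) :=
  tens_eq σ τ (hu.acc hσ hτ hv)

end Tens

end

section
variable {𝔸 : Thy A} {𝔹 : Thy B}

section TensGraph
variable {σ σ' : Env 𝔸} {τ τ' : Env 𝔹} {X : PreCtx A} {Y : PreCtx B} {k l : ℕ}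

theorem cs_agree (hσ : Agree σ X) (hσ' : Agree σ' X) {u : Expr A} {U : SortE A}
    (h : W 𝔸.ax k X (.tm u U)) : cs σ u = cs σ' u := by
  cases u with
  | var x =>
    obtain ⟨U₀, hU⟩ := h.var_mem
    exact (hσ _ hU).trans (hσ' _ hU).symm
  | app t es => rfl

theorem tens_fix (hσ : Agree σ X) (hσ' : Agree σ' X) (hτ : Agree τ Y) (hτ' : Agree τ' Y)
    {ρ : (A.tensor B).Var → Expr (A.tensor B)}
    (hρ : ∀ p ∈ X, ∀ q ∈ Y, ρ (p.1, q.1) = .var (p.1, q.1))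
    {a : Expr A} {b : Expr B} {U : SortE A} {V : SortE B}
    (ha : W 𝔸.ax k X (.tm a U)) (hb : W 𝔹.ax l Y (.tm b V)) :
    (tens σ' τ' a b).subst ρ = tens σ τ a b := by
  induction hs : k + l using Nat.strong_induction_on generalizing k l a b U V with
  | _ s ih =>
    subst hs
    cases b with
    | app t p =>
      rw [tens_app hσ hτ (ha.arg hσ) (hb.arg hτ), tens_app hσ' hτ' (ha.arg hσ') (hb.arg hτ'),
        subst_app, map_grid, cs_agree hσ' hσ ha]
      congr 1
      refine grid_congr fun a' ha' b' hb' => ?_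
      obtain ⟨l', V', hl, hb'⟩ := hb.args_app hb'
      simp only [List.mem_append, List.mem_singleton] at ha'
      rcases ha' with ha' | rfl
      · obtain ⟨k', U', hk, ha'⟩ := (ha.arg hσ).cs_args hσ ha'
        exact ih _ (by omega) ha' hb' rfl
      · exact ih _ (by omega) ha hb' rfl
    | var y =>
      obtain ⟨V₀, hV⟩ := hb.var_mem
      cases a with
      | var x =>
        obtain ⟨U₀, hU⟩ := ha.var_mem
        rw [tens_var, tens_var, subst_var]
        exact hρ _ hU _ hV
      | app s h =>
        rw [tens_app_var hσ hτ (ha.arg hσ) (hb.arg hτ),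
          tens_app_var hσ' hτ' (ha.arg hσ') (hb.arg hτ'), subst_app, map_grid]
        have e : τ' y = τ y := (hτ' _ hV).trans (hτ _ hV).symm
        rw [e]
        congr 1
        refine grid_congr fun a' ha' b' hb' => ?_
        obtain ⟨k', U', hk, ha'⟩ := ha.args_app ha'
        simp only [List.mem_append, List.mem_singleton] at hb'
        rcases hb' with hb' | rfl
        · obtain ⟨l', V', hl, hb'⟩ := (hb.arg hτ).cs_args hτ hb'
          exact ih _ (by omega) ha' hb' rfl
        · exact ih _ (by omega) ha' hb rfl

theorem tens_subst_left (hσ : Agree σ X) (hσ' : Agree σ' X) (hτ : Agree τ Y)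
    {ρ : (A.tensor B).Var → Expr (A.tensor B)}
    (hρ : ∀ p ∈ X, ∀ q ∈ Y, ρ (p.1, q.1) = .var (p.1, q.1))
    {u : Expr A} {x : A.Var} {U : SortE A}
    (hu : W 𝔸.ax k X (.tm u U)) (hx : σ' x = cs σ u)
    (hρx : ∀ q ∈ Y, ρ (x, q.1) = tens σ τ u (.var q.1))
    {v : Expr B} {V : SortE B} (hv : W 𝔹.ax l Y (.tm v V)) :
    (tens σ' τ (.var x) v).subst ρ = tens σ τ u v := by
  have hx' : Arg σ' X k (.var x) := .var (by rw [hx]; exact (hu.cs hσ).presup)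
  induction l using Nat.strong_induction_on generalizing v V with
  | _ l ih =>
    cases v with
    | var y =>
      obtain ⟨V₀, hV⟩ := hv.var_mem
      rw [tens_var, subst_var]
      exact hρx _ hV
    | app t p =>
      rw [tens_app hσ hτ (hu.arg hσ) (hv.arg hτ), tens_app hσ' hτ hx' (hv.arg hτ), subst_app,
        map_grid, cs_var, hx]
      congr 1
      rw [grid_append, grid_append, grid_singleton, grid_singleton]
      congr 1
      · refine grid_congr fun a ha b hb => ?_
        obtain ⟨k', U', hk, ha⟩ := (hu.arg hσ).cs_args hσ ha
        obtain ⟨l', V', hl, hb⟩ := hv.args_app hb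
        exact tens_fix hσ hσ' hτ hτ hρ ha hb
      · refine List.map_congr_left fun b hb => ?_
        obtain ⟨l', V', hl, hb⟩ := hv.args_app hb
        exact ih l' hl hb

theorem lookupV_pairsR_of_ne {x x' : A.Var} (h : x' ≠ x) (y : B.Var) (Y : PreCtx B)
    (g : ℕ → Expr (A.tensor B)) : lookupV (pairsR x Y g) (x', y) = .var (x', y) := by
  apply lookupV_of_notMem
  simp only [pairsR, List.map_map, List.mem_map, Function.comp_apply, not_exists, not_and]
  rintro j - e
  exact h (Prod.ext_iff.1 e).1.symm

theorem lookupV_pairsR {x : A.Var} {Y : PreCtx B} {g : ℕ → Expr (A.tensor B)}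
    {F : B.Var → Expr (A.tensor B)} (hg : ∀ j (hj : j < Y.length), g j = F Y[j].1)
    {q : B.Var × SortE B} (hq : q ∈ Y) : lookupV (pairsR x Y g) (x, q.1) = F q.1 := by
  apply lookupV_of_forall
  · simp only [pairsR, List.mem_map, forall_exists_index, and_imp, forall_apply_eq_imp_iff₂]
    rintro j - e
    rw [hg _ j.2]
    exact congrArg F (Prod.ext_iff.1 e).2
  · simp only [pairsR, List.map_map, List.mem_map, Function.comp_apply]
    obtain ⟨i, hi, rfl⟩ := List.getElem_of_mem hq
    exact ⟨⟨i, hi⟩, List.mem_finRange _, rfl⟩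

open Classical in
/-- An environment changed at one variable. -/
noncomputable def Env.set (σ : Env 𝔸) (x : A.Var) (U : SortE A) : Env 𝔸 :=
  fun x' => if x' = x then U else σ x'

theorem Env.set_self (σ : Env 𝔸) (x : A.Var) (U : SortE A) : σ.set x U x = U := by
  simp [Env.set]

theorem Env.set_of_ne (σ : Env 𝔸) {x x' : A.Var} (h : x' ≠ x) (U : SortE A) :
    σ.set x U x' = σ x' := by
  simp [Env.set, h]

theorem Agree.set (hσ : Agree σ X) {x : A.Var} (hx : ∀ p ∈ X, p.1 ≠ x) (U : SortE A) :
    Agree (σ.set x U) X := fun p hp => (σ.set_of_ne (hx p hp) U).trans (hσ p hp)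

theorem Agree.take (hσ : Agree σ X) (i : ℕ) : Agree σ (X.take i) :=
  fun p hp => hσ p (List.mem_of_mem_take hp)

theorem exists_fresh (X : PreCtx A) : ∃ x : A.Var, ∀ p ∈ X, p.1 ≠ x := by
  classical
  obtain ⟨x, hx⟩ := Infinite.exists_notMem_finset (X.map Prod.fst).toFinset
  refine ⟨x, fun p hp e => hx ?_⟩
  simp only [List.mem_toFinset, List.mem_map]
  exact ⟨p, hp, e⟩

theorem DCtx.take {Ax : Set (Judg A)} {X : PreCtx A} (h : DCtx Ax X) (i : ℕ) :
    DCtx Ax (X.take i) := by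
  rw [← List.take_append_drop i X] at h
  exact h.left

theorem DCtx.arg (hY : DCtx 𝔹.ax Y) (hτ : Agree τ Y) {j : ℕ} (hj : j < Y.length) :
    ∃ l, Arg τ (Y.take j) l (.var Y[j].1) := by
  have e : Y = Y.take j ++ Y[j] :: Y.drop (j + 1) := by simp
  obtain ⟨l, hl⟩ := hY.2 _ _ _ e
  refine ⟨l, .var ?_⟩
  rwa [hτ _ (List.getElem_mem hj)]

/-- The value of a term tensor product is the function `tens`. -/
theorem TTg.eq_tens {f : Bool} {a : TArg A} {b : TArg B} {e : Expr (A.tensor B)}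
    (h : TTg 𝔸.ax 𝔹.ax f a b e) (hf : f = false) {σ : Env 𝔸} {τ : Env 𝔹} {k l : ℕ}
    (hY : DCtx 𝔹.ax b.ctx) (hσ : Agree σ a.ctx) (hτ : Agree τ b.ctx)
    (ha : Arg σ a.ctx k a.tm) (hb : Arg τ b.ctx l b.tm)
    (hU : a.srt = cs σ a.tm ∨ ∃ y, b.tm = .var y) (hV : (∃ x, a.tm = .var x) ∨ ∀ y, b.tm = .var y → b.srt = τ y) :
    e = tens σ τ a.tm b.tm := by
  induction h generalizing σ τ k l with
  | varvar => exact (tens_var _ _ _ _).symm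
  | @varapp f X x S ss Y t ts V SS TSf hSS hTS M out hM hMx hout ihM ihMx =>
    have hU' : (⟨S, ss⟩ : SortE A) = σ x := by simpa using hU
    have hss : ∀ i (hi : i < ss.length), ∃ k' U, W 𝔸.ax k' X (.tm ss[i] U) := fun i hi => by
      obtain ⟨k', U, -, h⟩ := ha.cs_args hσ (a := ss[i])
        (by rw [cs_var, ← hU']; exact List.getElem_mem hi)
      exact ⟨k', U, h⟩
    have hts : ∀ j (hj : j < ts.length), ∃ l' V, W 𝔹.ax l' Y (.tm ts[j] V) := fun j hj => by
      cases hb with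
      | app hb =>
        obtain ⟨l', V, -, h⟩ := hb.args_app (List.getElem_mem hj)
        exact ⟨l', V, h⟩
    have hTS' : ∀ j (hj : j < ts.length), TSf j = cs τ ts[j] := fun j hj => by
      obtain ⟨l', V, h⟩ := hts j hj
      exact (canonSort_iff hτ h).1 (hTS j hj)
    rw [isGrid_iff (F := tens σ τ) (L := (cs σ (.var x)).args ++ [.var x]) (L' := ts)
      (by simp [← hU']) rfl] at hout
    · rw [hout, tens_app hσ hτ ha hb, cs_var, ← hU']
    · intro i j hi hj
      simp only [cs_var, ← hU', List.length_append, List.length_singleton] at hi ⊢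
      obtain ⟨l', V, hb'⟩ := hts j hj
      rcases Nat.lt_or_ge i ss.length with hi' | hi'
      · rw [List.getElem_append_left hi']
        obtain ⟨k', U, ha'⟩ := hss i hi'
        exact ihM i hi' j hj hf hY hσ hτ (ha'.arg hσ) (hb'.arg hτ)
          (.inl ((canonSort_iff hσ ha').1 (hSS i hi')))
          (.inr fun y hy => by simp only at hy ⊢; rw [hTS' j hj, hy, cs_var])
      · obtain rfl : i = ss.length := by omega
        simp only [List.getElem_concat_length]
        exact ihMx j hj hf hY hσ hτ ha (hb'.arg hτ) (.inl hU')
          (.inr fun y hy => by simp only at hy ⊢; rw [hTS' j hj, hy, cs_var])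
  | @appvar f X s ss U Y y T ts SS TSf hSS hTS M out hM hMy hout ihM ihMy =>
    have hV' : (⟨T, ts⟩ : SortE B) = τ y := by simpa using hV
    have hss : ∀ i (hi : i < ss.length), ∃ k' U, W 𝔸.ax k' X (.tm ss[i] U) := fun i hi => by
      cases ha with
      | app ha =>
        obtain ⟨l', V, -, h⟩ := ha.args_app (List.getElem_mem hi)
        exact ⟨l', V, h⟩
    have hts : ∀ j (hj : j < ts.length), ∃ l' V, W 𝔹.ax l' Y (.tm ts[j] V) := fun j hj => by
      obtain ⟨k', U, -, h⟩ := hb.cs_args hτ (a := ts[j])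
        (by rw [cs_var, ← hV']; exact List.getElem_mem hj)
      exact ⟨k', U, h⟩
    rw [isGrid_iff (F := tens σ τ) (L := ss) (L' := (τ y).args ++ [.var y])
      rfl (by simp [← hV'])] at hout
    · rw [hout, tens_app_var hσ hτ ha hb, ← hV']
    · intro i j hi hj
      simp only [← hV', List.length_append, List.length_singleton] at hj ⊢
      obtain ⟨k', U, ha'⟩ := hss i hi
      rcases Nat.lt_or_ge j ts.length with hj' | hj'
      · rw [List.getElem_append_left hj']
        obtain ⟨l', V, hb'⟩ := hts j hj'
        exact ihM i hi j hj' hf hY hσ hτ (ha'.arg hσ) (hb'.arg hτ)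
          (.inl ((canonSort_iff hσ ha').1 (hSS i hi)))
          (.inr fun y hy => by
            simp only at hy ⊢; rw [(canonSort_iff hτ hb').1 (hTS j hj'), hy, cs_var])
      · obtain rfl : j = ts.length := by omega
        simp only [List.getElem_concat_length]
        exact ihMy i hi hf hY hσ hτ (ha'.arg hσ) hb
          (.inl ((canonSort_iff hσ ha').1 (hSS i hi))) (.inr (by simpa using hV))
  | @appapp_base X s ss U Y t ts V x hx e0 h0 g hg ih0 ihg =>
    have hU' : U = cs σ (.app s ss) := by simpa using hU
    have hσ' : Agree (σ.set x U) X := hσ.set hx U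
    cases ha with
    | app ha =>
    cases hb with
    | app hb =>
    have hx' : Arg (σ.set x U) X k (.var x) :=
      .var (by rw [σ.set_self, hU']; exact (ha.cs hσ).presup)
    rw [ih0 hf hY hσ' hτ hx' (.app hb) (.inl (σ.set_self x U).symm) (.inl ⟨x, rfl⟩)]
    refine tens_subst_left hσ hσ' hτ ?_ ha (by rw [σ.set_self, hU']) ?_ hb
    · intro p hp q hq
      exact lookupV_pairsR_of_ne (hx p hp) _ _ _
    · intro q hq
      refine lookupV_pairsR (F := fun y => tens σ τ (.app s ss) (.var y)) ?_ hq
      intro j hj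
      obtain ⟨l', hl'⟩ := DCtx.arg hY hτ hj
      exact ihg j hj hf (DCtx.take hY j) hσ (hτ.take j) (.app ha) hl' (.inr ⟨_, rfl⟩)
        (.inr fun y hy => by
          simp only [Expr.var.injEq] at hy
          rw [← hy]; exact (hτ _ (List.getElem_mem hj)).symm)
  | appapp_star => cases hf

theorem tens_graph {σ : Env 𝔸} {τ : Env 𝔹} {k l : ℕ}
    (hY : DCtx 𝔹.ax Y) (hσ : Agree σ X) (hτ : Agree τ Y) {u : Expr A} {v : Expr B}
    (ha : Arg σ X k u) (hb : Arg τ Y l v) {U : SortE A} {V : SortE B}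
    (hU : U = cs σ u ∨ ∃ y, v = .var y) (hV : (∃ x, u = .var x) ∨ ∀ y, v = .var y → V = τ y) :
    TTg 𝔸.ax 𝔹.ax false ⟨X, u, U⟩ ⟨Y, v, V⟩ (tens σ τ u v) := by
  induction hN : Y.length using Nat.strong_induction_on
    generalizing σ X Y k l u v U V with
  | _ N ihY =>
  subst hN
  induction hs : k + l using Nat.strong_induction_on generalizing σ k l u v U V with
  | _ s ih =>
    subst hs
    have app_args : ∀ {t ts}, Arg τ Y l (.app t ts) → ∀ j (hj : j < ts.length),
        ∃ l' V, l' < l ∧ W 𝔹.ax l' Y (.tm ts[j] V) := fun {t ts} hb j hj => by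
      cases hb with
      | app hb => exact hb.args_app (List.getElem_mem hj)
    have hvar : ∀ {σ : Env 𝔸} {x : A.Var} {t ts V}, Agree σ X → Arg σ X k (.var x) →
        Arg τ Y l (.app t ts) →
        TTg 𝔸.ax 𝔹.ax false ⟨X, .var x, σ x⟩ ⟨Y, .app t ts, V⟩ (tens σ τ (.var x) (.app t ts)) := by
      intro σ x t ts V hσ ha hb
      rw [tens_app hσ hτ ha hb, cs_var]
      have hargs := fun i hi => ha.cs_args hσ (List.getElem_mem (l := (cs σ (.var x)).args) (n := i) hi)
      rw [cs_var] at hargs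
      generalize hS : σ x = S at hargs ⊢
      obtain ⟨S, ss⟩ := S
      refine .varapp (fun i => if h : i < ss.length then cs σ ss[i] else ⟨S, ss⟩)
        (fun j => if h : j < ts.length then cs τ ts[j] else V) ?_ ?_
        (fun i j => if h : j < ts.length then
          tens σ τ (if h : i < ss.length then ss[i] else .var x) ts[j] else .var (x, Classical.arbitrary _))
        _ ?_ ?_ ((isGrid_iff (by simp) rfl ?_).2 rfl)
      · intro i hi
        obtain ⟨k', U', -, h⟩ := hargs i hi
        simp only [dif_pos hi]
        exact (canonSort_iff hσ h).2 rfl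
      · intro j hj
        obtain ⟨l', V', -, h⟩ := app_args hb j hj
        simp only [dif_pos hj]
        exact (canonSort_iff hτ h).2 rfl
      · intro i hi j hj
        obtain ⟨k', U', hk, h⟩ := hargs i hi
        obtain ⟨l', V', hl, h'⟩ := app_args hb j hj
        simp only [dif_pos hi, dif_pos hj]
        exact ih _ (by omega) hσ (h.arg hσ) (h'.arg hτ) (.inl rfl)
          (.inr fun y hy => by rw [hy, cs_var]) rfl
      · intro j hj
        obtain ⟨l', V', hl, h'⟩ := app_args hb j hj
        simp only [dif_pos hj, lt_irrefl, dite_false]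
        exact ih _ (by omega) hσ ha (h'.arg hτ) (.inl hS.symm) (.inr fun y hy => by rw [hy, cs_var]) rfl
      · intro i j hi hj
        simp only [dif_pos hj, List.getElem_append, List.getElem_singleton]
    cases v with
    | var y =>
      cases u with
      | var x => rw [tens_var]; exact .varvar
      | app s ss =>
        obtain rfl : V = τ y := by simpa using hV
        rw [tens_app_var hσ hτ ha hb]
        have hargs := fun i hi => hb.cs_args hτ (List.getElem_mem (l := (cs τ (.var y)).args) (n := i) hi)
        have hargs' : ∀ i (hi : i < ss.length), ∃ k' U, k' < k ∧ W 𝔸.ax k' X (.tm ss[i] U) :=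
          fun i hi => by cases ha with
            | app ha => exact ha.args_app (List.getElem_mem hi)
        rw [cs_var] at hargs
        generalize hS : τ y = S at hargs ⊢
        obtain ⟨T, ts⟩ := S
        refine .appvar (fun i => if h : i < ss.length then cs σ ss[i] else U)
          (fun j => if h : j < ts.length then cs τ ts[j] else ⟨T, ts⟩) ?_ ?_
          (fun i j => if h : i < ss.length then
            tens σ τ ss[i] (if h : j < ts.length then ts[j] else .var y) else
              .var (Classical.arbitrary _, y))
          _ ?_ ?_ ((isGrid_iff rfl (by simp) ?_).2 rfl)
        · intro i hi
          obtain ⟨k', U', -, h⟩ := hargs' i hi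
          simp only [dif_pos hi]
          exact (canonSort_iff hσ h).2 rfl
        · intro j hj
          obtain ⟨l', V', -, h⟩ := hargs j hj
          simp only [dif_pos hj]
          exact (canonSort_iff hτ h).2 rfl
        · intro i hi j hj
          obtain ⟨k', U', hk, h⟩ := hargs' i hi
          obtain ⟨l', V', hl, h'⟩ := hargs j hj
          simp only [dif_pos hi, dif_pos hj]
          exact ih _ (by omega) hσ (h.arg hσ) (h'.arg hτ) (.inl rfl)
            (.inr fun y hy => by rw [hy, cs_var]) rfl
        · intro i hi
          obtain ⟨k', U', hk, h⟩ := hargs' i hi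
          simp only [dif_pos hi, lt_irrefl, dite_false]
          exact ih _ (by omega) hσ (h.arg hσ) hb (.inl rfl)
            (.inr fun y' hy => by cases hy; exact hS.symm) rfl
        · intro i j hi hj
          simp only [dif_pos hi, List.getElem_append, List.getElem_singleton]
    | app t ts =>
      obtain rfl : U = cs σ u := by simpa using hU
      cases u with
      | var x => exact hvar hσ ha hb
      | app s ss =>
        obtain ⟨x, hx⟩ := exists_fresh X
        have hσ' := hσ.set hx (cs σ (.app s ss))
        cases ha with
        | app ha =>
        cases hb with
        | app hb =>
        have hx' : Arg (σ.set x (cs σ (.app s ss))) X k (.var x) :=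
          .var (by rw [σ.set_self]; exact (ha.cs hσ).presup)
        have h0 := hvar (V := V) hσ' hx' (.app hb)
        have := TTg.appapp_base (s := s) (ss := ss) (U := cs σ (.app s ss)) hx _
          (by rw [σ.set_self] at h0; exact h0)
          (fun j => if h : j < Y.length then tens σ τ (.app s ss) (.var Y[j].1)
            else .var (x, Classical.arbitrary _)) (fun j hj => by
              simp only [dif_pos hj]
              obtain ⟨l', hl'⟩ := hY.arg hτ hj
              refine ihY _ ?_ (hY.take j) hσ (hτ.take j) (.app ha) hl' (.inr ⟨_, rfl⟩) (.inr ?_) rfl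
              · simp [hj]
              · intro y hy
                cases hy
                exact (hτ _ (List.getElem_mem hj)).symm)
        convert this using 1
        symm
        refine tens_subst_left hσ hσ' hτ ?_ ha (by rw [σ.set_self]) ?_ hb
        · intro p hp q hq
          exact lookupV_pairsR_of_ne (hx p hp) _ _ _
        · intro q hq
          refine lookupV_pairsR (F := fun y => tens σ τ (.app s ss) (.var y)) ?_ hq
          intro j hj
          simp [hj]

theorem TTg_iff {σ : Env 𝔸} {τ : Env 𝔹} {k l : ℕ}
    (hY : DCtx 𝔹.ax Y) (hσ : Agree σ X) (hτ : Agree τ Y) {u : Expr A} {v : Expr B}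
    (ha : Arg σ X k u) (hb : Arg τ Y l v) {U : SortE A} {V : SortE B}
    (hU : U = cs σ u ∨ ∃ y, v = .var y) (hV : (∃ x, u = .var x) ∨ ∀ y, v = .var y → V = τ y)
    {e : Expr (A.tensor B)} :
    TTg 𝔸.ax 𝔹.ax false ⟨X, u, U⟩ ⟨Y, v, V⟩ e ↔ e = tens σ τ u v := by
  constructor
  · intro h
    exact h.eq_tens rfl hY hσ hτ ha hb hU hV
  · rintro rfl
    exact tens_graph hY hσ hτ ha hb hU hV

end TensGraph

end

section
variable {𝔸 : Thy A} {𝔹 : Thy B}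

section Axioms
variable {σ : Env 𝔸} {τ : Env 𝔹} {X : PreCtx A} {Y : PreCtx B} {U U' : SortE A} {V V' : SortE B}
  {x : A.Var} {y : B.Var}

/-- `x` is a fresh variable whose sort `U` is a sort over the context `X`. -/
structure Pt (σ : Env 𝔸) (X : PreCtx A) (x : A.Var) (U : SortE A) : Prop where
  ctx : DCtx 𝔸.ax X
  so : Dv 𝔸.ax X (.so U)
  agree : Agree σ X
  sort : σ x = U
  fresh : ∀ p ∈ X, p.1 ≠ x

theorem Pt.arg (h : Pt σ X x U) : ∃ k, Arg σ X k (.var x) := by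
  obtain ⟨k, hk⟩ := h.so
  exact ⟨k, .var (by rwa [h.sort])⟩

theorem Pt.concat (h : Pt σ X x U) : DCtx 𝔸.ax (X ++ [(x, U)]) := h.ctx.concat h.fresh h.so

theorem Pt.agree_concat (h : Pt σ X x U) : Agree σ (X ++ [(x, U)]) := by
  intro p hp
  simp only [List.mem_append, List.mem_singleton] at hp
  rcases hp with hp | rfl
  · exact h.agree p hp
  · exact h.sort

theorem Pt.set (h : Pt σ X x U) (hU' : Dv 𝔸.ax X (.so U')) : Pt (σ.set x U') X x U' :=
  ⟨h.ctx, hU', h.agree.set h.fresh _, σ.set_self _ _, h.fresh⟩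

theorem DCtx.pt (h : DCtx 𝔸.ax X) (hσ : Agree σ X) {i : ℕ} (hi : i < X.length) :
    Pt σ (X.take i) X[i].1 X[i].2 := by
  have e : X = X.take i ++ X[i] :: X.drop (i + 1) := by simp
  refine ⟨h.take i, h.2 _ _ _ e, hσ.take i, hσ _ (List.getElem_mem hi), fun p hp he => ?_⟩
  have nd := h.1
  rw [e, List.map_append, List.nodup_append] at nd
  exact nd.2.2 _ (List.mem_map_of_mem hp) _ List.mem_cons_self he

theorem dropLast_grid {α β γ : Type} (F : α → β → γ) (L : List α) (a : α) (L' : List β) (b : β) :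
    (grid F (L ++ [a]) (L' ++ [b])).dropLast = grid F L (L' ++ [b]) ++ L'.map (F a) := by
  rw [grid_append, grid_singleton, List.map_append, ← List.append_assoc]
  simp

theorem TSo_iff (hx : Pt σ X x U) (hy : Pt τ Y y V) {T : SortE (A.tensor B)} :
    TSo 𝔸.ax 𝔹.ax false X x U Y y V T ↔ T = Ty σ τ U V (.var x) (.var y) := by
  obtain ⟨k, hX⟩ := hx.arg
  obtain ⟨l, hY⟩ := hy.arg
  have hss : ∀ i (hi : i < U.args.length), ∃ k' U', W 𝔸.ax k' X (.tm U.args[i] U') := fun i hi => by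
    obtain ⟨k', U', -, h⟩ := hX.cs_args hx.agree (a := U.args[i])
      (by rw [cs_var, hx.sort]; exact List.getElem_mem hi)
    exact ⟨k', U', h⟩
  have hts : ∀ j (hj : j < V.args.length), ∃ k' V', W 𝔹.ax k' Y (.tm V.args[j] V') := fun j hj => by
    obtain ⟨k', U', -, h⟩ := hY.cs_args hy.agree (a := V.args[j])
      (by rw [cs_var, hy.sort]; exact List.getElem_mem hj)
    exact ⟨k', U', h⟩
  have hgr : ∀ i (hi : i < U.args.length) j (hj : j < V.args.length) (e : Expr (A.tensor B)),
      TTg 𝔸.ax 𝔹.ax false ⟨X, U.args[i], cs σ U.args[i]⟩ ⟨Y, V.args[j], cs τ V.args[j]⟩ e ↔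
        e = tens σ τ U.args[i] V.args[j] := fun i hi j hj e => by
    obtain ⟨k', U', h⟩ := hss i hi
    obtain ⟨l', V', h'⟩ := hts j hj
    exact TTg_iff hy.ctx hx.agree hy.agree (h.arg hx.agree) (h'.arg hy.agree) (.inl rfl)
      (.inr fun y e => by rw [e, cs_var])
  have hgx : ∀ j (hj : j < V.args.length) (e : Expr (A.tensor B)),
      TTg 𝔸.ax 𝔹.ax false ⟨X, .var x, U⟩ ⟨Y, V.args[j], cs τ V.args[j]⟩ e ↔
        e = tens σ τ (.var x) V.args[j] := fun j hj e => by
    obtain ⟨l', V', h'⟩ := hts j hj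
    exact TTg_iff hy.ctx hx.agree hy.agree hX (h'.arg hy.agree) (.inl hx.sort.symm) (.inl ⟨x, rfl⟩)
  have hgy : ∀ i (hi : i < U.args.length) (e : Expr (A.tensor B)),
      TTg 𝔸.ax 𝔹.ax false ⟨X, U.args[i], cs σ U.args[i]⟩ ⟨Y, .var y, V⟩ e ↔
        e = tens σ τ U.args[i] (.var y) := fun i hi e => by
    obtain ⟨k', U', h⟩ := hss i hi
    exact TTg_iff hy.ctx hx.agree hy.agree (h.arg hx.agree) hY (.inr ⟨y, rfl⟩)
      (.inr fun y e => by cases e; exact hy.sort.symm)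
  have hcA : ∀ i (hi : i < U.args.length) T, CanonSort 𝔸.ax X U.args[i] T ↔ T = cs σ U.args[i] :=
    fun i hi T => by
      obtain ⟨k', U', h⟩ := hss i hi
      exact canonSort_iff hx.agree h
  have hcB : ∀ j (hj : j < V.args.length) T, CanonSort 𝔹.ax Y V.args[j] T ↔ T = cs τ V.args[j] :=
    fun i hi T => by
      obtain ⟨k', U', h⟩ := hts i hi
      exact canonSort_iff hy.agree h
  constructor
  · intro h
    cases h with
    | @mk S ss _ _ T ts hfx hfy SS TSf hSS hTS M out hM hMx hMy hout =>
    simp only at hss hts hgr hgx hgy hcA hcB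
    rw [isGrid_iff (F := M) (L := List.range ss.length ++ [ss.length])
      (L' := List.range ts.length ++ [ts.length]) (by simp) (by simp)
      (by intro i j hi hj; simp [List.getElem_append] at hi hj ⊢; grind)] at hout
    rw [hout, dropLast_grid, Ty]
    simp only
    congr 2
    · refine (isGrid_iff rfl (by simp) ?_).1 ((isGrid_iff (M := M) (m := ss.length)
        (n := ts.length + 1) (by simp) (by simp)
        (by intro i j hi hj; simp [List.getElem_append] at hi hj ⊢; grind)).2 rfl)
      intro i j hi hj
      simp only [List.length_append, List.length_singleton] at hj
      rcases Nat.lt_or_ge j ts.length with hj' | hj'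
      · rw [List.getElem_append_left hj']
        have := hM i hi j hj'
        rwa [(hcA i hi _).1 (hSS i hi), (hcB j hj' _).1 (hTS j hj'), hgr i hi j hj'] at this
      · obtain rfl : j = ts.length := by omega
        rw [List.getElem_concat_length rfl]
        have := hMy i hi
        rwa [(hcA i hi _).1 (hSS i hi), hgy i hi] at this
    · apply List.ext_getElem (by simp)
      intro j hj hj'
      simp only [List.length_map] at hj'
      have := hMx j hj'
      rw [(hcB j hj' _).1 (hTS j hj'), hgx j hj'] at this
      simpa using this
  · rintro rfl
    obtain ⟨S, ss⟩ := U
    obtain ⟨T, ts⟩ := V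
    simp only at hss hts hgr hgx hgy hcA hcB
    rw [Ty, ← dropLast_grid]
    refine .mk hx.fresh hy.fresh (fun i => if h : i < ss.length then cs σ ss[i] else ⟨S, ss⟩)
      (fun j => if h : j < ts.length then cs τ ts[j] else ⟨T, ts⟩) ?_ ?_
      (fun i j => tens σ τ (if h : i < ss.length then ss[i] else .var x)
        (if h : j < ts.length then ts[j] else .var y)) _ ?_ ?_ ?_
        ((isGrid_iff (by simp) (by simp) ?_).2 rfl)
    · intro i hi
      rw [dif_pos hi, hcA i hi]
    · intro i hi
      rw [dif_pos hi, hcB i hi]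
    · intro i hi j hj
      simp only [dif_pos hi, dif_pos hj]
      rw [hgr i hi j hj]
    · intro j hj
      simp only [dif_pos hj, lt_irrefl, dite_false]
      rw [hgx j hj]
    · intro i hi
      simp only [dif_pos hi, lt_irrefl, dite_false]
      rw [hgy i hi]
    · intro i j hi hj
      simp only [List.getElem_append, List.getElem_singleton]

theorem TCtx_iff (hX : DCtx 𝔸.ax X) (hY : DCtx 𝔹.ax Y) (hσ : Agree σ X) (hτ : Agree τ Y)
    {Z : PreCtx (A.tensor B)} : TCtx 𝔸.ax 𝔹.ax false X Y Z ↔ Z = tctx σ τ X Y := by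
  have key : ∀ i j (hi : i < X.length) (hj : j < Y.length) (r : (A.tensor B).Var × SortE (A.tensor B)),
      (r.1 = (X[i].1, Y[j].1) ∧ TSo 𝔸.ax 𝔹.ax false (X.take i) X[i].1 X[i].2
        (Y.take j) Y[j].1 Y[j].2 r.2) ↔
      r = ((X[i].1, Y[j].1), Ty σ τ X[i].2 Y[j].2 (.var X[i].1) (.var Y[j].1)) := by
    intro i j hi hj r
    rw [TSo_iff (hX.pt hσ hi) (hY.pt hτ hj)]
    exact ⟨fun h => Prod.ext h.1 h.2, fun h => ⟨congrArg Prod.fst h, congrArg Prod.snd h⟩⟩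
  constructor
  · rintro ⟨hl, h⟩
    exact grid_ext hl fun i j hi hj h' => (key i j hi hj _).1 (h i j hi hj h')
  · rintro rfl
    refine ⟨length_grid _ _ _, fun i j hi hj h => ?_⟩
    rw [key]
    exact getElem_grid _ _ _ hi hj h

/-- The substitution of the tensor products `xᵢ ⊗ v` for the variables `(xᵢ, y)`. -/
noncomputable def pL (σ : Env 𝔸) (τ : Env 𝔹) (X : PreCtx A) (y : B.Var) (v : Expr B) :
    List ((A.tensor B).Var × Expr (A.tensor B)) :=
  X.map fun p => ((p.1, y), tens σ τ (.var p.1) v)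

/-- The substitution of the tensor products `u ⊗ yⱼ` for the variables `(x, yⱼ)`. -/
noncomputable def pR (σ : Env 𝔸) (τ : Env 𝔹) (x : A.Var) (Y : PreCtx B) (u : Expr A) :
    List ((A.tensor B).Var × Expr (A.tensor B)) :=
  Y.map fun q => ((x, q.1), tens σ τ u (.var q.1))

theorem pairsL_eq {v : Expr B} {g : ℕ → Expr (A.tensor B)}
    (h : ∀ i (hi : i < X.length), g i = tens σ τ (.var X[i].1) v) :
    pairsL X y g = pL σ τ X y v := by
  apply List.ext_getElem (by simp [pairsL, pL])
  intro i hi hi'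
  simp [pairsL, pL, h i (by simpa [pL] using hi')]

theorem pairsR_eq {u : Expr A} {g : ℕ → Expr (A.tensor B)}
    (h : ∀ j (hj : j < Y.length), g j = tens σ τ u (.var Y[j].1)) :
    pairsR x Y g = pR σ τ x Y u := by
  apply List.ext_getElem (by simp [pairsR, pR])
  intro i hi hi'
  simp [pairsR, pR, h i (by simpa [pR] using hi')]

theorem exists_seq {n : ℕ} (f : ∀ i, i < n → Expr A) : ∃ g : ℕ → Expr A, ∀ i (h : i < n), g i = f i h :=
  ⟨fun i => if h : i < n then f i h else .var (Classical.arbitrary _), fun i h => by simp [h]⟩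

theorem TTg_var_left_iff (hX : DCtx 𝔸.ax X) (hY : DCtx 𝔹.ax Y) (hσ : Agree σ X) (hτ : Agree τ Y)
    {l : ℕ} {v : Expr B} (hv : Arg τ Y l v) {i : ℕ} (hi : i < X.length) {e : Expr (A.tensor B)} :
    TTg 𝔸.ax 𝔹.ax false ⟨X.take i, .var X[i].1, X[i].2⟩ ⟨Y, v, V⟩ e ↔
      e = tens σ τ (.var X[i].1) v := by
  have h := hX.pt hσ hi
  obtain ⟨k, hk⟩ := h.arg
  exact TTg_iff hY h.agree hτ hk hv (.inl h.sort.symm) (.inl ⟨_, rfl⟩)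

theorem TTg_var_right_iff (hY : DCtx 𝔹.ax Y) (hσ : Agree σ X) (hτ : Agree τ Y)
    {k : ℕ} {u : Expr A} (hu : Arg σ X k u) {j : ℕ} (hj : j < Y.length) {e : Expr (A.tensor B)} :
    TTg 𝔸.ax 𝔹.ax false ⟨X, u, U⟩ ⟨Y.take j, .var Y[j].1, Y[j].2⟩ e ↔
      e = tens σ τ u (.var Y[j].1) := by
  have h := hY.pt hτ hj
  obtain ⟨l, hl⟩ := h.arg
  exact TTg_iff h.ctx hσ h.agree hu hl (.inr ⟨_, rfl⟩) (.inr fun y e => by cases e; exact h.sort.symm)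

end Axioms

end

section
variable {𝔸 : Thy A} {𝔹 : Thy B}

/-! ### The axioms of the tensor theory -/

/-- A choice of fresh variables for the contexts of two theories. -/
structure Ch (𝔸 : Thy A) (𝔹 : Thy B) where
  a : PreCtx A → A.Var
  b : PreCtx B → B.Var
  fresh_a : FreshCh a
  fresh_b : FreshCh b

/-- The axioms of the tensor theory. -/
abbrev Ch.T (c : Ch 𝔸 𝔹) : Set (Judg (A.tensor B)) := tensorAx 𝔸.ax 𝔹.ax c.a c.b

section Membership
variable {σ : Env 𝔸} {τ : Env 𝔹} {X : PreCtx A} {Y : PreCtx B} {U U' : SortE A} {V V' : SortE B}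
  {x : A.Var} {y : B.Var} {u u' : Expr A} {v v' : Expr B} {k k' l l' : ℕ}
  (c : Ch 𝔸 𝔹)

theorem Pt.tctx_iff (hx : Pt σ X x U) (hy : Pt τ Y y V) {Z : PreCtx (A.tensor B)} :
    TCtx 𝔸.ax 𝔹.ax false (X ++ [(x, U)]) (Y ++ [(y, V)]) Z ↔
      Z = tctx σ τ (X ++ [(x, U)]) (Y ++ [(y, V)]) :=
  TCtx_iff hx.concat hy.concat hx.agree_concat hy.agree_concat

theorem Pt.tctx_left_iff (hx : Pt σ X x U) (hy : DCtx 𝔹.ax Y) (hτ : Agree τ Y)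
    {Z : PreCtx (A.tensor B)} :
    TCtx 𝔸.ax 𝔹.ax false (X ++ [(x, U)]) Y Z ↔ Z = tctx σ τ (X ++ [(x, U)]) Y :=
  TCtx_iff hx.concat hy hx.agree_concat hτ

theorem Pt.tctx_right_iff (hx : DCtx 𝔸.ax X) (hσ : Agree σ X) (hy : Pt τ Y y V)
    {Z : PreCtx (A.tensor B)} :
    TCtx 𝔸.ax 𝔹.ax false X (Y ++ [(y, V)]) Z ↔ Z = tctx σ τ X (Y ++ [(y, V)]) :=
  TCtx_iff hx hy.concat hσ hy.agree_concat

theorem Pt.tTg_left_iff (hx : Pt σ X x U) (hy : Pt τ Y y V) (hv : Arg τ Y l v)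
    {e : Expr (A.tensor B)} :
    TTg 𝔸.ax 𝔹.ax false ⟨X, .var x, U⟩ ⟨Y, v, V⟩ e ↔ e = tens σ τ (.var x) v := by
  obtain ⟨k, hk⟩ := hx.arg
  exact TTg_iff hy.ctx hx.agree hy.agree hk hv (.inl hx.sort.symm) (.inl ⟨_, rfl⟩)

theorem Pt.tTg_right_iff (hx : Pt σ X x U) (hy : Pt τ Y y V) (hu : Arg σ X k u)
    {e : Expr (A.tensor B)} :
    TTg 𝔸.ax 𝔹.ax false ⟨X, u, U⟩ ⟨Y, .var y, V⟩ e ↔ e = tens σ τ u (.var y) := by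
  obtain ⟨l, hl⟩ := hy.arg
  exact TTg_iff hy.ctx hx.agree hy.agree hu hl (.inr ⟨_, rfl⟩)
    (.inr fun y e => by cases e; exact hy.sort.symm)

theorem exists_TTg_left (hX : DCtx 𝔸.ax X) (hY : DCtx 𝔹.ax Y) (hσ : Agree σ X) (hτ : Agree τ Y)
    (hv : Arg τ Y l v) (y : B.Var) (V : SortE B) : ∃ g, (∀ i (hi : i < X.length),
      TTg 𝔸.ax 𝔹.ax false ⟨X.take i, .var X[i].1, X[i].2⟩ ⟨Y, v, V⟩ (g i)) ∧
        pairsL X y g = pL σ τ X y v := by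
  obtain ⟨g, hg⟩ := exists_seq fun i (hi : i < X.length) => tens σ τ (.var X[i].1) v
  exact ⟨g, fun i hi => (TTg_var_left_iff hX hY hσ hτ hv hi).2 (hg i hi), pairsL_eq hg⟩

theorem exists_TTg_right (hY : DCtx 𝔹.ax Y) (hσ : Agree σ X) (hτ : Agree τ Y)
    (hu : Arg σ X k u) (x : A.Var) (U : SortE A) : ∃ g, (∀ j (hj : j < Y.length),
      TTg 𝔸.ax 𝔹.ax false ⟨X, u, U⟩ ⟨Y.take j, .var Y[j].1, Y[j].2⟩ (g j)) ∧
        pairsR x Y g = pR σ τ x Y u := by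
  obtain ⟨g, hg⟩ := exists_seq fun j (hj : j < Y.length) => tens σ τ u (.var Y[j].1)
  exact ⟨g, fun j hj => (TTg_var_right_iff hY hσ hτ hu hj).2 (hg j hj), pairsR_eq hg⟩

theorem mem_ss (hU : Judg.sort X U ∈ 𝔸.ax) (hV : Judg.sort Y V ∈ 𝔹.ax) (hx : Pt σ X (c.a X) U)
    (hy : Pt τ Y (c.b Y) V) :
    Judg.sort (tctx σ τ (X ++ [(c.a X, U)]) (Y ++ [(c.b Y, V)])).dropLast
      (Ty σ τ U V (.var (c.a X)) (.var (c.b Y))) ∈ c.T :=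
  ⟨_, _, hU, hV, .ss ((hx.tctx_iff hy).2 rfl) ((TSo_iff hx hy).2 rfl)⟩

theorem mem_sseq (hU : Judg.sort X U ∈ 𝔸.ax) (hV : Judg.sortEq Y V V' ∈ 𝔹.ax)
    (hx : Pt σ X (c.a X) U) (hy : Pt τ Y (c.b Y) V) (hV' : Dv 𝔹.ax Y (.so V')) :
    Judg.sortEq (tctx σ τ (X ++ [(c.a X, U)]) (Y ++ [(c.b Y, V)])).dropLast
      (Ty σ τ U V (.var (c.a X)) (.var (c.b Y)))
      (Ty σ (τ.set (c.b Y) V') U V' (.var (c.a X)) (.var (c.b Y))) ∈ c.T :=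
  ⟨_, _, hU, hV, .sseq ((hx.tctx_iff hy).2 rfl) ((TSo_iff hx hy).2 rfl)
    ((TSo_iff hx (hy.set hV')).2 rfl)⟩

theorem mem_seqs (hU : Judg.sortEq X U U' ∈ 𝔸.ax) (hV : Judg.sort Y V ∈ 𝔹.ax)
    (hx : Pt σ X (c.a X) U) (hy : Pt τ Y (c.b Y) V) (hU' : Dv 𝔸.ax X (.so U')) :
    Judg.sortEq (tctx σ τ (X ++ [(c.a X, U)]) (Y ++ [(c.b Y, V)])).dropLast
      (Ty σ τ U V (.var (c.a X)) (.var (c.b Y)))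
      (Ty (σ.set (c.a X) U') τ U' V (.var (c.a X)) (.var (c.b Y))) ∈ c.T :=
  ⟨_, _, hU, hV, .seqs ((hx.tctx_iff hy).2 rfl) ((TSo_iff hx hy).2 rfl)
    ((TSo_iff (hx.set hU') hy).2 rfl)⟩

theorem mem_st (hU : Judg.sort X U ∈ 𝔸.ax) (hV : Judg.term Y v V ∈ 𝔹.ax)
    (hx : Pt σ X (c.a X) U) (hy : Pt τ Y (c.b Y) V) (hv : Arg τ Y l v) :
    Judg.term (tctx σ τ (X ++ [(c.a X, U)]) Y) (tens σ τ (.var (c.a X)) v)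
      ((Ty σ τ U V (.var (c.a X)) (.var (c.b Y))).substL (pL σ τ X (c.b Y) v)) ∈ c.T := by
  obtain ⟨g, hg, e⟩ := exists_TTg_left hx.ctx hy.ctx hx.agree hy.agree hv (c.b Y) V
  rw [← e]
  exact ⟨_, _, hU, hV, .st ((hx.tctx_left_iff hy.ctx hy.agree).2 rfl)
    ((hx.tTg_left_iff hy hv).2 rfl) ((TSo_iff hx hy).2 rfl) hg⟩

theorem mem_ts (hU : Judg.term X u U ∈ 𝔸.ax) (hV : Judg.sort Y V ∈ 𝔹.ax)
    (hx : Pt σ X (c.a X) U) (hy : Pt τ Y (c.b Y) V) (hu : Arg σ X k u) :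
    Judg.term (tctx σ τ X (Y ++ [(c.b Y, V)])) (tens σ τ u (.var (c.b Y)))
      ((Ty σ τ U V (.var (c.a X)) (.var (c.b Y))).substL (pR σ τ (c.a X) Y u)) ∈ c.T := by
  obtain ⟨g, hg, e⟩ := exists_TTg_right hy.ctx hx.agree hy.agree hu (c.a X) U
  rw [← e]
  exact ⟨_, _, hU, hV, .ts ((Pt.tctx_right_iff hx.ctx hx.agree hy).2 rfl)
    ((hx.tTg_right_iff hy hu).2 rfl) ((TSo_iff hx hy).2 rfl) hg⟩

theorem mem_steq (hU : Judg.sort X U ∈ 𝔸.ax) (hV : Judg.termEq Y v v' V ∈ 𝔹.ax)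
    (hx : Pt σ X (c.a X) U) (hy : Pt τ Y (c.b Y) V) (hv : Arg τ Y l v) (hv' : Arg τ Y l' v') :
    Judg.termEq (tctx σ τ (X ++ [(c.a X, U)]) Y) (tens σ τ (.var (c.a X)) v)
      (tens σ τ (.var (c.a X)) v')
      ((Ty σ τ U V (.var (c.a X)) (.var (c.b Y))).substL (pL σ τ X (c.b Y) v)) ∈ c.T := by
  obtain ⟨g, hg, e⟩ := exists_TTg_left hx.ctx hy.ctx hx.agree hy.agree hv (c.b Y) V
  rw [← e]
  exact ⟨_, _, hU, hV, .steq ((hx.tctx_left_iff hy.ctx hy.agree).2 rfl)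
    ((hx.tTg_left_iff hy hv).2 rfl) ((hx.tTg_left_iff hy hv').2 rfl) ((TSo_iff hx hy).2 rfl) hg⟩

theorem mem_teqs (hU : Judg.termEq X u u' U ∈ 𝔸.ax) (hV : Judg.sort Y V ∈ 𝔹.ax)
    (hx : Pt σ X (c.a X) U) (hy : Pt τ Y (c.b Y) V) (hu : Arg σ X k u) (hu' : Arg σ X k' u') :
    Judg.termEq (tctx σ τ X (Y ++ [(c.b Y, V)])) (tens σ τ u (.var (c.b Y)))
      (tens σ τ u' (.var (c.b Y)))
      ((Ty σ τ U V (.var (c.a X)) (.var (c.b Y))).substL (pR σ τ (c.a X) Y u)) ∈ c.T := by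
  obtain ⟨g, hg, e⟩ := exists_TTg_right hy.ctx hx.agree hy.agree hu (c.a X) U
  rw [← e]
  exact ⟨_, _, hU, hV, .teqs ((Pt.tctx_right_iff hx.ctx hx.agree hy).2 rfl)
    ((hx.tTg_right_iff hy hu).2 rfl) ((hx.tTg_right_iff hy hu').2 rfl) ((TSo_iff hx hy).2 rfl) hg⟩

theorem mem_seqt (hU : Judg.sortEq X U U' ∈ 𝔸.ax) (hV : Judg.term Y v V ∈ 𝔹.ax)
    (hx : Pt σ X (c.a X) U) (hy : Pt τ Y (c.b Y) V) (hU' : Dv 𝔸.ax X (.so U'))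
    (hv : Arg τ Y l v) :
    Judg.termEq (tctx σ τ (X ++ [(c.a X, U)]) Y) (tens σ τ (.var (c.a X)) v)
      (tens (σ.set (c.a X) U') τ (.var (c.a X)) v)
      ((Ty σ τ U V (.var (c.a X)) (.var (c.b Y))).substL (pL σ τ X (c.b Y) v)) ∈ c.T := by
  obtain ⟨g, hg, e⟩ := exists_TTg_left hx.ctx hy.ctx hx.agree hy.agree hv (c.b Y) V
  rw [← e]
  exact ⟨_, _, hU, hV, .seqt ((hx.tctx_left_iff hy.ctx hy.agree).2 rfl)
    ((hx.tTg_left_iff hy hv).2 rfl) (((hx.set hU').tTg_left_iff hy hv).2 rfl)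
    ((TSo_iff hx hy).2 rfl) hg⟩

theorem mem_tseq (hU : Judg.term X u U ∈ 𝔸.ax) (hV : Judg.sortEq Y V V' ∈ 𝔹.ax)
    (hx : Pt σ X (c.a X) U) (hy : Pt τ Y (c.b Y) V) (hV' : Dv 𝔹.ax Y (.so V'))
    (hu : Arg σ X k u) :
    Judg.termEq (tctx σ τ X (Y ++ [(c.b Y, V)])) (tens σ τ u (.var (c.b Y)))
      (tens σ (τ.set (c.b Y) V') u (.var (c.b Y)))
      ((Ty σ τ U V (.var (c.a X)) (.var (c.b Y))).substL (pR σ τ (c.a X) Y u)) ∈ c.T := by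
  obtain ⟨g, hg, e⟩ := exists_TTg_right hy.ctx hx.agree hy.agree hu (c.a X) U
  rw [← e]
  exact ⟨_, _, hU, hV, .tseq ((Pt.tctx_right_iff hx.ctx hx.agree hy).2 rfl)
    ((hx.tTg_right_iff hy hu).2 rfl) ((hx.tTg_right_iff (hy.set hV') hu).2 rfl)
    ((TSo_iff hx hy).2 rfl) hg⟩

theorem mem_tt {s : A.TermSym} {ss : List (Expr A)} {t : B.TermSym} {ts : List (Expr B)}
    (hU : Judg.term X (.app s ss) U ∈ 𝔸.ax) (hV : Judg.term Y (.app t ts) V ∈ 𝔹.ax)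
    (hx : Pt σ X (c.a X) U) (hy : Pt τ Y (c.b Y) V) (hu : Arg σ X k (.app s ss))
    (hv : Arg τ Y l (.app t ts)) (hcs : cs σ (.app s ss) = U) :
    Judg.termEq (tctx σ τ X Y) (tens σ τ (.app s ss) (.app t ts))
      ((tens σ τ (.app s ss) (.var (c.b Y))).substL (pL σ τ X (c.b Y) (.app t ts)))
      ((Ty σ τ U V (.var (c.a X)) (.var (c.b Y))).substL
        (pL σ τ X (c.b Y) (.app t ts) ++ pR σ τ (c.a X) Y (.app s ss))) ∈ c.T := by
  obtain ⟨gx, hgx, ex⟩ := exists_TTg_left hx.ctx hy.ctx hx.agree hy.agree hv (c.b Y) V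
  obtain ⟨gy, hgy, ey⟩ := exists_TTg_right hy.ctx hx.agree hy.agree hu (c.a X) U
  rw [← ex, ← ey]
  exact ⟨_, _, hU, hV, .tt ((TCtx_iff hx.ctx hy.ctx hx.agree hy.agree).2 rfl)
    ((TTg_iff hy.ctx hx.agree hy.agree hu hv (.inl hcs.symm) (.inr fun y e => nomatch e)).2 rfl)
    (.appapp_base hy.fresh _ ((hx.tTg_right_iff hy hu).2 rfl) gx hgx)
    ((TSo_iff hx hy).2 rfl) hgx hgy⟩

/-- Some environment agrees with a given context. -/
theorem exists_agree (hX : (X.map Prod.fst).Nodup) (U : SortE A) : ∃ σ : Env 𝔸, Agree σ X := by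
  classical
  induction X with
  | nil => exact ⟨fun _ => U, fun p hp => by simp at hp⟩
  | cons p X ih =>
    simp only [List.map_cons, List.nodup_cons, List.mem_map, not_exists, not_and] at hX
    obtain ⟨σ, hσ⟩ := ih hX.2
    refine ⟨σ.set p.1 p.2, fun q hq => ?_⟩
    rcases List.mem_cons.1 hq with rfl | hq
    · exact σ.set_self _ _
    · rw [σ.set_of_ne (hX.1 q hq), hσ q hq]

theorem exists_pt (hX : DCtx 𝔸.ax X) (hU : Dv 𝔸.ax X (.so U)) (hx : ∀ p ∈ X, p.1 ≠ x) :
    ∃ σ : Env 𝔸, Pt σ X x U := by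
  obtain ⟨σ, hσ⟩ := exists_agree (𝔸 := 𝔸) (hX.concat hx hU).1 U
  exact ⟨σ, hX, hU, hσ.left, hσ (x, U) (by simp), hx⟩

theorem Thy.good (𝔸 : Thy A) {J : Judg A} (h : J ∈ 𝔸.ax) : J.Good 𝔸.ax :=
  𝔸.gat.1.good (𝔸.gat.2 J h)

theorem TSo.head_eq {W : SortE (A.tensor B)} (h : TSo 𝔸.ax 𝔹.ax false X x U Y y V W) :
    W.head = (U.head, V.head) := by
  cases h
  rfl

/-- A sort symbol of the tensor theory is introduced by the tensor product of two axioms. -/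
theorem introSort_inv {Z : PreCtx (A.tensor B)} {S : A.SortSym} {R : B.SortSym}
    (h : introSort Z (S, R) ∈ c.T) : ∃ X Y, introSort X S ∈ 𝔸.ax ∧ introSort Y R ∈ 𝔹.ax ∧
      ∀ (σ : Env 𝔸) (τ : Env 𝔹), Pt σ X (c.a X) ⟨S, ctxVars X⟩ → Pt τ Y (c.b Y) ⟨R, ctxVars Y⟩ →
        Z = (tctx σ τ (X ++ [(c.a X, ⟨S, ctxVars X⟩)]) (Y ++ [(c.b Y, ⟨R, ctxVars Y⟩)])).dropLast := by
  obtain ⟨J, J', hJ, hJ', h⟩ := h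
  generalize hK : introSort Z (S, R) = K at h
  cases h with
  | @ss X U Y V Z' W hZ hW =>
    simp only [introSort, Judg.sort.injEq] at hK
    have h1 := hW.head_eq
    rw [← hK.2] at h1
    simp only [Prod.mk.injEq] at h1
    obtain ⟨P, es⟩ := U
    obtain ⟨Q, es'⟩ := V
    obtain ⟨rfl, rfl⟩ := h1
    have f := 𝔸.gat.1.sort_shape _ _ hJ
    have f' := 𝔹.gat.1.sort_shape _ _ hJ'
    simp only at f f'
    subst f f'
    refine ⟨X, Y, hJ, hJ', fun σ τ hσ hτ => ?_⟩
    rw [hK.1, (hσ.tctx_iff hτ).1 hZ]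
  | _ => cases hK

theorem Thy.arg (hτ : Agree τ Y) (h : Judg.term Y v V ∈ 𝔹.ax) : ∃ l, Arg τ Y l v := by
  obtain ⟨l, hl⟩ := (𝔹.good h).2
  exact ⟨l, hl.arg hτ⟩

/-- A term symbol of the tensor theory of the first kind is introduced by the tensor product of a
sort axiom and a term axiom. -/
theorem introTerm_inl_inv {Z : PreCtx (A.tensor B)} {S : A.SortSym} {t : B.TermSym}
    {W : SortE (A.tensor B)} (h : introTerm Z (Sum.inl (S, t)) W ∈ c.T) :
    ∃ X Y V, introSort X S ∈ 𝔸.ax ∧ introTerm Y t V ∈ 𝔹.ax ∧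
      ∀ (σ : Env 𝔸) (τ : Env 𝔹), Pt σ X (c.a X) ⟨S, ctxVars X⟩ → Pt τ Y (c.b Y) V →
        Z = tctx σ τ (X ++ [(c.a X, ⟨S, ctxVars X⟩)]) Y ∧
        W = (Ty σ τ ⟨S, ctxVars X⟩ V (.var (c.a X)) (.var (c.b Y))).substL
          (pL σ τ X (c.b Y) (.app t (ctxVars Y))) := by
  obtain ⟨J, J', hJ, hJ', h⟩ := h
  generalize hK : introTerm Z (Sum.inl (S, t)) W = K at h
  cases h with
  | @st X U Y v V Z' e W' g hZ he hW hg =>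
    simp only [introTerm, Judg.term.injEq] at hK
    obtain ⟨t', rfl⟩ := 𝔹.gat.1.term_shape _ _ _ hJ'
    obtain ⟨P, es⟩ := U
    have f := 𝔸.gat.1.sort_shape _ _ hJ
    simp only at f
    subst f
    obtain ⟨rfl, he', rfl⟩ := hK
    subst he'
    cases he
    refine ⟨X, Y, V, hJ, hJ', fun σ τ hσ hτ => ?_⟩
    obtain ⟨l, hl⟩ := 𝔹.arg hτ.agree hJ'
    refine ⟨(hσ.tctx_left_iff hτ.ctx hτ.agree).1 hZ, ?_⟩
    rw [(TSo_iff hσ hτ).1 hW, pairsL_eq fun i hi =>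
      (TTg_var_left_iff hσ.ctx hτ.ctx hσ.agree hτ.agree hl hi).1 (hg i hi)]
  | ts hZ he hW hg =>
    simp only [introTerm, Judg.term.injEq] at hK
    obtain ⟨s, rfl⟩ := 𝔸.gat.1.term_shape _ _ _ hJ
    obtain ⟨rfl, he', rfl⟩ := hK
    subst he'
    cases he
  | _ => cases hK

/-- A term symbol of the tensor theory of the second kind is introduced by the tensor product of a
term axiom and a sort axiom. -/
theorem introTerm_inr_inv {Z : PreCtx (A.tensor B)} {s : A.TermSym} {R : B.SortSym}
    {W : SortE (A.tensor B)} (h : introTerm Z (Sum.inr (s, R)) W ∈ c.T) :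
    ∃ X Y U, introTerm X s U ∈ 𝔸.ax ∧ introSort Y R ∈ 𝔹.ax ∧
      ∀ (σ : Env 𝔸) (τ : Env 𝔹), Pt σ X (c.a X) U → Pt τ Y (c.b Y) ⟨R, ctxVars Y⟩ →
        Z = tctx σ τ X (Y ++ [(c.b Y, ⟨R, ctxVars Y⟩)]) ∧
        W = (Ty σ τ U ⟨R, ctxVars Y⟩ (.var (c.a X)) (.var (c.b Y))).substL
          (pR σ τ (c.a X) Y (.app s (ctxVars X))) := by
  obtain ⟨J, J', hJ, hJ', h⟩ := h
  generalize hK : introTerm Z (Sum.inr (s, R)) W = K at h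
  cases h with
  | @ts X u U Y V Z' e W' g hZ he hW hg =>
    simp only [introTerm, Judg.term.injEq] at hK
    obtain ⟨s', rfl⟩ := 𝔸.gat.1.term_shape _ _ _ hJ
    obtain ⟨Q, es⟩ := V
    have f := 𝔹.gat.1.sort_shape _ _ hJ'
    simp only at f
    subst f
    obtain ⟨rfl, he', rfl⟩ := hK
    subst he'
    cases he
    refine ⟨X, Y, U, hJ, hJ', fun σ τ hσ hτ => ?_⟩
    obtain ⟨k, hk⟩ := 𝔸.arg hσ.agree hJ
    refine ⟨(Pt.tctx_right_iff hσ.ctx hσ.agree hτ).1 hZ, ?_⟩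
    rw [(TSo_iff hσ hτ).1 hW, pairsR_eq fun j hj =>
      (TTg_var_right_iff hτ.ctx hσ.agree hτ.agree hk hj).1 (hg j hj)]
  | st hZ he hW hg =>
    simp only [introTerm, Judg.term.injEq] at hK
    obtain ⟨t', rfl⟩ := 𝔹.gat.1.term_shape _ _ _ hJ'
    obtain ⟨rfl, he', rfl⟩ := hK
    subst he'
    cases he
  | _ => cases hK

theorem Thy.exists_pt_sort (𝔸 : Thy A) (h : Judg.sort X U ∈ 𝔸.ax) (hx : ∀ p ∈ X, p.1 ≠ x) :
    ∃ σ : Env 𝔸, Pt σ X x U :=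
  exists_pt (𝔸.good h).1 (𝔸.good h).2 hx

theorem Thy.exists_pt_term (𝔸 : Thy A) (h : Judg.term X u U ∈ 𝔸.ax) (hx : ∀ p ∈ X, p.1 ≠ x) :
    ∃ σ : Env 𝔸, Pt σ X x U :=
  exists_pt (𝔸.good h).1 (𝔸.good h).2.tm_so hx

theorem Ch.unique : UniqueIntro c.T where
  sort := by
    rintro ⟨S, R⟩ Z Z' h h'
    obtain ⟨X, Y, hX, hY, H⟩ := introSort_inv c h
    obtain ⟨X', Y', hX', hY', H'⟩ := introSort_inv c h'
    obtain rfl := 𝔸.unique.sort hX hX'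
    obtain rfl := 𝔹.unique.sort hY hY'
    obtain ⟨σ, hσ⟩ := 𝔸.exists_pt_sort hX (c.fresh_a X)
    obtain ⟨τ, hτ⟩ := 𝔹.exists_pt_sort hY (c.fresh_b Y)
    rw [H σ τ hσ hτ, H' σ τ hσ hτ]
  term := by
    rintro (⟨S, t⟩ | ⟨s, R⟩) Z Z' W W' h h'
    · obtain ⟨X, Y, V, hX, hY, H⟩ := introTerm_inl_inv c h
      obtain ⟨X', Y', V', hX', hY', H'⟩ := introTerm_inl_inv c h'
      obtain rfl := 𝔸.unique.sort hX hX'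
      obtain ⟨rfl, rfl⟩ := 𝔹.unique.term hY hY'
      obtain ⟨σ, hσ⟩ := 𝔸.exists_pt_sort hX (c.fresh_a X)
      obtain ⟨τ, hτ⟩ := 𝔹.exists_pt_term hY (c.fresh_b Y)
      obtain ⟨rfl, rfl⟩ := H σ τ hσ hτ
      obtain ⟨rfl, rfl⟩ := H' σ τ hσ hτ
      exact ⟨rfl, rfl⟩
    · obtain ⟨X, Y, U, hX, hY, H⟩ := introTerm_inr_inv c h
      obtain ⟨X', Y', U', hX', hY', H'⟩ := introTerm_inr_inv c h'
      obtain rfl := 𝔹.unique.sort hY hY'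
      obtain ⟨rfl, rfl⟩ := 𝔸.unique.term hX hX'
      obtain ⟨σ, hσ⟩ := 𝔸.exists_pt_term hX (c.fresh_a X)
      obtain ⟨τ, hτ⟩ := 𝔹.exists_pt_sort hY (c.fresh_b Y)
      obtain ⟨rfl, rfl⟩ := H σ τ hσ hτ
      obtain ⟨rfl, rfl⟩ := H' σ τ hσ hτ
      exact ⟨rfl, rfl⟩

end Membership

end

section
variable {𝔸 : Thy A} {𝔹 : Thy B}
section
variable {σ σ' : Env 𝔸} {τ τ' : Env 𝔹} {X C : PreCtx A} {Y D : PreCtx B} {U U' : SortE A}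
  {V V' : SortE B} {x z : A.Var} {y : B.Var} {k l : ℕ}

theorem tctx_append (σ : Env 𝔸) (τ : Env 𝔹) (C C' : PreCtx A) (D : PreCtx B) :
    tctx σ τ (C ++ C') D = tctx σ τ C D ++ tctx σ τ C' D := grid_append _ _ _ _

theorem tctx_dropLast (σ : Env 𝔸) (τ : Env 𝔹) (C : PreCtx A) (D : PreCtx B) (p : A.Var × SortE A)
    (q : B.Var × SortE B) : (tctx σ τ (C ++ [p]) (D ++ [q])).dropLast =
      tctx σ τ C (D ++ [q]) ++ tctx σ τ [p] D := by
  unfold tctx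
  rw [dropLast_grid, grid_singleton]

theorem mem_tctx {r : (A.tensor B).Var × SortE (A.tensor B)} : r ∈ tctx σ τ C D ↔
    ∃ p ∈ C, ∃ q ∈ D, ((p.1, q.1), Ty σ τ p.2 q.2 (.var p.1) (.var q.1)) = r := mem_grid

theorem map_tctx (ρ : (A.tensor B).Var → Expr (A.tensor B)) (C : PreCtx A) (D : PreCtx B) :
    ((tctx σ τ C D).map fun r => ρ r.1) = grid (fun p q => ρ (p.1, q.1)) C D := map_grid _ _ _ _

theorem ctxVars_tctx (σ : Env 𝔸) (τ : Env 𝔹) (C : PreCtx A) (D : PreCtx B) :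
    ctxVars (tctx σ τ C D) = grid (tens σ τ) (ctxVars C) (ctxVars D) := by
  unfold ctxVars
  rw [map_tctx, grid_map]
  simp only [tens_var]

theorem ctxVars_append (C C' : PreCtx A) : ctxVars (C ++ C') = ctxVars C ++ ctxVars C' :=
  List.map_append

theorem lookupV_append_of_mem {ps qs : List (A.Var × Expr A)} (h : x ∈ ps.map Prod.fst) :
    lookupV (ps ++ qs) x = lookupV ps x := by
  induction ps with
  | nil => simp at h
  | cons p ps ih =>
    simp only [List.cons_append, lookupV]
    split_ifs with hp
    · rfl
    · apply ih
      simp only [List.map_cons, List.mem_cons] at h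
      exact h.resolve_left fun e => hp e.symm

theorem lookupV_append_of_notMem {ps qs : List (A.Var × Expr A)} (h : x ∉ ps.map Prod.fst) :
    lookupV (ps ++ qs) x = lookupV qs x := by
  induction ps with
  | nil => rfl
  | cons p ps ih =>
    simp only [List.map_cons, List.mem_cons, not_or] at h
    simp only [List.cons_append, lookupV]
    rw [if_neg fun e => h.1 e.symm, ih h.2]

theorem mem_pL {v : Expr B} {a : A.Var} {b : B.Var} :
    (a, b) ∈ (pL σ τ X y v).map Prod.fst ↔ b = y ∧ a ∈ X.map Prod.fst := by
  simp only [pL, List.map_map, List.mem_map, Function.comp_apply]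
  constructor
  · rintro ⟨p, hp, e⟩
    obtain ⟨rfl, rfl⟩ := Prod.mk.inj e
    exact ⟨rfl, p, hp, rfl⟩
  · rintro ⟨rfl, p, hp, rfl⟩
    exact ⟨p, hp, rfl⟩

theorem mem_pR {u : Expr A} {a : A.Var} {b : B.Var} :
    (a, b) ∈ (pR σ τ x Y u).map Prod.fst ↔ a = x ∧ b ∈ Y.map Prod.fst := by
  simp only [pR, List.map_map, List.mem_map, Function.comp_apply]
  constructor
  · rintro ⟨p, hp, e⟩
    obtain ⟨rfl, rfl⟩ := Prod.mk.inj e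
    exact ⟨rfl, p, hp, rfl⟩
  · rintro ⟨rfl, p, hp, rfl⟩
    exact ⟨p, hp, rfl⟩

theorem lookupV_pL {v : Expr B} {a : A.Var} (ha : a ∈ X.map Prod.fst) :
    lookupV (pL σ τ X y v) (a, y) = tens σ τ (.var a) v := by
  apply lookupV_of_forall
  · rintro r hr e
    simp only [pL, List.mem_map] at hr
    obtain ⟨p, hp, rfl⟩ := hr
    have : p.1 = a := congrArg Prod.fst e
    rw [← this]
  · exact mem_pL.2 ⟨rfl, ha⟩

theorem lookupV_pL_of_ne {v : Expr B} {a : A.Var} {b : B.Var} (hb : b ≠ y) :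
    lookupV (pL σ τ X y v) (a, b) = .var (a, b) :=
  lookupV_of_notMem fun h => hb (mem_pL.1 h).1

theorem lookupV_pR {u : Expr A} {b : B.Var} (hb : b ∈ Y.map Prod.fst) :
    lookupV (pR σ τ x Y u) (x, b) = tens σ τ u (.var b) := by
  apply lookupV_of_forall
  · rintro r hr e
    simp only [pR, List.mem_map] at hr
    obtain ⟨p, hp, rfl⟩ := hr
    have : p.1 = b := congrArg Prod.snd e
    rw [← this]
  · exact mem_pR.2 ⟨rfl, hb⟩

theorem lookupV_pR_of_ne {u : Expr A} {a : A.Var} {b : B.Var} (ha : a ≠ x) :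
    lookupV (pR σ τ x Y u) (a, b) = .var (a, b) :=
  lookupV_of_notMem fun h => ha (mem_pR.1 h).1

theorem Pt.notMem (h : Pt σ X x U) : x ∉ X.map Prod.fst := fun hx => by
  obtain ⟨p, hp, e⟩ := List.mem_map.1 hx
  exact h.fresh p hp e

theorem Pt.mem_ne (h : Pt σ X x U) {a : A.Var} (ha : a ∈ X.map Prod.fst) : a ≠ x :=
  fun e => h.notMem (e ▸ ha)

theorem tens_agree (hσ : Agree σ X) (hσ' : Agree σ' X) (hτ : Agree τ Y) (hτ' : Agree τ' Y)
    {a : Expr A} {b : Expr B} {U : SortE A} {V : SortE B}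
    (ha : W 𝔸.ax k X (.tm a U)) (hb : W 𝔹.ax l Y (.tm b V)) : tens σ' τ' a b = tens σ τ a b := by
  have := tens_fix (ρ := Expr.var) hσ hσ' hτ hτ' (fun _ _ _ _ => rfl) ha hb
  rwa [subst_id] at this

theorem ty_ext {S S' : SortE (A.tensor B)} (h : S.head = S'.head) (h' : S.args = S'.args) :
    S = S' := by
  cases S; cases S'; simp_all

theorem Ty_subst (U : SortE A) (V : SortE B) (u : Expr A) (v : Expr B)
    (ρ : (A.tensor B).Var → Expr (A.tensor B)) : (Ty σ τ U V u v).subst ρ =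
      ⟨(U.head, V.head), grid (fun a b => (tens σ τ a b).subst ρ) U.args (V.args ++ [v]) ++
        V.args.map fun b => (tens σ τ u b).subst ρ⟩ := by
  simp only [Ty, SortE.subst, List.map_append, map_grid, List.map_map]
  rfl

theorem Dv.args {U : SortE A} (h : Dv 𝔸.ax X (.so U)) {a : Expr A} (ha : a ∈ U.args) :
    ∃ k U', W 𝔸.ax k X (.tm a U') := by
  obtain ⟨n, h⟩ := h
  obtain ⟨k, U', -, h⟩ := h.args_so ha
  exact ⟨k, U', h⟩

theorem Pt.var (h : Pt σ X x U) : ∃ k, W 𝔸.ax k (X ++ [(x, U)]) (.tm (.var x) U) := by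
  obtain ⟨k, h⟩ := h.so
  exact ⟨k, .var h⟩

theorem tens_fix_pL (hx : Pt σ C z U) (hy : Pt τ D y V) {v : Expr B} {a : Expr A} {b : Expr B}
    {S : SortE A} {R : SortE B} (ha : W 𝔸.ax k (C ++ [(z, U)]) (.tm a S))
    (hb : W 𝔹.ax l D (.tm b R)) :
    (tens σ τ a b).subst (lookupV (pL σ τ C y v)) = tens σ τ a b :=
  tens_fix hx.agree_concat hx.agree_concat hy.agree hy.agree
    (fun _ _ q hq => lookupV_pL_of_ne (hy.fresh q hq)) ha hb

theorem tens_fix_pR (hx : Pt σ C z U) (hy : Pt τ D y V) {u : Expr A} {a : Expr A} {b : Expr B}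
    {S : SortE A} {R : SortE B} (ha : W 𝔸.ax k C (.tm a S))
    (hb : W 𝔹.ax l (D ++ [(y, V)]) (.tm b R)) :
    (tens σ τ a b).subst (lookupV (pR σ τ z D u)) = tens σ τ a b :=
  tens_fix hx.agree hx.agree hy.agree_concat hy.agree_concat
    (fun p hp _ _ => lookupV_pR_of_ne (hx.fresh p hp)) ha hb

theorem grid_concat_congr {α β γ : Type} {F G : α → β → γ} {L : List α} {M : List β} {b b' : β}
    (h : ∀ a ∈ L, ∀ c ∈ M, F a c = G a c) (h' : ∀ a ∈ L, F a b = G a b') :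
    grid F L (M ++ [b]) = grid G L (M ++ [b']) := by
  induction L with
  | nil => rfl
  | cons a L ih =>
    rw [grid_cons, grid_cons, ih (fun a ha => h a (List.mem_cons_of_mem _ ha))
      (fun a ha => h' a (List.mem_cons_of_mem _ ha))]
    simp only [List.map_append, List.map_cons, List.map_nil]
    rw [List.map_congr_left (h a List.mem_cons_self), h' a List.mem_cons_self]

theorem Ty_pL {S : A.SortSym} (hx : Pt σ C z ⟨S, ctxVars C⟩) (hy : Pt τ D y V) (v : Expr B) :
    (Ty σ τ ⟨S, ctxVars C⟩ V (.var z) (.var y)).substL (pL σ τ C y v) =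
      Ty σ τ ⟨S, ctxVars C⟩ V (.var z) v := by
  have h1 : ∀ a ∈ ctxVars C, ∀ b ∈ V.args,
      (tens σ τ a b).subst (lookupV (pL σ τ C y v)) = tens σ τ a b := by
    intro a ha b hb
    obtain ⟨p, hp, rfl⟩ := List.mem_map.1 ha
    obtain ⟨k, hk⟩ := hx.ctx.var hp
    obtain ⟨l, R, hb⟩ := hy.so.args hb
    exact tens_fix_pL hx hy (hk.weaken _) hb
  have h2 : ∀ b ∈ V.args,
      (tens σ τ (.var z) b).subst (lookupV (pL σ τ C y v)) = tens σ τ (.var z) b := by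
    intro b hb
    obtain ⟨k, hz⟩ := hx.var
    obtain ⟨l, R, hb⟩ := hy.so.args hb
    exact tens_fix_pL hx hy hz hb
  refine (Ty_subst _ _ _ _ _).trans (ty_ext rfl ?_)
  simp only [Ty]
  congr 1
  · refine grid_concat_congr h1 fun a ha => ?_
    obtain ⟨p, hp, rfl⟩ := List.mem_map.1 ha
    rw [tens_var, subst_var, lookupV_pL (List.mem_map_of_mem hp)]
  · exact List.map_congr_left h2

theorem Ty_pR {R : B.SortSym} (hx : Pt σ C z U) (hy : Pt τ D y ⟨R, ctxVars D⟩) (u : Expr A) :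
    (Ty σ τ U ⟨R, ctxVars D⟩ (.var z) (.var y)).substL (pR σ τ z D u) =
      Ty σ τ U ⟨R, ctxVars D⟩ u (.var y) := by
  refine (Ty_subst _ _ _ _ _).trans (ty_ext rfl ?_)
  simp only [Ty]
  congr 1
  · refine grid_congr fun a ha b hb => ?_
    obtain ⟨k, S, ha⟩ := hx.so.args ha
    rcases List.mem_append.1 hb with hb | hb
    · obtain ⟨q, hq, rfl⟩ := List.mem_map.1 hb
      obtain ⟨l, hl⟩ := hy.ctx.var hq
      exact tens_fix_pR hx hy ha (hl.weaken _)
    · obtain rfl := List.mem_singleton.1 hb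
      obtain ⟨l, hl⟩ := hy.var
      exact tens_fix_pR hx hy ha hl
  · refine List.map_congr_left fun b hb => ?_
    obtain ⟨q, hq, rfl⟩ := List.mem_map.1 hb
    rw [tens_var, subst_var, lookupV_pR (List.mem_map_of_mem hq)]

theorem Ty_pR_of_sort (hx : Pt σ C z U) (hy : Pt τ D y V) {u : Expr A}
    (hu : W 𝔸.ax k C (.tm u U)) (hcs : cs σ u = U) :
    (Ty σ τ U V (.var z) (.var y)).substL (pR σ τ z D u) = Ty σ τ U V u (.var y) := by
  refine (Ty_subst _ _ _ _ _).trans (ty_ext rfl ?_)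
  simp only [Ty]
  congr 1
  · refine grid_congr fun a ha b hb => ?_
    obtain ⟨k, S, ha⟩ := hx.so.args ha
    rcases List.mem_append.1 hb with hb | hb
    · obtain ⟨l, R, hb⟩ := hy.so.args hb
      exact tens_fix_pR hx hy ha (hb.weaken _)
    · obtain rfl := List.mem_singleton.1 hb
      obtain ⟨l, hl⟩ := hy.var
      exact tens_fix_pR hx hy ha hl
  · refine List.map_congr_left fun b hb => ?_
    obtain ⟨l, R, hb⟩ := hy.so.args hb
    exact tens_subst_left hx.agree hx.agree hy.agree
      (fun p hp q hq => lookupV_pR_of_ne (hx.fresh p hp)) hu (hx.sort.trans hcs.symm)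
      (fun q hq => lookupV_pR (List.mem_map_of_mem hq)) hb

theorem Ty_set_left {R : B.SortSym} (hx : Pt σ C z U) (hy : Pt τ D y ⟨R, ctxVars D⟩)
    (hU' : Dv 𝔸.ax C (.so U')) :
    Ty (σ.set z U') τ U' ⟨R, ctxVars D⟩ (.var z) (.var y) =
      Ty σ τ U' ⟨R, ctxVars D⟩ (.var z) (.var y) := by
  refine ty_ext rfl ?_
  simp only [Ty]
  congr 1
  · refine grid_congr fun a ha b hb => ?_
    obtain ⟨k, S, ha⟩ := hU'.args ha
    have hσ := hx.agree.set hx.fresh U'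
    rcases List.mem_append.1 hb with hb | hb
    · obtain ⟨q, hq, rfl⟩ := List.mem_map.1 hb
      obtain ⟨l, hl⟩ := hy.ctx.var hq
      exact tens_agree hx.agree hσ hy.agree hy.agree ha hl
    · obtain rfl := List.mem_singleton.1 hb
      obtain ⟨l, hl⟩ := hy.var
      exact tens_agree hx.agree hσ hy.agree_concat hy.agree_concat ha hl
  · refine List.map_congr_left fun b hb => ?_
    obtain ⟨q, hq, rfl⟩ := List.mem_map.1 hb
    rw [tens_var, tens_var]

theorem Ty_set_right {S : A.SortSym} (hx : Pt σ C z ⟨S, ctxVars C⟩) (hy : Pt τ D y V)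
    (hV' : Dv 𝔹.ax D (.so V')) :
    Ty σ (τ.set y V') ⟨S, ctxVars C⟩ V' (.var z) (.var y) =
      Ty σ τ ⟨S, ctxVars C⟩ V' (.var z) (.var y) := by
  have hτ := hy.agree.set hy.fresh V'
  refine ty_ext rfl ?_
  simp only [Ty]
  congr 1
  · refine grid_congr fun a ha b hb => ?_
    obtain ⟨p, hp, rfl⟩ := List.mem_map.1 ha
    obtain ⟨k, hk⟩ := hx.ctx.var hp
    rcases List.mem_append.1 hb with hb | hb
    · obtain ⟨l, R, hb⟩ := hV'.args hb
      exact tens_agree hx.agree hx.agree hy.agree hτ hk hb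
    · obtain rfl := List.mem_singleton.1 hb
      rw [tens_var, tens_var]
  · refine List.map_congr_left fun b hb => ?_
    obtain ⟨k, hz⟩ := hx.var
    obtain ⟨l, R, hb⟩ := hV'.args hb
    exact tens_agree hx.agree_concat hx.agree_concat hy.agree hτ hz hb

theorem tens_set_left {t : B.TermSym} (hx : Pt σ C z U) (hD : DCtx 𝔹.ax D) (hτ : Agree τ D)
    (hv : Arg τ D l (.app t (ctxVars D))) (hU' : Dv 𝔸.ax C (.so U')) :
    tens (σ.set z U') τ (.var z) (.app t (ctxVars D)) =
      .app (.inl (U'.head, t)) (grid (tens σ τ) (U'.args ++ [.var z]) (ctxVars D)) := by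
  have hp := hx.set hU'
  obtain ⟨k, hz⟩ := hp.arg
  rw [tens_app hp.agree hτ hz hv, cs_var, hp.sort]
  congr 1
  refine grid_congr fun a ha b hb => ?_
  obtain ⟨q, hq, rfl⟩ := List.mem_map.1 hb
  obtain ⟨l, hl⟩ := hD.var hq
  rcases List.mem_append.1 ha with ha | ha
  · obtain ⟨k, S, ha⟩ := hU'.args ha
    exact tens_agree hx.agree hp.agree hτ hτ ha hl
  · obtain rfl := List.mem_singleton.1 ha
    rw [tens_var, tens_var]

theorem tens_set_right {s : A.TermSym} (hC : DCtx 𝔸.ax C) (hσ : Agree σ C) (hy : Pt τ D y V)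
    (hu : Arg σ C k (.app s (ctxVars C))) (hV' : Dv 𝔹.ax D (.so V')) :
    tens σ (τ.set y V') (.app s (ctxVars C)) (.var y) =
      .app (.inr (s, V'.head)) (grid (tens σ τ) (ctxVars C) (V'.args ++ [.var y])) := by
  have hp := hy.set hV'
  obtain ⟨l, hl⟩ := hp.arg
  rw [tens_app_var hσ hp.agree hu hl, hp.sort]
  congr 1
  refine grid_congr fun a ha b hb => ?_
  obtain ⟨q, hq, rfl⟩ := List.mem_map.1 ha
  obtain ⟨k, hk⟩ := hC.var hq
  rcases List.mem_append.1 hb with hb | hb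
  · obtain ⟨l, S, hb⟩ := hV'.args hb
    exact tens_agree hσ hσ hy.agree hp.agree hk hb
  · obtain rfl := List.mem_singleton.1 hb
    rw [tens_var, tens_var]

end

end

section
variable {𝔸 : Thy A} {𝔹 : Thy B}
section
variable {c : Ch 𝔸 𝔹} {σ : Env 𝔸} {τ : Env 𝔹} {C : PreCtx A} {D : PreCtx B} {U U' : SortE A}
  {V V' : SortE B} {S : A.SortSym} {R : B.SortSym} {s : A.TermSym} {t : B.TermSym}

theorem Thy.good_term (h : Judg.term C u U ∈ 𝔸.ax) : DCtx 𝔸.ax C ∧ Dv 𝔸.ax C (.tm u U) := 𝔸.good h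

theorem intro_ss (hS : introSort C S ∈ 𝔸.ax) (hR : introSort D R ∈ 𝔹.ax)
    (hx : Pt σ C (c.a C) ⟨S, ctxVars C⟩) (hy : Pt τ D (c.b D) ⟨R, ctxVars D⟩) :
    introSort (tctx σ τ C (D ++ [(c.b D, ⟨R, ctxVars D⟩)]) ++
      tctx σ τ [(c.a C, ⟨S, ctxVars C⟩)] D) (S, R) ∈ c.T := by
  have h := mem_ss c hS hR hx hy
  rw [tctx_dropLast] at h
  unfold introSort
  rw [ctxVars_append, ctxVars_tctx, ctxVars_tctx, ctxVars_append]
  have : ctxVars [(c.a C, (⟨S, ctxVars C⟩ : SortE A))] = [.var (c.a C)] := rfl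
  rw [this, grid_singleton]
  exact h

theorem intro_st (hS : introSort C S ∈ 𝔸.ax) (ht : introTerm D t V ∈ 𝔹.ax)
    (hx : Pt σ C (c.a C) ⟨S, ctxVars C⟩) (hy : Pt τ D (c.b D) V) :
    introTerm (tctx σ τ (C ++ [(c.a C, ⟨S, ctxVars C⟩)]) D) (.inl (S, t))
      (Ty σ τ ⟨S, ctxVars C⟩ V (.var (c.a C)) (.app t (ctxVars D))) ∈ c.T := by
  obtain ⟨l, hl⟩ := Thy.arg hy.agree ht
  obtain ⟨k, hk⟩ := hx.arg
  have h := mem_st c hS ht hx hy hl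
  rw [Ty_pL hx hy, tens_app hx.agree hy.agree hk hl, cs_var, hx.sort] at h
  unfold introTerm
  rw [ctxVars_tctx, ctxVars_append]
  exact h

theorem intro_ts (hs : introTerm C s U ∈ 𝔸.ax) (hR : introSort D R ∈ 𝔹.ax)
    (hx : Pt σ C (c.a C) U) (hy : Pt τ D (c.b D) ⟨R, ctxVars D⟩) :
    introTerm (tctx σ τ C (D ++ [(c.b D, ⟨R, ctxVars D⟩)])) (.inr (s, R))
      (Ty σ τ U ⟨R, ctxVars D⟩ (.app s (ctxVars C)) (.var (c.b D))) ∈ c.T := by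
  obtain ⟨k, hk⟩ := Thy.arg hx.agree hs
  obtain ⟨l, hl⟩ := hy.arg
  have h := mem_ts c hs hR hx hy hk
  rw [Ty_pR hx hy, tens_app_var hx.agree hy.agree hk hl, hy.sort] at h
  unfold introTerm
  rw [ctxVars_tctx, ctxVars_append]
  exact h

theorem ax_seqs (hU : Judg.sortEq C U U' ∈ 𝔸.ax) (hR : introSort D R ∈ 𝔹.ax)
    (hx : Pt σ C (c.a C) U) (hy : Pt τ D (c.b D) ⟨R, ctxVars D⟩) (hU' : Dv 𝔸.ax C (.so U')) :
    Judg.sortEq (tctx σ τ C (D ++ [(c.b D, ⟨R, ctxVars D⟩)]) ++ tctx σ τ [(c.a C, U)] D)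
      (Ty σ τ U ⟨R, ctxVars D⟩ (.var (c.a C)) (.var (c.b D)))
      (Ty σ τ U' ⟨R, ctxVars D⟩ (.var (c.a C)) (.var (c.b D))) ∈ c.T := by
  have h := mem_seqs c hU hR hx hy hU'
  rwa [tctx_dropLast, Ty_set_left hx hy hU'] at h

theorem ax_sseq (hS : introSort C S ∈ 𝔸.ax) (hV : Judg.sortEq D V V' ∈ 𝔹.ax)
    (hx : Pt σ C (c.a C) ⟨S, ctxVars C⟩) (hy : Pt τ D (c.b D) V) (hV' : Dv 𝔹.ax D (.so V')) :
    Judg.sortEq (tctx σ τ C (D ++ [(c.b D, V)]) ++ tctx σ τ [(c.a C, ⟨S, ctxVars C⟩)] D)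
      (Ty σ τ ⟨S, ctxVars C⟩ V (.var (c.a C)) (.var (c.b D)))
      (Ty σ τ ⟨S, ctxVars C⟩ V' (.var (c.a C)) (.var (c.b D))) ∈ c.T := by
  have h := mem_sseq c hS hV hx hy hV'
  rwa [tctx_dropLast, Ty_set_right hx hy hV'] at h

theorem ax_steq (hS : introSort C S ∈ 𝔸.ax) (hV : Judg.termEq D v v' V ∈ 𝔹.ax)
    (hx : Pt σ C (c.a C) ⟨S, ctxVars C⟩) (hy : Pt τ D (c.b D) V) (hv : Arg τ D l v)
    (hv' : Arg τ D l' v') :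
    Judg.termEq (tctx σ τ (C ++ [(c.a C, ⟨S, ctxVars C⟩)]) D) (tens σ τ (.var (c.a C)) v)
      (tens σ τ (.var (c.a C)) v') (Ty σ τ ⟨S, ctxVars C⟩ V (.var (c.a C)) v) ∈ c.T := by
  have h := mem_steq c hS hV hx hy hv hv'
  rwa [Ty_pL hx hy] at h

theorem ax_teqs (hU : Judg.termEq C u u' U ∈ 𝔸.ax) (hR : introSort D R ∈ 𝔹.ax)
    (hx : Pt σ C (c.a C) U) (hy : Pt τ D (c.b D) ⟨R, ctxVars D⟩) (hu : Arg σ C k u)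
    (hu' : Arg σ C k' u') :
    Judg.termEq (tctx σ τ C (D ++ [(c.b D, ⟨R, ctxVars D⟩)])) (tens σ τ u (.var (c.b D)))
      (tens σ τ u' (.var (c.b D))) (Ty σ τ U ⟨R, ctxVars D⟩ u (.var (c.b D))) ∈ c.T := by
  have h := mem_teqs c hU hR hx hy hu hu'
  rwa [Ty_pR hx hy] at h

theorem ax_seqt (hU : Judg.sortEq C U U' ∈ 𝔸.ax) (ht : introTerm D t V ∈ 𝔹.ax)
    (hx : Pt σ C (c.a C) U) (hy : Pt τ D (c.b D) V) (hU' : Dv 𝔸.ax C (.so U')) :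
    Judg.termEq (tctx σ τ (C ++ [(c.a C, U)]) D)
      (.app (.inl (U.head, t)) (grid (tens σ τ) (U.args ++ [.var (c.a C)]) (ctxVars D)))
      (.app (.inl (U'.head, t)) (grid (tens σ τ) (U'.args ++ [.var (c.a C)]) (ctxVars D)))
      ((Ty σ τ U V (.var (c.a C)) (.var (c.b D))).substL
        (pL σ τ C (c.b D) (.app t (ctxVars D)))) ∈ c.T := by
  obtain ⟨l, hl⟩ := Thy.arg hy.agree ht
  obtain ⟨k, hk⟩ := hx.arg
  have h := mem_seqt c hU ht hx hy hU' hl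
  rwa [tens_set_left hx hy.ctx hy.agree hl hU', tens_app hx.agree hy.agree hk hl, cs_var,
    hx.sort] at h

theorem ax_tseq (hs : introTerm C s U ∈ 𝔸.ax) (hV : Judg.sortEq D V V' ∈ 𝔹.ax)
    (hx : Pt σ C (c.a C) U) (hy : Pt τ D (c.b D) V) (hV' : Dv 𝔹.ax D (.so V')) :
    Judg.termEq (tctx σ τ C (D ++ [(c.b D, V)]))
      (.app (.inr (s, V.head)) (grid (tens σ τ) (ctxVars C) (V.args ++ [.var (c.b D)])))
      (.app (.inr (s, V'.head)) (grid (tens σ τ) (ctxVars C) (V'.args ++ [.var (c.b D)])))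
      (Ty σ τ U V (.app s (ctxVars C)) (.var (c.b D))) ∈ c.T := by
  obtain ⟨k, hk⟩ := Thy.arg hx.agree hs
  obtain ⟨l, hl⟩ := hy.arg
  have h := mem_tseq c hs hV hx hy hV' hk
  obtain ⟨n, hn⟩ := (Thy.good_term hs).2
  have hcs : cs σ (.app s (ctxVars C)) = U := by
    have := cs_app σ hs (φ := Expr.var) hx.so
    rw [ssubst_id] at this
    exact this
  rwa [tens_set_right hx.ctx hx.agree hy hk hV', tens_app_var hx.agree hy.agree hk hl, hy.sort,
    Ty_pR_of_sort hx hy hn hcs] at h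

theorem ax_tt (hs : introTerm C s U ∈ 𝔸.ax) (ht : introTerm D t V ∈ 𝔹.ax)
    (hx : Pt σ C (c.a C) U) (hy : Pt τ D (c.b D) V) :
    Judg.termEq (tctx σ τ C D)
      (.app (.inl (U.head, t)) (grid (tens σ τ) (U.args ++ [.app s (ctxVars C)]) (ctxVars D)))
      (.app (.inr (s, V.head)) (grid (tens σ τ) (ctxVars C) (V.args ++ [.app t (ctxVars D)])))
      ((Ty σ τ U V (.var (c.a C)) (.var (c.b D))).substL
        (pL σ τ C (c.b D) (.app t (ctxVars D)) ++ pR σ τ (c.a C) D (.app s (ctxVars C)))) ∈ c.T := by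
  obtain ⟨k, hk⟩ := Thy.arg hx.agree hs
  obtain ⟨l, hl⟩ := Thy.arg hy.agree ht
  obtain ⟨l', hl'⟩ := hy.arg
  have hcs : cs σ (.app s (ctxVars C)) = U := by
    have := cs_app σ hs (φ := Expr.var) hx.so
    rw [ssubst_id] at this
    exact this
  have h := mem_tt c hs ht hx hy hk hl hcs
  rw [tens_app hx.agree hy.agree hk hl, hcs] at h
  convert h using 1
  rw [tens_app_var hx.agree hy.agree hk hl', hy.sort]
  unfold Expr.substL
  rw [subst_app, map_grid]
  congr 1
  refine congrArg (Expr.app _) (grid_concat_congr (fun a ha b hb => ?_) fun a ha => ?_).symm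
  · obtain ⟨p, hp, rfl⟩ := List.mem_map.1 ha
    obtain ⟨k, hk⟩ := hx.ctx.var hp
    obtain ⟨l, R, hb⟩ := hy.so.args hb
    exact tens_fix_pL hx hy (hk.weaken _) hb
  · obtain ⟨p, hp, rfl⟩ := List.mem_map.1 ha
    rw [tens_var, subst_var, lookupV_pL (List.mem_map_of_mem hp)]

end

end

section
variable {𝔸 : Thy A} {𝔹 : Thy B}

/-- A context of the tensor product over which all tensor variables of `X` and `Y` are typed. -/
structure Fr (c : Ch 𝔸 𝔹) (σ : Env 𝔸) (τ : Env 𝔹) (X : PreCtx A) (Y : PreCtx B)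
    (Z : PreCtx (A.tensor B)) : Prop where
  dX : DCtx 𝔸.ax X
  dY : DCtx 𝔹.ax Y
  aX : Agree σ X
  aY : Agree τ Y
  ctx : DCtx c.T Z
  var : ∀ p ∈ X, ∀ q ∈ Y,
    Dv c.T Z (.tm (.var (p.1, q.1)) (Ty σ τ p.2 q.2 (.var p.1) (.var q.1)))

/-- The tensor of `u : U` and `v : V` is well typed and has both of its possible shapes. -/
structure Good (c : Ch 𝔸 𝔹) (σ : Env 𝔸) (τ : Env 𝔹) (Z : PreCtx (A.tensor B))
    (u : Expr A) (U : SortE A) (v : Expr B) (V : SortE B) : Prop where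
  tm : Dv c.T Z (.tm (tens σ τ u v) (Ty σ τ U V u v))
  inl : ∀ t p, v = .app t p → Te c.T Z (tens σ τ u v)
    (.app (.inl (U.head, t)) (grid (tens σ τ) (U.args ++ [u]) p))
  inr : ∀ s h, u = .app s h → Te c.T Z (tens σ τ u v)
    (.app (.inr (s, V.head)) (grid (tens σ τ) h (V.args ++ [v])))

/-- `u : U` can be tensored with the terms over `Y` of rank less than `m`. -/
structure PtL (c : Ch 𝔸 𝔹) (σ : Env 𝔸) (τ : Env 𝔹) (Y : PreCtx B) (Z : PreCtx (A.tensor B))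
    (u : Expr A) (U : SortE A) (m : ℕ) : Prop where
  good : ∀ m' < m, ∀ w W', W 𝔹.ax m' Y (.tm w W') → Good c σ τ Z u U w W'
  te : ∀ m' < m, ∀ w w' W', W 𝔹.ax m' Y (.teq w w' W') → Te c.T Z (tens σ τ u w) (tens σ τ u w')

/-- `v : V` can be tensored with the terms over `X` of rank less than `n`. -/
structure PtR (c : Ch 𝔸 𝔹) (σ : Env 𝔸) (τ : Env 𝔹) (X : PreCtx A) (Z : PreCtx (A.tensor B))
    (v : Expr B) (V : SortE B) (n : ℕ) : Prop where
  good : ∀ n' < n, ∀ w W', W 𝔸.ax n' X (.tm w W') → Good c σ τ Z w W' v V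
  te : ∀ n' < n, ∀ w w' W', W 𝔸.ax n' X (.teq w w' W') → Te c.T Z (tens σ τ w v) (tens σ τ w' v)

/-- The term which the tensor of `u : U` and a compound term should be. -/
noncomputable def inlApp (σ : Env 𝔸) (τ : Env 𝔹) (U : SortE A) (u : Expr A) (t : B.TermSym)
    (p : List (Expr B)) : Expr (A.tensor B) :=
  .app (.inl (U.head, t)) (grid (tens σ τ) (U.args ++ [u]) p)

/-- The term which the tensor of a compound term and `v : V` should be. -/
noncomputable def inrApp (σ : Env 𝔸) (τ : Env 𝔹) (s : A.TermSym) (h : List (Expr A))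
    (V : SortE B) (v : Expr B) : Expr (A.tensor B) :=
  .app (.inr (s, V.head)) (grid (tens σ τ) h (V.args ++ [v]))

/-- The statements proved by simultaneous induction on the ranks of the two factors. -/
structure Claims (c : Ch 𝔸 𝔹) (n m : ℕ) : Prop where
  sort : ∀ {σ τ X Y Z}, Fr c σ τ X Y Z → ∀ {U V u v}, W 𝔸.ax n X (.so U) → W 𝔹.ax m Y (.so V) →
    PtL c σ τ Y Z u U m → PtR c σ τ X Z v V n → Dv c.T Z (.so (Ty σ τ U V u v))
  appL : ∀ {σ τ X Y Z}, Fr c σ τ X Y Z → ∀ {U V u t p}, W 𝔸.ax n X (.so U) →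
    W 𝔹.ax m Y (.tm (.app t p) V) → PtL c σ τ Y Z u U m →
    Dv c.T Z (.tm (inlApp σ τ U u t p) (Ty σ τ U (cs τ (.app t p)) u (.app t p)))
  appR : ∀ {σ τ X Y Z}, Fr c σ τ X Y Z → ∀ {U V s h v}, W 𝔸.ax n X (.tm (.app s h) U) →
    W 𝔹.ax m Y (.so V) → PtR c σ τ X Z v V n →
    Dv c.T Z (.tm (inrApp σ τ s h V v) (Ty σ τ (cs σ (.app s h)) V (.app s h) v))
  pair : ∀ {σ τ X Y Z}, Fr c σ τ X Y Z → ∀ {U V u v}, W 𝔸.ax n X (.tm u U) →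
    W 𝔹.ax m Y (.tm v V) → Good c σ τ Z u U v V
  eqL : ∀ {σ τ X Y Z}, Fr c σ τ X Y Z → ∀ {U V u u' v}, W 𝔸.ax n X (.teq u u' U) →
    W 𝔹.ax m Y (.tm v V) → Te c.T Z (tens σ τ u v) (tens σ τ u' v)
  eqR : ∀ {σ τ X Y Z}, Fr c σ τ X Y Z → ∀ {U V u v v'}, W 𝔸.ax n X (.tm u U) →
    W 𝔹.ax m Y (.teq v v' V) → Te c.T Z (tens σ τ u v) (tens σ τ u v')
  seqL : ∀ {σ τ X Y Z}, Fr c σ τ X Y Z → ∀ {U U' V u v}, W 𝔸.ax n X (.seq U U') →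
    W 𝔹.ax m Y (.so V) → PtL c σ τ Y Z u U m → PtL c σ τ Y Z u U' m → PtR c σ τ X Z v V n →
    Dv c.T Z (.seq (Ty σ τ U V u v) (Ty σ τ U' V u v))
  seqR : ∀ {σ τ X Y Z}, Fr c σ τ X Y Z → ∀ {U V V' u v}, W 𝔸.ax n X (.so U) →
    W 𝔹.ax m Y (.seq V V') → PtL c σ τ Y Z u U m → PtR c σ τ X Z v V n → PtR c σ τ X Z v V' n →
    Dv c.T Z (.seq (Ty σ τ U V u v) (Ty σ τ U V' u v))
  seqtL : ∀ {σ τ X Y Z}, Fr c σ τ X Y Z → ∀ {U U' V u t p}, W 𝔸.ax n X (.seq U U') →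
    W 𝔹.ax m Y (.tm (.app t p) V) → PtL c σ τ Y Z u U m → PtL c σ τ Y Z u U' m →
    Te c.T Z (inlApp σ τ U u t p) (inlApp σ τ U' u t p)
  seqtR : ∀ {σ τ X Y Z}, Fr c σ τ X Y Z → ∀ {U V V' s h v}, W 𝔸.ax n X (.tm (.app s h) U) →
    W 𝔹.ax m Y (.seq V V') → PtR c σ τ X Z v V n → PtR c σ τ X Z v V' n →
    Te c.T Z (inrApp σ τ s h V v) (inrApp σ τ s h V' v)

def Below (c : Ch 𝔸 𝔹) (n m : ℕ) : Prop :=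
  ∀ n' m', n' ≤ n → m' ≤ m → (n' < n ∨ m' < m) → Claims c n' m'

theorem Below.left {c : Ch 𝔸 𝔹} (h : Below c n m) (hk : k < n) : Claims c k m :=
  h k m hk.le le_rfl (.inl hk)

theorem Below.right {c : Ch 𝔸 𝔹} (h : Below c n m) (hl : l < m) : Claims c n l :=
  h n l le_rfl hl.le (.inr hl)

theorem Below.both {c : Ch 𝔸 𝔹} (h : Below c n m) (hk : k < n) (hl : l < m) : Claims c k l :=
  h k l hk.le hl.le (.inl hk)

section
variable {c : Ch 𝔸 𝔹} {σ : Env 𝔸} {τ : Env 𝔹} {X : PreCtx A} {Y : PreCtx B}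
  {Z : PreCtx (A.tensor B)} {U U' : SortE A} {V V' : SortE B} {u u' : Expr A} {v v' : Expr B}
  {n m k l : ℕ}

theorem PtL.mono (h : PtL c σ τ Y Z u U m) (hk : k ≤ m) : PtL c σ τ Y Z u U k :=
  ⟨fun m' hm => h.good m' (hm.trans_le hk), fun m' hm => h.te m' (hm.trans_le hk)⟩

theorem PtR.mono (h : PtR c σ τ X Z v V n) (hk : k ≤ n) : PtR c σ τ X Z v V k :=
  ⟨fun m' hm => h.good m' (hm.trans_le hk), fun m' hm => h.te m' (hm.trans_le hk)⟩

theorem PtL.of (F : Fr c σ τ X Y Z) (hc : ∀ l < m, Claims c n l) (hu : W 𝔸.ax n X (.tm u U)) :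
    PtL c σ τ Y Z u U m :=
  ⟨fun l hl _ _ hw => (hc l hl).pair F hu hw, fun l hl _ _ _ hw => (hc l hl).eqR F hu hw⟩

theorem PtR.of (F : Fr c σ τ X Y Z) (hc : ∀ k < n, Claims c k m) (hv : W 𝔹.ax m Y (.tm v V)) :
    PtR c σ τ X Z v V n :=
  ⟨fun k hk _ _ hw => (hc k hk).pair F hw hv, fun k hk _ _ _ hw => (hc k hk).eqL F hw hv⟩

theorem Fr.nd (F : Fr c σ τ X Y Z) : (Z.map Prod.fst).Nodup := F.ctx.1

theorem Fr.te_trans (F : Fr c σ τ X Y Z) {a b d : Expr (A.tensor B)} (h : Te c.T Z a b)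
    (h' : Te c.T Z b d) : Te c.T Z a d := h.trans c.unique F.nd h'

theorem Good.conv (hd : (Z.map Prod.fst).Nodup) (h : Good c σ τ Z u U v V)
    (hs : Dv c.T Z (.seq (Ty σ τ U V u v) (Ty σ τ U' V u v)))
    (ht : ∀ t p, v = .app t p → Te c.T Z (inlApp σ τ U u t p) (inlApp σ τ U' u t p)) :
    Good c σ τ Z u U' v V :=
  ⟨h.tm.conv hs, fun t p e => (h.inl t p e).trans c.unique hd (ht t p e), h.inr⟩

theorem Good.convR (hd : (Z.map Prod.fst).Nodup) (h : Good c σ τ Z u U v V)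
    (hs : Dv c.T Z (.seq (Ty σ τ U V u v) (Ty σ τ U V' u v)))
    (ht : ∀ s h, u = .app s h → Te c.T Z (inrApp σ τ s h V v) (inrApp σ τ s h V' v)) :
    Good c σ τ Z u U v V' :=
  ⟨h.tm.conv hs, h.inl, fun t p e => (h.inr t p e).trans c.unique hd (ht t p e)⟩

theorem PtL.conv (F : Fr c σ τ X Y Z) (hc : ∀ k ≤ n, ∀ l < m, Claims c k l)
    (hs : W 𝔸.ax n X (.seq U U')) (h : PtL c σ τ Y Z u U m) : PtL c σ τ Y Z u U' m := by
  refine ⟨fun l => ?_, h.te⟩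
  induction l using Nat.strong_induction_on with
  | _ l ih =>
    intro hl w W' hw
    have h' : PtL c σ τ Y Z u U' l :=
      ⟨fun l' hl' => ih l' hl' (hl'.trans hl), (h.mono hl.le).te⟩
    refine (h.good l hl w W' hw).conv F.nd ?_ ?_
    · exact (hc n le_rfl l hl).seqL F hs hw.presup (h.mono hl.le) h'
        (.of F (fun k hk => hc k hk.le l hl) hw)
    · rintro t p rfl
      exact (hc n le_rfl l hl).seqtL F hs hw (h.mono hl.le) h'

theorem PtR.conv (F : Fr c σ τ X Y Z) (hc : ∀ k < n, ∀ l ≤ m, Claims c k l)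
    (hs : W 𝔹.ax m Y (.seq V V')) (h : PtR c σ τ X Z v V n) : PtR c σ τ X Z v V' n := by
  refine ⟨fun k => ?_, h.te⟩
  induction k using Nat.strong_induction_on with
  | _ k ih =>
    intro hk w W' hw
    have h' : PtR c σ τ X Z v V' k :=
      ⟨fun l' hl' => ih l' hl' (hl'.trans hk), (h.mono hk.le).te⟩
    refine (h.good k hk w W' hw).convR F.nd ?_ ?_
    · exact (hc k hk m le_rfl).seqR F hw.presup hs (.of F (fun l hl => hc k hk l hl.le) hw)
        (h.mono hk.le) h'
    · rintro t p rfl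
      exact (hc k hk m le_rfl).seqtR F hw hs (h.mono hk.le) h'

end

end

section
variable {𝔸 : Thy A} {𝔹 : Thy B}

/-- Substitutions `φ`, `ψ` and `ρ` which are compatible with tensors on the pairs of terms in
`P`. -/
structure Hom (c : Ch 𝔸 𝔹) (σ₀ : Env 𝔸) (τ₀ : Env 𝔹) (C : PreCtx A) (D : PreCtx B) (σ : Env 𝔸)
    (τ : Env 𝔹) (Z : PreCtx (A.tensor B)) (P : Expr A → Expr B → Prop)
    (ρ : A.Var × B.Var → Expr (A.tensor B)) (φ : A.Var → Expr A) (ψ : B.Var → Expr B) : Prop where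
  nd : (Z.map Prod.fst).Nodup
  aC : Agree σ₀ C
  aD : Agree τ₀ D
  argA : ∀ {α β}, P α β → ∃ k, Arg σ₀ C k α
  argB : ∀ {α β}, P α β → ∃ k, Arg τ₀ D k β
  csA : ∀ {α β}, P α β → ∀ a ∈ (cs σ₀ α).args, P a β
  csB : ∀ {α β}, P α β → ∀ b ∈ (cs τ₀ β).args, P α b
  appA : ∀ {s h β}, P (.app s h) β → ∀ a ∈ h, P a β
  appB : ∀ {α t p}, P α (.app t p) → ∀ b ∈ p, P α b
  rho : ∀ {x y}, P (.var x) (.var y) → ρ (x, y) = tens σ τ (φ x) (ψ y)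
  good : ∀ {α β}, P α β → Good c σ τ Z (α.subst φ) ((cs σ₀ α).subst φ) (β.subst ψ)
    ((cs τ₀ β).subst ψ)

section
variable {c : Ch 𝔸 𝔹} {σ₀ σ : Env 𝔸} {τ₀ τ : Env 𝔹} {C X : PreCtx A} {D Y : PreCtx B}
  {Z : PreCtx (A.tensor B)} {P : Expr A → Expr B → Prop}
  {ρ : (A.tensor B).Var → Expr (A.tensor B)} {φ : A.Var → Expr A} {ψ : B.Var → Expr B}
  {U : SortE A} {V : SortE B} {α : Expr A} {β : Expr B}

theorem forall₂_grid_subst {L : List (Expr A)} {M : List (Expr B)}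
    (h : ∀ a ∈ L, ∀ b ∈ M,
      Te c.T Z ((tens σ₀ τ₀ a b).subst ρ) (tens σ τ (a.subst φ) (b.subst ψ))) :
    List.Forall₂ (Te c.T Z) (grid (tens σ τ) (L.map (Expr.subst φ)) (M.map (Expr.subst ψ)))
      ((grid (tens σ₀ τ₀) L M).map (Expr.subst ρ)) := by
  rw [map_grid, grid_map]
  exact forall₂_grid fun a ha b hb => (h a ha b hb).symm

theorem inlApp_te (hd : (Z.map Prod.fst).Nodup) {T : SortE (A.tensor B)} {t : B.TermSym}
    {p : List (Expr B)}
    (h : ∀ a ∈ U.args ++ [α], ∀ b ∈ p,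
      Te c.T Z ((tens σ₀ τ₀ a b).subst ρ) (tens σ τ (a.subst φ) (b.subst ψ)))
    (ht : Dv c.T Z (.tm (inlApp σ τ (U.subst φ) (α.subst φ) t (p.map (Expr.subst ψ))) T)) :
    Dv c.T Z (.teq (inlApp σ τ (U.subst φ) (α.subst φ) t (p.map (Expr.subst ψ)))
      ((inlApp σ₀ τ₀ U α t p).subst ρ) T) := by
  unfold inlApp at ht ⊢
  rw [subst_app]
  refine Te.app c.unique hd ht ?_
  simpa [SortE.subst] using forall₂_grid_subst h

theorem inrApp_te (hd : (Z.map Prod.fst).Nodup) {T : SortE (A.tensor B)} {s : A.TermSym}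
    {h : List (Expr A)}
    (he : ∀ a ∈ h, ∀ b ∈ V.args ++ [β],
      Te c.T Z ((tens σ₀ τ₀ a b).subst ρ) (tens σ τ (a.subst φ) (b.subst ψ)))
    (ht : Dv c.T Z (.tm (inrApp σ τ s (h.map (Expr.subst φ)) (V.subst ψ) (β.subst ψ)) T)) :
    Dv c.T Z (.teq (inrApp σ τ s (h.map (Expr.subst φ)) (V.subst ψ) (β.subst ψ))
      ((inrApp σ₀ τ₀ s h V β).subst ρ) T) := by
  unfold inrApp at ht ⊢
  rw [subst_app]
  refine Te.app c.unique hd ht ?_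
  simpa [SortE.subst] using forall₂_grid_subst he

theorem Ty_te (hd : (Z.map Prod.fst).Nodup)
    (h : ∀ a ∈ U.args, ∀ b ∈ V.args ++ [β],
      Te c.T Z ((tens σ₀ τ₀ a b).subst ρ) (tens σ τ (a.subst φ) (b.subst ψ)))
    (h' : ∀ b ∈ V.args, Te c.T Z ((tens σ₀ τ₀ α b).subst ρ) (tens σ τ (α.subst φ) (b.subst ψ)))
    (hs : Dv c.T Z (.so (Ty σ τ (U.subst φ) (V.subst ψ) (α.subst φ) (β.subst ψ)))) :
    Dv c.T Z (.seq (Ty σ τ (U.subst φ) (V.subst ψ) (α.subst φ) (β.subst ψ))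
      ((Ty σ₀ τ₀ U V α β).subst ρ)) := by
  rw [Ty_subst]
  refine Te.sort c.unique hd hs ?_
  refine List.rel_append ?_ ?_
  · have := forall₂_grid_subst h
    rw [map_grid] at this
    simpa [SortE.subst] using this
  · simp only [SortE.subst, List.map_map, List.forall₂_map_left_iff, List.forall₂_map_right_iff,
      List.forall₂_same]
    exact fun b hb => (h' b hb).symm

theorem Hom.te (H : Hom c σ₀ τ₀ C D σ τ Z P ρ φ ψ) (h : P α β) :
    Te c.T Z ((tens σ₀ τ₀ α β).subst ρ) (tens σ τ (α.subst φ) (β.subst ψ)) := by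
  obtain ⟨k, hk⟩ := H.argA h
  obtain ⟨l, hl⟩ := H.argB h
  induction hN : k + l using Nat.strong_induction_on generalizing α β k l with
  | _ N ih =>
    have hG := H.good h
    rcases β with y | ⟨t, p⟩
    · rcases α with x | ⟨s, as⟩
      · have := hG.tm.te
        simp only [subst_var] at this
        rw [tens_var, subst_var, subst_var, subst_var, H.rho h]
        exact this
      · have hte := hG.inr s _ (subst_app ..)
        refine (hte.trans c.unique H.nd ?_).symm
        obtain ⟨T, hT⟩ := hte
        rw [tens_app_var H.aC H.aD hk hl, ← cs_var τ₀ y]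
        refine ⟨T, inrApp_te H.nd (fun a ha b hb => ?_) hT.teq_right⟩
        obtain ⟨k', hk', ha'⟩ := hk.args H.aC ha
        have hPa := H.appA h a ha
        rcases List.mem_append.1 hb with hb | hb
        · obtain ⟨l', hl', hb'⟩ := hl.cs_args' H.aD hb
          exact ih (k' + l') (by omega) (H.csB hPa b hb) k' ha' l' hb' rfl
        · obtain rfl := List.mem_singleton.1 hb
          exact ih (k' + l) (by omega) hPa k' ha' l hl rfl
    · have hte := hG.inl t _ (subst_app ..)
      refine (hte.trans c.unique H.nd ?_).symm
      obtain ⟨T, hT⟩ := hte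
      rw [tens_app H.aC H.aD hk hl]
      refine ⟨T, inlApp_te H.nd (fun a ha b hb => ?_) hT.teq_right⟩
      obtain ⟨l', hl', hb'⟩ := hl.args H.aD hb
      have hPb := H.appB h b hb
      rcases List.mem_append.1 ha with ha | ha
      · obtain ⟨k', hk', ha'⟩ := hk.cs_args' H.aC ha
        exact ih (k' + l') (by omega) (H.csA hPb a ha) k' ha' l' hb' rfl
      · obtain rfl := List.mem_singleton.1 ha
        exact ih (k + l') (by omega) hPb k hk l' hb' rfl

theorem Hom.entry (H : Hom c σ₀ τ₀ C D σ τ Z P ρ φ ψ) (h : P α β) :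
    Dv c.T Z (.tm ((tens σ₀ τ₀ α β).subst ρ)
      ((Ty σ₀ τ₀ (cs σ₀ α) (cs τ₀ β) α β).subst ρ)) := by
  have hG := (H.good h).tm
  refine ((H.te h).symm.typed c.unique H.nd hG).teq_right.conv ?_
  refine Ty_te H.nd (fun a ha b hb => ?_) (fun b hb => H.te (H.csB h b hb)) hG.tm_so
  have := H.csA h a ha
  rcases List.mem_append.1 hb with hb | hb
  · exact H.te (H.csB this b hb)
  · obtain rfl := List.mem_singleton.1 hb
    exact H.te this

end

end

section
variable {𝔸 : Thy A} {𝔹 : Thy B}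

/-- A context whose sorts have rank at most `k`. -/
structure Tele (σ : Env 𝔸) (C : PreCtx A) (k : ℕ) : Prop where
  nd : (C.map Prod.fst).Nodup
  agree : Agree σ C
  so : ∀ C₀ p C₁, C = C₀ ++ p :: C₁ → W 𝔸.ax k C₀ (.so p.2)

section
variable {c : Ch 𝔸 𝔹} {σ : Env 𝔸} {τ : Env 𝔹} {C C' X : PreCtx A} {D D' Y : PreCtx B}
  {Z Z' : PreCtx (A.tensor B)} {U : SortE A} {V : SortE B} {x z : A.Var} {y : B.Var}
  {k l n m : ℕ}

theorem Tele.dctx (h : Tele σ C k) : DCtx 𝔸.ax C :=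
  ⟨h.nd, fun C₀ p C₁ e => ⟨k, h.so C₀ p C₁ e⟩⟩

theorem Tele.left (h : Tele σ (C ++ C') k) : Tele σ C k :=
  ⟨h.dctx.left.1, h.agree.left, fun C₀ p C₁ e => h.so C₀ p (C₁ ++ C') (by simp [e])⟩

theorem Tele.mono (h : Tele σ C k) (hk : k ≤ n) : Tele σ C n :=
  ⟨h.nd, h.agree, fun C₀ p C₁ e => (h.so C₀ p C₁ e).mono hk⟩

theorem Tele.concat (h : Tele σ C k) (hz : Pt σ C z U) (hU : W 𝔸.ax k C (.so U)) :
    Tele σ (C ++ [(z, U)]) k := by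
  refine ⟨hz.concat.1, hz.agree_concat, fun C₀ p C₁ e => ?_⟩
  obtain ⟨rfl, rfl, rfl⟩ | ⟨C₂, rfl, e'⟩ := concat_eq_append_cons e
  · exact hU
  · exact h.so _ _ _ e'

theorem Tele.var (h : Tele σ C k) {p : A.Var × SortE A} (hp : p ∈ C) :
    W 𝔸.ax k C (.tm (.var p.1) p.2) := by
  obtain ⟨C₀, C₁, rfl⟩ := List.append_of_mem hp
  exact W.var (h.so _ _ _ rfl)

theorem Tele.last (h : Tele σ (C ++ [(z, U)]) k) : Pt σ C z U ∧ W 𝔸.ax k C (.so U) := by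
  have hU := h.so C _ [] rfl
  refine ⟨⟨h.left.dctx, ⟨k, hU⟩, h.left.agree, h.agree (z, U) (by simp), fun p hp e => ?_⟩, hU⟩
  have := h.nd
  rw [List.map_append, List.nodup_append] at this
  exact this.2.2 _ (List.mem_map_of_mem hp) z (by simp) e

theorem Fr.weaken (F : Fr c σ τ X Y Z) (h : DCtx c.T (Z ++ Z')) : Fr c σ τ X Y (Z ++ Z') :=
  { F with ctx := h, var := fun p hp q hq => (F.var p hp q hq).weaken Z' }

theorem Fr.left {Y' : PreCtx B} (F : Fr c σ τ X (Y ++ Y') Z) : Fr c σ τ X Y Z :=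
  { F with
    dY := F.dY.left
    aY := F.aY.left
    var := fun p hp q hq => F.var p hp q (List.mem_append_left _ hq) }

theorem Fr.row (hz : Pt σ C z U) (hU : W 𝔸.ax n C (.so U)) (hD : Tele τ D l)
    (hc : ∀ n' ≤ n, ∀ l' ≤ l, Claims c n' l') (F : Fr c σ τ C D Z)
    (hZ : ∀ r ∈ Z, r.1.1 ≠ z) :
    Fr c σ τ (C ++ [(z, U)]) D (Z ++ tctx σ τ [(z, U)] D) := by
  induction D using List.reverseRecOn with
  | nil =>
    refine ⟨hz.concat, .nil, hz.agree_concat, F.aY, ?_, by simp⟩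
    simpa [tctx, grid_empty] using F.ctx
  | append_singleton D q ih =>
    obtain ⟨y, V⟩ := q
    have G := ih hD.left F.left
    obtain ⟨hy, hV⟩ := hD.last
    have F' := F.weaken G.ctx
    have hso := (hc n le_rfl l le_rfl).sort F'.left hU hV
      (.of G (fun l' hl => hc n le_rfl l' hl.le) (W.var (X₁ := []) hU))
      (.of F' (fun k hk => hc k hk.le l le_rfl) (W.var (X₁ := []) hV))
    have hctx : tctx σ τ [(z, U)] (D ++ [(y, V)]) =
        tctx σ τ [(z, U)] D ++ [((z, y), Ty σ τ U V (.var z) (.var y))] := by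
      simp [tctx, grid_singleton]
    rw [hctx, ← List.append_assoc]
    have hZ' : DCtx c.T (Z ++ tctx σ τ [(z, U)] D ++ [((z, y), Ty σ τ U V (.var z) (.var y))]) := by
      refine G.ctx.concat (fun r hr e => ?_) hso
      rcases List.mem_append.1 hr with hr | hr
      · exact hZ r hr (by rw [e])
      · obtain ⟨p, hp, q, hq, rfl⟩ := mem_tctx.1 hr
        exact hy.fresh q hq (congrArg Prod.snd e)
    refine ⟨hz.concat, F.dY, hz.agree_concat, F.aY, hZ', fun p hp q hq => ?_⟩
    rcases List.mem_append.1 hq with hq | hq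
    · exact (G.var p hp q hq).weaken _
    · rcases List.mem_append.1 hp with hp | hp
      · exact ((F'.var p hp q (List.mem_append_right _ hq)).weaken _)
      · simp only [List.mem_singleton] at hp hq
        subst hp hq
        exact Dv.var (X₁ := []) hso

theorem Tele.fr (hC : Tele σ C k) (hD : Tele τ D l)
    (hc : ∀ n' ≤ k, ∀ l' ≤ l, Claims c n' l') : Fr c σ τ C D (tctx σ τ C D) := by
  induction C using List.reverseRecOn with
  | nil =>
    exact ⟨.nil, hD.dctx, hC.agree, hD.agree, by simpa [tctx, grid_nil] using DCtx.nil, by simp⟩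
  | append_singleton C p ih =>
    obtain ⟨z, U⟩ := p
    rw [tctx_append]
    refine (ih hC.left).row hC.last.1 hC.last.2 hD hc fun r hr => ?_
    obtain ⟨p, hp, q, hq, rfl⟩ := mem_tctx.1 hr
    exact hC.last.1.fresh p hp

theorem Tele.fr_corner (hC : Tele σ (C ++ [(z, U)]) n) (hk : Tele σ C k)
    (hD : Tele τ (D ++ [(y, V)]) m) (hl : Tele τ D l)
    (hc : ∀ n' ≤ k, ∀ l' ≤ m, Claims c n' l') (hc' : ∀ n' ≤ n, ∀ l' ≤ l, Claims c n' l') :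
    Fr c σ τ C (D ++ [(y, V)]) (tctx σ τ C (D ++ [(y, V)]) ++ tctx σ τ [(z, U)] D) ∧
    Fr c σ τ (C ++ [(z, U)]) D (tctx σ τ C (D ++ [(y, V)]) ++ tctx σ τ [(z, U)] D) := by
  have F := hk.fr hD hc
  have G := F.left.row hC.last.1 hC.last.2 hl hc' fun r hr => by
    obtain ⟨p, hp, q, hq, rfl⟩ := mem_tctx.1 hr
    exact hC.last.1.fresh p hp
  exact ⟨F.weaken G.ctx, G⟩

end

end

section
variable {𝔸 : Thy A} {𝔹 : Thy B}

/-- The terms over `C` whose image under `φ` is a term over `X` of rank at most `k`. -/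
def Im (𝔸 : Thy A) (C X : PreCtx A) (φ : A.Var → Expr A) (k : ℕ) (α : Expr A) : Prop :=
  (∃ j S, W 𝔸.ax j C (.tm α S)) ∧ ∃ S, W 𝔸.ax k X (.tm (α.subst φ) S)

/-- A substitution `φ` from `X` to `C`, together with a fresh variable `z : U₀` over `C`. -/
structure Sb (σ₀ : Env 𝔸) (C : PreCtx A) (z : A.Var) (U₀ : SortE A) (k : ℕ) (X : PreCtx A)
    (φ : A.Var → Expr A) : Prop where
  pt : Pt σ₀ C z U₀
  tele : Tele σ₀ C k
  args : ∀ p ∈ C, W 𝔸.ax k X (.tm (φ p.1) (p.2.subst φ))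

section
variable {σ₀ σ : Env 𝔸} {C X : PreCtx A} {z : A.Var} {U₀ : SortE A} {k : ℕ} {φ : A.Var → Expr A}
  {α : Expr A}

theorem Sb.exists (hz : Pt σ₀ C z U₀) (hC : ∀ C₀ p C₁, C = C₀ ++ p :: C₁ → W 𝔸.ax k C₀ (.so p.2))
    (ha : ∀ p ∈ C, W 𝔸.ax k X (.tm (φ p.1) (p.2.subst φ))) (u : Expr A) :
    ∃ φ', Sb σ₀ C z U₀ k X φ' ∧ φ' z = u ∧ ∀ x ∈ C.map Prod.fst, φ' x = φ x := by
  classical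
  have h : ∀ x ∈ C.map Prod.fst, Function.update φ z u x = φ x := fun x hx =>
    Function.update_of_ne (hz.mem_ne hx) ..
  exact ⟨Function.update φ z u, ⟨hz, ⟨hz.ctx.1, hz.agree, hC⟩,
    args_transfer hC (fun x hx => (h x hx).symm) ha⟩, Function.update_self .., h⟩

theorem Sb.im_var (S : Sb σ₀ C z U₀ k X φ) {p : A.Var × SortE A} (hp : p ∈ C) :
    Im 𝔸 C X φ k (.var p.1) :=
  ⟨⟨k, _, S.tele.var hp⟩, p.2.subst φ, by rw [subst_var]; exact S.args p hp⟩

theorem Im.typed (h : Im 𝔸 C X φ k α) (S : Sb σ₀ C z U₀ k X φ) (hσ : Agree σ X) :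
    W 𝔸.ax k X (.tm (α.subst φ) ((cs σ₀ α).subst φ)) := by
  obtain ⟨⟨j, T, hT⟩, T', hT'⟩ := h
  cases α with
  | var x =>
    obtain ⟨T₀, hx⟩ := hT.var_mem
    rw [cs_var, S.tele.agree _ hx, subst_var]
    exact S.args _ hx
  | app s es =>
    have := hT'.cs hσ
    rwa [cs_subst hT (σ₀ := σ₀)] at this

theorem Sb.im_sort {n : ℕ} (S : Sb σ₀ C z U₀ k X φ) {U : SortE A} (hU : Dv 𝔸.ax C (.so U))
    (hU' : W 𝔸.ax n X (.so (U.subst φ))) (hn : n ≤ k + 1) {a : Expr A} (ha : a ∈ U.args) :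
    Im 𝔸 C X φ k a := by
  obtain ⟨j, T, hT⟩ := hU.args ha
  obtain ⟨k', T', hk', hT'⟩ := hU'.args_so (List.mem_map_of_mem ha)
  exact ⟨⟨j, T, hT⟩, T', hT'.mono (by omega)⟩

theorem Im.cs (h : Im 𝔸 C X φ k α) (S : Sb σ₀ C z U₀ k X φ) (hσ : Agree σ X) {a : Expr A}
    (ha : a ∈ (cs σ₀ α).args) : Im 𝔸 C X φ k a := by
  obtain ⟨j, T, hT⟩ := h.1
  exact S.im_sort ⟨j, (hT.cs S.tele.agree).presup⟩ (h.typed S hσ).presup (by omega) ha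

theorem Im.app {s : A.TermSym} {es : List (Expr A)} (h : Im 𝔸 C X φ k (.app s es)) {a : Expr A}
    (ha : a ∈ es) : Im 𝔸 C X φ k a := by
  obtain ⟨⟨j, T, hT⟩, T', hT'⟩ := h
  obtain ⟨j', S, -, hS⟩ := hT.args_app ha
  rw [subst_app] at hT'
  obtain ⟨k', S', hk', hS'⟩ := hT'.args_app (List.mem_map_of_mem ha)
  exact ⟨⟨j', S, hS⟩, S', hS'.mono hk'.le⟩

theorem Im.arg (h : Im 𝔸 C X φ k α) (hz : Pt σ₀ C z U₀) :
    ∃ j, Arg σ₀ (C ++ [(z, U₀)]) j α := by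
  obtain ⟨j, T, hT⟩ := h.1
  exact ⟨j, (hT.weaken _).arg hz.agree_concat⟩

end

/-- The pairs of terms in `I` and `J`, together with the pairs containing `z` or `y` if `p` or `q`
holds. -/
def Pairs (I : Expr A → Prop) (J : Expr B → Prop) (p q : Prop) (z : A.Var) (y : B.Var)
    (α : Expr A) (β : Expr B) : Prop :=
  I α ∧ J β ∨ (p ∧ α = .var z) ∧ J β ∨ I α ∧ q ∧ β = .var y

section
variable {c : Ch 𝔸 𝔹} {σ₀ σ : Env 𝔸} {τ₀ τ : Env 𝔹} {C X : PreCtx A} {D Y : PreCtx B}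
  {Z : PreCtx (A.tensor B)} {ρ : (A.tensor B).Var → Expr (A.tensor B)} {φ : A.Var → Expr A}
  {ψ : B.Var → Expr B} {U₀ : SortE A} {V₀ : SortE B} {z : A.Var} {y : B.Var} {k l : ℕ}
  {p q : Prop}

/-- The compatibility statement for a pair of substitutions. -/
abbrev SbHom (c : Ch 𝔸 𝔹) (σ₀ : Env 𝔸) (τ₀ : Env 𝔹) (C : PreCtx A) (z : A.Var) (U₀ : SortE A)
    (k : ℕ) (X : PreCtx A) (φ : A.Var → Expr A) (D : PreCtx B) (y : B.Var) (V₀ : SortE B) (l : ℕ)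
    (Y : PreCtx B) (ψ : B.Var → Expr B) (σ : Env 𝔸) (τ : Env 𝔹) (Z : PreCtx (A.tensor B))
    (p q : Prop) (ρ : (A.tensor B).Var → Expr (A.tensor B)) : Prop :=
  Hom c σ₀ τ₀ (C ++ [(z, U₀)]) (D ++ [(y, V₀)]) σ τ Z
    (Pairs (Im 𝔸 C X φ k) (Im 𝔹 D Y ψ l) p q z y) ρ φ ψ

theorem Sb.hom (SA : Sb σ₀ C z U₀ k X φ) (SB : Sb τ₀ D y V₀ l Y ψ) (F : Fr c σ τ X Y Z)
    (hc : Claims c k l)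
    (hp : p → (∀ a ∈ U₀.args, Im 𝔸 C X φ k a) ∧ PtL c σ τ Y Z (φ z) (U₀.subst φ) (l + 1))
    (hq : q → (∀ b ∈ V₀.args, Im 𝔹 D Y ψ l b) ∧ PtR c σ τ X Z (ψ y) (V₀.subst ψ) (k + 1))
    (hρ : ∀ a b, Pairs (Im 𝔸 C X φ k) (Im 𝔹 D Y ψ l) p q z y (.var a) (.var b) →
      ρ (a, b) = tens σ τ (φ a) (ψ b)) :
    SbHom c σ₀ τ₀ C z U₀ k X φ D y V₀ l Y ψ σ τ Z p q ρ where
  nd := F.nd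
  aC := SA.pt.agree_concat
  aD := SB.pt.agree_concat
  argA := by
    rintro α β (⟨h, -⟩ | ⟨⟨-, rfl⟩, -⟩ | ⟨h, -⟩)
    · exact h.arg SA.pt
    · exact SA.pt.var.imp fun _ h => h.arg SA.pt.agree_concat
    · exact h.arg SA.pt
  argB := by
    rintro α β (⟨-, h⟩ | ⟨-, h⟩ | ⟨-, -, rfl⟩)
    · exact h.arg SB.pt
    · exact h.arg SB.pt
    · exact SB.pt.var.imp fun _ h => h.arg SB.pt.agree_concat
  csA := by
    rintro α β (⟨h, h'⟩ | ⟨⟨hp', rfl⟩, h'⟩ | ⟨h, h'⟩) a ha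
    · exact .inl ⟨h.cs SA F.aX ha, h'⟩
    · rw [cs_var, SA.pt.sort] at ha
      exact .inl ⟨(hp hp').1 a ha, h'⟩
    · exact .inr (.inr ⟨h.cs SA F.aX ha, h'⟩)
  csB := by
    rintro α β (⟨h, h'⟩ | ⟨h, h'⟩ | ⟨h, hq', rfl⟩) a ha
    · exact .inl ⟨h, h'.cs SB F.aY ha⟩
    · exact .inr (.inl ⟨h, h'.cs SB F.aY ha⟩)
    · rw [cs_var, SB.pt.sort] at ha
      exact .inl ⟨h, (hq hq').1 a ha⟩
  appA := by
    rintro s es β (⟨h, h'⟩ | ⟨⟨-, h⟩, -⟩ | ⟨h, h'⟩) a ha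
    · exact .inl ⟨h.app ha, h'⟩
    · cases h
    · exact .inr (.inr ⟨h.app ha, h'⟩)
  appB := by
    rintro α t es (⟨h, h'⟩ | ⟨h, h'⟩ | ⟨-, -, h⟩) a ha
    · exact .inl ⟨h, h'.app ha⟩
    · exact .inr (.inl ⟨h, h'.app ha⟩)
    · cases h
  rho h := hρ _ _ h
  good := by
    rintro α β (⟨h, h'⟩ | ⟨⟨hp', rfl⟩, h'⟩ | ⟨h, hq', rfl⟩)
    · exact hc.pair F (h.typed SA F.aX) (h'.typed SB F.aY)
    · rw [subst_var, cs_var, SA.pt.sort]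
      exact (hp hp').2.good l (Nat.lt_succ_self l) _ _ (h'.typed SB F.aY)
    · rw [subst_var, cs_var, SB.pt.sort]
      exact (hq hq').2.good k (Nat.lt_succ_self k) _ _ (h.typed SA F.aX)

theorem Hom.entry_var {C : PreCtx A} {D : PreCtx B} {P : Expr A → Expr B → Prop}
    (H : Hom c σ₀ τ₀ C D σ τ Z P ρ φ ψ) {p : A.Var × SortE A} {q : B.Var × SortE B} (hp : p ∈ C)
    (hq : q ∈ D) (h : P (.var p.1) (.var q.1)) :
    Dv c.T Z (.tm (ρ (p.1, q.1)) ((Ty σ₀ τ₀ p.2 q.2 (.var p.1) (.var q.1)).subst ρ)) := by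
  have := H.entry h
  rwa [tens_var, subst_var, cs_var, cs_var, H.aC p hp, H.aD q hq] at this

theorem Sb.args_base (SA : Sb σ₀ C z U₀ k X φ) (SB : Sb τ₀ D y V₀ l Y ψ)
    (H : SbHom c σ₀ τ₀ C z U₀ k X φ D y V₀ l Y ψ σ τ Z p q ρ) :
    ∀ r ∈ tctx σ₀ τ₀ C D, Dv c.T Z (.tm (ρ r.1) (r.2.subst ρ)) := by
  intro r hr
  obtain ⟨p, hp, q, hq, rfl⟩ := mem_tctx.1 hr
  exact H.entry_var (List.mem_append_left _ hp) (List.mem_append_left _ hq)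
    (.inl ⟨SA.im_var hp, SB.im_var hq⟩)

theorem Sb.args_row (SA : Sb σ₀ C z U₀ k X φ) (SB : Sb τ₀ D y V₀ l Y ψ)
    (H : SbHom c σ₀ τ₀ C z U₀ k X φ D y V₀ l Y ψ σ τ Z p q ρ) (hp : p) :
    ∀ r ∈ tctx σ₀ τ₀ [(z, U₀)] D, Dv c.T Z (.tm (ρ r.1) (r.2.subst ρ)) := by
  intro r hr
  obtain ⟨_, hp', q, hq, rfl⟩ := mem_tctx.1 hr
  obtain rfl := List.mem_singleton.1 hp'
  exact H.entry_var (List.mem_append_right _ hp') (List.mem_append_left _ hq)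
    (.inr (.inl ⟨⟨hp, rfl⟩, SB.im_var hq⟩))

theorem Sb.args_left (SA : Sb σ₀ C z U₀ k X φ) (SB : Sb τ₀ D y V₀ l Y ψ)
    (H : SbHom c σ₀ τ₀ C z U₀ k X φ D y V₀ l Y ψ σ τ Z p q ρ) (hp : p) :
    ∀ r ∈ tctx σ₀ τ₀ (C ++ [(z, U₀)]) D, Dv c.T Z (.tm (ρ r.1) (r.2.subst ρ)) := by
  intro r hr
  rw [tctx_append] at hr
  exact (List.mem_append.1 hr).elim (SA.args_base SB H r) (SA.args_row SB H hp r)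

theorem Sb.args_right (SA : Sb σ₀ C z U₀ k X φ) (SB : Sb τ₀ D y V₀ l Y ψ)
    (H : SbHom c σ₀ τ₀ C z U₀ k X φ D y V₀ l Y ψ σ τ Z p q ρ) (hq : q) :
    ∀ r ∈ tctx σ₀ τ₀ C (D ++ [(y, V₀)]), Dv c.T Z (.tm (ρ r.1) (r.2.subst ρ)) := by
  intro r hr
  obtain ⟨p, hp, _, hq', rfl⟩ := mem_tctx.1 hr
  rcases List.mem_append.1 hq' with hq' | hq'
  · exact SA.args_base SB H _ (mem_tctx.2 ⟨p, hp, _, hq', rfl⟩)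
  · obtain rfl := List.mem_singleton.1 hq'
    exact H.entry_var (List.mem_append_left _ hp) (List.mem_append_right _ hq')
      (.inr (.inr ⟨SA.im_var hp, hq, rfl⟩))

theorem Sb.args_corner (SA : Sb σ₀ C z U₀ k X φ) (SB : Sb τ₀ D y V₀ l Y ψ)
    (H : SbHom c σ₀ τ₀ C z U₀ k X φ D y V₀ l Y ψ σ τ Z p q ρ) (hp : p) (hq : q) :
    ∀ r ∈ tctx σ₀ τ₀ C (D ++ [(y, V₀)]) ++ tctx σ₀ τ₀ [(z, U₀)] D,
      Dv c.T Z (.tm (ρ r.1) (r.2.subst ρ)) := fun r hr =>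
  (List.mem_append.1 hr).elim (SA.args_right SB H hq r) (SA.args_row SB H hp r)

end

end

section
variable {𝔸 : Thy A} {𝔹 : Thy B}

section
variable {σ₀ σ : Env 𝔸} {C X : PreCtx A} {z : A.Var} {U₀ : SortE A} {k n : ℕ} {φ : A.Var → Expr A}
  {α : Expr A}

theorem ctxVars_map (C : PreCtx A) (φ : A.Var → Expr A) :
    (ctxVars C).map (Expr.subst φ) = C.map fun p => φ p.1 := by
  simp [ctxVars]

theorem Tele.var_subst (h : Tele σ₀ C k) :
    ∀ p ∈ C, W 𝔸.ax k C (.tm (.var p.1) (p.2.subst .var)) := fun p hp => by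
  rw [ssubst_id]
  exact h.var hp

theorem Tele.sort (h : Tele σ₀ C k) {S : A.SortSym} (hS : introSort C S ∈ 𝔸.ax) :
    W 𝔸.ax (k + 1) C (.so ⟨S, ctxVars C⟩) :=
  .so k.lt_succ_self hS h.nd h.so h.var_subst

theorem Tele.term (h : Tele σ₀ C k) {s : A.TermSym} (hs : introTerm C s U₀ ∈ 𝔸.ax)
    (hU : W 𝔸.ax k C (.so U₀)) : W 𝔸.ax (k + 1) C (.tm (.app s (ctxVars C)) U₀) := by
  have := W.tm (φ := .var) k.lt_succ_self hs h.nd h.so hU h.var_subst (by rwa [ssubst_id])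
  rwa [ssubst_id] at this

theorem Sb.tele_concat (S : Sb σ₀ C z U₀ k X φ) (hk : k ≤ n) (hU : W 𝔸.ax n C (.so U₀)) :
    Tele σ₀ (C ++ [(z, U₀)]) n := (S.tele.mono hk).concat S.pt hU

theorem Dv.subst_eq {U : SortE A} (hU : Dv 𝔸.ax C (.so U)) {φ' : A.Var → Expr A}
    (h : ∀ x ∈ C.map Prod.fst, φ' x = φ x) : U.subst φ' = U.subst φ :=
  ssubst_congr fun x hx => h x (hU.scoped x hx)

theorem W.so_sb {S : A.SortSym} {es : List (Expr A)} (h : W 𝔸.ax n X (.so ⟨S, es⟩)) (u : Expr A)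
    {a : PreCtx A → A.Var} (ha : FreshCh a) : ∃ (k : ℕ) (C : PreCtx A) (σ₀ : Env 𝔸) (φ : A.Var → Expr A), k < n ∧
      introSort C S ∈ 𝔸.ax ∧
      Sb σ₀ C (a C) ⟨S, ctxVars C⟩ k X φ ∧ es = (ctxVars C).map (Expr.subst φ) ∧
      φ (a C) = u := by
  obtain ⟨k, C, φ, hk, ax, nd, hC, hφ, he⟩ := h.so_inv
  obtain ⟨σ₀, hz⟩ := 𝔸.exists_pt_sort ax (ha C)
  obtain ⟨φ', hS, hu, hφ'⟩ := Sb.exists hz hC hφ u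
  refine ⟨k, C, σ₀, φ', hk, ax, hS, ?_, hu⟩
  rw [ctxVars_map]
  exact he.trans (List.map_congr_left fun p hp => (hφ' _ (List.mem_map_of_mem hp)).symm)

theorem W.app_sb {s : A.TermSym} {es : List (Expr A)} {U : SortE A}
    (h : W 𝔸.ax n X (.tm (.app s es) U)) (u : Expr A) {a : PreCtx A → A.Var} (ha : FreshCh a) :
    ∃ (k : ℕ) (C : PreCtx A) (U₀ : SortE A) (σ₀ : Env 𝔸) (φ : A.Var → Expr A), k < n ∧
      introTerm C s U₀ ∈ 𝔸.ax ∧ Sb σ₀ C (a C) U₀ k X φ ∧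
      W 𝔸.ax k C (.so U₀) ∧ W 𝔸.ax k X (.so (U₀.subst φ)) ∧
      es = (ctxVars C).map (Expr.subst φ) ∧ (∀ σ : Env 𝔸, GATPaper.cs σ (.app s es) = U₀.subst φ) ∧
      φ (a C) = u := by
  obtain ⟨k, C, U₀, φ, hk, ax, nd, hC, hU, hφ, hU', rfl, -⟩ := h.app_inv
  obtain ⟨σ₀, hz⟩ := 𝔸.exists_pt_term ax (ha C)
  obtain ⟨φ', hS, hu, hφ'⟩ := Sb.exists hz hC hφ u
  have e := Dv.subst_eq ⟨k, hU⟩ hφ'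
  refine ⟨k, C, U₀, σ₀, φ', hk, ax, hS, hU, e ▸ hU', ?_, fun σ => ?_, hu⟩
  · rw [ctxVars_map]
    exact List.map_congr_left fun p hp => (hφ' _ (List.mem_map_of_mem hp)).symm
  · rw [cs_app σ ax ⟨k, hU⟩, e]

end

section
variable {c : Ch 𝔸 𝔹} {σ₀ σ : Env 𝔸} {τ₀ τ : Env 𝔹} {C X : PreCtx A} {D Y : PreCtx B}
  {Z : PreCtx (A.tensor B)} {ρ : (A.tensor B).Var → Expr (A.tensor B)} {φ : A.Var → Expr A}
  {ψ : B.Var → Expr B} {U₀ : SortE A} {V₀ : SortE B} {z : A.Var} {y : B.Var} {k l n m : ℕ}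

/-- The substitution induced by two substitutions. -/
noncomputable def rho (σ : Env 𝔸) (τ : Env 𝔹) (φ : A.Var → Expr A) (ψ : B.Var → Expr B) :
    (A.tensor B).Var → Expr (A.tensor B) := fun r => tens σ τ (φ r.1) (ψ r.2)

theorem map_rho (C : PreCtx A) (D : PreCtx B) :
    ((tctx σ₀ τ₀ C D).map fun r => rho σ τ φ ψ r.1) =
      grid (tens σ τ) ((ctxVars C).map (Expr.subst φ)) ((ctxVars D).map (Expr.subst ψ)) := by
  rw [map_tctx, ctxVars_map, ctxVars_map, grid_map]
  rfl

theorem ctxVars_concat (C : PreCtx A) (x : A.Var) (U : SortE A) :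
    ctxVars (C ++ [(x, U)]) = ctxVars C ++ [.var x] := by
  simp [ctxVars]

theorem Below.fr_corner (hB : Below c n m) (SA : Sb σ₀ C z U₀ k X φ) (SB : Sb τ₀ D y V₀ l Y ψ)
    (hk : k < n) (hl : l < m) (hU : W 𝔸.ax n C (.so U₀)) (hV : W 𝔹.ax m D (.so V₀)) :
    Fr c σ₀ τ₀ C (D ++ [(y, V₀)])
      (tctx σ₀ τ₀ C (D ++ [(y, V₀)]) ++ tctx σ₀ τ₀ [(z, U₀)] D) ∧
    Fr c σ₀ τ₀ (C ++ [(z, U₀)]) D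
      (tctx σ₀ τ₀ C (D ++ [(y, V₀)]) ++ tctx σ₀ τ₀ [(z, U₀)] D) :=
  (SA.tele_concat hk.le hU).fr_corner SA.tele (SB.tele_concat hl.le hV) SB.tele
    (fun n' hn m' hm => hB n' m' (by omega) hm (.inl (by omega)))
    fun n' hn m' hm => hB n' m' hn (by omega) (.inr (by omega))

theorem Below.fr_left (hB : Below c n m) (SA : Sb σ₀ C z U₀ k X φ) (SB : Sb τ₀ D y V₀ l Y ψ)
    (hk : k < n) (hl : l < m) (hU : W 𝔸.ax n C (.so U₀)) :
    Fr c σ₀ τ₀ (C ++ [(z, U₀)]) D (tctx σ₀ τ₀ (C ++ [(z, U₀)]) D) :=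
  (SA.tele_concat hk.le hU).fr SB.tele fun n' hn m' hm => hB n' m' hn (by omega) (.inr (by omega))

theorem Below.fr_right (hB : Below c n m) (SA : Sb σ₀ C z U₀ k X φ) (SB : Sb τ₀ D y V₀ l Y ψ)
    (hk : k < n) (hl : l < m) (hV : W 𝔹.ax m D (.so V₀)) :
    Fr c σ₀ τ₀ C (D ++ [(y, V₀)]) (tctx σ₀ τ₀ C (D ++ [(y, V₀)])) :=
  SA.tele.fr (SB.tele_concat hl.le hV) fun n' hn m' hm => hB n' m' (by omega) hm (.inl (by omega))

theorem Sb.im_base (SA : Sb σ₀ C z U₀ k X φ) {a : Expr A} (ha : a ∈ ctxVars C) :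
    Im 𝔸 C X φ k a := by
  obtain ⟨p, hp, rfl⟩ := List.mem_map.1 ha
  exact SA.im_var hp

theorem Below.sort (hB : Below c n m) (F : Fr c σ τ X Y Z) {U : SortE A} {V : SortE B}
    {u : Expr A} {v : Expr B} (hU : W 𝔸.ax n X (.so U)) (hV : W 𝔹.ax m Y (.so V))
    (hu : PtL c σ τ Y Z u U m) (hv : PtR c σ τ X Z v V n) : Dv c.T Z (.so (Ty σ τ U V u v)) := by
  obtain ⟨S, es⟩ := U
  obtain ⟨R, fs⟩ := V
  obtain ⟨k, C, σ₀, φ, hk, hS, SA, rfl, rfl⟩ := hU.so_sb u c.fresh_a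
  obtain ⟨l, D, τ₀, ψ, hl, hR, SB, rfl, rfl⟩ := hV.so_sb v c.fresh_b
  have E := (hB.fr_corner SA SB hk hl ((SA.tele.sort hS).mono hk) ((SB.tele.sort hR).mono hl)).1
  have H := SA.hom SB F (hB.both hk hl) (p := True) (q := True) (ρ := rho σ τ φ ψ)
    (fun _ => ⟨fun a ha => SA.im_base ha, hu.mono hl⟩)
    (fun _ => ⟨fun a ha => SB.im_base ha, hv.mono hk⟩) (fun _ _ _ => rfl)
  have := Dv.so (intro_ss hS hR SA.pt SB.pt) E.ctx (SA.args_corner SB H trivial trivial)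
  rw [List.map_append, map_rho, map_rho, ctxVars_concat, List.map_append] at this
  simpa [Ty, ctxVars, grid_singleton] using this

end

end

section
variable {𝔸 : Thy A} {𝔹 : Thy B}

section
variable {c : Ch 𝔸 𝔹} {σ₀ σ : Env 𝔸} {τ₀ τ : Env 𝔹} {C X : PreCtx A} {D Y : PreCtx B}
  {Z : PreCtx (A.tensor B)} {ρ : (A.tensor B).Var → Expr (A.tensor B)} {φ : A.Var → Expr A}
  {ψ : B.Var → Expr B} {U₀ U U' : SortE A} {V₀ V V' : SortE B} {z : A.Var} {y : B.Var}
  {k l n m : ℕ} {u u' : Expr A} {v v' : Expr B}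

theorem Sb.mono (S : Sb σ₀ C z U₀ k X φ) (hk : k ≤ n) : Sb σ₀ C z U₀ n X φ :=
  ⟨S.pt, S.tele.mono hk, fun p hp => (S.args p hp).mono hk⟩

theorem Im.mono {a : Expr A} (h : Im 𝔸 C X φ k a) (hk : k ≤ n) : Im 𝔸 C X φ n a :=
  ⟨h.1, h.2.imp fun _ h => h.mono hk⟩

/-- The compatibility statement for a pair of substitutions, without fresh variables. -/
theorem Sb.hom_base (SA : Sb σ₀ C z U₀ k X φ) (SB : Sb τ₀ D y V₀ l Y ψ) (F : Fr c σ τ X Y Z)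
    (hc : Claims c k l) :
    SbHom c σ₀ τ₀ C z U₀ k X φ D y V₀ l Y ψ σ τ Z False False (rho σ τ φ ψ) :=
  SA.hom SB F hc False.elim False.elim fun _ _ _ => rfl

theorem Sb.hom_left (SA : Sb σ₀ C z U₀ k X φ) (SB : Sb τ₀ D y V₀ l Y ψ) (F : Fr c σ τ X Y Z)
    (hc : Claims c k l) (hU : ∀ a ∈ U₀.args, Im 𝔸 C X φ k a)
    (hu : PtL c σ τ Y Z (φ z) (U₀.subst φ) (l + 1)) :
    SbHom c σ₀ τ₀ C z U₀ k X φ D y V₀ l Y ψ σ τ Z True False (rho σ τ φ ψ) :=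
  SA.hom SB F hc (fun _ => ⟨hU, hu⟩) False.elim fun _ _ _ => rfl

theorem Sb.hom_right (SA : Sb σ₀ C z U₀ k X φ) (SB : Sb τ₀ D y V₀ l Y ψ) (F : Fr c σ τ X Y Z)
    (hc : Claims c k l) (hV : ∀ b ∈ V₀.args, Im 𝔹 D Y ψ l b)
    (hv : PtR c σ τ X Z (ψ y) (V₀.subst ψ) (k + 1)) :
    SbHom c σ₀ τ₀ C z U₀ k X φ D y V₀ l Y ψ σ τ Z False True (rho σ τ φ ψ) :=
  SA.hom SB F hc False.elim (fun _ => ⟨hV, hv⟩) fun _ _ _ => rfl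

theorem Sb.hom_corner (SA : Sb σ₀ C z U₀ k X φ) (SB : Sb τ₀ D y V₀ l Y ψ) (F : Fr c σ τ X Y Z)
    (hc : Claims c k l) (hU : ∀ a ∈ U₀.args, Im 𝔸 C X φ k a)
    (hu : PtL c σ τ Y Z (φ z) (U₀.subst φ) (l + 1)) (hV : ∀ b ∈ V₀.args, Im 𝔹 D Y ψ l b)
    (hv : PtR c σ τ X Z (ψ y) (V₀.subst ψ) (k + 1)) :
    SbHom c σ₀ τ₀ C z U₀ k X φ D y V₀ l Y ψ σ τ Z True True (rho σ τ φ ψ) :=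
  SA.hom SB F hc (fun _ => ⟨hU, hu⟩) (fun _ => ⟨hV, hv⟩) fun _ _ _ => rfl

theorem Below.appL (hB : Below c n m) (F : Fr c σ τ X Y Z) {t : B.TermSym} {p : List (Expr B)}
    (hU : W 𝔸.ax n X (.so U)) (hv : W 𝔹.ax m Y (.tm (.app t p) V)) (hu : PtL c σ τ Y Z u U m) :
    Dv c.T Z (.tm (inlApp σ τ U u t p) (Ty σ τ U (cs τ (.app t p)) u (.app t p))) := by
  obtain ⟨S, es⟩ := U
  obtain ⟨k, C, σ₀, φ, hk, hS, SA, rfl, rfl⟩ := hU.so_sb u c.fresh_a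
  obtain ⟨l, D, V₀, τ₀, ψ, hl, ht, SB, hV₀, hV, rfl, hcs, -⟩ := hv.app_sb (.app t p) c.fresh_b
  have hU₀ := (SA.tele.sort hS).mono hk
  have hv₀ := (SB.tele.term ht hV₀).mono hl
  have E := hB.fr_left SA SB hk hl hU₀
  have hso := (hB.right hl).sort E (hU₀.weaken _) hV₀
    (.of E (fun l' h => hB.right (h.trans hl)) (W.var (X₁ := []) hU₀))
    (.of E (fun k h => hB.left h) hv₀)
  have H := SA.hom_left SB F (hB.both hk hl) (fun a ha => SA.im_base ha) (hu.mono hl)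
  have H' := SA.hom_base (SB.mono hl.le) F (hB.left hk)
  have h := Dv.tm (intro_st hS ht SA.pt SB.pt) E.ctx hso (SA.args_left SB H trivial)
  rw [map_rho, ctxVars_concat, List.map_append] at h
  have hIm : ∀ b ∈ V₀.args, Im 𝔹 D Y ψ l b := fun b hb => SB.im_sort ⟨l, hV₀⟩ hV (by omega) hb
  have := Ty_te (σ := σ) (τ := τ) (φ := φ) (ψ := ψ) (ρ := rho σ τ φ ψ) F.nd
    (U := ⟨S, ctxVars C⟩) (V := V₀) (α := .var (c.a C)) (β := .app t (ctxVars D)) (σ₀ := σ₀)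
    (τ₀ := τ₀)
    (fun a ha b hb => by
      refine H'.te (.inl ⟨SA.im_base ha, ?_⟩)
      rcases List.mem_append.1 hb with hb | hb
      · exact (hIm b hb).mono hl.le
      · obtain rfl := List.mem_singleton.1 hb
        exact ⟨⟨_, _, hv₀⟩, _, by rw [subst_app]; exact hv⟩)
    (fun b hb => H.te (.inr (.inl ⟨⟨trivial, rfl⟩, hIm b hb⟩)))
    ((hB.right hl).sort F hU hV (by rw [subst_var]; exact hu.mono hl.le)
      (.of F (fun k h => hB.left h) (by rw [subst_app, ← hcs τ]; exact hv.cs F.aY)))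
  have := h.conv this.ssym
  rw [List.map_cons, List.map_nil, subst_app, subst_var, ← hcs τ] at this
  exact this

theorem Below.appR (hB : Below c n m) (F : Fr c σ τ X Y Z) {s : A.TermSym} {h : List (Expr A)}
    (hu : W 𝔸.ax n X (.tm (.app s h) U)) (hV : W 𝔹.ax m Y (.so V)) (hv : PtR c σ τ X Z v V n) :
    Dv c.T Z (.tm (inrApp σ τ s h V v) (Ty σ τ (cs σ (.app s h)) V (.app s h) v)) := by
  obtain ⟨R, es⟩ := V
  obtain ⟨l, D, τ₀, ψ, hl, hR, SB, rfl, rfl⟩ := hV.so_sb v c.fresh_b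
  obtain ⟨k, C, U₀, σ₀, φ, hk, hs, SA, hU₀, hU, rfl, hcs, -⟩ := hu.app_sb (.app s h) c.fresh_a
  have hV₀ := (SB.tele.sort hR).mono hl
  have hu₀ := (SA.tele.term hs hU₀).mono hk
  have E := hB.fr_right SA SB hk hl hV₀
  have hso := (hB.left hk).sort E hU₀ (hV₀.weaken _)
    (.of E (fun l h => hB.right h) hu₀)
    (.of E (fun k' h => hB.left (h.trans hk)) (W.var (X₁ := []) hV₀))
  have H := SA.hom_right SB F (hB.both hk hl) (fun a ha => SB.im_base ha) (hv.mono hk)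
  have H' := (SA.mono hk.le).hom_base SB F (hB.right hl)
  have h := Dv.tm (intro_ts hs hR SA.pt SB.pt) E.ctx hso (SA.args_right SB H trivial)
  rw [map_rho, ctxVars_concat, List.map_append] at h
  have hIm : ∀ a ∈ U₀.args, Im 𝔸 C X φ k a := fun a ha => SA.im_sort ⟨k, hU₀⟩ hU (by omega) ha
  have := Ty_te (σ := σ) (τ := τ) (φ := φ) (ψ := ψ) (ρ := rho σ τ φ ψ) F.nd
    (U := U₀) (V := ⟨R, ctxVars D⟩) (α := .app s (ctxVars C)) (β := .var (c.b D)) (σ₀ := σ₀)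
    (τ₀ := τ₀)
    (fun a ha b hb => by
      rcases List.mem_append.1 hb with hb | hb
      · exact H.te (.inl ⟨hIm a ha, SB.im_base hb⟩)
      · obtain rfl := List.mem_singleton.1 hb
        exact H.te (.inr (.inr ⟨hIm a ha, trivial, rfl⟩)))
    (fun b hb => H'.te (.inl ⟨⟨⟨_, _, hu₀⟩, _, by rw [subst_app]; exact hu⟩, SB.im_base hb⟩))
    ((hB.left hk).sort F hU hV
      (.of F (fun l h => hB.right h) (by rw [subst_app, ← hcs σ]; exact hu.cs F.aX))
      (by rw [subst_var]; exact hv.mono hk.le))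
  have := h.conv this.ssym
  rw [List.map_cons, List.map_nil, subst_app, subst_var, ← hcs σ] at this
  exact this

end

end

section
variable {𝔸 : Thy A} {𝔹 : Thy B}

section
variable {c : Ch 𝔸 𝔹} {σ₀ σ : Env 𝔸} {τ₀ τ : Env 𝔹} {C X : PreCtx A} {D Y : PreCtx B}
  {Z : PreCtx (A.tensor B)} {ρ : (A.tensor B).Var → Expr (A.tensor B)} {φ : A.Var → Expr A}
  {ψ : B.Var → Expr B} {U₀ U U' : SortE A} {V₀ V V' : SortE B} {z : A.Var} {y : B.Var}
  {k l n m : ℕ} {u u' : Expr A} {v v' : Expr B}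

theorem Sb.exists_id (hz : Pt σ₀ C z U₀) (h : Tele σ₀ C k) (u : Expr A) :
    ∃ φ, Sb σ₀ C z U₀ k C φ ∧ φ z = u ∧ ∀ x ∈ C.map Prod.fst, φ x = .var x :=
  Sb.exists hz h.so h.var_subst u

theorem Dv.subst_fix (hU : Dv 𝔸.ax C (.so U)) (h : ∀ x ∈ C.map Prod.fst, φ x = .var x) :
    U.subst φ = U :=
  (hU.subst_eq h).trans (ssubst_id U)

theorem cs_intro (σ : Env 𝔸) {s : A.TermSym} (hs : introTerm C s U ∈ 𝔸.ax)
    (hU : Dv 𝔸.ax C (.so U)) : cs σ (.app s (ctxVars C)) = U := by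
  simpa [ctxVars] using cs_app σ hs (φ := .var) hU

theorem Im.var_mem {x : A.Var} (h : Im 𝔸 C X φ k (.var x)) : x ∈ C.map Prod.fst := by
  obtain ⟨⟨j, S, h⟩, -⟩ := h
  obtain ⟨U, h⟩ := h.var_mem
  exact List.mem_map_of_mem h

/-- Both sides of the interchange axiom for two term symbols are typed. -/
theorem Below.tt_typed (hB : Below c n m) (tC : Tele σ₀ C k) (tD : Tele τ₀ D l)
    (hx : Pt σ₀ C z U₀) (hy : Pt τ₀ D y V₀) {s : A.TermSym} {t : B.TermSym} (hk : k < n)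
    (hl : l < m) (hs : introTerm C s U₀ ∈ 𝔸.ax) (ht : introTerm D t V₀ ∈ 𝔹.ax)
    (hU₀ : W 𝔸.ax k C (.so U₀)) (hV₀ : W 𝔹.ax l D (.so V₀)) :
    Dv c.T (tctx σ₀ τ₀ C D) (.tm (inlApp σ₀ τ₀ U₀ (.app s (ctxVars C)) t (ctxVars D))
      ((Ty σ₀ τ₀ U₀ V₀ (.var z) (.var y)).substL
        (pL σ₀ τ₀ C y (.app t (ctxVars D)) ++ pR σ₀ τ₀ z D (.app s (ctxVars C))))) ∧
    Dv c.T (tctx σ₀ τ₀ C D) (.tm (inrApp σ₀ τ₀ s (ctxVars C) V₀ (.app t (ctxVars D)))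
      ((Ty σ₀ τ₀ U₀ V₀ (.var z) (.var y)).substL
        (pL σ₀ τ₀ C y (.app t (ctxVars D)) ++ pR σ₀ τ₀ z D (.app s (ctxVars C))))) := by
  have E := tC.fr tD (c := c) fun n' h m' h' =>
    hB n' m' (h.trans hk.le) (h'.trans hl.le) (.inl (h.trans_lt hk))
  have hu₀ := (tC.term hs hU₀).mono hk
  have hv₀ := (tD.term ht hV₀).mono hl
  have hL : PtL c σ₀ τ₀ D (tctx σ₀ τ₀ C D) (.app s (ctxVars C)) U₀ m :=
    .of E (fun l h => hB.right h) hu₀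
  have hR : PtR c σ₀ τ₀ C (tctx σ₀ τ₀ C D) (.app t (ctxVars D)) V₀ n :=
    .of E (fun l h => hB.left h) hv₀
  have h₁ := hB.appL E (hU₀.mono hk.le) hv₀ hL
  have h₂ := hB.appR E hu₀ (hV₀.mono hl.le) hR
  rw [cs_intro _ ht ⟨l, hV₀⟩] at h₁
  rw [cs_intro _ hs ⟨k, hU₀⟩] at h₂
  obtain ⟨φ, SA, hφ, hφ'⟩ := Sb.exists_id hx tC (.app s (ctxVars C))
  obtain ⟨ψ, SB, hψ, hψ'⟩ := Sb.exists_id hy tD (.app t (ctxVars D))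
  have eU : U₀.subst φ = U₀ := Dv.subst_fix ⟨k, hU₀⟩ hφ'
  have eV : V₀.subst ψ = V₀ := Dv.subst_fix ⟨l, hV₀⟩ hψ'
  have iU : ∀ a ∈ U₀.args, Im 𝔸 C C φ k a := fun a ha =>
    SA.im_sort ⟨k, hU₀⟩ (eU.symm ▸ hU₀) (by omega) ha
  have iV : ∀ b ∈ V₀.args, Im 𝔹 D D ψ l b := fun b hb =>
    SB.im_sort ⟨l, hV₀⟩ (eV.symm ▸ hV₀) (by omega) hb
  have H := SA.hom SB E (hB.both hk hl) (p := True) (q := True)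
    (ρ := lookupV (pL σ₀ τ₀ C y (.app t (ctxVars D)) ++ pR σ₀ τ₀ z D (.app s (ctxVars C))))
    (fun _ => ⟨iU, by rw [hφ, eU]; exact hL.mono hl⟩)
    (fun _ => ⟨iV, by rw [hψ, eV]; exact hR.mono hk⟩) (by
      rintro a b (⟨ha, hb⟩ | ⟨⟨-, ha⟩, hb⟩ | ⟨ha, -, hb⟩)
      · have ha := ha.var_mem
        have hb := hb.var_mem
        rw [lookupV_append_of_notMem (fun h => hy.mem_ne hb (mem_pL.1 h).1),
          lookupV_pR_of_ne (hx.mem_ne ha), hφ' a ha, hψ' b hb, tens_var]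
      · obtain rfl : a = z := by simpa using ha
        have hb := hb.var_mem
        rw [lookupV_append_of_notMem (fun h => hy.mem_ne hb (mem_pL.1 h).1),
          lookupV_pR hb, hφ, hψ' b hb]
      · obtain rfl : b = y := by simpa using hb
        have ha := ha.var_mem
        rw [lookupV_append_of_mem (mem_pL.2 ⟨rfl, ha⟩),
          lookupV_pL ha, hψ, hφ' a ha])
  have := Ty_te E.nd (U := U₀) (V := V₀) (α := .var z) (β := .var y)
    (fun a ha b hb => by
      rcases List.mem_append.1 hb with hb | hb
      · exact H.te (.inl ⟨iU a ha, iV b hb⟩)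
      · obtain rfl := List.mem_singleton.1 hb
        exact H.te (.inr (.inr ⟨iU a ha, trivial, rfl⟩)))
    (fun b hb => H.te (.inr (.inl ⟨⟨trivial, rfl⟩, iV b hb⟩)))
    (by
      rw [subst_var, subst_var, eU, eV, hφ, hψ]
      exact hB.sort E (hU₀.mono hk.le) (hV₀.mono hl.le) hL hR)
  rw [subst_var, subst_var, eU, eV, hφ, hψ] at this
  exact ⟨h₁.conv this, h₂.conv this⟩

theorem Below.tt (hB : Below c n m) (F : Fr c σ τ X Y Z) {s : A.TermSym} {h : List (Expr A)}
    {t : B.TermSym} {p : List (Expr B)}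
    (hu : W 𝔸.ax n X (.tm (.app s h) U)) (hv : W 𝔹.ax m Y (.tm (.app t p) V)) :
    Te c.T Z (inlApp σ τ (cs σ (.app s h)) (.app s h) t p)
      (inrApp σ τ s h (cs τ (.app t p)) (.app t p)) := by
  have h₁ := hB.appL F (hu.cs F.aX).presup hv (.of F (fun l h => hB.right h) (hu.cs F.aX))
  have h₂ := hB.appR F hu (hv.cs F.aY).presup (.of F (fun l h => hB.left h) (hv.cs F.aY))
  obtain ⟨k, C, U₀, σ₀, φ, hk, hs, SA, hU₀, hU, rfl, hcs, -⟩ := hu.app_sb (.app s h) c.fresh_a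
  obtain ⟨l, D, V₀, τ₀, ψ, hl, ht, SB, hV₀, hV, rfl, hcs', -⟩ := hv.app_sb (.app t p) c.fresh_b
  obtain ⟨e₁, e₂⟩ := hB.tt_typed SA.tele SB.tele SA.pt SB.pt hk hl hs ht hU₀ hV₀
  have H := SA.hom_base SB F (hB.both hk hl)
  have HL := (SA.mono hk.le).hom_base SB F (hB.right hl)
  have HR := SA.hom_base (SB.mono hl.le) F (hB.left hk)
  have hu₀ := (SA.tele.term hs hU₀).mono hk
  have hv₀ := (SB.tele.term ht hV₀).mono hl
  have : Te c.T Z _ _ := ⟨_, Dv.tax (ax_tt hs ht SA.pt SB.pt) (SA.tele.fr SB.tele fun n' h m' h' =>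
    hB n' m' (h.trans hk.le) (h'.trans hl.le) (.inl (h.trans_lt hk))).ctx e₁ e₂
    (SA.args_base SB H)⟩
  rw [hcs σ] at h₁ ⊢
  rw [hcs' τ] at h₂ ⊢
  rw [← subst_app] at h₁ h₂ hu hv ⊢
  rw [← subst_app] at h₁ h₂ ⊢
  have iU : ∀ a ∈ U₀.args, Im 𝔸 C X φ k a := fun a ha =>
    SA.im_sort ⟨k, hU₀⟩ hU (by omega) ha
  have iV : ∀ b ∈ V₀.args, Im 𝔹 D Y ψ l b := fun b hb =>
    SB.im_sort ⟨l, hV₀⟩ hV (by omega) hb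
  have h₁ : Te c.T Z _ _ := ⟨_, inlApp_te (ρ := rho σ τ φ ψ) (σ₀ := σ₀) (τ₀ := τ₀) F.nd (fun a ha b hb => by
    rcases List.mem_append.1 ha with ha | ha
    · exact H.te (.inl ⟨iU a ha, SB.im_base hb⟩)
    · obtain rfl := List.mem_singleton.1 ha
      exact HL.te (.inl ⟨⟨⟨_, _, hu₀⟩, _, hu⟩, SB.im_base hb⟩)) h₁⟩
  have h₂ : Te c.T Z _ _ := ⟨_, inrApp_te (ρ := rho σ τ φ ψ) (σ₀ := σ₀) (τ₀ := τ₀) F.nd (fun a ha b hb => by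
    rcases List.mem_append.1 hb with hb | hb
    · exact H.te (.inl ⟨SA.im_base ha, iV b hb⟩)
    · obtain rfl := List.mem_singleton.1 hb
      exact HR.te (.inl ⟨SA.im_base ha, ⟨_, _, hv₀⟩, _, hv⟩)) h₂⟩
  exact F.te_trans h₁ (F.te_trans this h₂.symm)

theorem Below.pair_cs (hB : Below c n m) (F : Fr c σ τ X Y Z) (hu : W 𝔸.ax n X (.tm u U))
    (hv : W 𝔹.ax m Y (.tm v V)) : Good c σ τ Z u (cs σ u) v (cs τ v) := by
  have hu' := hu.cs F.aX
  have hv' := hv.cs F.aY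
  cases v with
  | var y =>
    obtain ⟨R, hy⟩ := hv.var_mem
    have ey : cs τ (.var y) = R := by rw [cs_var]; exact F.aY _ hy
    cases u with
    | var x =>
      obtain ⟨S, hx⟩ := hu.var_mem
      have ex : cs σ (.var x) = S := by rw [cs_var]; exact F.aX _ hx
      refine ⟨?_, by simp, by simp⟩
      rw [tens_var, ex, ey]
      exact F.var _ hx _ hy
    | app s h =>
      have h₂ := hB.appR F hu hv'.presup (.of F (fun l h => hB.left h) hv')
      have e := tens_app_var F.aX F.aY (hu.arg F.aX) (hv.arg F.aY)
      rw [← cs_var τ y] at e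
      refine ⟨e ▸ h₂, by simp, ?_⟩
      rintro s h ⟨⟩
      rw [e]
      exact ⟨_, h₂.trefl⟩
  | app t p =>
    have h₁ := hB.appL F hu'.presup hv (.of F (fun l h => hB.right h) hu')
    have e := tens_app F.aX F.aY (hu.arg F.aX) (hv.arg F.aY)
    refine ⟨e ▸ h₁, ?_, ?_⟩
    · rintro t p ⟨⟩
      rw [e]
      exact ⟨_, h₁.trefl⟩
    · rintro s h rfl
      rw [e]
      exact hB.tt F hu hv

theorem Below.pair (hB : Below c n m) (F : Fr c σ τ X Y Z) (hu : W 𝔸.ax n X (.tm u U))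
    (hv : W 𝔹.ax m Y (.tm v V)) : Good c σ τ Z u U v V := by
  rcases hu.tm_cases F.aX with rfl | ⟨k, U', hk, hs, hu', -⟩
  · rcases hv.tm_cases F.aY with rfl | ⟨l, V', hl, hs, hv', -⟩
    · exact hB.pair_cs F hu hv
    · have h₁ : PtR c σ τ X Z v V' n := .of F (fun k h => hB.both h hl) hv'
      have h₂ : PtR c σ τ X Z v V n :=
        .of F (fun k h => hB.left h) hv
      refine ((hB.right hl).pair F hu hv').convR F.nd ?_ ?_
      · exact (hB.right hl).seqR F hu.presup hs (.of F (fun l' h => hB.right (h.trans hl)) hu)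
          h₁ h₂
      · rintro s h rfl
        exact (hB.right hl).seqtR F hu hs h₁ h₂
  · have h₁ : PtL c σ τ Y Z u U' m := .of F (fun l h => hB.both hk h) hu'
    have h₂ : PtL c σ τ Y Z u U m := .of F (fun l h => hB.right h) hu
    refine ((hB.left hk).pair F hu' hv).conv F.nd ?_ ?_
    · exact (hB.left hk).seqL F hs hv.presup h₁ h₂
        (.of F (fun k' h => hB.left (h.trans hk)) hv)
    · rintro t p rfl
      exact (hB.left hk).seqtL F hs hv h₁ h₂

end

end

section
variable {𝔸 : Thy A} {𝔹 : Thy B}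

section
variable {α β γ : Type} {R : γ → γ → Prop} {F G : α → β → γ}

theorem forall₂_grid_left {L L' : List α} {M : List β}
    (h : List.Forall₂ (fun a a' => ∀ b ∈ M, R (F a b) (G a' b)) L L') :
    List.Forall₂ R (grid F L M) (grid G L' M) := by
  induction h with
  | nil => exact .nil
  | cons h _ ih =>
    rw [grid_cons, grid_cons]
    refine List.rel_append ?_ ih
    rwa [List.forall₂_map_left_iff, List.forall₂_map_right_iff, List.forall₂_same]

theorem forall₂_grid_right {L : List α} {M M' : List β}
    (h : List.Forall₂ (fun b b' => ∀ a ∈ L, R (F a b) (G a b')) M M') :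
    List.Forall₂ R (grid F L M) (grid G L M') := by
  induction L with
  | nil => exact .nil
  | cons a L ih =>
    rw [grid_cons, grid_cons]
    refine List.rel_append ?_ (ih (h.imp fun _ _ h a ha => h a (List.mem_cons_of_mem _ ha)))
    rw [List.forall₂_map_left_iff, List.forall₂_map_right_iff]
    exact h.imp fun _ _ h => h a List.mem_cons_self

end

section
variable {c : Ch 𝔸 𝔹} {σ₀ σ : Env 𝔸} {τ₀ τ : Env 𝔹} {C X : PreCtx A} {D Y : PreCtx B}
  {Z : PreCtx (A.tensor B)} {ρ : (A.tensor B).Var → Expr (A.tensor B)} {φ : A.Var → Expr A}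
  {ψ : B.Var → Expr B} {U₀ U U' : SortE A} {V₀ V V' : SortE B} {z : A.Var} {y : B.Var}
  {k l n m : ℕ} {u u' : Expr A} {v v' : Expr B}

theorem Sb.of_args (hU : W 𝔸.ax k C (.so U₀)) (nd : (C.map Prod.fst).Nodup)
    (hC : ∀ C₀ p C₁, C = C₀ ++ p :: C₁ → W 𝔸.ax k C₀ (.so p.2))
    (ha : ∀ p ∈ C, W 𝔸.ax k X (.tm (φ p.1) (p.2.subst φ))) (u : Expr A) {a : PreCtx A → A.Var}
    (h : FreshCh a) :
    ∃ (σ₀ : Env 𝔸) (φ' : A.Var → Expr A), Sb σ₀ C (a C) U₀ k X φ' ∧ φ' (a C) = u ∧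
      (∀ U, Dv 𝔸.ax C (.so U) → U.subst φ = U.subst φ') ∧
      (∀ w U, Dv 𝔸.ax C (.tm w U) → w.subst φ = w.subst φ') ∧
      ∀ x ∈ C.map Prod.fst, φ' x = φ x := by
  have dC : DCtx 𝔸.ax C := ⟨nd, fun C₀ p C₁ e => ⟨k, hC C₀ p C₁ e⟩⟩
  obtain ⟨σ₀, hz⟩ := exists_pt dC ⟨k, hU⟩ (h C)
  obtain ⟨φ', SA, e, e'⟩ := Sb.exists hz hC ha u
  exact ⟨σ₀, φ', SA, e, fun U hU => (Dv.subst_eq hU e').symm,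
    fun w U hw => subst_congr fun x hx => (e' x (hw.scoped.1 x hx)).symm, e'⟩

theorem Below.refl_te (hB : Below c n m) (F : Fr c σ τ X Y Z) (hk : k < n) (hl : l < m)
    (hu : W 𝔸.ax k X (.tm u U)) (hv : W 𝔹.ax l Y (.tm v V)) :
    Te c.T Z (tens σ τ u v) (tens σ τ u v) :=
  ((hB.both hk hl).pair F hu hv).tm.te

/-- Second factor compound. -/
theorem Below.eqL_app (hB : Below c n m) (F : Fr c σ τ X Y Z) {t : B.TermSym}
    {p : List (Expr B)} (he : W 𝔸.ax n X (.teq u u' U)) (hv : W 𝔹.ax m Y (.tm (.app t p) V)) :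
    Te c.T Z (tens σ τ u (.app t p)) (tens σ τ u' (.app t p)) := by
  obtain ⟨hu, hu', hU⟩ := he.presup
  have h := hB.appL F hU hv (.of F (fun l h => hB.right h) hu)
  refine F.te_trans ((hB.pair F hu hv).inl t p rfl)
    (F.te_trans ⟨_, Te.app c.unique F.nd h ?_⟩ ((hB.pair F hu' hv).inl t p rfl).symm)
  refine forall₂_grid_left (List.rel_append ?_ (.cons ?_ .nil))
  · refine List.forall₂_same.2 fun a ha b hb => ?_
    obtain ⟨k, _, hk, ha⟩ := hU.args_so ha
    obtain ⟨l, _, hl, hb⟩ := hv.args_app hb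
    exact hB.refl_te F hk hl ha hb
  · intro b hb
    obtain ⟨l, _, hl, hb⟩ := hv.args_app hb
    exact (hB.right hl).eqL F he hb

theorem Below.eqR_app (hB : Below c n m) (F : Fr c σ τ X Y Z) {s : A.TermSym}
    {h : List (Expr A)} (hu : W 𝔸.ax n X (.tm (.app s h) U)) (he : W 𝔹.ax m Y (.teq v v' V)) :
    Te c.T Z (tens σ τ (.app s h) v) (tens σ τ (.app s h) v') := by
  obtain ⟨hv, hv', hV⟩ := he.presup
  have h' := hB.appR F hu hV (.of F (fun l h => hB.left h) hv)
  refine F.te_trans ((hB.pair F hu hv).inr s h rfl)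
    (F.te_trans ⟨_, Te.app c.unique F.nd h' ?_⟩ ((hB.pair F hu hv').inr s h rfl).symm)
  refine forall₂_grid_right (List.rel_append ?_ (.cons ?_ .nil))
  · refine List.forall₂_same.2 fun b hb a ha => ?_
    obtain ⟨k, _, hk, ha⟩ := hu.args_app ha
    obtain ⟨l, _, hl, hb⟩ := hV.args_so hb
    exact hB.refl_te F hk hl ha hb
  · intro a ha
    obtain ⟨k, _, hk, ha⟩ := hu.args_app ha
    exact (hB.left hk).eqR F ha he

theorem Below.eqL_ax (hB : Below c n m) (F : Fr c σ τ X Y Z) (hk : k < n)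
    (ax : Judg.termEq C u u' U ∈ 𝔸.ax) (nd : (C.map Prod.fst).Nodup)
    (hC : ∀ C₀ p C₁, C = C₀ ++ p :: C₁ → W 𝔸.ax k C₀ (.so p.2))
    (hu : W 𝔸.ax k C (.tm u U)) (hu' : W 𝔸.ax k C (.tm u' U))
    (ha : ∀ p ∈ C, W 𝔸.ax k X (.tm (φ p.1) (p.2.subst φ)))
    (huφ : W 𝔸.ax k X (.tm (u.subst φ) (U.subst φ)))
    (huφ' : W 𝔸.ax k X (.tm (u'.subst φ) (U.subst φ)))
    (hv : W 𝔹.ax m Y (.tm (.var y) V)) :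
    Te c.T Z (tens σ τ (u.subst φ) (.var y)) (tens σ τ (u'.subst φ) (.var y)) := by
  obtain ⟨σ₀, φ', SA, -, -, e, -⟩ := Sb.of_args hu.presup nd hC ha (.var (c.a C)) c.fresh_a
  rw [e _ _ ⟨k, hu⟩] at huφ ⊢
  rw [e _ _ ⟨k, hu'⟩] at huφ' ⊢
  have hv := hv.cs F.aY
  obtain ⟨⟨R, fs⟩, hR⟩ : ∃ R, cs τ (.var y) = R := ⟨_, rfl⟩
  rw [hR] at hv
  obtain ⟨l, D, τ₀, ψ, hl, hS, SB, rfl, eψ⟩ := (W.presup hv).so_sb (.var y) c.fresh_b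
  have tD := SB.tele_concat hl.le ((SB.tele.sort hS).mono hl)
  have E := SA.tele.fr tD (c := c) fun n' h m' h' => hB n' m' (h.trans hk.le) h' (.inl (h.trans_lt hk))
  have hb := tD.var (List.mem_append_right _ (List.mem_singleton_self _))
  have t₁ := ((hB.left hk).pair E hu hb).tm
  have t₂ := ((hB.left hk).pair E hu' hb).tm
  have he : W 𝔸.ax n C (.teq u u' U) := by
    simpa [subst_id] using W.tax (φ := .var) hk ax nd hC hu hu' SA.tele.var_subst (by simpa [subst_id] using hu)
      (by simpa [subst_id] using hu')
  have hs : Dv c.T (tctx σ₀ τ₀ C (D ++ [(c.b D, ⟨R, ctxVars D⟩)])) (.seq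
      (Ty σ₀ τ₀ U ⟨R, ctxVars D⟩ u (.var (c.b D))) (Ty σ₀ τ₀ U ⟨R, ctxVars D⟩ u' (.var (c.b D)))) := by
    refine Te.sort c.unique E.nd t₁.tm_so (List.rel_append ?_ ?_)
    · refine forall₂_grid fun a ha b hb => ?_
      obtain ⟨k', _, hk', ha⟩ := hu.presup.args_so ha
      rcases List.mem_append.1 hb with hb | hb
      · obtain ⟨q, hq, rfl⟩ := List.mem_map.1 hb
        exact ((hB.both (hk'.trans hk) hl).pair E.left ha (SB.tele.var hq)).tm.te
      · obtain rfl := List.mem_singleton.1 hb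
        exact ((hB.left (hk'.trans hk)).pair E ha (tD.var
          (List.mem_append_right _ (List.mem_singleton_self _)))).tm.te
    · rw [List.forall₂_map_left_iff, List.forall₂_map_right_iff, List.forall₂_same]
      intro b hb
      obtain ⟨q, hq, rfl⟩ := List.mem_map.1 hb
      exact (hB.right hl).eqL E.left he (SB.tele.var hq)
  have H := SA.hom_right SB F (hB.both hk hl) (fun b hb => SB.im_base hb)
    (.of F (fun k' h => hB.left (h.trans_le hk)) (eψ.symm ▸ hv))
  have := Dv.tax (ax_teqs ax hS SA.pt SB.pt (hu.arg SA.pt.agree) (hu'.arg SA.pt.agree)) E.ctx t₁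
    (t₂.conv hs.ssym) (SA.args_right SB H trivial)
  have i₁ := H.te (.inr (.inr ⟨⟨⟨_, _, hu⟩, _, huφ⟩, trivial, rfl⟩))
  have i₂ := H.te (.inr (.inr ⟨⟨⟨_, _, hu'⟩, _, huφ'⟩, trivial, rfl⟩))
  rw [subst_var, eψ] at i₁ i₂
  exact F.te_trans i₁.symm (F.te_trans ⟨_, this⟩ i₂)

theorem Below.eqR_ax (hB : Below c n m) (F : Fr c σ τ X Y Z) {x : A.Var} (hl : l < m)
    (ax : Judg.termEq D v v' V ∈ 𝔹.ax) (nd : (D.map Prod.fst).Nodup)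
    (hD : ∀ D₀ p D₁, D = D₀ ++ p :: D₁ → W 𝔹.ax l D₀ (.so p.2))
    (hv : W 𝔹.ax l D (.tm v V)) (hv' : W 𝔹.ax l D (.tm v' V))
    (ha : ∀ p ∈ D, W 𝔹.ax l Y (.tm (ψ p.1) (p.2.subst ψ)))
    (hvψ : W 𝔹.ax l Y (.tm (v.subst ψ) (V.subst ψ)))
    (hvψ' : W 𝔹.ax l Y (.tm (v'.subst ψ) (V.subst ψ)))
    (hu : W 𝔸.ax n X (.tm (.var x) U)) :
    Te c.T Z (tens σ τ (.var x) (v.subst ψ)) (tens σ τ (.var x) (v'.subst ψ)) := by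
  obtain ⟨τ₀, ψ', SB, -, -, e, -⟩ := Sb.of_args hv.presup nd hD ha (.var (c.b D)) c.fresh_b
  rw [e _ _ ⟨l, hv⟩] at hvψ ⊢
  rw [e _ _ ⟨l, hv'⟩] at hvψ' ⊢
  have hu := hu.cs F.aX
  obtain ⟨⟨S, fs⟩, hS⟩ : ∃ S, cs σ (.var x) = S := ⟨_, rfl⟩
  rw [hS] at hu
  clear hS
  obtain ⟨k, C, σ₀, φ, hk, hS, SA, rfl, eφ⟩ := (W.presup hu).so_sb (.var x) c.fresh_a
  have tC := SA.tele_concat hk.le ((SA.tele.sort hS).mono hk)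
  have E := tC.fr SB.tele (c := c) fun n' h m' h' =>
    hB n' m' h (h'.trans hl.le) (.inr (h'.trans_lt hl))
  have EC := SA.tele.fr SB.tele (c := c) fun n' h m' h' =>
    hB n' m' (h.trans hk.le) (h'.trans hl.le) (.inr (h'.trans_lt hl))
  have hz := tC.var (List.mem_append_right _ (List.mem_singleton_self _))
  have t₁ := ((hB.right hl).pair E hz hv).tm
  have t₂ := ((hB.right hl).pair E hz hv').tm
  have he : W 𝔹.ax m D (.teq v v' V) := by
    simpa [subst_id] using W.tax (φ := .var) hl ax nd hD hv hv' SB.tele.var_subst (by simpa [subst_id] using hv)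
      (by simpa [subst_id] using hv')
  have hs : Dv c.T (tctx σ₀ τ₀ (C ++ [(c.a C, ⟨S, ctxVars C⟩)]) D) (.seq
      (Ty σ₀ τ₀ ⟨S, ctxVars C⟩ V (.var (c.a C)) v) (Ty σ₀ τ₀ ⟨S, ctxVars C⟩ V (.var (c.a C)) v')) := by
    have hp : ∀ p ∈ C, W 𝔸.ax k (C ++ [(c.a C, ⟨S, ctxVars C⟩)]) (.tm (.var p.1) p.2) :=
      fun p hp => (SA.tele.var hp).weaken _
    refine Te.sort c.unique E.nd t₁.tm_so (List.rel_append (forall₂_grid_right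
      (List.rel_append ?_ (.cons ?_ .nil))) ?_)
    · refine List.forall₂_same.2 fun b hb a ha => ?_
      obtain ⟨l', _, hl', hb⟩ := hv.presup.args_so hb
      obtain ⟨p, hp', rfl⟩ := List.mem_map.1 ha
      exact hB.refl_te E hk (hl'.trans hl) (hp p hp') hb
    · intro a ha
      obtain ⟨p, hp', rfl⟩ := List.mem_map.1 ha
      exact (hB.left hk).eqR E (hp p hp') he
    · rw [List.forall₂_map_left_iff, List.forall₂_map_right_iff, List.forall₂_same]
      intro b hb
      obtain ⟨l', _, hl', hb⟩ := hv.presup.args_so hb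
      exact ((hB.right (hl'.trans hl)).pair E hz hb).tm.te
  have H := SA.hom_left SB F (hB.both hk hl) (fun b hb => SA.im_base hb)
    (.of F (fun k' h => hB.right (h.trans_le hl)) (eφ.symm ▸ hu))
  have := Dv.tax (ax_steq hS ax SA.pt SB.pt (hv.arg SB.pt.agree) (hv'.arg SB.pt.agree)) E.ctx t₁
    (t₂.conv hs.ssym) (SA.args_left SB H trivial)
  have i₁ := H.te (.inr (.inl ⟨⟨trivial, rfl⟩, ⟨⟨_, _, hv⟩, _, hvψ⟩⟩))
  have i₂ := H.te (.inr (.inl ⟨⟨trivial, rfl⟩, ⟨⟨_, _, hv'⟩, _, hvψ'⟩⟩))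
  rw [subst_var, eφ] at i₁ i₂
  exact F.te_trans i₁.symm (F.te_trans ⟨_, this⟩ i₂)

end

end

section
variable {𝔸 : Thy A} {𝔹 : Thy B}

section
variable {c : Ch 𝔸 𝔹} {σ₀ σ : Env 𝔸} {τ₀ τ : Env 𝔹} {C X : PreCtx A} {D Y : PreCtx B}
  {Z : PreCtx (A.tensor B)} {ρ : (A.tensor B).Var → Expr (A.tensor B)} {φ φ' : A.Var → Expr A}
  {ψ ψ' : B.Var → Expr B} {U₀ U U' : SortE A} {V₀ V V' : SortE B} {z x : A.Var} {y : B.Var}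
  {k l n m : ℕ} {u u' : Expr A} {v v' : Expr B}

theorem Below.eqL_cong (hB : Below c n m) (F : Fr c σ τ X Y Z) {s : A.TermSym} (hk : k < n)
    (he : ∀ p ∈ C, W 𝔸.ax k X (.teq (φ p.1) (φ' p.1) (p.2.subst φ)))
    (h : W 𝔸.ax k X (.tm (.app s (C.map fun p => φ p.1)) U))
    (h' : W 𝔸.ax k X (.tm (.app s (C.map fun p => φ' p.1)) U))
    (hv : W 𝔹.ax m Y (.tm (.var y) V)) :
    Te c.T Z (tens σ τ (.app s (C.map fun p => φ p.1)) (.var y))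
      (tens σ τ (.app s (C.map fun p => φ' p.1)) (.var y)) := by
  have hv' := hv.cs F.aY
  rw [tens_app_var F.aX F.aY (h.arg F.aX) (hv.arg F.aY),
    tens_app_var F.aX F.aY (h'.arg F.aX) (hv.arg F.aY)]
  have hT := (hB.left hk).appR F h (W.presup hv') (.of F (fun k' h => hB.left (h.trans hk)) hv')
  rw [cs_var τ y] at hT hv'
  refine ⟨_, Te.app c.unique F.nd hT (forall₂_grid_left ?_)⟩
  rw [List.forall₂_map_left_iff, List.forall₂_map_right_iff, List.forall₂_same]
  intro p hp b hb
  rcases List.mem_append.1 hb with hb | hb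
  · obtain ⟨l, _, hl, hb⟩ := (W.presup hv').args_so hb
    exact (hB.both hk hl).eqL F (he p hp) hb
  · obtain rfl := List.mem_singleton.1 hb
    exact (hB.left hk).eqL F (he p hp) hv

theorem Below.eqR_cong (hB : Below c n m) (F : Fr c σ τ X Y Z) {t : B.TermSym} (hl : l < m)
    (he : ∀ p ∈ D, W 𝔹.ax l Y (.teq (ψ p.1) (ψ' p.1) (p.2.subst ψ)))
    (h : W 𝔹.ax l Y (.tm (.app t (D.map fun p => ψ p.1)) V))
    (h' : W 𝔹.ax l Y (.tm (.app t (D.map fun p => ψ' p.1)) V))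
    (hu : W 𝔸.ax n X (.tm (.var x) U)) :
    Te c.T Z (tens σ τ (.var x) (.app t (D.map fun p => ψ p.1)))
      (tens σ τ (.var x) (.app t (D.map fun p => ψ' p.1))) := by
  have hu' := hu.cs F.aX
  rw [tens_app F.aX F.aY (hu.arg F.aX) (h.arg F.aY),
    tens_app F.aX F.aY (hu.arg F.aX) (h'.arg F.aY)]
  have hT := (hB.right hl).appL F (W.presup hu') h (.of F (fun k' h => hB.right (h.trans hl)) hu')
  refine ⟨_, Te.app c.unique F.nd hT (forall₂_grid_right ?_)⟩
  rw [List.forall₂_map_left_iff, List.forall₂_map_right_iff, List.forall₂_same]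
  intro p hp a ha
  rcases List.mem_append.1 ha with ha | ha
  · obtain ⟨k, _, hk, ha⟩ := (W.presup hu').args_so ha
    exact (hB.both hk hl).eqR F ha (he p hp)
  · obtain rfl := List.mem_singleton.1 ha
    exact (hB.right hl).eqR F hu (he p hp)

theorem Below.eqL (hB : Below c n m) (F : Fr c σ τ X Y Z) (he : W 𝔸.ax n X (.teq u u' U))
    (hv : W 𝔹.ax m Y (.tm v V)) : Te c.T Z (tens σ τ u v) (tens σ τ u' v) := by
  cases v with
  | app t p => exact hB.eqL_app F he hv
  | var y =>
    cases he with
    | trefl hk h => exact ((hB.left hk).pair F h hv).tm.te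
    | tsym hk h => exact ((hB.left hk).eqL F h hv).symm
    | ttrans hk h h' => exact F.te_trans ((hB.left hk).eqL F h hv) ((hB.left hk).eqL F h' hv)
    | tconv hk _ h => exact (hB.left hk).eqL F h hv
    | tax hk ax nd hC hu hu' ha h h' => exact hB.eqL_ax F hk ax nd hC hu hu' ha h h' hv
    | tcong hk ax nd hC hU ha ha' he hUφ ht ht' => exact hB.eqL_cong F hk he ht ht' hv

theorem Below.eqR (hB : Below c n m) (F : Fr c σ τ X Y Z) (hu : W 𝔸.ax n X (.tm u U))
    (he : W 𝔹.ax m Y (.teq v v' V)) : Te c.T Z (tens σ τ u v) (tens σ τ u v') := by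
  cases u with
  | app t p => exact hB.eqR_app F hu he
  | var y =>
    cases he with
    | trefl hk h => exact ((hB.right hk).pair F hu h).tm.te
    | tsym hk h => exact ((hB.right hk).eqR F hu h).symm
    | ttrans hk h h' => exact F.te_trans ((hB.right hk).eqR F hu h) ((hB.right hk).eqR F hu h')
    | tconv hk _ h => exact (hB.right hk).eqR F hu h
    | tax hk ax nd hC hv hv' ha h h' => exact hB.eqR_ax F hk ax nd hC hv hv' ha h h' hu
    | tcong hk ax nd hC hU ha ha' he hUφ ht ht' => exact hB.eqR_cong F hk he ht ht' hu

end

end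

section
variable {𝔸 : Thy A} {𝔹 : Thy B}

section
variable {c : Ch 𝔸 𝔹} {σ₀ σ : Env 𝔸} {τ₀ τ : Env 𝔹} {C X : PreCtx A} {D Y : PreCtx B}
  {Z : PreCtx (A.tensor B)} {ρ : (A.tensor B).Var → Expr (A.tensor B)} {φ φ' : A.Var → Expr A}
  {ψ ψ' : B.Var → Expr B} {U₀ U U' : SortE A} {V₀ V V' : SortE B} {z x : A.Var} {y : B.Var}
  {k l n m : ℕ} {u u' : Expr A} {v v' : Expr B}

theorem Below.seqL_ax (hB : Below c n m) (F : Fr c σ τ X Y Z) (hk : k < n)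
    (ax : Judg.sortEq C U U' ∈ 𝔸.ax) (nd : (C.map Prod.fst).Nodup)
    (hC : ∀ C₀ p C₁, C = C₀ ++ p :: C₁ → W 𝔸.ax k C₀ (.so p.2))
    (hU : W 𝔸.ax k C (.so U)) (hU' : W 𝔸.ax k C (.so U'))
    (ha : ∀ p ∈ C, W 𝔸.ax k X (.tm (φ p.1) (p.2.subst φ)))
    (hUφ : W 𝔸.ax k X (.so (U.subst φ))) (hUφ' : W 𝔸.ax k X (.so (U'.subst φ)))
    (hV : W 𝔹.ax m Y (.so V)) (hu : PtL c σ τ Y Z u (U.subst φ) m)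
    (hu' : PtL c σ τ Y Z u (U'.subst φ) m) (hv : PtR c σ τ X Z v V n) :
    Dv c.T Z (.seq (Ty σ τ (U.subst φ) V u v) (Ty σ τ (U'.subst φ) V u v)) := by
  obtain ⟨σ₀, φ', SA, rfl, e, -, -⟩ := Sb.of_args hU nd hC ha u c.fresh_a
  rw [e _ ⟨k, hU⟩] at hUφ hu ⊢
  rw [e _ ⟨k, hU'⟩] at hUφ' hu' ⊢
  obtain ⟨R, fs⟩ := V
  obtain ⟨l, D, τ₀, ψ, hl, hR, SB, rfl, rfl⟩ := hV.so_sb v c.fresh_b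
  have hR₀ := (SB.tele.sort hR).mono hl
  obtain ⟨E, E'⟩ := hB.fr_corner SA SB hk hl (hU.mono hk.le) hR₀
  have hs : W 𝔸.ax n C (.seq U U') := by
    simpa using (W.sax (φ := .var) (Nat.lt_succ_self k) ax nd hC hU hU' SA.tele.var_subst
      (by simpa using hU) (by simpa using hU')).mono hk
  have pz : PtL c σ₀ τ₀ D _ (.var (c.a C)) U m :=
    .of E' (fun l h => hB.right h) (W.var (X₁ := []) (hU.mono hk.le))
  have pz' := pz.conv E' (fun k' hk l' hl => hB k' l' hk hl.le (.inr hl)) (hs.weaken _)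
  have py : PtR c σ₀ τ₀ C _ (.var (c.b D)) ⟨R, ctxVars D⟩ k :=
    .of E (fun k' h => hB.left (h.trans hk)) (W.var (X₁ := []) hR₀)
  have so := (hB.left hk).sort E.left hU hR₀ pz py
  have so' := (hB.left hk).sort E.left hU' hR₀ pz' py
  have H := SA.hom_corner SB F (hB.both hk hl) (fun a ha => SA.im_sort ⟨k, hU⟩ hUφ (by omega) ha)
    (hu.mono hl) (fun b hb => SB.im_base hb) (hv.mono hk)
  have h := Dv.sax (ax_seqs ax hR SA.pt SB.pt ⟨k, hU'⟩) E.ctx so so' (SA.args_corner SB H trivial trivial)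
  have key : ∀ T : SortE A, W 𝔸.ax k C (.so T) → W 𝔸.ax k X (.so (T.subst φ')) →
      PtL c σ τ Y Z (φ' (c.a C)) (T.subst φ') m →
      Dv c.T Z (.seq (Ty σ τ (T.subst φ') ⟨R, (ctxVars D).map (Expr.subst ψ)⟩ (φ' (c.a C))
        (ψ (c.b D))) ((Ty σ₀ τ₀ T ⟨R, ctxVars D⟩ (.var (c.a C)) (.var (c.b D))).subst
          (rho σ τ φ' ψ))) := by
    intro T hT hTφ hP
    have iT : ∀ a ∈ T.args, Im 𝔸 C X φ' k a := fun a ha => SA.im_sort ⟨k, hT⟩ hTφ (by omega) ha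
    have := Ty_te (σ := σ) (τ := τ) (φ := φ') (ψ := ψ) (ρ := rho σ τ φ' ψ) F.nd (U := T)
      (V := ⟨R, ctxVars D⟩) (α := .var (c.a C)) (β := .var (c.b D)) (σ₀ := σ₀) (τ₀ := τ₀)
      (fun a ha b hb => by
        rcases List.mem_append.1 hb with hb | hb
        · exact H.te (.inl ⟨iT a ha, SB.im_base hb⟩)
        · obtain rfl := List.mem_singleton.1 hb
          exact H.te (.inr (.inr ⟨iT a ha, trivial, rfl⟩)))
      (fun b hb => H.te (.inr (.inl ⟨⟨trivial, rfl⟩, SB.im_base hb⟩)))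
      (by
        rw [subst_var, subst_var]
        exact (hB.left hk).sort F hTφ hV hP (hv.mono hk.le))
    rwa [subst_var, subst_var] at this
  exact ((key U hU hUφ hu).strans h).strans (key U' hU' hUφ' hu').ssym

theorem Below.seqR_ax (hB : Below c n m) (F : Fr c σ τ X Y Z) (hl : l < m)
    (ax : Judg.sortEq D V V' ∈ 𝔹.ax) (nd : (D.map Prod.fst).Nodup)
    (hD : ∀ D₀ p D₁, D = D₀ ++ p :: D₁ → W 𝔹.ax l D₀ (.so p.2))
    (hV : W 𝔹.ax l D (.so V)) (hV' : W 𝔹.ax l D (.so V'))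
    (ha : ∀ p ∈ D, W 𝔹.ax l Y (.tm (ψ p.1) (p.2.subst ψ)))
    (hVψ : W 𝔹.ax l Y (.so (V.subst ψ))) (hVψ' : W 𝔹.ax l Y (.so (V'.subst ψ)))
    (hU : W 𝔸.ax n X (.so U)) (hu : PtL c σ τ Y Z u U m)
    (hv : PtR c σ τ X Z v (V.subst ψ) n) (hv' : PtR c σ τ X Z v (V'.subst ψ) n) :
    Dv c.T Z (.seq (Ty σ τ U (V.subst ψ) u v) (Ty σ τ U (V'.subst ψ) u v)) := by
  obtain ⟨τ₀, ψ', SB, rfl, e, -, -⟩ := Sb.of_args hV nd hD ha v c.fresh_b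
  rw [e _ ⟨l, hV⟩] at hVψ hv ⊢
  rw [e _ ⟨l, hV'⟩] at hVψ' hv' ⊢
  obtain ⟨S, fs⟩ := U
  obtain ⟨k, C, σ₀, φ, hk, hS, SA, rfl, rfl⟩ := hU.so_sb u c.fresh_a
  have hS₀ := (SA.tele.sort hS).mono hk
  obtain ⟨E, E'⟩ := hB.fr_corner SA SB hk hl hS₀ (hV.mono hl.le)
  have hs : W 𝔹.ax m D (.seq V V') := by
    simpa using (W.sax (φ := .var) (Nat.lt_succ_self l) ax nd hD hV hV' SB.tele.var_subst
      (by simpa using hV) (by simpa using hV')).mono hl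
  have py : PtR c σ₀ τ₀ C _ (.var (c.b D)) V n :=
    .of E (fun k h => hB.left h) (W.var (X₁ := []) (hV.mono hl.le))
  have py' := py.conv E (fun k' hk l' hl => hB k' l' hk.le hl (.inl hk)) (hs.weaken _)
  have pz : PtL c σ₀ τ₀ D _ (.var (c.a C)) ⟨S, ctxVars C⟩ l :=
    .of E' (fun l' h => hB.right (h.trans hl)) (W.var (X₁ := []) hS₀)
  have so := (hB.right hl).sort E.left hS₀ hV pz py
  have so' := (hB.right hl).sort E.left hS₀ hV' pz py'
  have H := SA.hom_corner SB F (hB.both hk hl) (fun a ha => SA.im_base ha) (hu.mono hl)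
    (fun b hb => SB.im_sort ⟨l, hV⟩ hVψ (by omega) hb) (hv.mono hk)
  have h := Dv.sax (ax_sseq hS ax SA.pt SB.pt ⟨l, hV'⟩) E.ctx so so' (SA.args_corner SB H trivial trivial)
  have key : ∀ T : SortE B, W 𝔹.ax l D (.so T) → W 𝔹.ax l Y (.so (T.subst ψ')) →
      PtR c σ τ X Z (ψ' (c.b D)) (T.subst ψ') n →
      Dv c.T Z (.seq (Ty σ τ ⟨S, (ctxVars C).map (Expr.subst φ)⟩ (T.subst ψ') (φ (c.a C))
        (ψ' (c.b D))) ((Ty σ₀ τ₀ ⟨S, ctxVars C⟩ T (.var (c.a C)) (.var (c.b D))).subst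
          (rho σ τ φ ψ'))) := by
    intro T hT hTψ hP
    have iT : ∀ b ∈ T.args, Im 𝔹 D Y ψ' l b := fun b hb => SB.im_sort ⟨l, hT⟩ hTψ (by omega) hb
    have := Ty_te (σ := σ) (τ := τ) (φ := φ) (ψ := ψ') (ρ := rho σ τ φ ψ') F.nd
      (U := ⟨S, ctxVars C⟩)
      (V := T) (α := .var (c.a C)) (β := .var (c.b D)) (σ₀ := σ₀) (τ₀ := τ₀)
      (fun a ha b hb => by
        rcases List.mem_append.1 hb with hb | hb
        · exact H.te (.inl ⟨SA.im_base ha, iT b hb⟩)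
        · obtain rfl := List.mem_singleton.1 hb
          exact H.te (.inr (.inr ⟨SA.im_base ha, trivial, rfl⟩)))
      (fun b hb => H.te (.inr (.inl ⟨⟨trivial, rfl⟩, iT b hb⟩)))
      (by
        rw [subst_var, subst_var]
        exact (hB.right hl).sort F hU hTψ (hu.mono hl.le) hP)
    rwa [subst_var, subst_var] at this
  exact ((key V hV hVψ hv).strans h).strans (key V' hV' hVψ' hv').ssym

theorem Below.seqL (hB : Below c n m) (F : Fr c σ τ X Y Z) (he : W 𝔸.ax n X (.seq U U'))
    (hV : W 𝔹.ax m Y (.so V)) (hu : PtL c σ τ Y Z u U m) (hu' : PtL c σ τ Y Z u U' m)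
    (hv : PtR c σ τ X Z v V n) : Dv c.T Z (.seq (Ty σ τ U V u v) (Ty σ τ U' V u v)) := by
  cases he with
  | srefl hk h => exact ((hB.left hk).sort F h hV hu (hv.mono hk.le)).srefl
  | ssym hk h => exact ((hB.left hk).seqL F h hV hu' hu (hv.mono hk.le)).ssym
  | strans hk h h' =>
    have hm := hu.conv F (fun k' hk' l hl => hB k' l (hk'.trans hk.le) hl.le (.inr hl)) h
    exact ((hB.left hk).seqL F h hV hu hm (hv.mono hk.le)).strans
      ((hB.left hk).seqL F h' hV hm hu' (hv.mono hk.le))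
  | sax hk ax nd hC hU hU' ha h h' => exact hB.seqL_ax F hk ax nd hC hU hU' ha h h' hV hu hu' hv
  | scong hk ax nd hC ha ha' he =>
    refine Te.sort c.unique F.nd (hB.sort F (W.so hk ax nd hC ha) hV hu hv)
      (List.rel_append (forall₂_grid_left ?_) ?_)
    · rw [List.forall₂_map_left_iff, List.forall₂_map_right_iff, List.forall₂_same]
      intro p hp b hb
      rcases List.mem_append.1 hb with hb | hb
      · obtain ⟨l, _, hl, hb⟩ := hV.args_so hb
        exact (hB.both hk hl).eqL F (he p hp) hb
      · obtain rfl := List.mem_singleton.1 hb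
        exact hv.te _ hk _ _ _ (he p hp)
    · rw [List.forall₂_map_left_iff, List.forall₂_map_right_iff, List.forall₂_same]
      intro b hb
      obtain ⟨l, _, hl, hb⟩ := hV.args_so hb
      exact (hu.good l hl _ _ hb).tm.te

theorem Below.seqR (hB : Below c n m) (F : Fr c σ τ X Y Z) (hU : W 𝔸.ax n X (.so U))
    (he : W 𝔹.ax m Y (.seq V V')) (hu : PtL c σ τ Y Z u U m) (hv : PtR c σ τ X Z v V n)
    (hv' : PtR c σ τ X Z v V' n) : Dv c.T Z (.seq (Ty σ τ U V u v) (Ty σ τ U V' u v)) := by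
  cases he with
  | srefl hk h => exact ((hB.right hk).sort F hU h (hu.mono hk.le) hv).srefl
  | ssym hk h => exact ((hB.right hk).seqR F hU h (hu.mono hk.le) hv' hv).ssym
  | strans hk h h' =>
    have hm := hv.conv F (fun k' hk' l hl => hB k' l hk'.le (hl.trans hk.le) (.inl hk')) h
    exact ((hB.right hk).seqR F hU h (hu.mono hk.le) hv hm).strans
      ((hB.right hk).seqR F hU h' (hu.mono hk.le) hm hv')
  | sax hk ax nd hC hV hV' ha h h' => exact hB.seqR_ax F hk ax nd hC hV hV' ha h h' hU hu hv hv'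
  | scong hl ax nd hC ha ha' he =>
    refine Te.sort c.unique F.nd (hB.sort F hU (W.so hl ax nd hC ha) hu hv)
      (List.rel_append (forall₂_grid_right (List.rel_append ?_ (.cons ?_ .nil))) ?_)
    · rw [List.forall₂_map_left_iff, List.forall₂_map_right_iff, List.forall₂_same]
      intro p hp a ha
      obtain ⟨k, _, hk, ha⟩ := hU.args_so ha
      exact (hB.both hk hl).eqR F ha (he p hp)
    · intro a ha
      obtain ⟨k, _, hk, ha⟩ := hU.args_so ha
      exact (hv.good k hk _ _ ha).tm.te
    · simp only [List.map_map, List.forall₂_map_left_iff, List.forall₂_map_right_iff,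
        List.forall₂_same]
      exact fun p hp => hu.te _ hl _ _ _ (he p hp)

end

end

section
variable {𝔸 : Thy A} {𝔹 : Thy B}

section
variable {c : Ch 𝔸 𝔹} {σ₀ σ : Env 𝔸} {τ₀ τ : Env 𝔹} {C C' X : PreCtx A} {D Y : PreCtx B}
  {Z : PreCtx (A.tensor B)} {ρ : (A.tensor B).Var → Expr (A.tensor B)} {φ φ' : A.Var → Expr A}
  {ψ ψ' : B.Var → Expr B} {U₀ U U' : SortE A} {V₀ V V' : SortE B} {z x : A.Var} {y : B.Var}
  {k l n m : ℕ} {u u' : Expr A} {v v' : Expr B}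

theorem Fr.left' (F : Fr c σ τ (C ++ C') Y Z) : Fr c σ τ C Y Z :=
  ⟨F.dX.left, F.dY, fun p hp => F.aX p (List.mem_append_left _ hp), F.aY, F.ctx,
    fun p hp => F.var p (List.mem_append_left _ hp)⟩

/-- The type of the sort-equation axioms with a term symbol on the right. -/
theorem Below.seqt_type (hB : Below c n m) (E : Fr c σ₀ τ₀ C D Z) (tC : Tele σ₀ C k)
    (tD : Tele τ₀ D l) (hx : Pt σ₀ C z U₀) (hy : Pt τ₀ D y V₀) {t : B.TermSym} (hk : k < n)
    (hl : l < m) (ht : introTerm D t V₀ ∈ 𝔹.ax) (hU₀ : W 𝔸.ax k C (.so U₀))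
    (hV₀ : W 𝔹.ax l D (.so V₀)) (hL : PtL c σ₀ τ₀ D Z (.var z) U₀ m) :
    Dv c.T Z (.seq (Ty σ₀ τ₀ U₀ V₀ (.var z) (.app t (ctxVars D)))
      ((Ty σ₀ τ₀ U₀ V₀ (.var z) (.var y)).substL (pL σ₀ τ₀ C y (.app t (ctxVars D))))) := by
  have hv₀ := (tD.term ht hV₀).mono hl
  have hR : PtR c σ₀ τ₀ C Z (.app t (ctxVars D)) V₀ n := .of E (fun l h => hB.left h) hv₀
  obtain ⟨φ, SA, hφ, hφ'⟩ := Sb.exists_id hx tC (.var z)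
  obtain ⟨ψ, SB, hψ, hψ'⟩ := Sb.exists_id hy tD (.app t (ctxVars D))
  have eU : U₀.subst φ = U₀ := Dv.subst_fix ⟨k, hU₀⟩ hφ'
  have eV : V₀.subst ψ = V₀ := Dv.subst_fix ⟨l, hV₀⟩ hψ'
  have iU : ∀ a ∈ U₀.args, Im 𝔸 C C φ k a := fun a ha =>
    SA.im_sort ⟨k, hU₀⟩ (eU.symm ▸ hU₀) (by omega) ha
  have iV : ∀ b ∈ V₀.args, Im 𝔹 D D ψ l b := fun b hb =>
    SB.im_sort ⟨l, hV₀⟩ (eV.symm ▸ hV₀) (by omega) hb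
  have H := SA.hom SB E (hB.both hk hl) (p := True) (q := True)
    (ρ := lookupV (pL σ₀ τ₀ C y (.app t (ctxVars D))))
    (fun _ => ⟨iU, by rw [hφ, eU]; exact hL.mono hl⟩)
    (fun _ => ⟨iV, by rw [hψ, eV]; exact hR.mono hk⟩) (by
      rintro a b (⟨ha, hb⟩ | ⟨⟨-, ha⟩, hb⟩ | ⟨ha, -, hb⟩)
      · have hb := hb.var_mem
        rw [lookupV_pL_of_ne (hy.mem_ne hb), hφ' a ha.var_mem, hψ' b hb, tens_var]
      · obtain rfl : a = z := by simpa using ha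
        have hb := hb.var_mem
        rw [lookupV_pL_of_ne (hy.mem_ne hb), hφ, hψ' b hb, tens_var]
      · obtain rfl : b = y := by simpa using hb
        have ha := ha.var_mem
        rw [lookupV_pL ha, hψ, hφ' a ha])
  have := Ty_te E.nd (U := U₀) (V := V₀) (α := .var z) (β := .var y)
    (fun a ha b hb => by
      rcases List.mem_append.1 hb with hb | hb
      · exact H.te (.inl ⟨iU a ha, iV b hb⟩)
      · obtain rfl := List.mem_singleton.1 hb
        exact H.te (.inr (.inr ⟨iU a ha, trivial, rfl⟩)))
    (fun b hb => H.te (.inr (.inl ⟨⟨trivial, rfl⟩, iV b hb⟩)))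
    (by
      rw [subst_var, subst_var, eU, eV, hφ, hψ]
      exact hB.sort E (hU₀.mono hk.le) (hV₀.mono hl.le) hL hR)
  rwa [subst_var, subst_var, eU, eV, hφ, hψ] at this

theorem Below.seqtL_ax (hB : Below c n m) (F : Fr c σ τ X Y Z) (hk : k < n)
    (ax : Judg.sortEq C U U' ∈ 𝔸.ax) (nd : (C.map Prod.fst).Nodup)
    (hC : ∀ C₀ p C₁, C = C₀ ++ p :: C₁ → W 𝔸.ax k C₀ (.so p.2))
    (hU : W 𝔸.ax k C (.so U)) (hU' : W 𝔸.ax k C (.so U'))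
    (ha : ∀ p ∈ C, W 𝔸.ax k X (.tm (φ p.1) (p.2.subst φ)))
    (hUφ : W 𝔸.ax k X (.so (U.subst φ))) (hUφ' : W 𝔸.ax k X (.so (U'.subst φ)))
    {t : B.TermSym} {p : List (Expr B)}
    (hv : W 𝔹.ax m Y (.tm (.app t p) V)) (hu : PtL c σ τ Y Z u (U.subst φ) m)
    (hu' : PtL c σ τ Y Z u (U'.subst φ) m) :
    Te c.T Z (inlApp σ τ (U.subst φ) u t p) (inlApp σ τ (U'.subst φ) u t p) := by
  obtain ⟨σ₀, φ', SA, rfl, e, -, -⟩ := Sb.of_args hU nd hC ha u c.fresh_a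
  rw [e _ ⟨k, hU⟩] at hUφ hu ⊢
  rw [e _ ⟨k, hU'⟩] at hUφ' hu' ⊢
  obtain ⟨l, D, V₀, τ₀, ψ, hl, ht, SB, hV₀, hV, rfl, hcs, -⟩ := hv.app_sb (.app t p) c.fresh_b
  have hv₀ := (SB.tele.term ht hV₀).mono hl
  have E := hB.fr_left SA SB hk hl (hU.mono hk.le)
  have hs : W 𝔸.ax n C (.seq U U') := by
    simpa using (W.sax (φ := .var) (Nat.lt_succ_self k) ax nd hC hU hU' SA.tele.var_subst
      (by simpa using hU) (by simpa using hU')).mono hk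
  have pz : PtL c σ₀ τ₀ D _ (.var (c.a C)) U m :=
    .of E (fun l h => hB.right h) (W.var (X₁ := []) (hU.mono hk.le))
  have pz' := pz.conv E (fun k' hk l' hl => hB k' l' hk hl.le (.inr hl)) (hs.weaken _)
  have h₁ := (hB.left hk).appL E.left' hU hv₀ pz
  have h₂ := (hB.left hk).appL E.left' hU' hv₀ pz'
  rw [cs_intro _ ht ⟨l, hV₀⟩] at h₁ h₂
  have hE := (hB.right hl).seqL E.left' hs hV₀ (pz.mono hl.le) (pz'.mono hl.le)
    (.of E.left' (fun k h => hB.left h) hv₀)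
  have hT := hB.seqt_type E.left' SA.tele SB.tele SA.pt SB.pt hk hl ht hU hV₀ pz
  have H := SA.hom_left SB F (hB.both hk hl) (fun a ha => SA.im_sort ⟨k, hU⟩ hUφ (by omega) ha)
    (hu.mono hl)
  have h := Dv.tax (ax_seqt ax ht SA.pt SB.pt ⟨k, hU'⟩) E.ctx (h₁.conv hT)
    ((h₂.conv hE.ssym).conv hT) (SA.args_left SB H trivial)
  have key : ∀ T : SortE A, W 𝔸.ax k C (.so T) → W 𝔸.ax k X (.so (T.subst φ')) →
      PtL c σ τ Y Z (φ' (c.a C)) (T.subst φ') m →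
      Te c.T Z (inlApp σ τ (T.subst φ') (φ' (c.a C)) t ((ctxVars D).map (Expr.subst ψ)))
        ((inlApp σ₀ τ₀ T (.var (c.a C)) t (ctxVars D)).subst (rho σ τ φ' ψ)) := by
    intro T hT hTφ hP
    have := inlApp_te (σ := σ) (τ := τ) (φ := φ') (ψ := ψ) (ρ := rho σ τ φ' ψ) F.nd (U := T)
      (α := .var (c.a C)) (σ₀ := σ₀) (τ₀ := τ₀) (t := t) (p := ctxVars D)
      (fun a ha b hb => by
        rcases List.mem_append.1 ha with ha | ha
        · exact H.te (.inl ⟨SA.im_sort ⟨k, hT⟩ hTφ (by omega) ha, SB.im_base hb⟩)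
        · obtain rfl := List.mem_singleton.1 ha
          exact H.te (.inr (.inl ⟨⟨trivial, rfl⟩, SB.im_base hb⟩)))
      (by
        rw [subst_var]
        exact (hB.left hk).appL F hTφ hv hP)
    rw [subst_var] at this
    exact ⟨_, this⟩
  exact F.te_trans (key U hU hUφ hu) (F.te_trans ⟨_, h⟩ (key U' hU' hUφ' hu').symm)

theorem Below.seqtR_ax (hB : Below c n m) (F : Fr c σ τ X Y Z) (hl : l < m)
    (ax : Judg.sortEq D V V' ∈ 𝔹.ax) (nd : (D.map Prod.fst).Nodup)
    (hD : ∀ D₀ p D₁, D = D₀ ++ p :: D₁ → W 𝔹.ax l D₀ (.so p.2))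
    (hV : W 𝔹.ax l D (.so V)) (hV' : W 𝔹.ax l D (.so V'))
    (ha : ∀ p ∈ D, W 𝔹.ax l Y (.tm (ψ p.1) (p.2.subst ψ)))
    (hVψ : W 𝔹.ax l Y (.so (V.subst ψ))) (hVψ' : W 𝔹.ax l Y (.so (V'.subst ψ)))
    {s : A.TermSym} {p : List (Expr A)}
    (hu : W 𝔸.ax n X (.tm (.app s p) U))
    (hv : PtR c σ τ X Z v (V.subst ψ) n) (hv' : PtR c σ τ X Z v (V'.subst ψ) n) :
    Te c.T Z (inrApp σ τ s p (V.subst ψ) v) (inrApp σ τ s p (V'.subst ψ) v) := by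
  obtain ⟨τ₀, ψ', SB, rfl, e, -, -⟩ := Sb.of_args hV nd hD ha v c.fresh_b
  rw [e _ ⟨l, hV⟩] at hVψ hv ⊢
  rw [e _ ⟨l, hV'⟩] at hVψ' hv' ⊢
  obtain ⟨k, C, U₀, σ₀, φ, hk, hs, SA, hU₀, hU, rfl, hcs, -⟩ := hu.app_sb (.app s p) c.fresh_a
  have hu₀ := (SA.tele.term hs hU₀).mono hk
  have E := hB.fr_right SA SB hk hl (hV.mono hl.le)
  have he : W 𝔹.ax m D (.seq V V') := by
    simpa using (W.sax (φ := .var) (Nat.lt_succ_self l) ax nd hD hV hV' SB.tele.var_subst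
      (by simpa using hV) (by simpa using hV')).mono hl
  have py : PtR c σ₀ τ₀ C _ (.var (c.b D)) V n :=
    .of E (fun k h => hB.left h) (W.var (X₁ := []) (hV.mono hl.le))
  have py' := py.conv E (fun k' hk l' hl => hB k' l' hk.le hl (.inl hk)) (he.weaken _)
  have h₁ := (hB.right hl).appR E.left hu₀ hV py
  have h₂ := (hB.right hl).appR E.left hu₀ hV' py'
  rw [cs_intro _ hs ⟨k, hU₀⟩] at h₁ h₂
  have hE := (hB.left hk).seqR E.left hU₀ he (.of E.left (fun l h => hB.right h) hu₀)
    (py.mono hk.le) (py'.mono hk.le)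
  have H := SA.hom_right SB F (hB.both hk hl)
    (fun b hb => SB.im_sort ⟨l, hV⟩ hVψ (by omega) hb) (hv.mono hk)
  have h := Dv.tax (ax_tseq hs ax SA.pt SB.pt ⟨l, hV'⟩) E.ctx h₁ (h₂.conv hE.ssym)
    (SA.args_right SB H trivial)
  have key : ∀ T : SortE B, W 𝔹.ax l D (.so T) → W 𝔹.ax l Y (.so (T.subst ψ')) →
      PtR c σ τ X Z (ψ' (c.b D)) (T.subst ψ') n →
      Te c.T Z (inrApp σ τ s ((ctxVars C).map (Expr.subst φ)) (T.subst ψ') (ψ' (c.b D)))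
        ((inrApp σ₀ τ₀ s (ctxVars C) T (.var (c.b D))).subst (rho σ τ φ ψ')) := by
    intro T hT hTψ hP
    have := inrApp_te (σ := σ) (τ := τ) (φ := φ) (ψ := ψ') (ρ := rho σ τ φ ψ') F.nd (V := T)
      (β := .var (c.b D)) (σ₀ := σ₀) (τ₀ := τ₀) (s := s) (h := ctxVars C)
      (fun a ha b hb => by
        rcases List.mem_append.1 hb with hb | hb
        · exact H.te (.inl ⟨SA.im_base ha, SB.im_sort ⟨l, hT⟩ hTψ (by omega) hb⟩)
        · obtain rfl := List.mem_singleton.1 hb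
          exact H.te (.inr (.inr ⟨SA.im_base ha, trivial, rfl⟩)))
      (by
        rw [subst_var]
        exact (hB.right hl).appR F hu hTψ hP)
    rw [subst_var] at this
    exact ⟨_, this⟩
  exact F.te_trans (key V hV hVψ hv) (F.te_trans ⟨_, h⟩ (key V' hV' hVψ' hv').symm)

theorem Below.seqtL (hB : Below c n m) (F : Fr c σ τ X Y Z) (he : W 𝔸.ax n X (.seq U U'))
    {t : B.TermSym} {p : List (Expr B)} (hv : W 𝔹.ax m Y (.tm (.app t p) V))
    (hu : PtL c σ τ Y Z u U m) (hu' : PtL c σ τ Y Z u U' m) :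
    Te c.T Z (inlApp σ τ U u t p) (inlApp σ τ U' u t p) := by
  cases he with
  | srefl hk h => exact ((hB.left hk).appL F h hv hu).te
  | ssym hk h => exact ((hB.left hk).seqtL F h hv hu' hu).symm
  | strans hk h h' =>
    have hm := hu.conv F (fun k' hk' l hl => hB k' l (hk'.trans hk.le) hl.le (.inr hl)) h
    exact F.te_trans ((hB.left hk).seqtL F h hv hu hm) ((hB.left hk).seqtL F h' hv hm hu')
  | sax hk ax nd hC hU hU' ha h h' => exact hB.seqtL_ax F hk ax nd hC hU hU' ha h h' hv hu hu'
  | scong hk ax nd hC ha ha' he =>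
    refine ⟨_, Te.app c.unique F.nd (hB.appL F (W.so hk ax nd hC ha) hv hu)
      (forall₂_grid_left (List.rel_append ?_ (.cons ?_ .nil)))⟩
    · rw [List.forall₂_map_left_iff, List.forall₂_map_right_iff, List.forall₂_same]
      intro q hq b hb
      obtain ⟨l, _, hl, hb⟩ := hv.args_app hb
      exact (hB.both hk hl).eqL F (he q hq) hb
    · intro b hb
      obtain ⟨l, _, hl, hb⟩ := hv.args_app hb
      exact (hu.good l hl _ _ hb).tm.te

theorem Below.seqtR (hB : Below c n m) (F : Fr c σ τ X Y Z) {s : A.TermSym} {p : List (Expr A)}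
    (hu : W 𝔸.ax n X (.tm (.app s p) U)) (he : W 𝔹.ax m Y (.seq V V'))
    (hv : PtR c σ τ X Z v V n) (hv' : PtR c σ τ X Z v V' n) :
    Te c.T Z (inrApp σ τ s p V v) (inrApp σ τ s p V' v) := by
  cases he with
  | srefl hk h => exact ((hB.right hk).appR F hu h hv).te
  | ssym hk h => exact ((hB.right hk).seqtR F hu h hv' hv).symm
  | strans hk h h' =>
    have hm := hv.conv F (fun k' hk' l hl => hB k' l hk'.le (hl.trans hk.le) (.inl hk')) h
    exact F.te_trans ((hB.right hk).seqtR F hu h hv hm) ((hB.right hk).seqtR F hu h' hm hv')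
  | sax hk ax nd hC hV hV' ha h h' => exact hB.seqtR_ax F hk ax nd hC hV hV' ha h h' hu hv hv'
  | scong hl ax nd hC ha ha' he =>
    refine ⟨_, Te.app c.unique F.nd (hB.appR F hu (W.so hl ax nd hC ha) hv)
      (forall₂_grid_right (List.rel_append ?_ (.cons ?_ .nil)))⟩
    · rw [List.forall₂_map_left_iff, List.forall₂_map_right_iff, List.forall₂_same]
      intro q hq a ha
      obtain ⟨k, _, hk, ha⟩ := hu.args_app ha
      exact (hB.both hk hl).eqR F ha (he q hq)
    · intro a ha
      obtain ⟨k, _, hk, ha⟩ := hu.args_app ha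
      exact (hv.good k hk _ _ ha).tm.te

theorem Below.claims (hB : Below c n m) : Claims c n m where
  sort F _ _ _ _ := hB.sort F
  appL F _ _ _ _ _ := hB.appL F
  appR F _ _ _ _ _ := hB.appR F
  pair F _ _ _ _ := hB.pair F
  eqL F _ _ _ _ _ := hB.eqL F
  eqR F _ _ _ _ _ := hB.eqR F
  seqL F _ _ _ _ _ := hB.seqL F
  seqR F _ _ _ _ _ := hB.seqR F
  seqtL F _ _ _ _ _ _ h := hB.seqtL F h
  seqtR F _ _ _ _ _ _ := hB.seqtR F

theorem claims (c : Ch 𝔸 𝔹) (n m : ℕ) : Claims c n m := by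
  induction hN : n + m using Nat.strong_induction_on generalizing n m with
  | _ N ih =>
    exact Below.claims fun n' m' hn hm h => ih (n' + m') (by omega) n' m' rfl

end

end

section
variable {Ax : Set (Judg A)} {X Y Z : PreCtx A} {φ ψ : A.Var → Expr A}

theorem DCtx.isMor (hX : DCtx Ax X) (hY : DCtx Ax Y)
    (h : ∀ p ∈ Y, Dv Ax X (.tm (φ p.1) (p.2.subst φ))) :
    IsMor Ax X Y (Y.map fun p => φ p.1) := by
  refine ⟨hX.derivable, hY.derivable, by simp, fun i hi hif => ?_⟩
  rw [subPre_map (isPreCtx_of_dctx hY.2)]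
  simp only [List.getElem_map]
  exact (h _ (List.getElem_mem hi)).derivable hX

theorem compMor_map (hY : ∀ p ∈ Z, ∃ U, Dv Ax Y (.tm (ψ p.1) U)) :
    compMor Y (Y.map fun p => φ p.1) (Z.map fun p => ψ p.1) =
      Z.map fun p => (ψ p.1).subst φ := by
  rw [compMor, List.map_map]
  refine List.map_congr_left fun p hp => ?_
  obtain ⟨U, hU⟩ := hY p hp
  exact substL_map_tm hU.scoped.1

theorem DCtx.morEq (hu : UniqueIntro Ax) (hX : DCtx Ax X) (hY : DCtx Ax Y) (hZ : DCtx Ax Z)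
    {χ : A.Var → Expr A} (hφ : ∀ p ∈ Y, Dv Ax X (.tm (φ p.1) (p.2.subst φ)))
    (hψ : ∀ p ∈ Z, Dv Ax Y (.tm (ψ p.1) (p.2.subst ψ)))
    (hχ : ∀ p ∈ Z, Dv Ax X (.tm (χ p.1) (p.2.subst χ)))
    (he : ∀ p ∈ Z, Te Ax X ((ψ p.1).subst φ) (χ p.1)) :
    MorEq Ax X Z (Z.map fun p => χ p.1)
      (compMor Y (Y.map fun p => φ p.1) (Z.map fun p => ψ p.1)) := by
  rw [compMor_map fun p hp => ⟨_, hψ p hp⟩]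
  refine ⟨hX.isMor hZ hχ, hX.isMor (φ := fun x => (ψ x).subst φ) hZ fun p hp => ?_,
    fun i hi hif hig => ?_⟩
  · have := (hψ p hp).subst hφ
    rwa [Jd.subst, ssubst_subst] at this
  · rw [subPre_map (isPreCtx_of_dctx hZ.2)]
    have hp := List.getElem_mem hi
    simp only [List.getElem_map]
    exact ((he _ hp).symm.typed hu hX.1 (hχ _ hp)).derivable hX

theorem IsMor.exists_subst (hT : IsPretheory Ax) {f : List (Expr A)} (h : IsMor Ax X Y f) :
    DCtx Ax X ∧ DCtx Ax Y ∧ ∃ φ : A.Var → Expr A, f = (Y.map fun p => φ p.1) ∧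
      ∀ p ∈ Y, Dv Ax X (.tm (φ p.1) (p.2.subst φ)) := by
  have hY : DCtx Ax Y := hT.good h.2.1
  exact ⟨hT.good h.1, hY, good_args hY h.2.2.1 fun i hi hif => hT.good (h.2.2.2 i hi hif)⟩

theorem eq_nil_of_isEmpty (h : IsEmpty (SortE A)) (X : PreCtx A) : X = [] := by
  cases X with
  | nil => rfl
  | cons p X => exact h.elim p.2

end

section
variable {𝔸 : Thy A} {𝔹 : Thy B} {c : Ch 𝔸 𝔹} {σ₀ σ : Env 𝔸} {τ₀ τ : Env 𝔹} {C X : PreCtx A}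
  {D Y : PreCtx B} {φ : A.Var → Expr A} {ψ : B.Var → Expr B} {z : A.Var} {U : SortE A}

/-- A context with an environment which contains a fresh variable of some sort, if there is a
sort over the context at all. -/
structure Ec (σ : Env 𝔸) (X : PreCtx A) : Prop where
  ctx : DCtx 𝔸.ax X
  agree : Agree σ X
  pt : ∀ U, Dv 𝔸.ax X (.so U) → ∃ z U', Pt σ X z U'

theorem DCtx.exists_ec (hX : DCtx 𝔸.ax X) (U : SortE A) : ∃ σ : Env 𝔸, Ec σ X := by
  by_cases h : ∃ V, Dv 𝔸.ax X (.so V)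
  · obtain ⟨V, hV⟩ := h
    obtain ⟨z, hz⟩ := exists_fresh X
    obtain ⟨σ, hσ⟩ := exists_pt hX hV hz
    exact ⟨σ, hX, hσ.agree, fun _ _ => ⟨z, V, hσ⟩⟩
  · obtain ⟨σ, hσ⟩ := exists_agree (𝔸 := 𝔸) hX.1 U
    exact ⟨σ, hX, hσ, fun V hV => (h ⟨V, hV⟩).elim⟩

theorem DCtx.exists_tele (hX : DCtx 𝔸.ax X) (hσ : Agree σ X) : ∃ k, Tele σ X k := by
  obtain ⟨k, hk⟩ := exists_bound_ctx hX.2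
  exact ⟨k, hX.1, hσ, hk⟩

theorem Ec.frame (hX : Ec σ X) (hY : Ec τ Y) : Fr c σ τ X Y (tctx σ τ X Y) := by
  obtain ⟨k, hk⟩ := hX.ctx.exists_tele hX.agree
  obtain ⟨l, hl⟩ := hY.ctx.exists_tele hY.agree
  exact hk.fr hl fun n' _ l' _ => claims c n' l'

theorem Pt.exists_sb (hz : Pt σ₀ C z U) (ha : ∀ p ∈ C, Dv 𝔸.ax X (.tm (φ p.1) (p.2.subst φ))) :
    ∃ k, Sb σ₀ C z U k X φ := by
  obtain ⟨k, hk⟩ := hz.ctx.exists_tele hz.agree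
  obtain ⟨m, hm⟩ := exists_bound_tm ha
  exact ⟨max k m, hz, hk.mono (le_max_left _ _), fun p hp => (hm p hp).mono (le_max_right _ _)⟩

theorem Sb.exists_im {k : ℕ} (S : Sb σ₀ C z U k X φ) {α : Expr A} {V : SortE A}
    (h : Dv 𝔸.ax C (.tm α V)) : ∃ n, k ≤ n ∧ Im 𝔸 C X φ n α := by
  obtain ⟨m, hm⟩ := h.subst (Z := X) (φ := φ) fun p hp => ⟨k, S.args p hp⟩
  obtain ⟨j, hj⟩ := h
  exact ⟨max k m, le_max_left _ _, ⟨j, V, hj⟩, _, hm.mono (le_max_right _ _)⟩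

/-- The tensor of two substitutions is well typed. -/
theorem Ec.args (hC : Ec σ₀ C) (hD : Ec τ₀ D) (hX : Ec σ X) (hY : Ec τ Y)
    (hφ : ∀ p ∈ C, Dv 𝔸.ax X (.tm (φ p.1) (p.2.subst φ)))
    (hψ : ∀ p ∈ D, Dv 𝔹.ax Y (.tm (ψ p.1) (p.2.subst ψ))) :
    ∀ r ∈ tctx σ₀ τ₀ C D,
      Dv c.T (tctx σ τ X Y) (.tm (rho σ τ φ ψ r.1) (r.2.subst (rho σ τ φ ψ))) := by
  intro r hr
  obtain ⟨p, hp, q, hq, -⟩ := mem_tctx.1 hr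
  obtain ⟨z, U, hz⟩ := hC.pt _ (hC.ctx.so hp)
  obtain ⟨y, V, hy⟩ := hD.pt _ (hD.ctx.so hq)
  obtain ⟨k, S⟩ := hz.exists_sb hφ
  obtain ⟨l, T⟩ := hy.exists_sb hψ
  exact S.args_base T (S.hom_base T (hX.frame hY) (claims c k l)) r hr

/-- Substitution along a tensor of substitutions is the tensor of the substituted terms. -/
theorem Ec.te (hC : Ec σ₀ C) (hD : Ec τ₀ D) (hX : Ec σ X) (hY : Ec τ Y)
    (hφ : ∀ p ∈ C, Dv 𝔸.ax X (.tm (φ p.1) (p.2.subst φ)))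
    (hψ : ∀ p ∈ D, Dv 𝔹.ax Y (.tm (ψ p.1) (p.2.subst ψ)))
    {α : Expr A} {β : Expr B} {U : SortE A} {V : SortE B} (hα : Dv 𝔸.ax C (.tm α U))
    (hβ : Dv 𝔹.ax D (.tm β V)) :
    Te c.T (tctx σ τ X Y) ((tens σ₀ τ₀ α β).subst (rho σ τ φ ψ))
      (tens σ τ (α.subst φ) (β.subst ψ)) := by
  obtain ⟨z, U, hz⟩ := hC.pt _ hα.tm_so
  obtain ⟨y, V, hy⟩ := hD.pt _ hβ.tm_so
  obtain ⟨k, S⟩ := hz.exists_sb hφ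
  obtain ⟨l, T⟩ := hy.exists_sb hψ
  obtain ⟨n, hn, iα⟩ := S.exists_im hα
  obtain ⟨m, hm, iβ⟩ := T.exists_im hβ
  exact ((S.mono hn).hom_base (T.mono hm) (hX.frame hY) (claims c n m)).te (.inl ⟨iα, iβ⟩)

theorem tMor_eq (hX : Ec σ X) (hY : Ec τ Y)
    (hφ : ∀ p ∈ C, Dv 𝔸.ax X (.tm (φ p.1) (p.2.subst φ)))
    (hψ : ∀ p ∈ D, Dv 𝔹.ax Y (.tm (ψ p.1) (p.2.subst ψ))) {out : List (Expr (A.tensor B))}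
    (h : TMor 𝔸.ax 𝔹.ax false X (C.map fun p => φ p.1) Y (D.map fun q => ψ q.1) out) :
    out = (tctx σ₀ τ₀ C D).map fun r => rho σ τ φ ψ r.1 := by
  rw [map_rho, ctxVars_map, ctxVars_map]
  refine grid_ext h.1 fun i j hi hj hij => ?_
  obtain ⟨U, V, hU, hV, ht⟩ := h.2 i j hi hj hij
  obtain ⟨k, hu⟩ := hφ (C[i]'(by simpa using hi)) (List.getElem_mem _)
  obtain ⟨l, hv⟩ := hψ (D[j]'(by simpa using hj)) (List.getElem_mem _)
  simp only [List.getElem_map] at hU hV ht ⊢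
  rw [canonSort_iff hX.agree hu] at hU
  rw [canonSort_iff hY.agree hv] at hV
  refine (TTg_iff hY.ctx hX.agree hY.agree (hu.arg hX.agree) (hv.arg hY.agree) (.inl hU)
    (.inr fun y e => ?_)).1 ht
  rw [hV, e, cs_var]

theorem tMorCtx_eq (hX : Ec σ X) (hY : Ec τ Y)
    (hφ : ∀ p ∈ C, Dv 𝔸.ax X (.tm (φ p.1) (p.2.subst φ))) {out : List (Expr (A.tensor B))}
    (h : TMorCtx 𝔸.ax 𝔹.ax false X (C.map fun p => φ p.1) Y out) :
    out = (tctx σ₀ τ₀ C Y).map fun r => rho σ τ φ .var r.1 := by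
  rw [map_rho, ctxVars_map, ctxVars_map]
  refine grid_ext (by simpa using h.1) fun i j hi hj hij => ?_
  obtain ⟨U, hU, ht⟩ := h.2 i j hi (by simpa using hj) (by simpa using hij)
  obtain ⟨k, hu⟩ := hφ (C[i]'(by simpa using hi)) (List.getElem_mem _)
  simp only [List.getElem_map, List.length_map] at hU ht ⊢
  exact (TTg_var_right_iff hY.ctx hX.agree hY.agree (hu.arg hX.agree) _).1 ht

theorem tCtxMor_eq (hX : Ec σ X) (hY : Ec τ Y)
    (hψ : ∀ p ∈ D, Dv 𝔹.ax Y (.tm (ψ p.1) (p.2.subst ψ))) {out : List (Expr (A.tensor B))}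
    (h : TCtxMor 𝔸.ax 𝔹.ax false X Y (D.map fun q => ψ q.1) out) :
    out = (tctx σ₀ τ₀ X D).map fun r => rho σ τ .var ψ r.1 := by
  rw [map_rho, ctxVars_map, ctxVars_map]
  refine grid_ext (by simpa using h.1) fun i j hi hj hij => ?_
  obtain ⟨V, hV, ht⟩ := h.2 i j (by simpa using hi) hj (by simpa using hij)
  obtain ⟨l, hv⟩ := hψ (D[j]'(by simpa using hj)) (List.getElem_mem _)
  simp only [List.getElem_map] at hV ht ⊢
  exact (TTg_var_left_iff hX.ctx hY.ctx hX.agree hY.agree (hv.arg hY.agree) _).1 ht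

theorem DCtx.var_args {Ax : Set (Judg A)} (hX : DCtx Ax X) :
    ∀ p ∈ X, Dv Ax X (.tm (.var p.1) (p.2.subst .var)) := fun p hp => by
  rw [ssubst_id]
  exact hX.var hp

end

theorem isMor_nil {Ax : Set (Judg A)} : IsMor Ax [] [] [] :=
  DCtx.isMor (φ := .var) .nil .nil (by simp)

theorem morEq_nil {Ax : Set (Judg A)} : MorEq Ax [] [] [] [] :=
  ⟨isMor_nil, isMor_nil, fun i hi => absurd hi (by simp)⟩

/-- For context morphisms `f : X → A` in `𝔸` and `g : Y → B` in
`𝔹`, the tuple `f⊗g` is a context morphism `X⊗Y → A⊗B` in `𝔸⊗𝔹`, and the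
morphism equalities `f⊗g ≡ (A⊗g) ∘ (f⊗Y)` and `f⊗g ≡ (f⊗B) ∘ (X⊗g)` are
derivable, where `f⊗Y : X⊗Y → A⊗Y`, `A⊗g : A⊗Y → A⊗B`, `X⊗g : X⊗Y → X⊗B` and
`f⊗B : X⊗B → A⊗B` are context morphisms. -/
theorem tensor_of_morphisms
    (A B : Alphabet) (TA : Set (Judg A)) (TB : Set (Judg B))
    (hA : IsGAT TA) (hB : IsGAT TB)
    (chA : PreCtx A → A.Var) (hchA : FreshCh chA)
    (chB : PreCtx B → B.Var) (hchB : FreshCh chB)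
    (X Ac : PreCtx A) (f : List (Expr A)) (Y Bc : PreCtx B) (g : List (Expr B))
    (hf : IsMor TA X Ac f) (hg : IsMor TB Y Bc g)
    (ZXY ZAB ZAY ZXB : PreCtx (A.tensor B))
    (hZXY : TCtx TA TB false X Y ZXY) (hZAB : TCtx TA TB false Ac Bc ZAB)
    (hZAY : TCtx TA TB false Ac Y ZAY) (hZXB : TCtx TA TB false X Bc ZXB)
    (efg efY eAg eXg efB : List (Expr (A.tensor B)))
    (hefg : TMor TA TB false X f Y g efg)
    (hefY : TMorCtx TA TB false X f Y efY)
    (heAg : TCtxMor TA TB false Ac Y g eAg)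
    (heXg : TCtxMor TA TB false X Y g eXg)
    (hefB : TMorCtx TA TB false X f Bc efB) :
    IsMor (tensorAx TA TB chA chB) ZXY ZAB efg ∧
    IsMor (tensorAx TA TB chA chB) ZXY ZAY efY ∧
    IsMor (tensorAx TA TB chA chB) ZAY ZAB eAg ∧
    IsMor (tensorAx TA TB chA chB) ZXY ZXB eXg ∧
    IsMor (tensorAx TA TB chA chB) ZXB ZAB efB ∧
    MorEq (tensorAx TA TB chA chB) ZXY ZAB efg (compMor ZAY efY eAg) ∧
    MorEq (tensorAx TA TB chA chB) ZXY ZAB efg (compMor ZXB eXg efB) := by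
  obtain ⟨dX, dA, φ, rfl, hφ⟩ := hf.exists_subst hA.1
  obtain ⟨dY, dB, ψ, rfl, hψ⟩ := hg.exists_subst hB.1
  by_cases hs : Nonempty (SortE A) ∧ Nonempty (SortE B)
  · obtain ⟨⟨U⟩, ⟨V⟩⟩ := hs
    let 𝔸 : Thy A := ⟨TA, hA⟩
    let 𝔹 : Thy B := ⟨TB, hB⟩
    let c : Ch 𝔸 𝔹 := ⟨chA, chB, hchA, hchB⟩
    obtain ⟨σ, eX⟩ := DCtx.exists_ec (𝔸 := 𝔸) dX U
    obtain ⟨σ₀, eA⟩ := DCtx.exists_ec (𝔸 := 𝔸) dA U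
    obtain ⟨τ, eY⟩ := DCtx.exists_ec (𝔸 := 𝔹) dY V
    obtain ⟨τ₀, eB⟩ := DCtx.exists_ec (𝔸 := 𝔹) dB V
    obtain rfl := (TCtx_iff (𝔸 := 𝔸) (𝔹 := 𝔹) dX dY eX.agree eY.agree).1 hZXY
    obtain rfl := (TCtx_iff (𝔸 := 𝔸) (𝔹 := 𝔹) dA dB eA.agree eB.agree).1 hZAB
    obtain rfl := (TCtx_iff (𝔸 := 𝔸) (𝔹 := 𝔹) dA dY eA.agree eY.agree).1 hZAY
    obtain rfl := (TCtx_iff (𝔸 := 𝔸) (𝔹 := 𝔹) dX dB eX.agree eB.agree).1 hZXB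
    obtain rfl := tMor_eq (𝔸 := 𝔸) (𝔹 := 𝔹) (σ₀ := σ₀) (τ₀ := τ₀) eX eY hφ hψ hefg
    obtain rfl := tMorCtx_eq (𝔸 := 𝔸) (𝔹 := 𝔹) (σ₀ := σ₀) (τ₀ := τ) eX eY hφ hefY
    obtain rfl := tCtxMor_eq (𝔸 := 𝔸) (𝔹 := 𝔹) (σ₀ := σ₀) (τ₀ := τ₀) eA eY hψ heAg
    obtain rfl := tCtxMor_eq (𝔸 := 𝔸) (𝔹 := 𝔹) (σ₀ := σ) (τ₀ := τ₀) eX eY hψ heXg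
    obtain rfl := tMorCtx_eq (𝔸 := 𝔸) (𝔹 := 𝔹) (σ₀ := σ₀) (τ₀ := τ₀) eX eB hφ hefB
    have zXY := (eX.frame (c := c) eY).ctx
    have zAB := (eA.frame (c := c) eB).ctx
    have zAY := (eA.frame (c := c) eY).ctx
    have zXB := (eX.frame (c := c) eB).ctx
    have afg := eA.args (c := c) eB eX eY hφ hψ
    have afY := eA.args (c := c) eY eX eY hφ dY.var_args
    have aAg := eA.args (c := c) eB eA eY dA.var_args hψ
    have aXg := eX.args (c := c) eB eX eY dX.var_args hψ
    have afB := eA.args (c := c) eB eX eB hφ dB.var_args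
    refine ⟨zXY.isMor zAB afg, zXY.isMor zAY afY, zAY.isMor zAB aAg, zXY.isMor zXB aXg,
      zXB.isMor zAB afB, zXY.morEq c.unique zAY zAB afY aAg afg fun r hr => ?_,
      zXY.morEq c.unique zXB zAB aXg afB afg fun r hr => ?_⟩
    · obtain ⟨p, hp, q, hq, rfl⟩ := mem_tctx.1 hr
      have h := eA.te (c := c) eY eX eY hφ dY.var_args (dA.var hp) (hψ q hq)
      rw [subst_id, subst_var] at h
      exact h
    · obtain ⟨p, hp, q, hq, rfl⟩ := mem_tctx.1 hr
      have h := eX.te (c := c) eB eX eY dX.var_args hψ (hφ p hp) (dB.var hq)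
      rw [subst_id, subst_var] at h
      exact h
  · have hl : (X = [] ∧ Ac = []) ∨ (Y = [] ∧ Bc = []) := by
      rw [not_and_or, not_nonempty_iff, not_nonempty_iff] at hs
      exact hs.imp (fun h => ⟨eq_nil_of_isEmpty h _, eq_nil_of_isEmpty h _⟩)
        fun h => ⟨eq_nil_of_isEmpty h _, eq_nil_of_isEmpty h _⟩
    have e1 : ZXY = [] := List.eq_nil_of_length_eq_zero (by rw [hZXY.1]; aesop)
    have e2 : ZAB = [] := List.eq_nil_of_length_eq_zero (by rw [hZAB.1]; aesop)
    have e3 : ZAY = [] := List.eq_nil_of_length_eq_zero (by rw [hZAY.1]; aesop)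
    have e4 : ZXB = [] := List.eq_nil_of_length_eq_zero (by rw [hZXB.1]; aesop)
    have e5 : efg = [] := List.eq_nil_of_length_eq_zero (by rw [hefg.1]; aesop)
    have e6 : efY = [] := List.eq_nil_of_length_eq_zero (by rw [hefY.1]; aesop)
    have e7 : eAg = [] := List.eq_nil_of_length_eq_zero (by rw [heAg.1]; aesop)
    have e8 : eXg = [] := List.eq_nil_of_length_eq_zero (by rw [heXg.1]; aesop)
    have e9 : efB = [] := List.eq_nil_of_length_eq_zero (by rw [hefB.1]; aesop)
    subst e1 e2 e3 e4 e5 e6 e7 e8 e9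
    exact ⟨isMor_nil, isMor_nil, isMor_nil, isMor_nil, isMor_nil, morEq_nil, morEq_nil⟩

end GATPaper
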